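/- Every finite simple planar graph G admits a proper colouring φ : V(G) → {1, 2, 3, 4, 5} such that φ(v) ∈ {1, 2, 3, 4} for every vertex v with g_G(v) ≥ 4 (i.e., every vertex contained in no triangle), and φ(v) ∈ {1, 2, 3} for every vertex v with g_G(v) ≥ 5 (i.e., every vertex contained in no cycle of length 3 or 4). -/

import Mathlib

/-- `H` is a minor of `G`: there is a family of nonempty, pairwise disjoint, connected
branch sets in `G` indexed by the vertices of `H`, with an edge of `G` between the
branch sets of any two adjacent vertices of `H`. -/
def SimpleGraph.IsMinorOf {W V : Type*} (H : SimpleGraph W) (G : SimpleGraph V) : Prop :=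
  ∃ f : W → Set V,
    (∀ w, (G.induce (f w)).Connected) ∧
    (Pairwise fun w₁ w₂ => Disjoint (f w₁) (f w₂)) ∧
    ∀ ⦃w₁ w₂⦄, H.Adj w₁ w₂ → ∃ v₁ ∈ f w₁, ∃ v₂ ∈ f w₂, G.Adj v₁ v₂

/-- A graph is planar iff (by Wagner's theorem) it has neither `K₅` nor `K₃,₃` as a minor. -/
def SimpleGraph.IsPlanar {V : Type*} (G : SimpleGraph V) : Prop :=
  ¬ (completeGraph (Fin 5)).IsMinorOf G ∧
  ¬ (completeBipartiteGraph (Fin 3) (Fin 3)).IsMinorOf G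

/-- The vertex `v` lies on a cycle of length `n` in `G`. -/
def SimpleGraph.VertexInCycleOfLength {V : Type*} (G : SimpleGraph V) (v : V) (n : ℕ) : Prop :=
  ∃ c : G.Walk v v, c.IsCycle ∧ c.length = n

namespace LocalGirth

open Set Relation

variable {V : Type*} {G H : SimpleGraph V}

/-- `u` and `v` are joined by a walk all of whose steps stay inside `X`. -/
def Reach (G : SimpleGraph V) (X : Set V) : V → V → Prop :=
  ReflTransGen fun a b => G.Adj a b ∧ a ∈ X ∧ b ∈ X

/-- There is an edge between `A` and `B`. -/
def Touch (G : SimpleGraph V) (A B : Set V) : Prop :=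
  ∃ a ∈ A, ∃ b ∈ B, G.Adj a b

/-- `X` is nonempty and induces a connected subgraph. -/
def IsConn (G : SimpleGraph V) (X : Set V) : Prop :=
  X.Nonempty ∧ ∀ a ∈ X, ∀ b ∈ X, Reach G X a b

/-- The component of `v` in the subgraph induced by `X`. -/
def comp (G : SimpleGraph V) (X : Set V) (v : V) : Set V :=
  {w | v ∈ X ∧ Reach G X v w}

/-- No `K₅` and no `K₃,₃` minor, in terms of families of connected sets. -/
def NoMinor (G : SimpleGraph V) : Prop :=
  (¬ ∃ f : Fin 5 → Set V, (∀ i, IsConn G (f i)) ∧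
    (∀ i j, i ≠ j → Disjoint (f i) (f j)) ∧ ∀ i j, i ≠ j → Touch G (f i) (f j)) ∧
  ¬ ∃ f g : Fin 3 → Set V, (∀ i, IsConn G (f i)) ∧ (∀ i, IsConn G (g i)) ∧
    (∀ i j, i ≠ j → Disjoint (f i) (f j)) ∧ (∀ i j, i ≠ j → Disjoint (g i) (g j)) ∧
    (∀ i j, Disjoint (f i) (g j)) ∧ ∀ i j, Touch G (f i) (g j)

/-! ### Reachability inside a set -/

lemma Reach.refl (X : Set V) (v : V) : Reach G X v v := ReflTransGen.refl

lemma Reach.trans {X : Set V} {u v w : V} (h : Reach G X u v) (h' : Reach G X v w) :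
    Reach G X u w := ReflTransGen.trans h h'

lemma Reach.symm {X : Set V} {u v : V} (h : Reach G X u v) : Reach G X v u := by
  induction h with
  | refl => exact .refl _ _
  | tail _ h ih => exact (ReflTransGen.single ⟨h.1.symm, h.2.2, h.2.1⟩).trans ih

lemma Reach.of_adj {X : Set V} {u v : V} (h : G.Adj u v) (hu : u ∈ X) (hv : v ∈ X) :
    Reach G X u v := ReflTransGen.single ⟨h, hu, hv⟩

lemma Reach.mono {X Y : Set V} {u v : V} (h : Reach G X u v) (hXY : X ⊆ Y) : Reach G Y u v :=
  ReflTransGen.mono (fun _ _ h => ⟨h.1, hXY h.2.1, hXY h.2.2⟩) _ _ h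

lemma Reach.mono_graph {X : Set V} {u v : V} (h : Reach G X u v)
    (hGH : ∀ a ∈ X, ∀ b ∈ X, G.Adj a b → H.Adj a b) : Reach H X u v :=
  ReflTransGen.mono (fun _ _ h => ⟨hGH _ h.2.1 _ h.2.2 h.1, h.2⟩) _ _ h

lemma Reach.mem {X : Set V} {u v : V} (h : Reach G X u v) (hu : u ∈ X) : v ∈ X := by
  induction h with
  | refl => exact hu
  | tail _ h _ => exact h.2.2

/-- A set closed under steps inside `X` contains everything reachable from it. -/
lemma Reach.closed {X A : Set V} {u v : V} (h : Reach G X u v) (hu : u ∈ A)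
    (hA : ∀ a ∈ A, ∀ b ∈ X, G.Adj a b → b ∈ A) : v ∈ A := by
  induction h with
  | refl => exact hu
  | tail _ h ih => exact hA _ ih _ h.2.2 h.1

/-- If `A` is closed under steps inside `X`, a walk in `X` from `A` stays in `A`. -/
lemma Reach.restrict {X A : Set V} {u v : V} (h : Reach G X u v) (hu : u ∈ A)
    (hA : ∀ a ∈ A, ∀ b ∈ X, G.Adj a b → b ∈ A) : Reach G (X ∩ A) u v := by
  induction h with
  | refl => exact .refl _ _
  | tail h' h ih =>
    have := Reach.closed h' hu hA
    exact ih.trans (.of_adj h.1 ⟨h.2.1, this⟩ ⟨h.2.2, hA _ this _ h.2.2 h.1⟩)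

lemma Reach.lift {X Y : Set V} {u v : V} (h : Reach G X u v) 
    (hs : ∀ a ∈ X, ∀ b ∈ X, G.Adj a b → Reach H Y a b) : Reach H Y u v := by
  induction h with
  | refl => exact .refl _ _
  | tail _ h ih => exact ih.trans (hs _ h.2.1 _ h.2.2 h.1)

/-- A walk leaving `A` crosses an edge leaving `A`. -/
lemma Reach.exists_cross {X A : Set V} {u v : V} (h : Reach G X u v) (hu : u ∈ A) (hv : v ∉ A) :
    ∃ a ∈ X ∩ A, ∃ b ∈ X \ A, G.Adj a b := by
  by_contra hc
  push Not at hc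
  have : v ∈ A ∩ (A ∪ X) := by
    clear hv
    induction h with
    | refl => exact ⟨hu, .inl hu⟩
    | @tail b c _ h ih =>
      have : c ∈ A := by
        by_contra hcA
        exact hc _ ⟨h.2.1, ih.1⟩ _ ⟨h.2.2, hcA⟩ h.1
      exact ⟨this, .inl this⟩
  exact hv this.1

/-! ### Touching sets -/

lemma Touch.symm {A B : Set V} (h : Touch G A B) : Touch G B A := by
  obtain ⟨a, ha, b, hb, hab⟩ := h
  exact ⟨b, hb, a, ha, hab.symm⟩

lemma Touch.mono {A B A' B' : Set V} (h : Touch G A B) (hA : A ⊆ A') (hB : B ⊆ B') :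
    Touch G A' B' := by
  obtain ⟨a, ha, b, hb, hab⟩ := h
  exact ⟨a, hA ha, b, hB hb, hab⟩

lemma Touch.left {A B A' : Set V} (h : Touch G A B) (hA : A ⊆ A') : Touch G A' B :=
  h.mono hA subset_rfl

lemma Touch.right {A B B' : Set V} (h : Touch G A B) (hB : B ⊆ B') : Touch G A B' :=
  h.mono subset_rfl hB

lemma touch_of_adj {A B : Set V} {a b : V} (h : G.Adj a b) (ha : a ∈ A) (hb : b ∈ B) :
    Touch G A B := ⟨a, ha, b, hb, h⟩

lemma touch_singleton_left {B : Set V} {a : V} : Touch G {a} B ↔ ∃ b ∈ B, G.Adj a b := by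
  simp [Touch]

lemma touch_singleton_right {A : Set V} {b : V} : Touch G A {b} ↔ ∃ a ∈ A, G.Adj a b := by
  simp [Touch]

/-! ### Connected sets -/

lemma isConn_singleton (v : V) : IsConn G {v} :=
  ⟨singleton_nonempty v, by rintro a rfl b rfl; exact .refl _ _⟩

lemma IsConn.of_root {X : Set V} {v : V} (hv : v ∈ X) (h : ∀ w ∈ X, Reach G X v w) : IsConn G X :=
  ⟨⟨v, hv⟩, fun a ha b hb => (h a ha).symm.trans (h b hb)⟩

lemma IsConn.mono_graph {X : Set V} (h : IsConn G X)
    (hGH : ∀ a ∈ X, ∀ b ∈ X, G.Adj a b → H.Adj a b) : IsConn H X :=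
  ⟨h.1, fun a ha b hb => (h.2 a ha b hb).mono_graph hGH⟩

lemma IsConn.exists_cross {X A : Set V} (h : IsConn G X) (h₁ : (X ∩ A).Nonempty)
    (h₂ : (X \ A).Nonempty) : ∃ a ∈ X ∩ A, ∃ b ∈ X \ A, G.Adj a b := by
  obtain ⟨a, ha⟩ := h₁
  obtain ⟨b, hb⟩ := h₂
  exact (h.2 a ha.1 b hb.1).exists_cross ha.2 hb.2

lemma IsConn.union_inter {A B : Set V} (hA : IsConn G A) (hB : IsConn G B)
    (h : (A ∩ B).Nonempty) : IsConn G (A ∪ B) := by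
  obtain ⟨c, hcA, hcB⟩ := h
  refine .of_root (v := c) (.inl hcA) ?_
  rintro w (hw | hw)
  · exact (hA.2 c hcA w hw).mono subset_union_left
  · exact (hB.2 c hcB w hw).mono subset_union_right

lemma IsConn.union {A B : Set V} (hA : IsConn G A) (hB : IsConn G B)
    (h : Touch G A B) : IsConn G (A ∪ B) := by
  obtain ⟨a, ha, b, hb, hab⟩ := h
  refine .of_root (v := a) (.inl ha) ?_
  rintro w (hw | hw)
  · exact (hA.2 a ha w hw).mono subset_union_left
  · exact (Reach.of_adj hab (.inl ha) (.inr hb)).trans ((hB.2 b hb w hw).mono subset_union_right)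

lemma IsConn.insert {A : Set V} {v : V} (hA : IsConn G A) (h : ∃ a ∈ A, G.Adj v a) :
    IsConn G (insert v A) := by
  rw [← singleton_union]
  exact (isConn_singleton v).union hA (touch_singleton_left.2 h)

lemma isConn_pair {u v : V} (h : G.Adj u v) : IsConn G {u, v} :=
  (isConn_singleton v).insert ⟨v, rfl, h⟩

/-- The union of a connected set with connected sets each meeting or touching it. -/
lemma IsConn.biUnion {ι : Type*} {A : Set V} (hA : IsConn G A) (I : Set ι) (B : ι → Set V)
    (hB : ∀ i ∈ I, IsConn G (B i)) (h : ∀ i ∈ I, Touch G A (B i) ∨ (A ∩ B i).Nonempty) :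
    IsConn G (A ∪ ⋃ i ∈ I, B i) := by
  obtain ⟨a, ha⟩ := hA.1
  refine .of_root (v := a) (.inl ha) ?_
  rintro w (hw | hw)
  · exact (hA.2 a ha w hw).mono subset_union_left
  · simp only [mem_iUnion] at hw
    obtain ⟨i, hi, hw⟩ := hw
    have : IsConn G (A ∪ B i) := (h i hi).elim (hA.union (hB i hi)) (hA.union_inter (hB i hi))
    refine (this.2 a (.inl ha) w (.inr hw)).mono (union_subset_union_right _ ?_)
    exact subset_biUnion_of_mem hi

lemma comp_subset (X : Set V) (v : V) : comp G X v ⊆ X := fun _ h => h.2.mem h.1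

lemma mem_comp_self {X : Set V} {v : V} (hv : v ∈ X) : v ∈ comp G X v := ⟨hv, .refl _ _⟩

lemma mem_comp_of_adj {X : Set V} {v a b : V} (ha : a ∈ comp G X v) (hb : b ∈ X)
    (h : G.Adj a b) : b ∈ comp G X v :=
  ⟨ha.1, ha.2.trans (.of_adj h (comp_subset _ _ ha) hb)⟩

lemma isConn_comp {X : Set V} {v : V} (hv : v ∈ X) : IsConn G (comp G X v) := by
  refine .of_root (mem_comp_self hv) ?_
  intro w hw
  refine (hw.2.restrict (mem_comp_self hv) fun a ha b hb hab => mem_comp_of_adj ha hb hab).mono ?_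
  exact inter_subset_right

lemma IsConn.subset_comp {X A : Set V} {v : V} (hA : IsConn G A) (hAX : A ⊆ X) (hv : v ∈ A) :
    A ⊆ comp G X v := fun a ha => ⟨hAX hv, (hA.2 v hv a ha).mono hAX⟩

lemma comp_eq_of_mem {X : Set V} {v w : V} (h : w ∈ comp G X v) : comp G X w = comp G X v := by
  ext a
  exact ⟨fun ha => ⟨h.1, h.2.trans ha.2⟩, fun ha => ⟨comp_subset _ _ h, h.2.symm.trans ha.2⟩⟩

lemma mem_comp_comm {X : Set V} {v w : V} (h : w ∈ comp G X v) : v ∈ comp G X w :=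
  ⟨comp_subset _ _ h, h.2.symm⟩

/-- A walk in `X` between disjoint sets `A` and `B` gives an edge between them or a connected
set avoiding both and touching both. -/
lemma Reach.touch_or_exists {X A B : Set V} {a b : V} (h : Reach G X a b) (ha : a ∈ A)
    (hb : b ∈ B) (hAB : Disjoint A B) :
    Touch G A B ∨ ∃ Q ⊆ X \ (A ∪ B), IsConn G Q ∧ Touch G A Q ∧ Touch G Q B := by
  by_contra hcon
  have key : a ∉ A ∧ (a ∈ B ∨ ∃ Q ⊆ X \ (A ∪ B), IsConn G Q ∧ a ∈ Q ∧ Touch G Q B) := by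
    clear ha
    induction h using ReflTransGen.head_induction_on with
    | refl => exact ⟨disjoint_right.1 hAB hb, .inl hb⟩
    | @head a c h _ ih =>
      have haA : a ∉ A := by
        intro haA
        apply hcon
        rcases ih.2 with hc | ⟨Q, hQ, hQc, hcQ, hQB⟩
        · exact .inl ⟨a, haA, c, hc, h.1⟩
        · exact .inr ⟨Q, hQ, hQc, ⟨a, haA, c, hcQ, h.1⟩, hQB⟩
      refine ⟨haA, ?_⟩
      by_cases haB : a ∈ B
      · exact .inl haB
      · right
        have haX : a ∈ X \ (A ∪ B) := ⟨h.2.1, by simp [haA, haB]⟩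
        rcases ih.2 with hc | ⟨Q, hQ, hQc, hcQ, hQB⟩
        · exact ⟨{a}, by simpa using haX, isConn_singleton a, rfl,
            touch_singleton_left.2 ⟨c, hc, h.1⟩⟩
        · exact ⟨insert a Q, insert_subset haX hQ, hQc.insert ⟨c, hcQ, h.1⟩, mem_insert _ _,
            hQB.left (subset_insert _ _)⟩
  exact key.1 ha

/-! ### Excluded minors -/

lemma NoMinor.not_K5 (hG : NoMinor G) {A B C D E : Set V}
    (hA : IsConn G A) (hB : IsConn G B) (hC : IsConn G C) (hD : IsConn G D) (hE : IsConn G E)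
    (dAB : Disjoint A B) (dAC : Disjoint A C) (dAD : Disjoint A D) (dAE : Disjoint A E)
    (dBC : Disjoint B C) (dBD : Disjoint B D) (dBE : Disjoint B E)
    (dCD : Disjoint C D) (dCE : Disjoint C E) (dDE : Disjoint D E)
    (tAB : Touch G A B) (tAC : Touch G A C) (tAD : Touch G A D) (tAE : Touch G A E)
    (tBC : Touch G B C) (tBD : Touch G B D) (tBE : Touch G B E)
    (tCD : Touch G C D) (tCE : Touch G C E) (tDE : Touch G D E) : False := by
  refine hG.1 ⟨![A, B, C, D, E], ?_, ?_, ?_⟩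
  · intro i
    fin_cases i <;> assumption
  · have hs : ∀ i j : Fin 5, i < j →
        Disjoint ((![A, B, C, D, E] : Fin 5 → Set V) i) ((![A, B, C, D, E] : Fin 5 → Set V) j) := by
      intro i j hij
      fin_cases i <;> fin_cases j <;> first | assumption | (exact absurd hij (by decide))
    intro i j hij
    rcases lt_or_gt_of_ne hij with h | h
    · exact hs i j h
    · exact (hs j i h).symm
  · have hs : ∀ i j : Fin 5, i < j →
        Touch G ((![A, B, C, D, E] : Fin 5 → Set V) i) ((![A, B, C, D, E] : Fin 5 → Set V) j) := by
      intro i j hij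
      fin_cases i <;> fin_cases j <;> first | assumption | (exact absurd hij (by decide))
    intro i j hij
    rcases lt_or_gt_of_ne hij with h | h
    · exact hs i j h
    · exact (hs j i h).symm

lemma NoMinor.not_K33 (hG : NoMinor G) {A B C D E F : Set V}
    (hA : IsConn G A) (hB : IsConn G B) (hC : IsConn G C) (hD : IsConn G D) (hE : IsConn G E)
    (hF : IsConn G F)
    (dAB : Disjoint A B) (dAC : Disjoint A C) (dBC : Disjoint B C)
    (dDE : Disjoint D E) (dDF : Disjoint D F) (dEF : Disjoint E F)
    (dAD : Disjoint A D) (dAE : Disjoint A E) (dAF : Disjoint A F)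
    (dBD : Disjoint B D) (dBE : Disjoint B E) (dBF : Disjoint B F)
    (dCD : Disjoint C D) (dCE : Disjoint C E) (dCF : Disjoint C F)
    (tAD : Touch G A D) (tAE : Touch G A E) (tAF : Touch G A F)
    (tBD : Touch G B D) (tBE : Touch G B E) (tBF : Touch G B F)
    (tCD : Touch G C D) (tCE : Touch G C E) (tCF : Touch G C F) : False := by
  have hs : ∀ {A B C : Set V}, Disjoint A B → Disjoint A C → Disjoint B C →
      ∀ i j : Fin 3, i ≠ j →
        Disjoint ((![A, B, C] : Fin 3 → Set V) i) ((![A, B, C] : Fin 3 → Set V) j) := by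
    intro A B C h₁ h₂ h₃ i j hij
    fin_cases i <;> fin_cases j <;>
      first | assumption | (apply Disjoint.symm; assumption) | (exact absurd rfl hij)
  refine hG.2 ⟨![A, B, C], ![D, E, F], ?_, ?_, hs dAB dAC dBC, hs dDE dDF dEF, ?_, ?_⟩
  · intro i
    fin_cases i <;> assumption
  · intro i
    fin_cases i <;> assumption
  · intro i j
    fin_cases i <;> fin_cases j <;> assumption
  · intro i j
    fin_cases i <;> fin_cases j <;> assumption

lemma isConn_iff_connected {X : Set V} : IsConn G X ↔ (G.induce X).Connected := by
  constructor
  · intro h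
    have : Nonempty X := h.1.to_subtype
    refine ⟨?_⟩
    rintro ⟨a, ha⟩ ⟨b, hb⟩
    have h' := h.2 a ha b hb
    have : ∀ v, Reach G X a v → ∀ hv : v ∈ X, (G.induce X).Reachable ⟨a, ha⟩ ⟨v, hv⟩ := by
      intro v hv
      induction hv with
      | refl => intro _; exact .refl _
      | tail _ h ih =>
        intro hv
        exact (ih h.2.1).trans (SimpleGraph.Adj.reachable (by simpa using h.1))
    exact this b h' hb
  · intro h
    refine ⟨nonempty_coe_sort.1 h.nonempty, fun a ha b hb => ?_⟩
    obtain ⟨p⟩ := h.preconnected ⟨a, ha⟩ ⟨b, hb⟩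
    have : ∀ {x y : X}, (G.induce X).Walk x y → Reach G X x y := by
      intro x y p
      induction p with
      | nil => exact .refl _ _
      | cons h _ ih => exact (Reach.of_adj (by simpa using h) (Subtype.coe_prop _) (Subtype.coe_prop _)).trans ih
    exact this p

end LocalGirth

namespace LocalGirth

open Set Relation

variable {V : Type*} {G H : SimpleGraph V}

/-- The graph in which `u` stands for the set `R u` of vertices of `G`. -/
def quotientGraph (G : SimpleGraph V) (R : V → Set V) : SimpleGraph V where
  Adj u v := u ≠ v ∧ Touch G (R u) (R v)
  symm := ⟨fun _ _ h => ⟨h.1.symm, h.2.symm⟩⟩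
  loopless := ⟨fun _ h => h.1 rfl⟩

lemma NoMinor.of_branch (hG : NoMinor G) (R : V → Set V)
    (hR : ∀ v, (R v).Nonempty → IsConn G (R v))
    (hd : ∀ u v, u ≠ v → Disjoint (R u) (R v))
    (hadj : ∀ u v, H.Adj u v → Touch G (R u) (R v)) : NoMinor H := by
  have hne : ∀ u v, H.Adj u v → (R u).Nonempty := by
    intro u v h
    obtain ⟨a, ha, -⟩ := hadj u v h
    exact ⟨a, ha⟩
  have conn : ∀ A : Set V, IsConn H A → ∀ B, Touch H A B → IsConn G (⋃ v ∈ A, R v) := by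
    rintro A hA B ⟨a, ha, b, hb, hab⟩
    have hne' : ∀ v ∈ A, (R v).Nonempty := by
      intro v hv
      by_cases hva : v = a
      · exact hva ▸ hne a b hab
      · have := hA.2 v hv a ha
        rcases this.cases_head with h | ⟨c, h, -⟩
        · exact absurd h hva
        · exact hne v c h.1
    have hsub : ∀ v ∈ A, R v ⊆ ⋃ v ∈ A, R v := fun v hv => subset_biUnion_of_mem hv
    obtain ⟨x, hx⟩ := hne' a ha
    have key : ∀ v, Reach H A a v → v ∈ A → ∀ y ∈ R v, Reach G (⋃ v ∈ A, R v) x y := by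
      intro v hv
      induction hv with
      | refl => exact fun _ y hy => ((hR a ⟨x, hx⟩).2 x hx y hy).mono (hsub a ha)
      | @tail b c _ h ih =>
        intro hc y hy
        obtain ⟨p, hp, q, hq, hpq⟩ := hadj b c h.1
        exact ((ih h.2.1 p hp).trans (.of_adj hpq (hsub _ h.2.1 hp) (hsub _ hc hq))).trans
          (((hR c ⟨q, hq⟩).2 q hq y hy).mono (hsub c hc))
    refine .of_root (hsub a ha hx) ?_
    intro w hw
    simp only [mem_iUnion] at hw
    obtain ⟨v, hv, hw⟩ := hw
    exact key v (hA.2 a ha v hv) hv w hw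
  have disj : ∀ A B : Set V, Disjoint A B → Disjoint (⋃ v ∈ A, R v) (⋃ v ∈ B, R v) := by
    intro A B hAB
    rw [disjoint_iUnion₂_left]
    intro u hu
    rw [disjoint_iUnion₂_right]
    intro v hv
    exact hd u v fun h => disjoint_left.1 hAB hu (h ▸ hv)
  have touch : ∀ A B : Set V, Touch H A B → Touch G (⋃ v ∈ A, R v) (⋃ v ∈ B, R v) := by
    rintro A B ⟨a, ha, b, hb, hab⟩
    exact (hadj a b hab).mono (subset_biUnion_of_mem ha) (subset_biUnion_of_mem hb)
  constructor
  · rintro ⟨f, hc, hdis, ht⟩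
    refine hG.1 ⟨fun i => ⋃ v ∈ f i, R v, fun i => ?_, fun i j hij => disj _ _ (hdis i j hij),
      fun i j hij => touch _ _ (ht i j hij)⟩
    exact conn _ (hc i) _ (ht i (i + 1) (by fin_cases i <;> decide))
  · rintro ⟨f, g, hf, hg, df, dg, dfg, ht⟩
    exact hG.2 ⟨fun i => ⋃ v ∈ f i, R v, fun i => ⋃ v ∈ g i, R v,
      fun i => conn _ (hf i) _ (ht i 0), fun i => conn _ (hg i) _ (ht 0 i).symm,
      fun i j hij => disj _ _ (df i j hij), fun i j hij => disj _ _ (dg i j hij),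
      fun i j => disj _ _ (dfg i j), fun i j => touch _ _ (ht i j)⟩

lemma NoMinor.quotientGraph (hG : NoMinor G) (R : V → Set V)
    (hR : ∀ v, (R v).Nonempty → IsConn G (R v)) (hd : ∀ u v, u ≠ v → Disjoint (R u) (R v)) :
    NoMinor (quotientGraph G R) :=
  hG.of_branch R hR hd fun _ _ h => h.2

lemma NoMinor.mono (hG : NoMinor G) (h : H ≤ G) : NoMinor H :=
  hG.of_branch (fun v => {v}) (fun v _ => isConn_singleton v) (by simp)
    fun u v huv => ⟨u, rfl, v, rfl, h huv⟩

lemma noMinor_of_isPlanar (hG : G.IsPlanar) : NoMinor G := by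
  constructor
  · rintro ⟨f, hc, hd, ht⟩
    exact hG.1 ⟨f, fun i => isConn_iff_connected.1 (hc i), fun i j h => hd i j h,
      fun i j h => ht i j h.ne⟩
  · rintro ⟨f, g, hf, hg, df, dg, dfg, ht⟩
    refine hG.2 ⟨Sum.elim f g, ?_, ?_, ?_⟩
    · rintro (i | i)
      · exact isConn_iff_connected.1 (hf i)
      · exact isConn_iff_connected.1 (hg i)
    · rintro (i | i) (j | j) h
      · exact df i j fun e => h (e ▸ rfl)
      · exact dfg i j
      · exact (dfg j i).symm
      · exact dg i j fun e => h (e ▸ rfl)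
    · rintro (i | i) (j | j) h
      · simp at h
      · exact ht i j
      · exact (ht j i).symm
      · simp at h

/-! ### Three connectors -/

/-- Two adjacent connected sets `S`, `S'` cannot have three common neighbouring connected sets
any two of which are joined outside `S`, `S'` and the third one. -/
lemma NoMinor.three_connectors (hG : NoMinor G) {S S' Ω C₁ C₂ C₃ : Set V}
    (hS : IsConn G S) (hS' : IsConn G S') (hSS : Disjoint S S') (tSS : Touch G S S')
    (hΩ : Disjoint S Ω) (hΩ' : Disjoint S' Ω)
    (h₁ : IsConn G C₁) (h₂ : IsConn G C₂) (h₃ : IsConn G C₃)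
    (s₁ : C₁ ⊆ Ω) (s₂ : C₂ ⊆ Ω) (s₃ : C₃ ⊆ Ω)
    (d₁₂ : Disjoint C₁ C₂) (d₁₃ : Disjoint C₁ C₃) (d₂₃ : Disjoint C₂ C₃)
    (t₁ : Touch G S C₁) (t₂ : Touch G S C₂) (t₃ : Touch G S C₃)
    (t₁' : Touch G S' C₁) (t₂' : Touch G S' C₂) (t₃' : Touch G S' C₃)
    (r₁₂ : ∃ a ∈ C₁, ∃ b ∈ C₂, Reach G (Ω \ C₃) a b)
    (r₂₃ : ∃ a ∈ C₂, ∃ b ∈ C₃, Reach G (Ω \ C₁) a b)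
    (r₃₁ : ∃ a ∈ C₃, ∃ b ∈ C₁, Reach G (Ω \ C₂) a b) : False := by
  set Z : Set V := C₁ ∪ C₂ ∪ C₃ with hZ
  have noT : ∀ T : Set V, IsConn G T → T ⊆ Ω \ Z → Touch G T C₁ → Touch G T C₂ →
      Touch G T C₃ → False := by
    intro T hT hTs a₁ a₂ a₃
    have hTΩ : T ⊆ Ω := hTs.trans sdiff_subset
    have hTZ : Disjoint T Z := disjoint_left.2 fun x hx => (hTs hx).2
    exact hG.not_K33 hS hS' hT h₁ h₂ h₃ hSS (hΩ.mono_right hTΩ) (hΩ'.mono_right hTΩ) d₁₂ d₁₃ d₂₃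
      (hΩ.mono_right s₁) (hΩ.mono_right s₂) (hΩ.mono_right s₃)
      (hΩ'.mono_right s₁) (hΩ'.mono_right s₂) (hΩ'.mono_right s₃)
      (hTZ.mono_right fun x hx => .inl (.inl hx)) (hTZ.mono_right fun x hx => .inl (.inr hx))
      (hTZ.mono_right fun x hx => .inr hx) t₁ t₂ t₃ t₁' t₂' t₃' a₁ a₂ a₃
  have link : ∀ {A B C : Set V}, IsConn G A → Disjoint A B → A ∪ B ∪ C = Z →
      (∃ a ∈ A, ∃ b ∈ B, Reach G (Ω \ C) a b) →
      ∃ Q ⊆ Ω \ Z, IsConn G (A ∪ Q) ∧ Touch G (A ∪ Q) B ∧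
        (Q.Nonempty → IsConn G Q ∧ Touch G Q A ∧ Touch G Q B) := by
    rintro A B C hA hAB hABC ⟨a, ha, b, hb, hr⟩
    rcases hr.touch_or_exists ha hb hAB with h | ⟨Q, hQ, hQc, hAQ, hQB⟩
    · exact ⟨∅, empty_subset _, by simpa using hA, by simpa using h, by simp⟩
    · refine ⟨Q, ?_, hA.union hQc hAQ, hQB.left subset_union_right, fun _ => ⟨hQc, hAQ.symm, hQB⟩⟩
      intro x hx
      have := hQ hx
      rw [← hABC]
      simp only [mem_sdiff, mem_union] at this ⊢
      tauto
  obtain ⟨Q₁, q₁, c₁, u₁, n₁⟩ := link h₁ d₁₂ rfl r₁₂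
  obtain ⟨Q₂, q₂, c₂, u₂, n₂⟩ := link h₂ d₂₃
    (by rw [hZ, union_comm, union_assoc]) r₂₃
  obtain ⟨Q₃, q₃, c₃, u₃, n₃⟩ := link h₃ d₁₃.symm
    (by rw [hZ, union_comm C₃, union_right_comm]) r₃₁
  have disj : ∀ {P Q A B C : Set V}, (P.Nonempty → IsConn G P ∧ Touch G P A ∧ Touch G P B) →
      (Q.Nonempty → IsConn G Q ∧ Touch G Q B ∧ Touch G Q C) → P ⊆ Ω \ Z → Q ⊆ Ω \ Z →
      (∀ T : Set V, IsConn G T → T ⊆ Ω \ Z → Touch G T A → Touch G T B → Touch G T C → False) →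
      Disjoint P Q := by
    intro P Q A B C hP hQ sP sQ hT
    rw [disjoint_iff_inter_eq_empty, ← not_nonempty_iff_eq_empty]
    intro hne
    obtain ⟨p1, p2, p3⟩ := hP (hne.mono inter_subset_left)
    obtain ⟨r1, r2, r3⟩ := hQ (hne.mono inter_subset_right)
    exact hT _ (p1.union_inter r1 hne) (union_subset sP sQ) (p2.left subset_union_left)
      (p3.left subset_union_left) (r3.left subset_union_right)
  have e₁₂ : Disjoint Q₁ Q₂ := disj n₁ n₂ q₁ q₂ noT
  have e₂₃ : Disjoint Q₂ Q₃ := disj n₂ n₃ q₂ q₃ fun T a b c d e => noT T a b e c d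
  have e₃₁ : Disjoint Q₃ Q₁ := disj n₃ n₁ q₃ q₁ fun T a b c d e => noT T a b d e c
  have out : ∀ {A Q : Set V}, A ⊆ Z → Q ⊆ Ω \ Z → Disjoint A Q := fun hA hQ =>
    disjoint_left.2 fun x hx hxQ => (hQ hxQ).2 (hA hx)
  have z₁ : C₁ ⊆ Z := fun x hx => .inl (.inl hx)
  have z₂ : C₂ ⊆ Z := fun x hx => .inl (.inr hx)
  have z₃ : C₃ ⊆ Z := fun x hx => .inr hx
  have dd : ∀ {A B P Q : Set V}, Disjoint A B → Disjoint P Q → A ⊆ Z → B ⊆ Z → P ⊆ Ω \ Z →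
      Q ⊆ Ω \ Z → Disjoint (A ∪ P) (B ∪ Q) := by
    intro A B P Q h h' hA hB hP hQ
    rw [disjoint_union_left, disjoint_union_right, disjoint_union_right]
    exact ⟨⟨h, out hA hQ⟩, (out hB hP).symm, h'⟩
  have m₁ : C₁ ∪ Q₁ ⊆ Ω := union_subset s₁ (q₁.trans sdiff_subset)
  have m₂ : C₂ ∪ Q₂ ⊆ Ω := union_subset s₂ (q₂.trans sdiff_subset)
  have m₃ : C₃ ∪ Q₃ ⊆ Ω := union_subset s₃ (q₃.trans sdiff_subset)
  exact hG.not_K5 hS hS' c₁ c₂ c₃ hSS (hΩ.mono_right m₁) (hΩ.mono_right m₂) (hΩ.mono_right m₃)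
    (hΩ'.mono_right m₁) (hΩ'.mono_right m₂) (hΩ'.mono_right m₃)
    (dd d₁₂ e₁₂ z₁ z₂ q₁ q₂) (dd d₁₃ e₃₁.symm z₁ z₃ q₁ q₃) (dd d₂₃ e₂₃ z₂ z₃ q₂ q₃)
    tSS (t₁.right subset_union_left) (t₂.right subset_union_left) (t₃.right subset_union_left)
    (t₁'.right subset_union_left) (t₂'.right subset_union_left) (t₃'.right subset_union_left)
    (u₁.right subset_union_left) (u₃.right subset_union_left).symm (u₂.right subset_union_left)

end LocalGirth

namespace LocalGirth

open Finset

open scoped Classical in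
/-- The number of pairs in `A × B` that are edges of `G`. -/
noncomputable def cross {V : Type*} (G : SimpleGraph V) (A B : Finset V) : ℤ :=
  ∑ a ∈ A, ∑ b ∈ B, if G.Adj a b then 1 else 0

/-- The number of edges of `G` inside `A`. -/
noncomputable def edgesIn {V : Type*} (G : SimpleGraph V) (A : Finset V) : ℤ := cross G A A / 2

/-- The potential of Kostochka and Yancey for 4-critical graphs. -/
noncomputable def potential {V : Type*} (G : SimpleGraph V) (A : Finset V) : ℤ :=
  5 * (A.card : ℤ) - 3 * edgesIn G A

/-- The subgraph induced by `A` is 3-colourable. -/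
def ThreeCol {V : Type*} (G : SimpleGraph V) (A : Finset V) : Prop :=
  ∃ φ : V → Fin 3, ∀ u ∈ A, ∀ v ∈ A, G.Adj u v → φ u ≠ φ v

section

open scoped Classical

variable {V : Type*} {G H : SimpleGraph V}

lemma cross_comm (A B : Finset V) : cross G A B = cross G B A := by
  unfold cross
  rw [sum_comm]
  simp only [G.adj_comm]

lemma cross_union_left {A B C : Finset V} (h : Disjoint A B) :
    cross G (A ∪ B) C = cross G A C + cross G B C := sum_union h

lemma cross_union_right {A B C : Finset V} (h : Disjoint A B) :
    cross G C (A ∪ B) = cross G C A + cross G C B := by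
  rw [cross_comm, cross_union_left h, cross_comm A, cross_comm B]

lemma cross_singleton (a : V) (B : Finset V) : cross G {a} B = (B.filter (G.Adj a)).card := by
  simp [cross]

lemma cross_eq_sum (A B : Finset V) : cross G A B = ∑ a ∈ A, ((B.filter (G.Adj a)).card : ℤ) := by
  simp [cross]

lemma cross_mono {A B : Finset V} (h : ∀ a ∈ A, ∀ b ∈ B, G.Adj a b → H.Adj a b) :
    cross G A B ≤ cross H A B := by
  refine sum_le_sum fun a ha => sum_le_sum fun b hb => ?_
  have := h a ha b hb
  split_ifs <;> simp_all

lemma cross_self_singleton (a : V) : cross G {a} {a} = 0 := by simp [cross]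

lemma even_cross (A : Finset V) : Even (cross G A A) := by
  induction A using Finset.induction_on with
  | empty => simp [cross]
  | insert a s ha ih =>
    have hd : Disjoint {a} s := by simpa using ha
    rw [insert_eq, cross_union_left hd, cross_union_right hd, cross_union_right hd,
      cross_self_singleton, cross_comm s {a}]
    obtain ⟨k, hk⟩ := ih
    exact ⟨cross G {a} s + k, by rw [hk]; ring⟩

lemma two_mul_edgesIn (A : Finset V) : 2 * edgesIn G A = cross G A A :=
  Int.mul_ediv_cancel' (even_cross A).two_dvd

lemma edgesIn_union {A B : Finset V} (h : Disjoint A B) :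
    edgesIn G (A ∪ B) = edgesIn G A + edgesIn G B + cross G A B := by
  have h₁ := two_mul_edgesIn (G := G) (A ∪ B)
  have h₂ := two_mul_edgesIn (G := G) A
  have h₃ := two_mul_edgesIn (G := G) B
  rw [cross_union_left h, cross_union_right h, cross_union_right h, cross_comm B A] at h₁
  linarith

lemma edgesIn_singleton (a : V) : edgesIn G {a} = 0 := by
  simp [edgesIn, cross_self_singleton]

lemma edgesIn_insert {A : Finset V} {a : V} (h : a ∉ A) :
    edgesIn G (insert a A) = edgesIn G A + (A.filter (G.Adj a)).card := by
  rw [insert_eq, edgesIn_union (by simpa using h), edgesIn_singleton, cross_singleton]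
  ring

lemma edgesIn_mono_graph {A : Finset V} (h : ∀ a ∈ A, ∀ b ∈ A, G.Adj a b → H.Adj a b) :
    edgesIn G A ≤ edgesIn H A := by
  have h₁ := two_mul_edgesIn (G := G) A
  have h₂ := two_mul_edgesIn (G := H) A
  have := cross_mono h
  linarith

lemma edgesIn_congr {A : Finset V} (h : ∀ a ∈ A, ∀ b ∈ A, G.Adj a b ↔ H.Adj a b) :
    edgesIn G A = edgesIn H A :=
  le_antisymm (edgesIn_mono_graph fun a ha b hb => (h a ha b hb).1)
    (edgesIn_mono_graph fun a ha b hb => (h a ha b hb).2)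

lemma two_mul_edgesIn_le (A : Finset V) : 2 * edgesIn G A ≤ A.card * (A.card - 1) := by
  rw [two_mul_edgesIn, cross_eq_sum]
  calc ∑ a ∈ A, ((A.filter (G.Adj a)).card : ℤ) ≤ ∑ a ∈ A, ((A.card : ℤ) - 1) := by
        refine sum_le_sum fun a ha => ?_
        have : (A.filter (G.Adj a)).card ≤ (A.erase a).card := by
          refine card_le_card fun b hb => ?_
          rw [mem_filter] at hb
          exact mem_erase.2 ⟨hb.2.ne', hb.1⟩
        rw [card_erase_of_mem ha] at this
        have h1 : 1 ≤ A.card := card_pos.2 ⟨a, ha⟩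
        omega
    _ = _ := by simp [mul_sub]

lemma potential_small {A : Finset V} (h₁ : 1 ≤ A.card) (h₂ : A.card ≤ 3) :
    5 ≤ potential G A ∧ (2 ≤ A.card → 6 ≤ potential G A) := by
  have h := two_mul_edgesIn_le (G := G) A
  unfold potential
  generalize A.card = n at *
  interval_cases n <;> constructor <;> intros <;> norm_num at * <;> linarith

lemma ThreeCol.mono {A B : Finset V} (h : ThreeCol G B) (hAB : A ⊆ B) : ThreeCol G A := by
  obtain ⟨φ, hφ⟩ := h
  exact ⟨φ, fun u hu v hv => hφ u (hAB hu) v (hAB hv)⟩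

lemma threeCol_of_card_le {A : Finset V} (h : A.card ≤ 3) : ThreeCol G A := by
  obtain ⟨f⟩ : Nonempty (A ↪ Fin 3) := Function.Embedding.nonempty_of_card_le (by simpa using h)
  refine ⟨fun v => if hv : v ∈ A then f ⟨v, hv⟩ else 0, fun u hu v hv huv he => ?_⟩
  simp only [hu, hv, dif_pos] at he
  exact huv.ne (by simpa using f.injective he)

lemma edgesIn_le_add_one {A : Finset V} (u v : V)
    (h : ∀ a b, H.Adj a b → G.Adj a b ∨ (a = u ∧ b = v) ∨ (a = v ∧ b = u)) :
    edgesIn H A ≤ edgesIn G A + 1 := by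
  have h₁ := two_mul_edgesIn (G := G) A
  have h₂ := two_mul_edgesIn (G := H) A
  have : cross H A A ≤ cross G A A + 2 := by
    have hp : ∀ a b : V, (if H.Adj a b then (1 : ℤ) else 0) ≤
        (if G.Adj a b then 1 else 0) + ((if a = u then (if b = v then 1 else 0) else 0) +
          (if a = v then (if b = u then 1 else 0) else 0)) := by
      intro a b
      have := h a b
      by_cases a = u <;> by_cases b = v <;> by_cases a = v <;> by_cases b = u <;>
        by_cases G.Adj a b <;> by_cases H.Adj a b <;> simp_all
    calc cross H A A ≤ ∑ a ∈ A, ∑ b ∈ A, ((if G.Adj a b then (1 : ℤ) else 0) +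
          ((if a = u then (if b = v then 1 else 0) else 0) +
          (if a = v then (if b = u then 1 else 0) else 0))) :=
        sum_le_sum fun a _ => sum_le_sum fun b _ => hp a b
      _ = cross G A A + (∑ a ∈ A, ∑ b ∈ A, (if a = u then (if b = v then (1 : ℤ) else 0) else 0) +
          ∑ a ∈ A, ∑ b ∈ A, (if a = v then (if b = u then (1 : ℤ) else 0) else 0)) := by
        simp only [sum_add_distrib, cross]
      _ ≤ cross G A A + 2 := by
        have hq : ∀ p q : V,
            ∑ a ∈ A, ∑ b ∈ A, (if a = p then (if b = q then (1 : ℤ) else 0) else 0) ≤ 1 := by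
          intro p q
          rw [sum_comm]
          simp only [sum_ite_eq']
          by_cases hpA : p ∈ A <;> by_cases hqA : q ∈ A <;> simp [hpA, hqA]
        linarith [hq u v, hq v u]
  linarith

end

end LocalGirth

namespace LocalGirth

open Finset

section

open scoped Classical

variable {V : Type*} {G : SimpleGraph V} {U : Finset V}

/-- Every graph induced on fewer than `n` vertices that is not 3-colourable contains a
non-3-colourable induced subgraph of potential at most `2`. -/
def PotentialBoundBelow (V : Type*) (n : ℕ) : Prop :=
  ∀ (G : SimpleGraph V) (A : Finset V), A.card < n → ¬ ThreeCol G A →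
    ∃ R ⊆ A, ¬ ThreeCol G R ∧ potential G R ≤ 2

/-- Replacing the coloured set `R` by a triangle, one vertex for each colour. -/
lemma exists_reduced (IH : PotentialBoundBelow V U.card) (hU : ¬ ThreeCol G U)
    (hcrit : ∀ A ⊂ U, ThreeCol G A) {R : Finset V} (hR : R ⊂ U) (hR4 : 4 ≤ R.card)
    {φ : V → Fin 3} (hφ : ∀ u ∈ R, ∀ v ∈ R, G.Adj u v → φ u ≠ φ v) :
    ∃ W ⊆ U \ R, ∃ I : Finset (Fin 3), I.Nonempty ∧ ∃ p : ℤ, 5 ≤ p ∧ (2 ≤ I.card → 6 ≤ p) ∧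
      potential G W + p - 3 * cross G W (R.filter fun w => φ w ∈ I) ≤ 2 := by
  obtain ⟨S, hSR, hS⟩ := exists_subset_card_eq (show 3 ≤ R.card by omega)
  let e : S ≃ Fin 3 := Fintype.equivFinOfCardEq (by simpa using hS)
  let r : Fin 3 → V := fun i => (e.symm i : V)
  have hrS : ∀ i, r i ∈ S := fun i => (e.symm i).2
  have hr : Function.Injective r := fun i j h => e.symm.injective (Subtype.ext h)
  have hSr : ∀ x ∈ S, ∃ i, r i = x := fun x hx => ⟨e ⟨x, hx⟩, by simp [r]⟩
  let c : V → V := fun w => if w ∈ R then r (φ w) else w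
  have hcR : ∀ w, c w ∈ R ↔ w ∈ R := by
    intro w
    by_cases hw : w ∈ R <;> simp [c, hw, hSR (hrS _)]
  have hcS : ∀ w ∈ R, c w ∈ S := fun w hw => by simp [c, hw, hrS]
  have hcn : ∀ w ∉ R, c w = w := fun w hw => by simp [c, hw]
  obtain ⟨H, hH⟩ : ∃ H : SimpleGraph V, ∀ a b, H.Adj a b ↔ a ≠ b ∧ ((a ∈ S ∧ b ∈ S) ∨
      ∃ w ∈ U, ∃ w' ∈ U, c w = a ∧ c w' = b ∧ G.Adj w w') := by
    refine ⟨{ Adj := fun a b => a ≠ b ∧ ((a ∈ S ∧ b ∈ S) ∨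
        ∃ w ∈ U, ∃ w' ∈ U, c w = a ∧ c w' = b ∧ G.Adj w w'), symm := ⟨?_⟩, loopless := ⟨?_⟩ },
      fun _ _ => Iff.rfl⟩
    · rintro a b ⟨hne, h | ⟨w, hw, w', hw', h1, h2, h3⟩⟩
      · exact ⟨hne.symm, .inl h.symm⟩
      · exact ⟨hne.symm, .inr ⟨w', hw', w, hw, h2, h1, h3.symm⟩⟩
    · exact fun _ h => h.1 rfl
  have hdisj : Disjoint (U \ R) S :=
    disjoint_left.2 fun x hx hxS => (mem_sdiff.1 hx).2 (hSR hxS)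
  have hcard : (U \ R ∪ S).card < U.card := by
    rw [card_union_of_disjoint hdisj, hS, card_sdiff_of_subset hR.1]
    have := card_le_card hR.1
    omega
  have hYcol : ¬ ThreeCol H (U \ R ∪ S) := by
    rintro ⟨ψ, hψ⟩
    apply hU
    have hcY : ∀ w ∈ U, c w ∈ U \ R ∪ S := by
      intro w hw
      by_cases hwR : w ∈ R
      · exact mem_union_right _ (hcS w hwR)
      · rw [hcn w hwR]
        exact mem_union_left _ (mem_sdiff.2 ⟨hw, hwR⟩)
    refine ⟨ψ ∘ c, fun u hu v hv huv => hψ _ (hcY u hu) _ (hcY v hv)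
      ((hH _ _).2 ⟨?_, .inr ⟨u, hu, v, hv, rfl, rfl, huv⟩⟩)⟩
    by_cases huR : u ∈ R <;> by_cases hvR : v ∈ R
    · simp only [c, huR, hvR, if_true]
      exact fun h => hφ u huR v hvR huv (hr h)
    · intro h
      exact hvR ((hcR v).1 (h ▸ (hcR u).2 huR))
    · intro h
      exact huR ((hcR u).1 (h ▸ (hcR v).2 hvR))
    · rw [hcn u huR, hcn v hvR]
      exact huv.ne
  obtain ⟨W, hWY, hWcol, hWpot⟩ := IH H _ hcard hYcol
  have hHG : ∀ a ∈ U \ R, ∀ b ∈ U \ R, H.Adj a b ↔ G.Adj a b := by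
    intro a ha b hb
    rw [mem_sdiff] at ha hb
    rw [hH]
    constructor
    · rintro ⟨-, h | ⟨w, hw, w', hw', h1, h2, h3⟩⟩
      · exact absurd (hSR h.1) ha.2
      · have hwR : w ∉ R := fun h => ha.2 (h1 ▸ (hcR w).2 h)
        have hwR' : w' ∉ R := fun h => hb.2 (h2 ▸ (hcR w').2 h)
        rw [hcn w hwR] at h1
        rw [hcn w' hwR'] at h2
        exact h1 ▸ h2 ▸ h3
    · intro h
      exact ⟨h.ne, .inr ⟨a, ha.1, b, hb.1, hcn a ha.2, hcn b hb.2, h⟩⟩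
  have hWo : W \ S ⊆ U \ R := by
    intro x hx
    rw [mem_sdiff] at hx
    exact (mem_union.1 (hWY hx.1)).resolve_right hx.2
  have hWi : W ∩ S ⊆ S := inter_subset_right
  let I : Finset (Fin 3) := univ.filter fun i => r i ∈ W
  have hIim : W ∩ S = I.image r := by
    ext x
    simp only [mem_inter, mem_image, I, mem_filter, mem_univ, true_and]
    constructor
    · rintro ⟨hxW, hxS⟩
      obtain ⟨i, rfl⟩ := hSr x hxS
      exact ⟨i, hxW, rfl⟩
    · rintro ⟨i, hi, rfl⟩
      exact ⟨hi, hrS i⟩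
  have hIcard : (W ∩ S).card = I.card := by
    rw [hIim, card_image_of_injective _ hr]
  have hIne : I.Nonempty := by
    by_contra hne
    rw [not_nonempty_iff_eq_empty] at hne
    have hWS : W ∩ S = ∅ := by rw [hIim, hne, image_empty]
    have hWU : W ⊆ U \ R := by
      intro x hx
      refine hWo (mem_sdiff.2 ⟨hx, fun hxS => ?_⟩)
      have := mem_inter.2 ⟨hx, hxS⟩
      rw [hWS] at this
      simp at this
    apply hWcol
    obtain ⟨x, hx⟩ := card_pos.1 (show 0 < R.card by omega)
    obtain ⟨ψ, hψ⟩ := hcrit (U \ R) (sdiff_ssubset hR.1 ⟨x, hx⟩)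
    exact ⟨ψ, fun u hu v hv huv => hψ u (hWU hu) v (hWU hv) ((hHG u (hWU hu) v (hWU hv)).1 huv)⟩
  have hI1 : 1 ≤ (W ∩ S).card := hIcard ▸ card_pos.2 hIne
  have hI3 : (W ∩ S).card ≤ 3 := hS ▸ card_le_card hWi
  obtain ⟨p1, p2⟩ := potential_small (G := H) hI1 hI3
  refine ⟨W \ S, hWo, I, hIne, potential H (W ∩ S), p1, fun h => p2 (hIcard ▸ h), ?_⟩
  have hsplit : W = (W \ S) ∪ (W ∩ S) := (sdiff_union_inter W S).symm
  have hdis : Disjoint (W \ S) (W ∩ S) := disjoint_sdiff_inter W S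
  have hpot : potential H W =
      potential H (W \ S) + potential H (W ∩ S) - 3 * cross H (W \ S) (W ∩ S) := by
    conv_lhs => rw [hsplit]
    unfold potential
    rw [card_union_of_disjoint hdis, edgesIn_union hdis]
    push_cast
    ring
  have hpo : potential H (W \ S) = potential G (W \ S) := by
    unfold potential
    rw [edgesIn_congr fun a ha b hb => hHG a (hWo ha) b (hWo hb)]
  have hcr : cross H (W \ S) (W ∩ S) ≤ cross G (W \ S) (R.filter fun w => φ w ∈ I) := by
    rw [cross_eq_sum, cross_eq_sum]
    refine sum_le_sum fun a ha => ?_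
    norm_cast
    have haU := mem_sdiff.1 (hWo ha)
    refine le_trans (card_le_card ?_) (card_image_le (f := c))
    intro b hb
    rw [mem_filter, mem_inter, hH] at hb
    obtain ⟨⟨hbW, hbS⟩, -, h | ⟨w, hw, w', hw', h1, h2, h3⟩⟩ := hb
    · exact absurd (hSR h.1) haU.2
    · have hwR : w ∉ R := fun h => haU.2 (h1 ▸ (hcR w).2 h)
      rw [hcn w hwR] at h1
      have hwR' : w' ∈ R := (hcR w').1 (h2 ▸ hSR hbS)
      have h4 : r (φ w') = b := by simpa [c, hwR'] using h2
      refine mem_image.2 ⟨w', ?_, h2⟩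
      simp only [mem_filter, I, mem_univ, true_and]
      exact ⟨⟨hwR', h4 ▸ hbW⟩, h1 ▸ h3⟩
  linarith

end

end LocalGirth

namespace LocalGirth

open Finset

section

open scoped Classical

variable {V : Type*} {G : SimpleGraph V} {U : Finset V}

/-- A hypothetical minimal counterexample to the Kostochka–Yancey bound. -/
structure MinCounterexample (G : SimpleGraph V) (U : Finset V) : Prop where
  below : PotentialBoundBelow V U.card
  notCol : ¬ ThreeCol G U
  crit : ∀ A ⊂ U, ThreeCol G A
  large : 3 ≤ potential G U

lemma potential_union {A B : Finset V} (h : Disjoint A B) :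
    potential G (A ∪ B) = potential G A + potential G B - 3 * cross G A B := by
  unfold potential
  rw [card_union_of_disjoint h, edgesIn_union h]
  push_cast
  ring

lemma cross_mono_right {A B C : Finset V} (h : B ⊆ C) : cross G A B ≤ cross G A C := by
  rw [cross_eq_sum, cross_eq_sum]
  refine sum_le_sum fun a _ => ?_
  exact_mod_cast card_le_card (filter_subset_filter _ h)

lemma MinCounterexample.six_le (h : MinCounterexample G U) :
    ∀ R ⊂ U, 2 ≤ R.card → 6 ≤ potential G R := by
  by_contra hcon
  push Not at hcon
  obtain ⟨R₀, hR₀, hR₀2, hR₀p⟩ := hcon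
  obtain ⟨R, hR, hmin⟩ := exists_min_image (U.powerset.filter fun R => R ⊂ U ∧ 2 ≤ R.card)
    (potential G) ⟨R₀, by simp [hR₀, hR₀2, hR₀.1]⟩
  simp only [mem_filter, mem_powerset, and_imp] at hR hmin
  obtain ⟨-, hRU, hR2⟩ := hR
  have hRp : potential G R ≤ 5 := by
    have := hmin R₀ hR₀.1 hR₀ hR₀2
    omega
  have hR4 : 4 ≤ R.card := by
    by_contra hlt
    have := (potential_small (G := G) (A := R) (by omega) (by omega)).2 hR2
    omega
  obtain ⟨φ, hφ⟩ := h.crit R hRU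
  obtain ⟨W, hW, I, -, p, hp, -, hWp⟩ := exists_reduced h.below h.notCol h.crit hRU hR4 hφ
  have hd : Disjoint W R := disjoint_left.2 fun x hx => (mem_sdiff.1 (hW hx)).2
  have hle := cross_mono_right (G := G) (A := W)
    (filter_subset (fun w => φ w ∈ I) R)
  have hpot := potential_union (G := G) hd
  have hsub : W ∪ R ⊆ U := union_subset (hW.trans sdiff_subset) hRU.1
  rcases hsub.eq_or_ssubset with he | hs
  · have := h.large
    rw [← he] at this
    linarith
  · have := hmin (W ∪ R) hsub hs (hR2.trans (card_le_card subset_union_right))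
    linarith

lemma MinCounterexample.card_ge (_h : MinCounterexample G U) {A : Finset V}
    {H : SimpleGraph V} (hA : ¬ ThreeCol H A) : 4 ≤ A.card := by
  by_contra hlt
  exact hA (threeCol_of_card_le (by omega))

/-- A proper part remains colourable after adding an edge. -/
lemma MinCounterexample.col_add_edge (h : MinCounterexample G U) {R : Finset V} (hR : R ⊂ U)
    {u v : V} (hu : u ∈ R) (hv : v ∈ R) (huv : u ≠ v) :
    ∃ φ : V → Fin 3, (∀ a ∈ R, ∀ b ∈ R, G.Adj a b → φ a ≠ φ b) ∧ φ u ≠ φ v := by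
  by_contra hcon
  obtain ⟨H, hH⟩ : ∃ H : SimpleGraph V, ∀ a b, H.Adj a b ↔
      G.Adj a b ∨ (a = u ∧ b = v) ∨ (a = v ∧ b = u) :=
    ⟨{ Adj := fun a b => G.Adj a b ∨ (a = u ∧ b = v) ∨ (a = v ∧ b = u)
       symm := ⟨fun a b hab => hab.elim (fun h => .inl h.symm) (fun h => .inr (by tauto))⟩
       loopless := ⟨fun a ha => by
        rcases ha with h | h | h
        · exact h.ne rfl
        · exact huv (h.1.symm.trans h.2)
        · exact huv (h.2.symm.trans h.1)⟩ }, fun _ _ => Iff.rfl⟩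
  have hcol : ¬ ThreeCol H R := by
    rintro ⟨φ, hφ⟩
    exact hcon ⟨φ, fun a ha b hb hab => hφ a ha b hb ((hH a b).2 (.inl hab)),
      hφ u hu v hv ((hH u v).2 (.inr (.inl ⟨rfl, rfl⟩)))⟩
  obtain ⟨R₁, hR₁, hR₁c, hR₁p⟩ := h.below H R (card_lt_card hR) hcol
  have hle := edgesIn_le_add_one (A := R₁) u v fun a b => (hH a b).1
  have h4 := h.card_ge hR₁c
  have := h.six_le R₁ (hR₁.trans_ssubset hR) (by omega)
  unfold potential at *
  linarith

lemma MinCounterexample.seven_le (h : MinCounterexample G U) :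
    ∀ R ⊂ U, 4 ≤ R.card → 7 ≤ potential G R := by
  intro R hR hR4
  by_contra hlt
  have hUR : (U \ R).Nonempty := by
    obtain ⟨x, hx, hxR⟩ := exists_of_ssubset hR
    exact ⟨x, mem_sdiff.2 ⟨hx, hxR⟩⟩
  have hbd : ∃ u ∈ R, ∃ v ∈ R, u ≠ v ∧ (∃ a ∈ U \ R, G.Adj u a) ∧ ∃ a ∈ U \ R, G.Adj v a := by
    by_contra hcon
    push Not at hcon
    obtain ⟨u, huR, hu⟩ : ∃ u ∈ R, ∀ v ∈ R, (∃ a ∈ U \ R, G.Adj v a) → v = u := by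
      by_cases hex : ∃ u ∈ R, ∃ a ∈ U \ R, G.Adj u a
      · obtain ⟨u, hu, a, ha, hua⟩ := hex
        refine ⟨u, hu, fun v hv ⟨b, hb, hvb⟩ => ?_⟩
        by_contra hne
        exact hcon v hv u hu hne ⟨b, hb, hvb⟩ a ha hua
      · obtain ⟨u, hu⟩ := card_pos.1 (show 0 < R.card by omega)
        exact ⟨u, hu, fun v hv hv' => absurd ⟨v, hv, hv'⟩ hex⟩
    obtain ⟨φ, hφ⟩ := h.crit R hR
    have hlt' : insert u (U \ R) ⊂ U := by
      refine ⟨insert_subset (hR.1 huR) sdiff_subset, fun hsub => ?_⟩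
      have := card_le_card (hsub.trans (Finset.insert_subset_iff.2 ⟨mem_insert_self _ _, subset_insert u (U \ R)⟩))
      rw [card_insert_of_notMem (by simp [huR]), card_sdiff_of_subset hR.1] at this
      have := card_le_card hR.1
      omega
    obtain ⟨ψ, hψ⟩ := h.crit _ hlt'
    apply h.notCol
    refine ⟨fun w => if w ∈ R then Equiv.swap (φ u) (ψ u) (φ w) else ψ w, fun a ha b hb hab => ?_⟩
    have side : ∀ a ∈ R, ∀ b ∈ U, b ∉ R → G.Adj a b →
        Equiv.swap (φ u) (ψ u) (φ a) ≠ ψ b := by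
      intro a haR b hb hbR hab
      have hb' : b ∈ U \ R := mem_sdiff.2 ⟨hb, hbR⟩
      obtain rfl := hu a haR ⟨b, hb', hab⟩
      rw [Equiv.swap_apply_left]
      exact hψ _ (mem_insert_self _ _) b (mem_insert_of_mem hb') hab
    by_cases haR : a ∈ R <;> by_cases hbR : b ∈ R <;> simp only [haR, hbR, if_true, if_false]
    · exact fun he => hφ a haR b hbR hab ((Equiv.swap _ _).injective he)
    · exact side a haR b hb hbR hab
    · exact (side b hbR a ha haR hab.symm).symm
    · exact hψ a (mem_insert_of_mem (mem_sdiff.2 ⟨ha, haR⟩)) b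
        (mem_insert_of_mem (mem_sdiff.2 ⟨hb, hbR⟩)) hab
  obtain ⟨u, hu, v, hv, huv, ⟨x, hx, hux⟩, ⟨y, hy, hvy⟩⟩ := hbd
  obtain ⟨φ, hφ, hφuv⟩ := h.col_add_edge hR hu hv huv
  obtain ⟨W, hW, I, hI, p, hp, hp2, hWp⟩ := exists_reduced h.below h.notCol h.crit hR hR4 hφ
  have hd : Disjoint W R := disjoint_left.2 fun x hx => (mem_sdiff.1 (hW hx)).2
  have hle := cross_mono_right (G := G) (A := W)
    (filter_subset (fun w => φ w ∈ I) R)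
  have hpot := potential_union (G := G) hd
  have hsub : W ∪ R ⊆ U := union_subset (hW.trans sdiff_subset) hR.1
  rcases hsub.eq_or_ssubset with he | hs
  · have hl := h.large
    rw [← he] at hl
    by_cases hI2 : 2 ≤ I.card
    · linarith [hp2 hI2]
    · obtain ⟨i, hi⟩ := card_eq_one.1 (show I.card = 1 by have := card_pos.2 hI; omega)
      have hWe : W = U \ R := by
        refine Subset.antisymm hW fun z hz => ?_
        rw [← he] at hz
        exact (mem_union.1 (mem_sdiff.1 hz).1).resolve_right (mem_sdiff.1 hz).2
      have hsp : cross G W R = cross G W (R.filter fun w => φ w ∈ I) +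
          cross G W (R.filter fun w => ¬ φ w ∈ I) := by
        rw [← cross_union_right (disjoint_filter_filter_not _ _ _), filter_union_filter_not_eq]
      have extra : ∀ w ∈ R, ∀ z ∈ U \ R, G.Adj w z → φ w ∉ I →
          1 ≤ cross G W (R.filter fun w => ¬ φ w ∈ I) := by
        intro w hw z hz hwz hwI
        have h1 : cross G {w} W ≤ cross G (R.filter fun w => ¬ φ w ∈ I) W := by
          rw [cross_comm, cross_comm _ W]
          exact cross_mono_right (by simp [hw, hwI])
        rw [cross_comm W]
        refine le_trans ?_ h1
        rw [cross_singleton]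
        norm_cast
        exact card_pos.2 ⟨z, by simp [hWe, mem_sdiff.1 hz, hwz]⟩
      have : 1 ≤ cross G W (R.filter fun w => ¬ φ w ∈ I) := by
        by_cases hui : φ u ∈ I
        · refine extra v hv y hy hvy fun hvi => hφuv ?_
          rw [hi, mem_singleton] at hui hvi
          rw [hui, hvi]
        · exact extra u hu x hx hux hui
      linarith
  · have := h.six_le (W ∪ R) hs (by have := card_le_card (subset_union_right (s₁ := W) (s₂ := R)); omega)
    by_cases hI2 : 2 ≤ I.card
    · linarith [hp2 hI2]
    · linarith

end

end LocalGirth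

namespace LocalGirth

open Finset

section

open scoped Classical

variable {V : Type*} {G : SimpleGraph V} {U : Finset V}

/-- `φ` is proper on `A`. -/
def ProperOn {V κ : Type*} (G : SimpleGraph V) (A : Finset V) (φ : V → κ) : Prop :=
  ∀ a ∈ A, ∀ b ∈ A, G.Adj a b → φ a ≠ φ b

lemma ProperOn.update {κ : Type*} {A : Finset V} {φ : V → κ} (h : ProperOn G A φ) {x : V}
    (hx : x ∉ A) {c : κ} (hc : ∀ b ∈ A, G.Adj x b → φ b ≠ c) :
    ProperOn G (insert x A) (Function.update φ x c) := by
  intro a ha b hb hab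
  rcases mem_insert.1 ha with ha' | ha' <;> rcases mem_insert.1 hb with hb' | hb'
  · exact absurd (ha'.trans hb'.symm) hab.ne
  · have : b ≠ x := fun e => hx (e ▸ hb')
    simpa [ha', Function.update_of_ne this] using (hc b hb' (ha' ▸ hab)).symm
  · have : a ≠ x := fun e => hx (e ▸ ha')
    simpa [hb', Function.update_of_ne this] using hc a ha' (hb' ▸ hab.symm)
  · have h1 : a ≠ x := fun e => hx (e ▸ ha')
    have h2 : b ≠ x := fun e => hx (e ▸ hb')
    simpa [Function.update_of_ne h1, Function.update_of_ne h2] using h a ha' b hb' hab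

lemma exists_fin_three_notMem {S : Finset (Fin 3)} (h : S.card ≤ 2) : ∃ c, c ∉ S := by
  by_contra hc
  push Not at hc
  have : S = univ := eq_univ_iff_forall.2 hc
  rw [this] at h
  simp at h

lemma MinCounterexample.three_le_deg (h : MinCounterexample G U) {v : V} (hv : v ∈ U) :
    3 ≤ (U.filter (G.Adj v)).card := by
  by_contra hlt
  obtain ⟨φ, hφ⟩ := h.crit (U.erase v) (erase_ssubset hv)
  obtain ⟨c, hc⟩ := exists_fin_three_notMem (S := (U.filter (G.Adj v)).image φ)
    (card_image_le.trans (by omega))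
  have := ProperOn.update (G := G) (A := U.erase v) (φ := φ) hφ (notMem_erase v U) (c := c) (by
    intro b hb hvb he
    exact hc (mem_image.2 ⟨b, mem_filter.2 ⟨mem_of_mem_erase hb, hvb⟩, he⟩))
  rw [insert_erase hv] at this
  exact h.notCol ⟨_, this⟩

/-- A colouring of `U` minus two adjacent cubic vertices `x`, `y` extends if the two other
neighbours of `x` get the same colour. -/
lemma MinCounterexample.not_same (h : MinCounterexample G U) {x y a₁ a₂ : V} (hx : x ∈ U)
    (hy : y ∈ U) (hNx : U.filter (G.Adj x) = {y, a₁, a₂}) (hdy : (U.filter (G.Adj y)).card = 3)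
    {φ : V → Fin 3} (hφ : ProperOn G (U \ {x, y}) φ) : φ a₁ ≠ φ a₂ := by
  intro heq
  have hxy : G.Adj x y := by
    have : y ∈ U.filter (G.Adj x) := by simp [hNx]
    exact (mem_filter.1 this).2
  obtain ⟨c, hc⟩ := exists_fin_three_notMem (S := ((U.filter (G.Adj y)).erase x).image φ)
    (card_image_le.trans (by
      rw [card_erase_of_mem (mem_filter.2 ⟨hx, hxy.symm⟩), hdy]))
  have h1 := hφ.update (x := y) (by simp) (c := c) (by
    intro b hb hyb he
    rw [mem_sdiff] at hb
    refine hc (mem_image.2 ⟨b, mem_erase.2 ⟨?_, mem_filter.2 ⟨hb.1, hyb⟩⟩, he⟩)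
    rintro rfl
    simp at hb)
  obtain ⟨d, hd⟩ := exists_fin_three_notMem (S := {c, φ a₁}) card_le_two
  have h2 := h1.update (x := x) (by simp [hxy.ne]) (c := d) (by
    intro b hb hxb he
    apply hd
    by_cases hby : b = y
    · subst hby
      simp at he
      simp [he]
    · rw [Function.update_of_ne hby] at he
      have hbU : b ∈ U := by
        rcases mem_insert.1 hb with rfl | hb
        · exact hy
        · exact (mem_sdiff.1 hb).1
      have hbN : b ∈ U.filter (G.Adj x) := mem_filter.2 ⟨hbU, hxb⟩
      rw [hNx] at hbN
      simp only [mem_insert, mem_singleton] at hbN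
      rcases hbN with rfl | rfl | rfl
      · exact absurd rfl hby
      · simp [he]
      · simp [heq, he])
  have he : insert x (insert y (U \ {x, y})) = U := by
    ext z
    simp only [mem_insert, mem_sdiff, mem_singleton]
    constructor
    · rintro (rfl | rfl | hz)
      · exact hx
      · exact hy
      · exact hz.1
    · intro hz
      tauto
  rw [he] at h2
  exact h.notCol ⟨_, h2⟩

lemma MinCounterexample.adj_of_cubic (h : MinCounterexample G U) {x y a₁ a₂ : V} (hx : x ∈ U)
    (hy : y ∈ U) (hNx : U.filter (G.Adj x) = {y, a₁, a₂}) (hdx : (U.filter (G.Adj x)).card = 3)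
    (hdy : (U.filter (G.Adj y)).card = 3) : G.Adj a₁ a₂ := by
  by_contra hna
  have hmem : ∀ z ∈ ({y, a₁, a₂} : Finset V), z ∈ U ∧ G.Adj x z := by
    intro z hz
    rw [← hNx] at hz
    exact mem_filter.1 hz
  have hxy : G.Adj x y := (hmem y (by simp)).2
  have hxa₁ := hmem a₁ (by simp)
  have hxa₂ := hmem a₂ (by simp)
  rw [hNx] at hdx
  obtain ⟨hya₁, hya₂, haa⟩ : y ≠ a₁ ∧ y ≠ a₂ ∧ a₁ ≠ a₂ := by
    refine ⟨?_, ?_, ?_⟩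
    · rintro rfl
      have := card_le_two (a := y) (b := a₂)
      simp at hdx
      omega
    · rintro rfl
      have := card_le_two (a := a₁) (b := y)
      rw [insert_eq_of_mem (by simp)] at hdx
      omega
    · rintro rfl
      have := card_le_two (a := y) (b := a₁)
      simp at hdx
      omega
  let c : V → V := fun w => if w = a₂ then a₁ else w
  have hc2 : c a₂ = a₁ := by simp [c]
  have hcn : ∀ w, w ≠ a₂ → c w = w := fun w hw => by simp [c, hw]
  obtain ⟨H, hH⟩ : ∃ H : SimpleGraph V, ∀ a b, H.Adj a b ↔ a ≠ b ∧
      ∃ w ∈ U \ {x, y}, ∃ w' ∈ U \ {x, y}, c w = a ∧ c w' = b ∧ G.Adj w w' := by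
    refine ⟨{ Adj := fun a b => a ≠ b ∧
      ∃ w ∈ U \ {x, y}, ∃ w' ∈ U \ {x, y}, c w = a ∧ c w' = b ∧ G.Adj w w', symm := ⟨?_⟩, loopless := ⟨?_⟩ },
      fun _ _ => Iff.rfl⟩
    · rintro a b ⟨hne, w, hw, w', hw', h1, h2, h3⟩
      exact ⟨hne.symm, w', hw', w, hw, h2, h1, h3.symm⟩
    · exact fun _ h => h.1 rfl
  have hY : ∀ w, w ∈ (U \ {x, y}).erase a₂ ↔ w ≠ a₂ ∧ w ∈ U ∧ w ≠ x ∧ w ≠ y := by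
    intro w
    simp [mem_erase, mem_sdiff]
  have hnc : ¬ ThreeCol H ((U \ {x, y}).erase a₂) := by
    rintro ⟨ψ, hψ⟩
    have hcY : ∀ w ∈ U \ {x, y}, c w ∈ (U \ {x, y}).erase a₂ := by
      intro w hw
      by_cases hw2 : w = a₂
      · subst hw2
        rw [hc2, hY]
        exact ⟨haa, hxa₁.1, hxa₁.2.ne', hya₁.symm⟩
      · rw [hcn w hw2]
        exact mem_erase.2 ⟨hw2, hw⟩
    have hpr : ProperOn G (U \ {x, y}) (ψ ∘ c) := by
      intro u hu v hv huv
      refine hψ _ (hcY u hu) _ (hcY v hv) ((hH _ _).2 ⟨?_, u, hu, v, hv, rfl, rfl, huv⟩)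
      by_cases hu2 : u = a₂ <;> by_cases hv2 : v = a₂
      · exact absurd (hu2.trans hv2.symm) huv.ne
      · subst hu2
        rw [hc2, hcn v hv2]
        rintro rfl
        exact hna huv.symm
      · subst hv2
        rw [hc2, hcn u hu2]
        rintro rfl
        exact hna huv
      · rw [hcn u hu2, hcn v hv2]
        exact huv.ne
    refine h.not_same hx hy hNx hdy hpr ?_
    simp [c, haa]
  obtain ⟨W, hW, hWc, hWp⟩ := h.below H _ (card_lt_card ⟨(erase_subset _ _).trans sdiff_subset,
    fun hs => by have := hs hx; simp at this⟩) hnc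
  have hWU : W ⊆ U := hW.trans ((erase_subset _ _).trans sdiff_subset)
  have hHG : ∀ a b, a ≠ a₁ → b ≠ a₁ → H.Adj a b → G.Adj a b := by
    intro a b ha hb hab
    obtain ⟨-, w, -, w', -, h1, h2, h3⟩ := (hH a b).1 hab
    have hw : w ≠ a₂ := by
      rintro rfl
      exact ha (h1.symm.trans hc2)
    have hw' : w' ≠ a₂ := by
      rintro rfl
      exact hb (h2.symm.trans hc2)
    rw [hcn _ hw] at h1
    rw [hcn _ hw'] at h2
    exact h1 ▸ h2 ▸ h3
  have hxW : x ∉ W := fun hxW => ((hY x).1 (hW hxW)).2.2.1 rfl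
  have hyW : y ∉ W := fun hxW => ((hY y).1 (hW hxW)).2.2.2 rfl
  have h2W : a₂ ∉ W := fun hxW => ((hY a₂).1 (hW hxW)).1 rfl
  have h1W : a₁ ∈ W := by
    by_contra h1W
    obtain ⟨ψ, hψ⟩ := h.crit W ⟨hWU, fun hs => hxW (hs hx)⟩
    exact hWc ⟨ψ, fun u hu v hv huv => hψ u hu v hv (hHG u v (fun e => h1W (e ▸ hu))
      (fun e => h1W (e ▸ hv)) huv)⟩
  have hW4 := h.card_ge hWc
  have e1 := edgesIn_insert (G := H) (notMem_erase a₁ W)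
  rw [insert_erase h1W] at e1
  have e2 := edgesIn_insert (G := G) (notMem_erase a₁ W)
  rw [insert_erase h1W] at e2
  have e3 := edgesIn_insert (G := G) h2W
  have e4 := edgesIn_insert (G := G) (A := insert a₂ W) (a := x)
    (by simp [hxW, hxa₂.2.ne])
  have e5 : edgesIn H (W.erase a₁) ≤ edgesIn G (W.erase a₁) :=
    edgesIn_mono_graph fun a ha b hb => hHG a b (ne_of_mem_erase ha) (ne_of_mem_erase hb)
  have e6 : ((W.erase a₁).filter (H.Adj a₁)).card ≤
      ((W.erase a₁).filter (G.Adj a₁)).card + (W.filter (G.Adj a₂)).card := by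
    refine le_trans (card_le_card ?_) (card_union_le _ _)
    intro z hz
    rw [mem_filter] at hz
    obtain ⟨-, w, -, w', -, h1, h2, h3⟩ := (hH _ _).1 hz.2
    have hw' : w' ≠ a₂ := by
      rintro rfl
      exact ne_of_mem_erase hz.1 (h2.symm.trans hc2)
    rw [hcn _ hw'] at h2
    subst h2
    by_cases hw : w = a₂
    · subst hw
      exact mem_union_right _ (mem_filter.2 ⟨mem_of_mem_erase hz.1, h3⟩)
    · rw [hcn _ hw] at h1
      subst h1
      exact mem_union_left _ (mem_filter.2 ⟨hz.1, h3⟩)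
  have e7 : 2 ≤ ((insert a₂ W).filter (G.Adj x)).card := by
    rw [← card_pair haa]
    refine card_le_card fun z hz => ?_
    simp only [mem_insert, mem_singleton] at hz
    rcases hz with rfl | rfl
    · simp [h1W, hxa₁.2]
    · simp [hxa₂.2]
  have hc1 : (insert a₂ W).card = W.card + 1 := card_insert_of_notMem h2W
  have hc3 : (insert x (insert a₂ W)).card = W.card + 2 := by
    rw [card_insert_of_notMem (by simp [hxW, hxa₂.2.ne]), hc1]
  have hss : insert x (insert a₂ W) ⊂ U :=
    ⟨insert_subset hx (insert_subset hxa₂.1 hWU), fun hs => by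
      have := hs hy
      simp [hxy.ne', hya₂, hyW] at this⟩
  have h7 := h.seven_le _ hss (by omega)
  unfold potential at h7 hWp
  rw [hc3] at h7
  zify at e6 e7
  push_cast at h7
  linarith

end

end LocalGirth

namespace LocalGirth

open Finset

section

open scoped Classical

variable {V : Type*} {G : SimpleGraph V} {U : Finset V}

lemma exists_eq_triple {S : Finset V} (hS : S.card = 3) {y z : V} (hy : y ∈ S) (hz : z ∈ S)
    (hyz : y ≠ z) : ∃ a, S = {y, z, a} := by
  have h : ((S.erase y).erase z).card = 1 := by
    rw [card_erase_of_mem (mem_erase.2 ⟨hyz.symm, hz⟩), card_erase_of_mem hy, hS]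
  obtain ⟨a, ha⟩ := card_eq_one.1 h
  exact ⟨a, by rw [← ha, insert_erase (mem_erase.2 ⟨hyz.symm, hz⟩), insert_erase hy]⟩

lemma MinCounterexample.triangle (h : MinCounterexample G U) {x y z : V} (hx : x ∈ U)
    (hy : y ∈ U) (hz : z ∈ U) (hxy : G.Adj x y) (hxz : G.Adj x z) (hyz : G.Adj y z)
    (hdx : (U.filter (G.Adj x)).card = 3) (hdy : (U.filter (G.Adj y)).card = 3) : False := by
  obtain ⟨a, ha⟩ := exists_eq_triple hdx (mem_filter.2 ⟨hy, hxy⟩) (mem_filter.2 ⟨hz, hxz⟩) hyz.ne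
  obtain ⟨b, hb⟩ := exists_eq_triple hdy (mem_filter.2 ⟨hx, hxy.symm⟩) (mem_filter.2 ⟨hz, hyz⟩)
    hxz.ne
  have hza := h.adj_of_cubic hx hy ha hdx hdy
  have hzb := h.adj_of_cubic hy hx hb hdy hdx
  have hxa : a ∈ U ∧ G.Adj x a := mem_filter.1 (by rw [ha]; simp)
  have hyb : b ∈ U ∧ G.Adj y b := mem_filter.1 (by rw [hb]; simp)
  by_cases hab : a = b
  · subst hab
    have hnc : ¬ ThreeCol G {x, y, z, a} := by
      rintro ⟨φ, hφ⟩
      have key : ∀ p q r s : Fin 3, ¬ (p ≠ q ∧ p ≠ r ∧ p ≠ s ∧ q ≠ r ∧ q ≠ s ∧ r ≠ s) := by decide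
      exact key _ _ _ _ ⟨hφ x (by simp) y (by simp) hxy, hφ x (by simp) z (by simp) hxz,
        hφ x (by simp) a (by simp) hxa.2, hφ y (by simp) z (by simp) hyz,
        hφ y (by simp) a (by simp) hyb.2, hφ z (by simp) a (by simp) hza⟩
    have hsub : {x, y, z, a} ⊆ U := by
      intro w hw
      simp only [mem_insert, mem_singleton] at hw
      rcases hw with rfl | rfl | rfl | rfl <;> tauto
    have hU : {x, y, z, a} = U := hsub.eq_or_ssubset.resolve_right fun hs => hnc (h.crit _ hs)
    have hc : U.card ≤ 4 := hU ▸ card_le_four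
    have hc4 := h.card_ge h.notCol
    have h2 := two_mul_edgesIn (G := G) U
    have h3 : (3 : ℤ) * U.card ≤ cross G U U := by
      rw [cross_eq_sum]
      calc (3 : ℤ) * U.card = ∑ v ∈ U, 3 := by simp [mul_comm]
        _ ≤ _ := sum_le_sum fun v hv => by exact_mod_cast h.three_le_deg hv
    have := h.large
    unfold potential at this
    have h4 : U.card = 4 := by omega
    rw [h4] at this h3
    push_cast at *
    linarith
  · have hss : U \ {x, y} ⊂ U := ⟨sdiff_subset, fun hs => by have := hs hx; simp at this⟩
    obtain ⟨φ, hφ, hφab⟩ := h.col_add_edge hss (u := a) (v := b)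
      (by simp [hxa.1, hxa.2.ne', (show a ≠ y by
        rintro rfl
        have h' := card_le_two (a := a) (b := z)
        rw [ha, show ({a, z, a} : Finset V) = {a, z} by ext; simp; tauto] at hdx
        omega)])
      (by simp [hyb.1, hyb.2.ne', (show b ≠ x by
        rintro rfl
        have h' := card_le_two (a := b) (b := z)
        rw [hb, show ({b, z, b} : Finset V) = {b, z} by ext; simp; tauto] at hdy
        omega)]) hab
    have h1 := h.not_same hx hy ha hdy hφ
    have h2 := h.not_same (x := y) (y := x) hy hx hb hdx (by rwa [pair_comm])
    have p1 := ProperOn.update (φ := φ) hφ (x := y) (by simp) (c := φ a) (by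
      intro w hw hyw he
      rw [mem_sdiff] at hw
      have : w ∈ U.filter (G.Adj y) := mem_filter.2 ⟨hw.1, hyw⟩
      rw [hb] at this
      simp only [mem_insert, mem_singleton] at this hw
      rcases this with rfl | rfl | rfl
      · tauto
      · exact h1 he
      · exact hφab he.symm)
    have p2 := p1.update (x := x) (by simp [hxy.ne]) (c := φ b) (by
      intro w hw hxw he
      by_cases hwy : w = y
      · subst hwy
        simp only [Function.update_self] at he
        exact hφab he
      · rw [Function.update_of_ne hwy] at he
        have hw' := mem_sdiff.1 ((mem_insert.1 hw).resolve_left hwy)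
        have : w ∈ U.filter (G.Adj x) := mem_filter.2 ⟨hw'.1, hxw⟩
        rw [ha] at this
        simp only [mem_insert, mem_singleton] at this
        rcases this with rfl | rfl | rfl
        · exact hwy rfl
        · exact h2 he
        · exact hφab he)
    have he : insert x (insert y (U \ {x, y})) = U := by
      ext w
      simp only [mem_insert, mem_sdiff, mem_singleton]
      constructor
      · rintro (rfl | rfl | hw)
        · exact hx
        · exact hy
        · exact hw.1
      · intro hw
        tauto
    rw [he] at p2
    exact h.notCol ⟨_, p2⟩

lemma MinCounterexample.cubic_nbrs (h : MinCounterexample G U) {x : V} (hx : x ∈ U)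
    (hdx : (U.filter (G.Adj x)).card = 3) :
    2 ≤ (U.filter fun v => G.Adj x v ∧ (U.filter (G.Adj v)).card ≠ 3).card := by
  have hle : (U.filter fun v => G.Adj x v ∧ (U.filter (G.Adj v)).card = 3).card ≤ 1 := by
    rw [card_le_one]
    intro y₁ h₁ y₂ h₂
    by_contra hne
    rw [mem_filter] at h₁ h₂
    obtain ⟨a, ha⟩ := exists_eq_triple hdx (mem_filter.2 ⟨h₁.1, h₁.2.1⟩)
      (mem_filter.2 ⟨h₂.1, h₂.2.1⟩) hne
    have hya := h.adj_of_cubic hx h₁.1 ha hdx h₁.2.2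
    have hxa : a ∈ U ∧ G.Adj x a := mem_filter.1 (by rw [ha]; simp)
    exact h.triangle hx h₂.1 hxa.1 h₂.2.1 hxa.2 hya hdx h₂.2.2
  have := card_filter_add_card_filter_not (s := U.filter (G.Adj x))
    (fun v => (U.filter (G.Adj v)).card = 3)
  rw [filter_filter, filter_filter, hdx] at this
  simp only [ne_eq]
  omega

lemma MinCounterexample.elim (h : MinCounterexample G U) : False := by
  let dg : V → ℕ := fun v => (U.filter (G.Adj v)).card
  let s : V → V → ℤ := fun v w => if G.Adj v w ∧ dg w = 3 ∧ dg v ≠ 3 then 1 else 0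
  have key : ∀ v ∈ U, 20 ≤ 6 * (dg v : ℤ) - ∑ w ∈ U, s v w + ∑ w ∈ U, s w v := by
    intro v hv
    have h3 : 3 ≤ dg v := h.three_le_deg hv
    by_cases hd : dg v = 3
    · have h1 : ∑ w ∈ U, s v w = 0 := sum_eq_zero fun w _ => by simp [s, hd]
      have h2 : 2 ≤ ∑ w ∈ U, s w v := by
        have := h.cubic_nbrs hv hd
        simp only [s, hd, true_and]
        rw [sum_boole]
        simp only [G.adj_comm _ v]
        exact_mod_cast this
      rw [hd]
      push_cast
      linarith
    · have h1 : ∑ w ∈ U, s v w ≤ dg v := by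
        simp only [s]
        rw [sum_boole]
        exact_mod_cast card_le_card fun w hw => by
          rw [mem_filter] at hw ⊢
          exact ⟨hw.1, hw.2.1⟩
      have h2 : 0 ≤ ∑ w ∈ U, s w v := sum_nonneg fun w _ => by simp only [s]; split_ifs <;> simp
      have : 4 ≤ dg v := by omega
      zify at this
      linarith
  have hsum := sum_le_sum key
  rw [sum_add_distrib, sum_sub_distrib, sum_comm (f := fun v w => s v w), ← mul_sum] at hsum
  have hc : cross G U U = ∑ v ∈ U, (dg v : ℤ) := cross_eq_sum U U
  have h2 := two_mul_edgesIn (G := G) U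
  have hl := h.large
  unfold potential at hl
  simp only [sum_const, nsmul_eq_mul] at hsum
  linarith

/-- The Kostochka–Yancey bound for 4-critical graphs. -/
theorem exists_potential_le_two {A : Finset V} (hA : ¬ ThreeCol G A) :
    ∃ R ⊆ A, ¬ ThreeCol G R ∧ potential G R ≤ 2 := by
  have key : ∀ n, PotentialBoundBelow V n := by
    intro n
    induction n with
    | zero => exact fun _ A hA => absurd hA (Nat.not_lt_zero _)
    | succ n ih =>
      intro G A hA hnc
      by_contra hcon
      push Not at hcon
      have hsub : ∀ B ⊂ A, ThreeCol G B := by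
        intro B hB
        by_contra hBc
        obtain ⟨R, hR, hRc, hRp⟩ := ih G B (by have := card_lt_card hB; omega) hBc
        have := hcon R (hR.trans hB.1) hRc
        omega
      have hlarge := hcon A Subset.rfl hnc
      exact MinCounterexample.elim ⟨fun H B hB => ih H B (by omega), hnc, hsub, by omega⟩
  exact key (A.card + 1) G A (by omega) hA

end

end LocalGirth

namespace LocalGirth

open Finset

section

open scoped Classical

variable {V : Type*} {G H : SimpleGraph V}

/-- Mod 2 chains on unordered pairs. -/
abbrev Chain (V : Type*) := Sym2 V → ZMod 2

lemma zmod_two_ne_zero {x : ZMod 2} : x ≠ 0 ↔ x = 1 := by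
  revert x
  decide

lemma zmod_two_add_self (x : ZMod 2) : x + x = 0 := CharTwo.add_self_eq_zero x

lemma chain_add_self (z : Chain V) : z + z = 0 := funext fun _ => zmod_two_add_self _

/-- The chain consisting of one pair. -/
noncomputable def single (u v : V) : Chain V := fun e => if e = s(u, v) then 1 else 0

lemma single_apply (u v a b : V) :
    single u v s(a, b) = if (a = u ∧ b = v) ∨ (a = v ∧ b = u) then 1 else 0 := by
  simp [single]

variable [Fintype V]

/-- The boundary of a chain. -/
def bd (z : Chain V) (v : V) : ZMod 2 := ∑ u, z s(v, u)

/-- The mod 2 cycle space of `G`. -/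
def cycles (G : SimpleGraph V) : Submodule (ZMod 2) (Chain V) where
  carrier := {z | (∀ u v, z s(u, v) ≠ 0 → G.Adj u v) ∧ ∀ v, bd z v = 0}
  add_mem' := by
    rintro z w ⟨hz, hz'⟩ ⟨hw, hw'⟩
    refine ⟨fun u v h => ?_, fun v => ?_⟩
    · by_cases h1 : z s(u, v) = 0
      · exact hw u v fun h2 => h (by simp [h1, h2])
      · exact hz u v h1
    · have h1 := hz' v
      have h2 := hw' v
      simp only [bd] at *
      simp [sum_add_distrib, h1, h2]
  zero_mem' := ⟨fun u v h => by simp at h, fun v => by simp [bd]⟩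
  smul_mem' := by
    rintro c z ⟨hz, hz'⟩
    refine ⟨fun u v h => hz u v fun h0 => h (by simp [h0]), fun v => ?_⟩
    have := hz' v
    simp only [bd] at *
    simp [← mul_sum, this]

lemma bd_add (z w : Chain V) (v : V) : bd (z + w) v = bd z v + bd w v := by
  simp [bd, sum_add_distrib]

lemma bd_sum {ι : Type*} (s : Finset ι) (F : ι → Chain V) (v : V) :
    bd (∑ i ∈ s, F i) v = ∑ i ∈ s, bd (F i) v := by
  simp only [bd, Finset.sum_apply]
  rw [sum_comm]

/-- The boundary of a chain without loops has even size. -/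
lemma sum_bd {z : Chain V} (hz : ∀ v, z s(v, v) = 0) : ∑ v, bd z v = 0 := by
  simp only [bd]
  rw [← sum_product']
  refine sum_involution (fun p _ => (p.2, p.1)) ?_ ?_ ?_ ?_
  · rintro ⟨a, b⟩ -
    simp only [Sym2.eq_swap (a := b) (b := a)]
    exact zmod_two_add_self _
  · rintro ⟨a, b⟩ - h he
    simp only [Prod.mk.injEq] at he
    rw [he.1] at h
    exact h (hz _)
  · simp
  · simp

lemma bd_single {u v : V} (h : u ≠ v) (w : V) :
    bd (single u v) w = (if w = u then 1 else 0) + if w = v then 1 else 0 := by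
  simp only [bd, single_apply]
  by_cases h1 : w = u
  · subst h1
    simp [h]
  · by_cases h2 : w = v
    · subst h2
      simp [h1]
    · simp [h1, h2]

/-- A chain with two ends at most at `a` has none. -/
lemma bd_eq_zero_of_forall_ne {z : Chain V} (hz : ∀ v, z s(v, v) = 0) {a : V}
    (h : ∀ v, v ≠ a → bd z v = 0) : bd z a = 0 := by
  have := sum_bd hz
  rwa [sum_eq_single a (fun v _ hv => h v hv) (by simp)] at this

lemma bd_eq_of_forall_ne {z : Chain V} (hz : ∀ v, z s(v, v) = 0) {a b : V} (hab : a ≠ b)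
    (h : ∀ v, v ≠ a → v ≠ b → bd z v = 0) : bd z a = bd z b := by
  have := sum_bd hz
  rw [← sum_subset (subset_univ {a, b}) (by
    intro v _ hv
    simp only [mem_insert, mem_singleton, not_or] at hv
    exact h v hv.1 hv.2), sum_pair hab] at this
  exact CharTwo.add_eq_zero.1 this

lemma cycles_loop {z : Chain V} (hz : z ∈ cycles G) (v : V) : z s(v, v) = 0 := by
  by_contra h
  exact (hz.1 v v h).ne rfl

/-- Paths inside a set give chains. -/
lemma Reach.exists_chain {X : Set V} {u v : V} (h : Reach G X u v) :
    ∃ p : Chain V, (∀ a b, p s(a, b) ≠ 0 → G.Adj a b ∧ a ∈ X ∧ b ∈ X) ∧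
      ∀ w, bd p w = (if w = u then 1 else 0) + if w = v then 1 else 0 := by
  induction h with
  | refl => exact ⟨0, fun a b h => by simp at h, fun w => by simp [bd, zmod_two_add_self]⟩
  | @tail b c _ h ih =>
    obtain ⟨p, hp, hpb⟩ := ih
    refine ⟨p + single b c, fun x y hxy => ?_, fun w => ?_⟩
    · by_cases h1 : p s(x, y) = 0
      · simp only [Pi.add_apply, h1, zero_add, single_apply] at hxy
        have : (x = b ∧ y = c) ∨ (x = c ∧ y = b) := by
          by_contra hc
          simp [hc] at hxy
        rcases this with ⟨rfl, rfl⟩ | ⟨rfl, rfl⟩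
        · exact h
        · exact ⟨h.1.symm, h.2.2, h.2.1⟩
      · exact hp x y h1
    · rw [bd_add, hpb, bd_single h.1.ne]
      linear_combination zmod_two_add_self (if w = b then 1 else 0)

/-- Every even set of vertices of a connected set is a boundary. -/
lemma exists_chain_of_sum_eq_zero {X : Set V} (hX : ∀ x ∈ X, ∀ y ∈ X, Reach G X x y)
    {f : V → ZMod 2} (hf : ∀ v, f v ≠ 0 → v ∈ X) (hs : ∑ v, f v = 0) :
    ∃ p : Chain V, (∀ a b, p s(a, b) ≠ 0 → G.Adj a b ∧ a ∈ X ∧ b ∈ X) ∧ ∀ w, bd p w = f w := by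
  by_cases hne : ∃ r, f r ≠ 0
  · obtain ⟨r, hr⟩ := hne
    have hex : ∀ v, ∃ p : Chain V, f v ≠ 0 →
        (∀ a b, p s(a, b) ≠ 0 → G.Adj a b ∧ a ∈ X ∧ b ∈ X) ∧
        ∀ w, bd p w = (if w = r then 1 else 0) + if w = v then 1 else 0 := by
      intro v
      by_cases hv : f v = 0
      · exact ⟨0, fun h => absurd hv h⟩
      · obtain ⟨p, hp⟩ := (hX r (hf r hr) v (hf v hv)).exists_chain
        exact ⟨p, fun _ => hp⟩
    choose p hp using hex
    refine ⟨∑ v ∈ univ.filter (fun v => f v ≠ 0), p v, fun a b hab => ?_, fun w => ?_⟩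
    · rw [Finset.sum_apply] at hab
      obtain ⟨v, hv, hab⟩ := exists_ne_zero_of_sum_ne_zero hab
      exact (hp v (mem_filter.1 hv).2).1 a b hab
    · rw [bd_sum, sum_congr rfl fun v hv => (hp v (mem_filter.1 hv).2).2 w, sum_add_distrib]
      have h1 : ∑ v ∈ univ.filter (fun v => f v ≠ 0), (if w = r then (1 : ZMod 2) else 0) = 0 := by
        split_ifs
        · rw [sum_filter]
          refine (sum_congr rfl fun v _ => ?_).trans hs
          by_cases hv : f v = 0
          · simp [hv]
          · simp [zmod_two_ne_zero.1 hv]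
        · simp
      rw [h1, zero_add, sum_ite_eq]
      by_cases hw : f w = 0
      · simp [hw]
      · simp [zmod_two_ne_zero.1 hw]
  · push Not at hne
    exact ⟨0, fun a b h => by simp at h, fun w => by simp [bd, hne]⟩

/-- A path from `a` to `b` through a connected set touching both. -/
lemma exists_chain_through {Y : Set V} (hY : IsConn G Y) {a b : V} (ha : a ∉ Y) (hb : b ∉ Y)
    (hab : a ≠ b) (hta : Touch G {a} Y) (htb : Touch G {b} Y) :
    ∃ p : Chain V, (∀ u v, p s(u, v) ≠ 0 → G.Adj u v ∧ (u ∈ Y ∨ u = a ∨ u = b) ∧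
        (v ∈ Y ∨ v = a ∨ v = b)) ∧
      (∀ w, bd p w = (if w = a then 1 else 0) + if w = b then 1 else 0) ∧
      ∃ y ∈ Y, ∀ u, p s(a, u) = if u = y then 1 else 0 := by
  obtain ⟨y, hy, hay⟩ := touch_singleton_left.1 hta
  obtain ⟨x, hx, hbx⟩ := touch_singleton_left.1 htb
  obtain ⟨p, hp, hpb⟩ := (hY.2 y hy x hx).exists_chain
  have hya : y ≠ a := fun e => ha (e ▸ hy)
  have hxb : x ≠ b := fun e => hb (e ▸ hx)
  have hxa : x ≠ a := fun e => ha (e ▸ hx)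
  refine ⟨p + (single a y + single b x), fun u v huv => ?_, fun w => ?_, y, hy, fun u => ?_⟩
  · by_cases h1 : p s(u, v) = 0
    · simp only [Pi.add_apply, h1, zero_add, single_apply] at huv
      have : ((u = a ∧ v = y) ∨ (u = y ∧ v = a)) ∨ ((u = b ∧ v = x) ∨ (u = x ∧ v = b)) := by
        by_contra hc
        rw [not_or] at hc
        simp [hc.1, hc.2] at huv
      rcases this with (⟨rfl, rfl⟩ | ⟨rfl, rfl⟩) | ⟨rfl, rfl⟩ | ⟨rfl, rfl⟩
      · exact ⟨hay, by simp, .inl hy⟩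
      · exact ⟨hay.symm, .inl hy, by simp⟩
      · exact ⟨hbx, by simp, .inl hx⟩
      · exact ⟨hbx.symm, .inl hx, by simp⟩
    · obtain ⟨h, h1, h2⟩ := hp u v h1
      exact ⟨h, .inl h1, .inl h2⟩
  · rw [bd_add, bd_add, hpb, bd_single hya.symm, bd_single hxb.symm]
    linear_combination zmod_two_add_self (if w = y then 1 else 0) +
      zmod_two_add_self (if w = x then 1 else 0)
  · have h1 : p s(a, u) = 0 := by
      by_contra h
      exact ha (hp a u h).2.1
    simp only [Pi.add_apply, h1, zero_add, single_apply]
    simp [hya.symm, hab, hxa.symm]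

end

end LocalGirth

namespace LocalGirth

open Finset

set_option linter.unusedSectionVars false

section

open scoped Classical

universe u

variable {V : Type u} [Fintype V] {G H : SimpleGraph V} {ι : Type u} [Fintype ι]

/-- A finite family of cycles (with multiplicity) behaving like the face boundaries of a plane
embedding. -/
structure IsFam (G : SimpleGraph V) (F : ι → Chain V) : Prop where
  mem : ∀ i, F i ∈ cycles G
  two : ∀ e i j k, F i e ≠ 0 → F j e ≠ 0 → F k e ≠ 0 → i = j ∨ j = k ∨ i = k
  sum : ∑ i, F i = 0
  gen : ∀ z ∈ cycles G, ∃ c : ι → ZMod 2, ∑ i, c i • F i = z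

/-- `G` has a face family. -/
def HasFam (G : SimpleGraph V) : Prop :=
  ∃ (ι : Type u) (_ : Fintype ι) (F : ι → Chain V), IsFam G F

/-- Replace two members of a family by their sum and zero. -/
noncomputable def merge (F : ι → Chain V) (i j : ι) : ι → Chain V :=
  fun k => if k = j then 0 else if k = i then F i + F j else F k

lemma cycles_mono (h : H ≤ G) : cycles H ≤ cycles G :=
  fun _ hz => ⟨fun u v huv => h (hz.1 u v huv), hz.2⟩

lemma sum_smul_merge (F : ι → Chain V) {i j : ι} (hij : i ≠ j) {c : ι → ZMod 2}
    (hc : c i = c j) : ∑ k, c k • merge F i j k = ∑ k, c k • F k := by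
  have h : ∀ k, c k • merge F i j k =
      c k • F k + ((if k = i then c j • F j else 0) + if k = j then c j • F j else 0) := by
    intro k
    unfold merge
    by_cases h1 : k = j
    · subst h1
      simp [hij.symm, chain_add_self]
    · by_cases h2 : k = i
      · subst h2
        simp [h1, hc]
      · simp [h1, h2]
  simp only [h, sum_add_distrib, sum_ite_eq', mem_univ, if_true, chain_add_self, add_zero]

lemma sum_merge (F : ι → Chain V) {i j : ι} (hij : i ≠ j) :
    ∑ k, merge F i j k = ∑ k, F k := by
  simpa using sum_smul_merge F hij (c := fun _ => 1) rfl

lemma merge_two {F : ι → Chain V} {i j : ι} {e : Sym2 V}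
    (h : ∀ a b c, F a e ≠ 0 → F b e ≠ 0 → F c e ≠ 0 → a = b ∨ b = c ∨ a = c) (a b c : ι)
    (ha : merge F i j a e ≠ 0) (hb : merge F i j b e ≠ 0) (hc : merge F i j c e ≠ 0) :
    a = b ∨ b = c ∨ a = c := by
  have key : ∀ k, merge F i j k e ≠ 0 → k ≠ j ∧ ∃ l, F l e ≠ 0 ∧ (l = k ∨ (k = i ∧ l = j)) := by
    intro k hk
    unfold merge at hk
    split_ifs at hk with h1 h2
    · exact absurd rfl hk
    · refine ⟨h1, ?_⟩
      by_cases hi : F i e = 0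
      · exact ⟨j, fun h0 => hk (by simp [hi, h0]), .inr ⟨h2, rfl⟩⟩
      · exact ⟨i, hi, .inl h2.symm⟩
    · exact ⟨h1, k, hk, .inl rfl⟩
  obtain ⟨ha', a', ha1, ha2⟩ := key a ha
  obtain ⟨hb', b', hb1, hb2⟩ := key b hb
  obtain ⟨hc', c', hc1, hc2⟩ := key c hc
  have := h a' b' c' ha1 hb1 hc1
  grind

lemma IsFam.exists_other {F : ι → Chain V} (hF : IsFam G F) {e : Sym2 V} {i : ι}
    (hi : F i e ≠ 0) : ∃ j, j ≠ i ∧ F j e ≠ 0 := by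
  by_contra! h
  have := congrFun hF.sum e
  rw [Finset.sum_apply, sum_eq_single i (fun j _ hj => h j hj) (by simp)] at this
  exact hi this

lemma mem_cycles_deleteEdges {z : Chain V} {e : Sym2 V} (hz : z ∈ cycles G) (he : z e = 0) :
    z ∈ cycles (G.deleteEdges {e}) := by
  refine ⟨fun u v huv => ?_, hz.2⟩
  rw [SimpleGraph.deleteEdges_adj]
  exact ⟨hz.1 u v huv, fun h => huv (by rw [Set.mem_singleton_iff.1 h, he])⟩

lemma eq_zero_of_mem_cycles_deleteEdges {z : Chain V} {e : Sym2 V}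
    (hz : z ∈ cycles (G.deleteEdges {e})) : z e = 0 := by
  induction e with | _ u v
  by_contra h
  have := hz.1 u v h
  rw [SimpleGraph.deleteEdges_adj] at this
  exact this.2 rfl

lemma IsFam.deleteEdge {F : ι → Chain V} (hF : IsFam G F) (e : Sym2 V) :
    ∃ F' : ι → Chain V, IsFam (G.deleteEdges {e}) F' ∧ ∀ k, F k e = 0 → F' k = F k := by
  by_cases h : ∃ i, F i e ≠ 0
  · obtain ⟨i, hi⟩ := h
    obtain ⟨j, hji, hj⟩ := hF.exists_other hi
    have hk : ∀ k, k ≠ j → k ≠ i → F k e = 0 := by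
      intro k hkj hki
      by_contra hk
      have := hF.two e i j k hi hj hk
      grind
    refine ⟨merge F i j, ⟨fun k => ?_, fun e' => merge_two (hF.two e'),
      (sum_merge F hji.symm).trans hF.sum, fun z hz => ?_⟩, fun k hke => ?_⟩
    · unfold merge
      split_ifs with h1 h2
      · exact Submodule.zero_mem _
      · refine mem_cycles_deleteEdges (Submodule.add_mem _ (hF.mem i) (hF.mem j)) ?_
        rw [Pi.add_apply, zmod_two_ne_zero.1 hi, zmod_two_ne_zero.1 hj]
        rfl
      · exact mem_cycles_deleteEdges (hF.mem k) (hk k h1 h2)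
    · obtain ⟨c, hc⟩ := hF.gen z (cycles_mono (SimpleGraph.deleteEdges_le _) hz)
      refine ⟨c, (sum_smul_merge F hji.symm ?_).trans hc⟩
      have h0 := eq_zero_of_mem_cycles_deleteEdges hz
      rw [← hc, Finset.sum_apply, ← sum_subset (subset_univ {i, j}) (by
        intro k _ hk'
        simp only [mem_insert, mem_singleton, not_or] at hk'
        simp [hk k hk'.2 hk'.1]), sum_pair hji.symm] at h0
      simp only [Pi.smul_apply, zmod_two_ne_zero.1 hi, zmod_two_ne_zero.1 hj, smul_eq_mul,
        mul_one] at h0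
      exact CharTwo.add_eq_zero.1 h0
    · have h1 : k ≠ j := fun h => hj (h ▸ hke)
      have h2 : k ≠ i := fun h => hi (h ▸ hke)
      simp [merge, h1, h2]
  · push Not at h
    exact ⟨F, ⟨fun k => mem_cycles_deleteEdges (hF.mem k) (h k), hF.two, hF.sum,
      fun z hz => hF.gen z (cycles_mono (SimpleGraph.deleteEdges_le _) hz)⟩, fun _ _ => rfl⟩

/-- Face families restrict to subgraphs; members inside the subgraph are kept. -/
lemma IsFam.mono {F : ι → Chain V} (hF : IsFam G F) (h : H ≤ G) :
    ∃ F' : ι → Chain V, IsFam H F' ∧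
      ∀ k, (∀ u v, F k s(u, v) ≠ 0 → H.Adj u v) → F' k = F k := by
  induction hn : (G.edgeSet \ H.edgeSet).ncard using Nat.strong_induction_on generalizing G F with
  | _ n ih =>
  by_cases hGH : G ≤ H
  · obtain rfl := le_antisymm h hGH
    exact ⟨F, hF, fun _ _ => rfl⟩
  · rw [SimpleGraph.le_iff_adj] at hGH
    push Not at hGH
    obtain ⟨u, v, huv, huv'⟩ := hGH
    obtain ⟨F₁, hF₁, h₁⟩ := hF.deleteEdge s(u, v)
    have hle : H ≤ G.deleteEdges {s(u, v)} := by
      intro a b hab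
      rw [SimpleGraph.deleteEdges_adj]
      refine ⟨h hab, fun he => huv' ?_⟩
      rw [← SimpleGraph.mem_edgeSet, ← Set.mem_singleton_iff.1 he]
      exact hab
    obtain ⟨F₂, hF₂, h₂⟩ := ih _ (by
      rw [← hn]
      refine Set.ncard_lt_ncard ⟨fun e he => ?_, fun hs => ?_⟩
      · exact ⟨SimpleGraph.edgeSet_mono (SimpleGraph.deleteEdges_le _) he.1, he.2⟩
      · have := (@hs s(u, v) ⟨huv, huv'⟩).1
        simp at this) hF₁ hle rfl
    refine ⟨F₂, hF₂, fun k hk => ?_⟩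
    have h0 : F₁ k = F k := h₁ k (by
      by_contra h0
      exact huv' (hk u v h0))
    rw [h₂ k (by rwa [h0]), h0]

lemma HasFam.mono (hG : HasFam G) (h : H ≤ G) : HasFam H := by
  obtain ⟨ι, hι, F, hF⟩ := hG
  obtain ⟨F', hF', -⟩ := hF.mono h
  exact ⟨ι, hι, F', hF'⟩

end

end LocalGirth

namespace LocalGirth

open Finset

set_option linter.unusedSectionVars false

section

open scoped Classical

universe u

variable {V : Type u} [Fintype V] {G H H₁ H₂ : SimpleGraph V}

lemma single_mem {u v a b : V} (h : single u v s(a, b) ≠ 0) :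
    (a = u ∧ b = v) ∨ (a = v ∧ b = u) := by
  rw [single_apply] at h
  by_contra hc
  simp [hc] at h

lemma exists_cycles_sup {X Y : Set V} (hX : ∀ u v, H₁.Adj u v → u ∈ X)
    (hY : ∀ u v, H₂.Adj u v → u ∈ Y) {p q : V} (hXY : X ∩ Y ⊆ {p, q})
    (hpq : p ≠ q → H₁.Adj p q ∧ H₂.Adj p q) {z : Chain V} (hz : z ∈ cycles (H₁ ⊔ H₂)) :
    ∃ w₁ ∈ cycles H₁, ∃ w₂ ∈ cycles H₂, w₁ + w₂ = z := by
  set z₁ : Chain V := fun e => if e ∈ H₁.edgeSet then z e else 0 with hz₁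
  have hz₁' : ∀ u v, z₁ s(u, v) = if H₁.Adj u v then z s(u, v) else 0 := fun u v => rfl
  have hloop : ∀ v, z₁ s(v, v) = 0 := fun v => by simp [hz₁']
  have hbd : ∀ v, v ≠ p → v ≠ q → bd z₁ v = 0 := by
    intro v hvp hvq
    by_cases hvX : v ∈ X
    · have hvY : v ∉ Y := fun hvY => by
        rcases hXY ⟨hvX, hvY⟩ with h | h
        exacts [hvp h, hvq h]
      rw [← hz.2 v]
      refine sum_congr rfl fun u _ => ?_
      rw [hz₁']
      split_ifs with h
      · rfl
      · by_contra hc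
        rcases hz.1 v u (Ne.symm hc) with h' | h'
        · exact h h'
        · exact hvY (hY _ _ h')
    · refine sum_eq_zero fun u _ => ?_
      rw [hz₁', if_neg fun h => hvX (hX _ _ h)]
  have hz₂ : ∀ u v, (z + z₁) s(u, v) ≠ 0 → H₂.Adj u v := by
    intro u v huv
    rw [Pi.add_apply, hz₁'] at huv
    split_ifs at huv with h
    · exact absurd (zmod_two_add_self _) huv
    · rw [add_zero] at huv
      exact (hz.1 u v huv).resolve_left h
  have hz₁a : ∀ u v, z₁ s(u, v) ≠ 0 → H₁.Adj u v := by
    intro u v huv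
    rw [hz₁'] at huv
    by_contra hc
    simp [hc] at huv
  by_cases h0 : bd z₁ p = 0
  · have h1 : ∀ v, bd z₁ v = 0 := by
      intro v
      by_cases hvp : v = p
      · rwa [hvp]
      · by_cases hvq : v = q
        · subst hvq
          rw [← bd_eq_of_forall_ne hloop (Ne.symm hvp) hbd, h0]
        · exact hbd v hvp hvq
    refine ⟨z₁, ⟨hz₁a, h1⟩, z + z₁, ⟨hz₂, fun v => ?_⟩, ?_⟩
    · rw [bd_add, h1, hz.2, add_zero]
    · rw [add_comm z, ← add_assoc, chain_add_self, zero_add]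
  · have hne : p ≠ q := by
      rintro rfl
      exact h0 (bd_eq_zero_of_forall_ne hloop fun v hv => hbd v hv hv)
    obtain ⟨ha₁, ha₂⟩ := hpq hne
    have h1 : ∀ v, bd (z₁ + single p q) v = 0 := by
      intro v
      rw [bd_add, bd_single hne]
      by_cases hvp : v = p
      · subst hvp
        rw [zmod_two_ne_zero.1 h0]
        simp [hne, zmod_two_add_self]
      · by_cases hvq : v = q
        · subst hvq
          rw [← bd_eq_of_forall_ne hloop (Ne.symm hvp) hbd, zmod_two_ne_zero.1 h0]
          simp [hne.symm, zmod_two_add_self]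
        · simp [hbd v hvp hvq, hvp, hvq]
    have aux : ∀ (K : SimpleGraph V) (w : Chain V), K.Adj p q →
        (∀ u v, w s(u, v) ≠ 0 → K.Adj u v) → ∀ u v, (w + single p q) s(u, v) ≠ 0 → K.Adj u v := by
      intro K w hK hw u v huv
      by_cases hs : single p q s(u, v) = 0
      · rw [Pi.add_apply, hs, add_zero] at huv
        exact hw u v huv
      · rcases single_mem hs with ⟨rfl, rfl⟩ | ⟨rfl, rfl⟩
        exacts [hK, hK.symm]
    refine ⟨z₁ + single p q, ⟨aux _ _ ha₁ hz₁a, h1⟩, z + z₁ + single p q,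
      ⟨aux _ _ ha₂ hz₂, fun v => ?_⟩, ?_⟩
    · rw [add_assoc, bd_add, h1, hz.2, add_zero]
    · rw [add_assoc z, add_comm z, ← add_assoc, chain_add_self, zero_add]

lemma HasFam.sup (h₁ : HasFam H₁) (h₂ : HasFam H₂) {X Y : Set V}
    (hX : ∀ u v, H₁.Adj u v → u ∈ X) (hY : ∀ u v, H₂.Adj u v → u ∈ Y) {p q : V}
    (hXY : X ∩ Y ⊆ {p, q}) (hpq : p ≠ q → H₁.Adj p q ∧ H₂.Adj p q) : HasFam (H₁ ⊔ H₂) := by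
  obtain ⟨ι, _, F, hF⟩ := h₁
  obtain ⟨κ, _, F', hF'⟩ := h₂
  have hmem : ∀ k, Sum.elim F F' k ∈ cycles (H₁ ⊔ H₂) := by
    rintro (i | j)
    · exact cycles_mono le_sup_left (hF.mem i)
    · exact cycles_mono le_sup_right (hF'.mem j)
  have hsum : ∑ k, Sum.elim F F' k = 0 := by
    rw [Fintype.sum_sum_type]
    simp [hF.sum, hF'.sum]
  have hgen : ∀ z ∈ cycles (H₁ ⊔ H₂), ∃ (c : ι → ZMod 2) (d : κ → ZMod 2), ∀ t : ZMod 2,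
      ∑ k, Sum.elim (fun i => c i + t) d k • Sum.elim F F' k = z := by
    intro z hz
    obtain ⟨w₁, hw₁, w₂, hw₂, rfl⟩ := exists_cycles_sup hX hY hXY hpq hz
    obtain ⟨c, hc⟩ := hF.gen _ hw₁
    obtain ⟨d, hd⟩ := hF'.gen _ hw₂
    refine ⟨c, d, fun t => ?_⟩
    rw [Fintype.sum_sum_type]
    simp only [Sum.elim_inl, Sum.elim_inr, add_smul, sum_add_distrib, ← smul_sum, hF.sum, hc, hd]
    simp
  have hshare : ∀ e i j, F i e ≠ 0 → F' j e ≠ 0 → e = s(p, q) := by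
    intro e i j hi hj
    induction e with | _ u v
    have hu := (hF.mem i).1 u v hi
    have hv := (hF'.mem j).1 u v hj
    have h1 := hXY ⟨hX _ _ hu, hY _ _ hv⟩
    have h2 := hXY ⟨hX _ _ hu.symm, hY _ _ hv.symm⟩
    have h3 := hu.ne
    simp only [Set.mem_insert_iff, Set.mem_singleton_iff] at h1 h2
    rw [Sym2.eq_iff]
    grind
  have htwo : ∀ e, (∀ i j, F i e ≠ 0 → F' j e ≠ 0 → False) → ∀ a b c,
      Sum.elim F F' a e ≠ 0 → Sum.elim F F' b e ≠ 0 → Sum.elim F F' c e ≠ 0 →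
      a = b ∨ b = c ∨ a = c := by
    rintro e he (a | a) (b | b) (c | c) h1 h2 h3 <;> simp only [Sum.elim_inl, Sum.elim_inr] at *
    · simpa using hF.two e a b c h1 h2 h3
    · exact (he _ _ h1 h3).elim
    · exact (he _ _ h1 h2).elim
    · exact (he _ _ h1 h2).elim
    · exact (he _ _ h2 h1).elim
    · exact (he _ _ h2 h1).elim
    · exact (he _ _ h3 h1).elim
    · simpa using hF'.two e a b c h1 h2 h3
  by_cases h : ∃ i j, F i s(p, q) ≠ 0 ∧ F' j s(p, q) ≠ 0
  · obtain ⟨i, j, hi, hj⟩ := h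
    have hij : (Sum.inl i : ι ⊕ κ) ≠ Sum.inr j := by simp
    refine ⟨ι ⊕ κ, inferInstance, merge (Sum.elim F F') (.inl i) (.inr j), ⟨?_, fun e => ?_,
      (sum_merge _ hij).trans hsum, fun z hz => ?_⟩⟩
    · intro k
      unfold merge
      split_ifs
      exacts [Submodule.zero_mem _, Submodule.add_mem _ (hmem _) (hmem _), hmem _]
    · by_cases he : e = s(p, q)
      · subst he
        have key : ∀ k, merge (Sum.elim F F') (.inl i) (.inr j) k s(p, q) ≠ 0 →
            Sum.elim F F' k s(p, q) ≠ 0 ∧ k ≠ .inl i ∧ k ≠ .inr j := by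
          intro k hk
          unfold merge at hk
          split_ifs at hk with h1 h2
          · exact absurd rfl hk
          · simp only [Sum.elim_inl, Sum.elim_inr, Pi.add_apply, zmod_two_ne_zero.1 hi,
              zmod_two_ne_zero.1 hj, zmod_two_add_self] at hk
            exact absurd rfl hk
          · exact ⟨hk, h2, h1⟩
        have kl : ∀ a b, F a s(p, q) ≠ 0 → F b s(p, q) ≠ 0 → a ≠ i → b ≠ i → a = b := by
          intro a b ha hb hai hbi
          have := hF.two _ a b i ha hb hi
          grind
        have kr : ∀ a b, F' a s(p, q) ≠ 0 → F' b s(p, q) ≠ 0 → a ≠ j → b ≠ j → a = b := by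
          intro a b ha hb hai hbi
          have := hF'.two _ a b j ha hb hj
          grind
        intro a b c ha hb hc
        replace ha := key a ha
        replace hb := key b hb
        replace hc := key c hc
        rcases a with a | a <;> rcases b with b | b <;> rcases c with c | c <;>
          simp only [Sum.elim_inl, Sum.elim_inr, ne_eq, Sum.inl.injEq, Sum.inr.injEq, reduceCtorEq,
            not_false_eq_true, and_true, true_and, or_false, false_or] at * <;> grind
      · exact merge_two (htwo e fun a b ha hb => he (hshare e a b ha hb))
    · obtain ⟨c, d, hcd⟩ := hgen z hz
      refine ⟨_, (sum_smul_merge _ hij ?_).trans (hcd (c i + d j))⟩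
      simp only [Sum.elim_inl, Sum.elim_inr]
      rw [← add_assoc, zmod_two_add_self, zero_add]
  · refine ⟨ι ⊕ κ, inferInstance, Sum.elim F F', ⟨hmem, fun e => htwo e fun i j hi hj => h ⟨i, j, ?_⟩,
      hsum, fun z hz => ?_⟩⟩
    · obtain rfl := hshare e i j hi hj
      exact ⟨hi, hj⟩
    · obtain ⟨c, d, hcd⟩ := hgen z hz
      exact ⟨_, hcd 0⟩

end

end LocalGirth

namespace LocalGirth

open Finset

set_option linter.unusedSectionVars false

section

open scoped Classical

universe u

variable {V : Type u} [Fintype V] {G H : SimpleGraph V} {x y z w : V}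

/-- Move all edges at `z` to `x`. -/
def ident (G : SimpleGraph V) (x z : V) : SimpleGraph V where
  Adj a b := a ≠ z ∧ b ≠ z ∧ a ≠ b ∧
    (G.Adj a b ∨ (a = x ∧ G.Adj z b) ∨ (b = x ∧ G.Adj z a))
  symm.symm a b := by
    rintro ⟨h1, h2, h3, h4⟩
    exact ⟨h2, h1, h3.symm, by rw [G.adj_comm]; tauto⟩
  loopless := ⟨fun a h => h.2.2.1 rfl⟩

/-- The effect of moving edges from `z` to `x` on chains. -/
noncomputable def push (x z : V) : Chain V →ₗ[ZMod 2] Chain V where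
  toFun c e := (if z ∈ e then 0 else c e) +
    if z ∉ e ∧ x ∈ e then c (e.map fun u => if u = x then z else u) else 0
  map_add' c d := by
    ext e
    simp only [Pi.add_apply]
    split_ifs <;> ring
  map_smul' t c := by
    ext e
    simp only [Pi.smul_apply, smul_eq_mul, RingHom.id_apply]
    split_ifs <;> ring

lemma push_z (c : Chain V) (b : V) : push x z c s(b, z) = 0 := by
  simp [push]

lemma push_x (c : Chain V) {b : V} (hxz : x ≠ z) (hb : b ≠ z) (hbx : b ≠ x) :
    push x z c s(b, x) = c s(b, x) + c s(b, z) := by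
  simp [push, hb.symm, hbx, hxz.symm]

lemma push_of_ne (c : Chain V) {a b : V} (ha : a ≠ z) (hax : a ≠ x) (hb : b ≠ z) (hbx : b ≠ x) :
    push x z c s(a, b) = c s(a, b) := by
  simp [push, ha.symm, hb.symm, hax.symm, hbx.symm]

lemma push_xx {c : Chain V} (hxz : x ≠ z) (hc : ∀ v, c s(v, v) = 0) :
    push x z c s(x, x) = 0 := by
  simp [push, hxz.symm, hc]

lemma bd_push_of_ne (c : Chain V) (hxz : x ≠ z) {v : V} (hvx : v ≠ x) (hvz : v ≠ z) :
    bd (push x z c) v = bd c v := by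
  have h : ∀ u, push x z c s(v, u) = c s(v, u) +
      ((if u = x then c s(v, z) else 0) + if u = z then c s(v, z) else 0) := by
    intro u
    by_cases hu : u = z
    · subst hu
      simp [push_z, hxz.symm, zmod_two_add_self]
    · by_cases hux : u = x
      · subst hux
        simp [push_x c hxz hvz hvx, hxz]
      · simp [push_of_ne c hvz hvx hu hux, hu, hux]
  simp only [bd, h, sum_add_distrib, sum_ite_eq', mem_univ, if_true, zmod_two_add_self, add_zero]

lemma bd_push_x {c : Chain V} (hxz : x ≠ z) (hc : ∀ v, c s(v, v) = 0) (h0 : c s(x, z) = 0) :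
    bd (push x z c) x = bd c x + bd c z := by
  have h : ∀ u, push x z c s(x, u) = c s(x, u) + c s(z, u) := by
    intro u
    by_cases hu : u = z
    · subst hu
      rw [push_z, h0, hc, add_zero]
    · by_cases hux : u = x
      · subst hux
        rw [push_xx hxz hc, hc, Sym2.eq_swap, h0, add_zero]
      · rw [Sym2.eq_swap, push_x c hxz hu hux, Sym2.eq_swap, Sym2.eq_swap (a := u) (b := z)]
  simp only [bd, h, sum_add_distrib]

lemma bd_push_z (c : Chain V) : bd (push x z c) z = 0 :=
  sum_eq_zero fun u _ => by rw [Sym2.eq_swap, push_z]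

lemma push_mem {c : Chain V} (hc : c ∈ cycles G) (hne : x ≠ z) (hxz : ¬ G.Adj x z) :
    push x z c ∈ cycles (ident G x z) := by
  refine ⟨?_, fun v => ?_⟩
  · have key : ∀ b, push x z c s(b, x) ≠ 0 → (ident G x z).Adj b x := by
      intro b h
      have hb : b ≠ z := by
        rintro rfl
        rw [Sym2.eq_swap, push_z] at h
        exact h rfl
      have hbx : b ≠ x := by
        rintro rfl
        exact h (push_xx hne (cycles_loop hc))
      refine ⟨hb, hne, hbx, ?_⟩
      by_cases h1 : c s(b, x) = 0
      · rw [push_x c hne hb hbx, h1, zero_add] at h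
        exact .inr (.inr ⟨rfl, (hc.1 _ _ h).symm⟩)
      · exact .inl (hc.1 _ _ h1)
    intro a b h
    by_cases hbx : b = x
    · subst hbx
      exact key a h
    · by_cases hax : a = x
      · subst hax
        rw [Sym2.eq_swap] at h
        exact (key b h).symm
      · have hb : b ≠ z := by
          rintro rfl
          exact h (push_z _ _)
        have ha : a ≠ z := by
          rintro rfl
          rw [Sym2.eq_swap] at h
          exact h (push_z _ _)
        rw [push_of_ne c ha hax hb hbx] at h
        have := hc.1 _ _ h
        exact ⟨ha, hb, this.ne, .inl this⟩
  · by_cases hvz : v = z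
    · subst hvz
      exact bd_push_z c
    · by_cases hvx : v = x
      · subst hvx
        rw [bd_push_x hne (cycles_loop hc), hc.2, hc.2, add_zero]
        by_contra h
        exact hxz (hc.1 _ _ h)
      · rw [bd_push_of_ne c hne hvx hvz, hc.2]

lemma push_path (hxz : x ≠ z) (hyx : y ≠ x) (hyz : y ≠ z) :
    push x z (single x y + single y z) = 0 := by
  have hl : ∀ v, (single x y + single y z : Chain V) s(v, v) = 0 := by
    intro v
    simp only [Pi.add_apply, single_apply]
    grind
  have key : ∀ b, push x z (single x y + single y z) s(b, x) = 0 := by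
    intro b
    by_cases hb : b = z
    · subst hb
      rw [Sym2.eq_swap, push_z]
    · by_cases hbx : b = x
      · subst hbx
        exact push_xx hxz hl
      · rw [push_x _ hxz hb hbx]
        simp only [Pi.add_apply, single_apply]
        by_cases hby : b = y
        · subst hby
          simp [hxz, hbx, hb, hxz.symm, zmod_two_add_self]
        · simp [hbx, hb, hby]
  ext e
  induction e with | _ a b
  rw [Pi.zero_apply]
  by_cases hbx : b = x
  · subst hbx
    exact key a
  · by_cases hax : a = x
    · subst hax
      rw [Sym2.eq_swap]
      exact key b
    · by_cases hb : b = z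
      · subst hb
        exact push_z _ _
      · by_cases ha : a = z
        · subst ha
          rw [Sym2.eq_swap]
          exact push_z _ _
        · rw [push_of_ne _ ha hax hb hbx]
          simp [single_apply, hax, ha, hb, hbx]

/-- Every chain of the identified graph lifts. -/
lemma exists_push_eq {d : Chain V} (hd : d ∈ cycles (ident G x z)) (hne : x ≠ z)
    (hxz : ¬ G.Adj x z) :
    ∃ c : Chain V, (∀ u v, c s(u, v) ≠ 0 → G.Adj u v) ∧ push x z c = d := by
  set c : Chain V := fun e => if e ∉ G.edgeSet then 0 else
    if z ∉ e then d e else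
      if e.map (fun u => if u = z then x else u) ∈ G.edgeSet then 0 else
        d (e.map fun u => if u = z then x else u) with hc
  have h1 : ∀ u v, c s(u, v) ≠ 0 → G.Adj u v := by
    intro u v h
    by_contra h'
    exact h (if_pos h')
  have h2 : ∀ u v, u ≠ z → v ≠ z → c s(u, v) = if G.Adj u v then d s(u, v) else 0 := by
    intro u v hu hv
    simp only [hc, SimpleGraph.mem_edgeSet]
    simp [hu.symm, hv.symm]
  have h3 : ∀ u, u ≠ z → c s(u, z) = if G.Adj u z ∧ ¬ G.Adj u x then d s(u, x) else 0 := by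
    intro u hu
    simp only [hc, SimpleGraph.mem_edgeSet, Sym2.map_mk]
    by_cases h : G.Adj u z <;> by_cases h' : G.Adj u x <;> simp [hu, h, h']
  have hl : ∀ v, c s(v, v) = 0 := by
    intro v
    by_contra h
    exact (h1 v v h).ne rfl
  have key : ∀ b, push x z c s(b, x) = d s(b, x) := by
    intro b
    by_cases hb : b = z
    · subst hb
      rw [Sym2.eq_swap, push_z]
      by_contra h
      exact (hd.1 _ _ (Ne.symm h)).2.1 rfl
    · by_cases hbx : b = x
      · subst hbx
        rw [push_xx hne hl, cycles_loop hd]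
      · rw [push_x c hne hb hbx, h2 b x hb hne, h3 b hb]
        by_cases h : G.Adj b x
        · simp [h]
        · by_cases h' : G.Adj b z
          · simp [h, h']
          · simp only [h, h', false_and, if_false, add_zero]
            by_contra h0
            rcases (hd.1 _ _ (Ne.symm h0)).2.2.2 with h4 | ⟨h4, -⟩ | ⟨-, h4⟩
            exacts [h h4, hbx h4, h' h4.symm]
  refine ⟨c, h1, ?_⟩
  ext e
  induction e with | _ a b
  by_cases hbx : b = x
  · subst hbx
    exact key a
  · by_cases hax : a = x
    · subst hax
      rw [Sym2.eq_swap]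
      exact key b
    · have hz : ∀ u, d s(u, z) = 0 := by
        intro u
        by_contra h
        exact (hd.1 _ _ h).2.1 rfl
      by_cases hb : b = z
      · subst hb
        rw [push_z, hz]
      · by_cases ha : a = z
        · subst ha
          rw [Sym2.eq_swap, push_z, hz]
        · rw [push_of_ne _ ha hax hb hbx, h2 a b ha hb]
          split_ifs with h
          · rfl
          · by_contra h0
            rcases (hd.1 _ _ (Ne.symm h0)).2.2.2 with h4 | ⟨h4, -⟩ | ⟨h4, -⟩
            exacts [h h4, hax h4, hbx h4]

/-- The chain of a quadrilateral. -/
noncomputable def quad (x y z w : V) : Chain V :=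
  single x y + single y z + (single z w + single w x)

lemma push_quad (hxz : x ≠ z) (hyx : y ≠ x) (hyz : y ≠ z) (hwx : w ≠ x) (hwz : w ≠ z) :
    push x z (quad x y z w) = 0 := by
  have h : (single z w + single w x : Chain V) = single x w + single w z := by
    rw [add_comm]
    congr 1 <;> · unfold single; rw [Sym2.eq_swap]
  rw [quad, map_add, h, push_path hxz hyx hyz, push_path hxz hwx hwz, add_zero]

lemma IsFam.hasFam_ident {ι : Type u} [Fintype ι] {F : ι → Chain V} (hF : IsFam G F) {k : ι}
    (hk : F k = quad x y z w) (hxz : x ≠ z) (hyx : y ≠ x) (hyz : y ≠ z) (hwx : w ≠ x)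
    (hwz : w ≠ z) (hyw : y ≠ w) (hn : ¬ G.Adj x z)
    (hcom : ∀ u, G.Adj u x → G.Adj u z → u = y ∨ u = w) : HasFam (ident G x z) := by
  have hk0 : push x z (F k) = 0 := by rw [hk, push_quad hxz hyx hyz hwx hwz]
  have hq : ∀ b, b = y ∨ b = w → F k s(b, x) ≠ 0 ∧ F k s(b, z) ≠ 0 := by
    rintro b (rfl | rfl) <;> rw [hk] <;> simp [quad, single_apply, hxz, hyx, hyz, hwx, hwz, hyw,
      hxz.symm, hyx.symm, hyz.symm, hwx.symm, hwz.symm, hyw.symm]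
  have hkey : ∀ b i j l, push x z (F i) s(b, x) ≠ 0 → push x z (F j) s(b, x) ≠ 0 →
      push x z (F l) s(b, x) ≠ 0 → i = j ∨ j = l ∨ i = l := by
    intro b i j l hi hj hl
    have hb : b ≠ z := by
      rintro rfl
      rw [Sym2.eq_swap, push_z] at hi
      exact hi rfl
    have hbx : b ≠ x := by
      rintro rfl
      exact hi (push_xx hxz (cycles_loop (hF.mem i)))
    have hne : ∀ m, push x z (F m) s(b, x) ≠ 0 →
        m ≠ k ∧ (F m s(b, x) ≠ 0 ∨ F m s(b, z) ≠ 0) := by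
      intro m hm
      refine ⟨?_, ?_⟩
      · rintro rfl
        rw [hk0] at hm
        exact hm rfl
      · by_contra! h
        rw [push_x _ hxz hb hbx, h.1, h.2] at hm
        exact hm rfl
    obtain ⟨hik, hi⟩ := hne i hi
    obtain ⟨hjk, hj⟩ := hne j hj
    obtain ⟨hlk, hl⟩ := hne l hl
    by_cases hbyw : b = y ∨ b = w
    · obtain ⟨h1, h2⟩ := hq b hbyw
      have hx : ∀ m n, F m s(b, x) ≠ 0 → F n s(b, x) ≠ 0 → m ≠ k → n ≠ k → m = n := by
        intro m n hm hn hmk hnk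
        have := hF.two _ m n k hm hn h1
        grind
      have hz : ∀ m n, F m s(b, z) ≠ 0 → F n s(b, z) ≠ 0 → m ≠ k → n ≠ k → m = n := by
        intro m n hm hn hmk hnk
        have := hF.two _ m n k hm hn h2
        grind
      rcases hi with hi | hi <;> rcases hj with hj | hj <;> rcases hl with hl | hl <;> grind
    · by_cases hax : G.Adj b x
      · have haz : ∀ m, F m s(b, z) = 0 := by
          intro m
          by_contra h
          exact hbyw (hcom b hax ((hF.mem m).1 _ _ h))
        exact hF.two _ i j l (hi.resolve_right (by simp [haz]))
          (hj.resolve_right (by simp [haz])) (hl.resolve_right (by simp [haz]))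
      · have haz : ∀ m, F m s(b, x) = 0 := by
          intro m
          by_contra h
          exact hax ((hF.mem m).1 _ _ h)
        exact hF.two _ i j l (hi.resolve_left (by simp [haz]))
          (hj.resolve_left (by simp [haz])) (hl.resolve_left (by simp [haz]))
  refine ⟨ι, inferInstance, fun i => push x z (F i), ⟨fun i => push_mem (hF.mem i) hxz hn,
    fun e i j l hi hj hl => ?_, by rw [← map_sum, hF.sum, map_zero], fun d hd => ?_⟩⟩
  · induction e with | _ a b
    by_cases hbx : b = x
    · subst hbx
      exact hkey a i j l hi hj hl
    · by_cases hax : a = x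
      · subst hax
        rw [Sym2.eq_swap] at hi hj hl
        exact hkey b i j l hi hj hl
      · have hb : b ≠ z := by
          rintro rfl
          exact hi (push_z _ _)
        have ha : a ≠ z := by
          rintro rfl
          rw [Sym2.eq_swap] at hi
          exact hi (push_z _ _)
        rw [push_of_ne _ ha hax hb hbx] at hi hj hl
        exact hF.two _ i j l hi hj hl
  · obtain ⟨c, hc, hcd⟩ := exists_push_eq hd hxz hn
    have hl : ∀ v, c s(v, v) = 0 := by
      intro v
      by_contra h
      exact (hc v v h).ne rfl
    have hc0 : c s(x, z) = 0 := by
      by_contra h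
      exact hn (hc _ _ h)
    have hb1 : ∀ v, v ≠ x → v ≠ z → bd c v = 0 := by
      intro v hvx hvz
      rw [← bd_push_of_ne c hxz hvx hvz, hcd, hd.2]
    have hb2 : bd c x + bd c z = 0 := by
      rw [← bd_push_x hxz hl hc0, hcd, hd.2]
    have hfin : ∃ c' ∈ cycles G, push x z c' = d := by
      by_cases h0 : bd c x = 0
      · refine ⟨c, ⟨hc, fun v => ?_⟩, hcd⟩
        rw [h0, zero_add] at hb2
        by_cases hvx : v = x
        · rwa [hvx]
        · by_cases hvz : v = z
          · rwa [hvz]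
          · exact hb1 v hvx hvz
      · have h1 := zmod_two_ne_zero.1 h0
        have h2 : bd c z = 1 := by
          rw [← CharTwo.add_eq_zero.1 hb2, h1]
        have hadj := hq y (.inl rfl)
        have hyx' := (hF.mem k).1 _ _ hadj.1
        have hyz' := (hF.mem k).1 _ _ hadj.2
        refine ⟨c + (single x y + single y z), ⟨fun u v huv => ?_, fun v => ?_⟩, by
          rw [map_add, hcd, push_path hxz hyx hyz, add_zero]⟩
        · by_cases h3 : c s(u, v) = 0
          · rw [Pi.add_apply, h3, zero_add, Pi.add_apply] at huv
            by_cases h4 : single x y s(u, v) = 0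
            · rw [h4, zero_add] at huv
              rcases single_mem huv with ⟨rfl, rfl⟩ | ⟨rfl, rfl⟩
              exacts [hyz', hyz'.symm]
            · rcases single_mem h4 with ⟨rfl, rfl⟩ | ⟨rfl, rfl⟩
              exacts [hyx'.symm, hyx']
          · exact hc u v h3
        · rw [bd_add, bd_add, bd_single hyx.symm, bd_single hyz]
          by_cases hvx : v = x
          · subst hvx
            rw [h1]
            simp [hxz, hyx.symm, zmod_two_add_self]
          · by_cases hvz : v = z
            · subst hvz
              rw [h2]
              simp [hxz.symm, hyz.symm, zmod_two_add_self]
            · rw [hb1 v hvx hvz]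
              by_cases hvy : v = y <;> simp [hvx, hvy, hvz]
              simp [hyx, hyz, zmod_two_add_self]
    obtain ⟨c', hc', rfl⟩ := hfin
    obtain ⟨t, ht⟩ := hF.gen c' hc'
    exact ⟨t, by rw [← ht, map_sum]; simp only [map_smul]⟩

end

end LocalGirth

namespace LocalGirth

open Finset

set_option linter.unusedSectionVars false

section

open scoped Classical

universe u

variable {V : Type u} [Fintype V] {G H : SimpleGraph V} {x y z w : V}

/-- Opposite vertices of a quadrilateral member may be identified. -/
lemma IsFam.ident {ι : Type u} [Fintype ι] {F : ι → Chain V} (hF : IsFam G F) {k : ι}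
    (hk : F k = quad x y z w) (hxz : x ≠ z) (hyx : y ≠ x) (hyz : y ≠ z) (hwx : w ≠ x)
    (hwz : w ≠ z) (hyw : y ≠ w) (hn : ¬ G.Adj x z) : HasFam (ident G x z) := by
  set H := G.deleteEdges {e | ∃ u, e = s(z, u) ∧ G.Adj u x ∧ u ≠ y ∧ u ≠ w} with hH
  have hle : H ≤ G := SimpleGraph.deleteEdges_le _
  have hadj : ∀ a b, H.Adj a b ↔
      G.Adj a b ∧ ¬ ∃ u, s(a, b) = s(z, u) ∧ G.Adj u x ∧ u ≠ y ∧ u ≠ w := by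
    intro a b
    rw [hH, SimpleGraph.deleteEdges_adj]
    rfl
  obtain ⟨F', hF', h'⟩ := hF.mono hle
  have hk' : F' k = quad x y z w := by
    rw [h' k, hk]
    intro a b hab
    rw [hadj]
    refine ⟨(hF.mem k).1 a b hab, ?_⟩
    rintro ⟨u, hu, -, huy, huw⟩
    rw [hu, hk] at hab
    simp [quad, single_apply, hxz.symm, hyz.symm, hwz.symm, huy, huw] at hab
  refine (hF'.hasFam_ident hk' hxz hyx hyz hwx hwz hyw (fun h => hn (hle h)) ?_).mono ?_
  · intro u hux huz
    by_contra! hc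
    exact ((hadj _ _).1 huz).2 ⟨u, Sym2.eq_swap, hle hux, hc⟩
  · rintro a b ⟨ha, hb, hab, h⟩
    refine ⟨ha, hb, hab, ?_⟩
    have aux : ∀ v, v ≠ z → G.Adj z v → H.Adj v x ∨ H.Adj z v := by
      intro v hv hzv
      by_contra! hc
      refine hc.2 ((hadj _ _).2 ⟨hzv, ?_⟩)
      rintro ⟨u, hu, hux, huy, huw⟩
      have : v = u := by
        rw [Sym2.eq_iff] at hu
        grind
      subst this
      refine hc.1 ((hadj _ _).2 ⟨hux, ?_⟩)
      rintro ⟨t, ht, -⟩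
      rw [Sym2.eq_iff] at ht
      grind
    rcases h with h | ⟨rfl, h⟩ | ⟨rfl, h⟩
    · refine .inl ((hadj _ _).2 ⟨h, ?_⟩)
      rintro ⟨u, hu, -⟩
      rw [Sym2.eq_iff] at hu
      grind
    · rcases aux b hb h with h1 | h1
      exacts [.inl h1.symm, .inr (.inl ⟨rfl, h1⟩)]
    · rcases aux a ha h with h1 | h1
      exacts [.inl h1, .inr (.inr ⟨rfl, h1⟩)]

end

end LocalGirth

namespace LocalGirth

open Finset

set_option linter.unusedSectionVars false

section

open scoped Classical

universe u

variable {V : Type u} [Fintype V] {G H : SimpleGraph V}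

/-- The number of edges of a chain between a vertex and a set, modulo 2. -/
noncomputable def deg2 (z : Chain V) (Y : Set V) (a : V) : ZMod 2 :=
  ∑ u, if u ∈ Y then z s(a, u) else 0

/-- The part of a chain meeting a set. -/
noncomputable def meet (z : Chain V) (Y : Set V) : Chain V :=
  fun e => if ∃ v ∈ e, v ∈ Y then z e else 0

lemma meet_apply (z : Chain V) (Y : Set V) (u v : V) :
    meet z Y s(u, v) = if u ∈ Y ∨ v ∈ Y then z s(u, v) else 0 := by
  simp [meet]

lemma bd_meet_of_mem {z : Chain V} (hz : z ∈ cycles G) {Y : Set V} {v : V} (hv : v ∈ Y) :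
    bd (meet z Y) v = 0 := by
  rw [← hz.2 v]
  exact sum_congr rfl fun u _ => by simp [meet_apply, hv]

lemma bd_meet_of_notMem (z : Chain V) {Y : Set V} {v : V} (hv : v ∉ Y) :
    bd (meet z Y) v = deg2 z Y v :=
  sum_congr rfl fun u _ => by simp [meet_apply, hv]

lemma deg2_eq_zero {z : Chain V} (hz : z ∈ cycles G) {Y : Set V} {v : V}
    (h : ∀ y ∈ Y, ¬ G.Adj y v) : deg2 z Y v = 0 := by
  refine sum_eq_zero fun u _ => ?_
  split_ifs with hu
  · by_contra h0
    exact h u hu (hz.1 _ _ h0).symm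
  · rfl

lemma meet_loop {z : Chain V} (hz : z ∈ cycles G) (Y : Set V) (v : V) : meet z Y s(v, v) = 0 := by
  rw [meet_apply, cycles_loop hz, ite_self]

lemma deg2_eq_deg2 {z : Chain V} (hz : z ∈ cycles G) {Y : Set V} {a b : V} (ha : a ∉ Y)
    (hb : b ∉ Y) (hab : a ≠ b) (h : ∀ y ∈ Y, ∀ w, G.Adj y w → w ∈ Y ∨ w = a ∨ w = b) :
    deg2 z Y a = deg2 z Y b := by
  rw [← bd_meet_of_notMem z ha, ← bd_meet_of_notMem z hb]
  refine bd_eq_of_forall_ne (meet_loop hz Y) hab fun v hva hvb => ?_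
  by_cases hv : v ∈ Y
  · exact bd_meet_of_mem hz hv
  · rw [bd_meet_of_notMem z hv]
    exact deg2_eq_zero hz fun y hy hyv => by
      rcases h y hy v hyv with h | h | h
      exacts [hv h, hva h, hvb h]

lemma deg2_eq_zero_of_single {z : Chain V} (hz : z ∈ cycles G) {Y : Set V} {a : V} (ha : a ∉ Y)
    (h : ∀ y ∈ Y, ∀ w, G.Adj y w → w ∈ Y ∨ w = a) : deg2 z Y a = 0 := by
  rw [← bd_meet_of_notMem z ha]
  refine bd_eq_zero_of_forall_ne (meet_loop hz Y) fun v hva => ?_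
  by_cases hv : v ∈ Y
  · exact bd_meet_of_mem hz hv
  · rw [bd_meet_of_notMem z hv]
    exact deg2_eq_zero hz fun y hy hyv => by
      rcases h y hy v hyv with h | h
      exacts [hv h, hva h]

/-- Connected 2-regular vertex sets: induced cycles. -/
def CycSet (G : SimpleGraph V) (C : Set V) : Prop :=
  IsConn G C ∧ ∀ v ∈ C, ∃ a b, a ≠ b ∧ ∀ u, (u ∈ C ∧ G.Adj v u) ↔ (u = a ∨ u = b)

/-- The chain of all edges inside a set. -/
noncomputable def chi (G : SimpleGraph V) (C : Set V) : Chain V :=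
  fun e => if e ∈ G.edgeSet ∧ ∀ v ∈ e, v ∈ C then 1 else 0

lemma chi_apply (C : Set V) (u v : V) :
    chi G C s(u, v) = if G.Adj u v ∧ u ∈ C ∧ v ∈ C then 1 else 0 := by
  simp [chi]

lemma chi_ne_zero {C : Set V} {u v : V} :
    chi G C s(u, v) ≠ 0 ↔ G.Adj u v ∧ u ∈ C ∧ v ∈ C := by
  rw [chi_apply]
  simp

lemma deg2_chi {C Y : Set V} {a a₁ a₂ : V} (ha : a ∈ C) (h12 : a₁ ≠ a₂)
    (h : ∀ u, (u ∈ C ∧ G.Adj a u) ↔ (u = a₁ ∨ u = a₂)) :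
    deg2 (chi G C) Y a = (if a₁ ∈ Y then 1 else 0) + if a₂ ∈ Y then 1 else 0 := by
  have : ∀ u, (if u ∈ Y then chi G C s(a, u) else 0) =
      (if u = a₁ then (if a₁ ∈ Y then (1 : ZMod 2) else 0) else 0) +
        if u = a₂ then (if a₂ ∈ Y then 1 else 0) else 0 := by
    intro u
    rw [chi_apply]
    have hu := h u
    by_cases h1 : u = a₁
    · subst h1
      have := hu.2 (.inl rfl)
      simp [h12, this, ha]
    · by_cases h2 : u = a₂
      · subst h2
        have := hu.2 (.inr rfl)
        simp [h1, this, ha]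
      · have : ¬ (G.Adj a u ∧ a ∈ C ∧ u ∈ C) := fun h' => by
          rcases hu.1 ⟨h'.2.2, h'.1⟩ with h' | h'
          exacts [h1 h', h2 h']
        simp [h1, h2, this]
  simp only [deg2, this, sum_add_distrib, sum_ite_eq', mem_univ, if_true]

lemma CycSet.chi_mem {C : Set V} (hC : CycSet G C) : chi G C ∈ cycles G := by
  refine ⟨fun u v h => (chi_ne_zero.1 h).1, fun v => ?_⟩
  by_cases hv : v ∈ C
  · obtain ⟨a, b, hab, h⟩ := hC.2 v hv
    have h1 := deg2_chi (G := G) (Y := C) hv hab h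
    have ha := ((h a).2 (.inl rfl)).1
    have hb := ((h b).2 (.inr rfl)).1
    simp only [ha, hb, if_true, zmod_two_add_self] at h1
    rw [← h1]
    refine sum_congr rfl fun u _ => ?_
    rw [chi_apply]
    by_cases hu : u ∈ C <;> simp [hu]
  · exact sum_eq_zero fun u _ => by simp [chi_apply, hv]

lemma zmod_two_ite_add {P Q : Prop} :
    ((if P then 1 else 0) + (if Q then 1 else 0) : ZMod 2) = 0 ↔ (P ↔ Q) := by
  by_cases hP : P <;> by_cases hQ : Q <;> simp [hP, hQ, zmod_two_add_self]

/-- A connected part of a cycle is left by at most two edges. -/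
lemma CycSet.exists_leave {C K : Set V} (hC : CycSet G C) (hK : IsConn G K) (hKC : K ⊆ C) :
    ∃ x₁ y₁ x₂ y₂, ∀ a ∈ K, ∀ b ∈ C, b ∉ K → G.Adj a b →
      (a = x₁ ∧ b = y₁) ∨ (a = x₂ ∧ b = y₂) := by
  obtain ⟨r, hr⟩ := hK.1
  suffices h : ∀ n, ∀ K' ⊆ K, r ∈ K' → (∃ x₁ y₁ x₂ y₂, ∀ a ∈ K', ∀ b ∈ C, b ∉ K' → G.Adj a b →
      (a = x₁ ∧ b = y₁) ∨ (a = x₂ ∧ b = y₂)) → (K \ K').ncard = n →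
      ∃ x₁ y₁ x₂ y₂, ∀ a ∈ K, ∀ b ∈ C, b ∉ K → G.Adj a b →
      (a = x₁ ∧ b = y₁) ∨ (a = x₂ ∧ b = y₂) by
    refine h _ {r} (by simpa using hr) rfl ?_ rfl
    obtain ⟨a, b, -, hab⟩ := hC.2 r (hKC hr)
    refine ⟨r, a, r, b, ?_⟩
    rintro _ rfl u hu - hru
    have := (hab u).1 ⟨hu, hru⟩
    tauto
  intro n
  induction n using Nat.strong_induction_on with
  | _ n ih =>
  rintro K' hK' hr' ⟨x₁, y₁, x₂, y₂, h⟩ hn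
  by_cases hne : (K \ K').Nonempty
  · obtain ⟨a, ha, b, hb, hab⟩ := hK.exists_cross (A := K') ⟨r, hr, hr'⟩ hne
    have hlt : (K \ insert b K').ncard < n := by
      rw [← hn]
      refine Set.ncard_lt_ncard ⟨fun v hv => ⟨hv.1, fun h => hv.2 (.inr h)⟩, fun hs => ?_⟩
      exact (hs hb).2 (.inl rfl)
    refine ih _ hlt (insert b K') (Set.insert_subset hb.1 hK') (.inr hr') ?_ rfl
    obtain ⟨c, d, -, hcd⟩ := hC.2 b (hKC hb.1)
    have hab' := h a ha.2 b (hKC hb.1) hb.2 hab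
    have hac := (hcd a).1 ⟨hKC ha.1, hab.symm⟩
    have key : ∃ e, ∀ u, u ∈ C → G.Adj b u → u = a ∨ u = e := by
      rcases hac with rfl | rfl
      · exact ⟨d, fun u hu hbu => (hcd u).1 ⟨hu, hbu⟩⟩
      · exact ⟨c, fun u hu hbu => ((hcd u).1 ⟨hu, hbu⟩).symm⟩
    obtain ⟨e, he⟩ := key
    have haK := ha.2
    rcases hab' with ⟨rfl, rfl⟩ | ⟨rfl, rfl⟩
    · refine ⟨b, e, x₂, y₂, ?_⟩
      rintro u (rfl | hu) v hv hv' huv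
      · have := he v hv huv
        simp only [Set.mem_insert_iff, not_or] at hv'
        grind
      · simp only [Set.mem_insert_iff, not_or] at hv'
        have := h u hu v hv hv'.2 huv
        grind
    · refine ⟨x₁, y₁, b, e, ?_⟩
      rintro u (rfl | hu) v hv hv' huv
      · have := he v hv huv
        simp only [Set.mem_insert_iff, not_or] at hv'
        grind
      · simp only [Set.mem_insert_iff, not_or] at hv'
        have := h u hu v hv hv'.2 huv
        grind
  · have : K' = K := by
      refine subset_antisymm hK' fun v hv => ?_
      by_contra hv'
      exact hne ⟨v, hv, hv'⟩
    subst this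
    exact ⟨x₁, y₁, x₂, y₂, h⟩

end

end LocalGirth

namespace LocalGirth

open Finset

set_option linter.unusedSectionVars false

section

open scoped Classical

universe u

variable {V : Type u} [Fintype V] {G H : SimpleGraph V}

/-- The edges of `G` inside a set. -/
def within (G : SimpleGraph V) (C : Set V) : SimpleGraph V where
  Adj a b := G.Adj a b ∧ a ∈ C ∧ b ∈ C
  symm.symm _ _ h := ⟨h.1.symm, h.2.2, h.2.1⟩
  loopless := ⟨fun _ h => h.1.ne rfl⟩

lemma within_le (C : Set V) : within G C ≤ G := fun _ _ h => h.1

lemma CycSet.chi_mem_within {C : Set V} (hC : CycSet G C) : chi G C ∈ cycles (within G C) :=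
  ⟨fun _ _ h => chi_ne_zero.1 h, hC.chi_mem.2⟩

lemma CycSet.parity_pair {C Y : Set V} (hC : CycSet G C) {a b a₁ a₂ b₁ b₂ : V}
    (ha : a ∈ C) (hb : b ∈ C) (haY : a ∉ Y) (hbY : b ∉ Y) (hab : a ≠ b)
    (ha₁₂ : a₁ ≠ a₂) (ha' : ∀ u, (u ∈ C ∧ G.Adj a u) ↔ (u = a₁ ∨ u = a₂))
    (hb₁₂ : b₁ ≠ b₂) (hb' : ∀ u, (u ∈ C ∧ G.Adj b u) ↔ (u = b₁ ∨ u = b₂))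
    (h : ∀ y ∈ Y, ∀ w ∈ C, G.Adj y w → w ∈ Y ∨ w = a ∨ w = b) :
    (a₁ ∈ Y ↔ a₂ ∈ Y) ↔ (b₁ ∈ Y ↔ b₂ ∈ Y) := by
  have := deg2_eq_deg2 hC.chi_mem_within haY hbY hab fun y hy w hyw => h y hy w hyw.2.2 hyw.1
  rw [deg2_chi ha ha₁₂ ha', deg2_chi hb hb₁₂ hb'] at this
  rw [← zmod_two_ite_add (P := a₁ ∈ Y), this, zmod_two_ite_add]

lemma CycSet.parity_single {C Y : Set V} (hC : CycSet G C) {a a₁ a₂ : V}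
    (ha : a ∈ C) (haY : a ∉ Y)
    (ha₁₂ : a₁ ≠ a₂) (ha' : ∀ u, (u ∈ C ∧ G.Adj a u) ↔ (u = a₁ ∨ u = a₂))
    (h : ∀ y ∈ Y, ∀ w ∈ C, G.Adj y w → w ∈ Y ∨ w = a) : a₁ ∈ Y ↔ a₂ ∈ Y := by
  have := deg2_eq_zero_of_single hC.chi_mem_within haY fun y hy w hyw => h y hy w hyw.2.2 hyw.1
  rwa [deg2_chi ha ha₁₂ ha', zmod_two_ite_add] at this

/-- Neighbours on a cycle, one of them given. -/
lemma CycSet.exists_other {C : Set V} (hC : CycSet G C) {v a : V} (hv : v ∈ C) (ha : a ∈ C)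
    (h : G.Adj v a) : ∃ b, a ≠ b ∧ ∀ u, (u ∈ C ∧ G.Adj v u) ↔ (u = a ∨ u = b) := by
  obtain ⟨c, d, hcd, hv'⟩ := hC.2 v hv
  rcases (hv' a).1 ⟨ha, h⟩ with rfl | rfl
  · exact ⟨d, hcd, hv'⟩
  · exact ⟨c, hcd.symm, fun u => (hv' u).trans or_comm⟩

/-- Removing an edge with its ends from a cycle. -/
lemma CycSet.arc {C : Set V} (hC : CycSet G C) {u v : V} (hu : u ∈ C) (hv : v ∈ C)
    (huv : G.Adj u v) :
    IsConn G (C \ {u, v}) ∧ Touch G {u} (C \ {u, v}) ∧ Touch G {v} (C \ {u, v}) := by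
  obtain ⟨u₁, hu₁, hu'⟩ := hC.exists_other hu hv huv
  obtain ⟨v₁, hv₁, hv'⟩ := hC.exists_other hv hu huv.symm
  have hu₁' := (hu' u₁).2 (.inr rfl)
  have hv₁' := (hv' v₁).2 (.inr rfl)
  have hmu : u₁ ∈ C \ {u, v} := ⟨hu₁'.1, by
    rintro (h | h)
    exacts [hu₁'.2.ne h.symm, hu₁ h.symm]⟩
  have hmv : v₁ ∈ C \ {u, v} := ⟨hv₁'.1, by
    rintro (h | h)
    exacts [hv₁ h.symm, hv₁'.2.ne h.symm]⟩
  refine ⟨.of_root hmu fun w hw => ?_, touch_singleton_left.2 ⟨u₁, hmu, hu₁'.2⟩,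
    touch_singleton_left.2 ⟨v₁, hmv, hv₁'.2⟩⟩
  set Y := comp G (C \ {u, v}) w with hY
  have hYs : Y ⊆ C \ {u, v} := comp_subset _ _
  have hcl : ∀ y ∈ Y, ∀ x ∈ C, G.Adj y x → x ∈ Y ∨ x = u ∨ x = v := by
    intro y hy x hx hyx
    by_contra! hc
    exact hc.1 (mem_comp_of_adj hy ⟨hx, by simp [hc]⟩ hyx)
  have huY : u ∉ Y := fun h => (hYs h).2 (by simp)
  have hvY : v ∉ Y := fun h => (hYs h).2 (by simp)
  have hpar := hC.parity_pair hu hv huY hvY huv.ne hu₁ hu' hv₁ hv' hcl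
  obtain ⟨a, ha, b, hb, hab⟩ := hC.1.exists_cross (A := Y) ⟨w, hw.1, mem_comp_self hw⟩
    ⟨u, hu, huY⟩
  have hmem : u₁ ∈ Y := by
    rcases hcl a ha.2 b hb.1 hab with h | rfl | rfl
    · exact absurd h hb.2
    · rcases (hu' a).1 ⟨ha.1, hab.symm⟩ with rfl | rfl
      exacts [absurd ha.2 hvY, ha.2]
    · rcases (hv' a).1 ⟨ha.1, hab.symm⟩ with rfl | rfl
      · exact absurd ha.2 huY
      · by_contra h
        have := ha.2
        tauto
  exact hmem.2.symm

/-- Removing two nonadjacent vertices from a cycle. -/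
lemma CycSet.arcs {C : Set V} (hC : CycSet G C) {p q : V} (hp : p ∈ C) (hq : q ∈ C)
    (hpq : p ≠ q) (hn : ¬ G.Adj p q) :
    ∃ Z₁ Z₂ : Set V, C \ {p, q} = Z₁ ∪ Z₂ ∧ Disjoint Z₁ Z₂ ∧ ¬ Touch G Z₁ Z₂ ∧
      IsConn G Z₁ ∧ IsConn G Z₂ ∧ Touch G {p} Z₁ ∧ Touch G {p} Z₂ ∧ Touch G {q} Z₁ ∧
      Touch G {q} Z₂ := by
  obtain ⟨p₁, p₂, hp₁₂, hp'⟩ := hC.2 p hp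
  obtain ⟨q₁, q₂, hq₁₂, hq'⟩ := hC.2 q hq
  have hp₁ := (hp' p₁).2 (.inl rfl)
  have hp₂ := (hp' p₂).2 (.inr rfl)
  have hq₁ := (hq' q₁).2 (.inl rfl)
  have hq₂ := (hq' q₂).2 (.inr rfl)
  have hcl : ∀ w, ∀ y ∈ comp G (C \ {p, q}) w, ∀ x ∈ C, G.Adj y x →
      x ∈ comp G (C \ {p, q}) w ∨ x = p ∨ x = q := by
    intro w y hy x hx hyx
    by_contra! hc
    exact hc.1 (mem_comp_of_adj hy ⟨hx, by simp [hc]⟩ hyx)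
  have hpY : ∀ w, p ∉ comp G (C \ {p, q}) w := fun w h => (comp_subset _ _ h).2 (by simp)
  have hqY : ∀ w, q ∉ comp G (C \ {p, q}) w := fun w h => (comp_subset _ _ h).2 (by simp)
  have hpar : ∀ w, _ := fun w =>
    hC.parity_pair hp hq (hpY w) (hqY w) hpq hp₁₂ hp' hq₁₂ hq' (hcl w)
  -- every component is attached to both vertices
  have hatt : ∀ w ∈ C \ {p, q},
      (p₁ ∈ comp G (C \ {p, q}) w ∨ p₂ ∈ comp G (C \ {p, q}) w) ∧
      (q₁ ∈ comp G (C \ {p, q}) w ∨ q₂ ∈ comp G (C \ {p, q}) w) := by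
    intro w hw
    have hpar := hpar w
    have hcl := hcl w
    have hpY := hpY w
    have hqY := hqY w
    set Y := comp G (C \ {p, q}) w with hY
    have hwY : w ∈ Y := mem_comp_self hw
    constructor
    · by_contra! hc
      have hq12 : q₁ ∈ Y ↔ q₂ ∈ Y := by tauto
      obtain ⟨a, ha, b, hb, hab⟩ := hC.1.exists_cross (A := insert q Y) ⟨w, hw.1, .inr hwY⟩
        ⟨p, hp, by simp [hpY, hpq]⟩
      have hq1 : q₁ ∈ Y := by
        obtain ⟨a, ha, b, hb, hab⟩ := hC.1.exists_cross (A := Y) ⟨w, hw.1, hwY⟩ ⟨p, hp, hpY⟩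
        rcases hcl a ha.2 b hb.1 hab with h | rfl | rfl
        · exact absurd h hb.2
        · rcases (hp' a).1 ⟨ha.1, hab.symm⟩ with rfl | rfl
          exacts [absurd ha.2 hc.1, absurd ha.2 hc.2]
        · have := ha.2
          rcases (hq' a).1 ⟨ha.1, hab.symm⟩ with rfl | rfl <;> tauto
      have hbY := hb.2
      simp only [Set.mem_insert_iff, not_or] at hbY
      rcases ha.2 with rfl | haY
      · rcases (hq' b).1 ⟨hb.1, hab⟩ with rfl | rfl <;> tauto
      · rcases hcl a haY b hb.1 hab with h | rfl | rfl
        · exact hbY.2 h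
        · rcases (hp' a).1 ⟨ha.1, hab.symm⟩ with rfl | rfl
          exacts [hc.1 haY, hc.2 haY]
        · exact hbY.1 rfl
    · by_contra! hc
      have hq12 : p₁ ∈ Y ↔ p₂ ∈ Y := by tauto
      obtain ⟨a, ha, b, hb, hab⟩ := hC.1.exists_cross (A := insert p Y) ⟨w, hw.1, .inr hwY⟩
        ⟨q, hq, by simp [hqY, hpq.symm]⟩
      have hp1 : p₁ ∈ Y := by
        obtain ⟨a, ha, b, hb, hab⟩ := hC.1.exists_cross (A := Y) ⟨w, hw.1, hwY⟩ ⟨q, hq, hqY⟩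
        rcases hcl a ha.2 b hb.1 hab with h | rfl | rfl
        · exact absurd h hb.2
        · have := ha.2
          rcases (hp' a).1 ⟨ha.1, hab.symm⟩ with rfl | rfl <;> tauto
        · rcases (hq' a).1 ⟨ha.1, hab.symm⟩ with rfl | rfl
          exacts [absurd ha.2 hc.1, absurd ha.2 hc.2]
      have hbY := hb.2
      simp only [Set.mem_insert_iff, not_or] at hbY
      rcases ha.2 with rfl | haY
      · rcases (hp' b).1 ⟨hb.1, hab⟩ with rfl | rfl <;> tauto
      · rcases hcl a haY b hb.1 hab with h | rfl | rfl
        · exact hbY.2 h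
        · exact hbY.1 rfl
        · rcases (hq' a).1 ⟨ha.1, hab.symm⟩ with rfl | rfl
          exacts [hc.1 haY, hc.2 haY]
  have hm₁ : p₁ ∈ C \ {p, q} := ⟨hp₁.1, by
    rintro (h | h)
    exacts [hp₁.2.ne h.symm, hn (h ▸ hp₁.2)]⟩
  have hm₂ : p₂ ∈ C \ {p, q} := ⟨hp₂.1, by
    rintro (h | h)
    exacts [hp₂.2.ne h.symm, hn (h ▸ hp₂.2)]⟩
  have hsep : p₂ ∉ comp G (C \ {p, q}) p₁ := by
    intro h
    obtain ⟨x₁, y₁, x₂, y₂, hl⟩ := hC.exists_leave (isConn_comp hm₁)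
      ((comp_subset (G := G) _ _).trans Set.sdiff_subset)
    have h₁ := mem_comp_self (G := G) hm₁
    have e1 := hl p₁ h₁ p hp (hpY _) hp₁.2.symm
    have e2 := hl p₂ h p hp (hpY _) hp₂.2.symm
    rcases (hatt p₁ hm₁).2 with h3 | h3
    · have e3 := hl q₁ h3 q hq (hqY _) hq₁.2.symm
      grind
    · have e3 := hl q₂ h3 q hq (hqY _) hq₂.2.symm
      grind
  have hne : comp G (C \ {p, q}) p₁ ≠ comp G (C \ {p, q}) p₂ := by
    intro h
    rw [h] at hsep
    exact hsep (mem_comp_self hm₂)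
  have htq : ∀ w ∈ C \ {p, q}, Touch G {q} (comp G (C \ {p, q}) w) := by
    intro w hw
    rcases (hatt w hw).2 with h | h
    exacts [touch_singleton_left.2 ⟨_, h, hq₁.2⟩, touch_singleton_left.2 ⟨_, h, hq₂.2⟩]
  refine ⟨comp G (C \ {p, q}) p₁, comp G (C \ {p, q}) p₂, ?_, ?_, ?_, isConn_comp hm₁,
    isConn_comp hm₂, touch_singleton_left.2 ⟨_, mem_comp_self hm₁, hp₁.2⟩,
    touch_singleton_left.2 ⟨_, mem_comp_self hm₂, hp₂.2⟩, htq _ hm₁, htq _ hm₂⟩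
  · refine subset_antisymm (fun w hw => ?_)
      (Set.union_subset (comp_subset _ _) (comp_subset _ _))
    rcases (hatt w hw).1 with h | h
    exacts [.inl (mem_comp_comm h), .inr (mem_comp_comm h)]
  · rw [Set.disjoint_left]
    intro w h1 h2
    exact hne ((comp_eq_of_mem h1).symm.trans (comp_eq_of_mem h2))
  · rintro ⟨a, ha, b, hb, hab⟩
    have hb' := mem_comp_of_adj ha (comp_subset _ _ hb) hab
    exact hne ((comp_eq_of_mem hb').symm.trans (comp_eq_of_mem hb))

end

end LocalGirth

namespace LocalGirth

set_option linter.unusedSectionVars false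

section

open scoped Classical

universe u

variable {V : Type u} [Fintype V] {G H : SimpleGraph V} {U : Set V}

/-- Induced nonseparating cycles of the graph inside `U`. -/
structure Periph (G : SimpleGraph V) (U C : Set V) : Prop where
  sub : C ⊆ U
  cyc : CycSet G C
  conn : ∀ a ∈ U \ C, ∀ b ∈ U \ C, Reach G (U \ C) a b

/-- No two vertices separate the graph inside `U`. -/
def NoSep (G : SimpleGraph V) (U : Set V) : Prop :=
  ∀ Y ⊆ U, Y.Nonempty → ∀ p q,
    (∃ y ∈ Y, ∃ w ∈ U, w ∉ Y ∧ w ≠ p ∧ w ≠ q ∧ G.Adj y w) ∨ U ⊆ Y ∪ {p, q}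

/-- A cycle contained in a cycle is the whole cycle. -/
lemma CycSet.eq_of_subset {C D : Set V} (hC : CycSet G C) (hD : CycSet G D) (h : C ⊆ D) :
    C = D := by
  refine subset_antisymm h fun d hd => ?_
  obtain ⟨c, hc⟩ := hC.1.1
  refine (hD.1.2 c (h hc) d hd).closed hc fun a ha b hb hab => ?_
  obtain ⟨x, y, hxy, hx⟩ := hC.2 a ha
  obtain ⟨x', y', hxy', hx'⟩ := hD.2 a (h ha)
  have h1 := (hx x).2 (.inl rfl)
  have h2 := (hx y).2 (.inr rfl)
  have h3 := (hx' x).1 ⟨h h1.1, h1.2⟩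
  have h4 := (hx' y).1 ⟨h h2.1, h2.2⟩
  have h5 := (hx' b).1 ⟨hb, hab⟩
  have h6 : b = x ∨ b = y := by grind
  rcases h6 with rfl | rfl
  exacts [h1.1, h2.1]

/-- The ends of a segment of a cycle. -/
lemma CycSet.exists_ends {C Y : Set V} (hC : CycSet G C) (hY : IsConn G Y) (hYC : Y ⊆ C)
    {u v : V} (hu : u ∈ C) (hv : v ∈ C) (huY : u ∉ Y) (hvY : v ∉ Y) (huv : u ≠ v) :
    ∃ p q, p ≠ q ∧ p ∈ C ∧ q ∈ C ∧ p ∉ Y ∧ q ∉ Y ∧ Touch G {p} Y ∧ Touch G {q} Y ∧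
      (∀ y ∈ Y, ∀ w ∈ C, G.Adj y w → w ∈ Y ∨ w = p ∨ w = q) ∧
      (∀ w ∈ C, G.Adj p w → ∀ w' ∈ C, G.Adj p w' → w ∈ Y → w' ∈ Y → w = w') ∧
      (∀ w ∈ C, G.Adj q w → ∀ w' ∈ C, G.Adj q w' → w ∈ Y → w' ∈ Y → w = w') := by
  obtain ⟨x₁, y₁, x₂, y₂, hl⟩ := hC.exists_leave hY hYC
  obtain ⟨y, hy⟩ := hY.1
  obtain ⟨a, ha, p, hp, hap⟩ := hC.1.exists_cross (A := Y) ⟨y, hYC hy, hy⟩ ⟨u, hu, huY⟩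
  have hex : ∃ q ∈ C, q ≠ p ∧ q ∉ Y ∧ ∃ b ∈ Y, G.Adj b q := by
    by_contra! hc
    obtain ⟨p₁, p₂, hp₁₂, hp'⟩ := hC.2 p hp.1
    have hcl : ∀ y ∈ Y, ∀ w ∈ C, G.Adj y w → w ∈ Y ∨ w = p := by
      intro y hy w hw hyw
      by_contra! h
      exact hc w hw h.2 h.1 y hy hyw
    have hpar := hC.parity_single hp.1 hp.2 hp₁₂ hp' hcl
    obtain ⟨r, hr, hrp, hrY⟩ : ∃ r ∈ C, r ≠ p ∧ r ∉ Y := by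
      by_cases h : u = p
      · exact ⟨v, hv, fun h' => huv (h.trans h'.symm), hvY⟩
      · exact ⟨u, hu, h, huY⟩
    obtain ⟨s, hs, t, ht, hst⟩ := hC.1.exists_cross (A := insert p Y) ⟨y, hYC hy, .inr hy⟩
      ⟨r, hr, by simp [hrp, hrY]⟩
    have htY := ht.2
    simp only [Set.mem_insert_iff, not_or] at htY
    have ha' := (hp' a).1 ⟨ha.1, hap.symm⟩
    have haY := ha.2
    rcases hs.2 with rfl | hsY
    · have ht' := (hp' t).1 ⟨ht.1, hst⟩
      grind
    · rcases hcl s hsY t ht.1 hst with h | h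
      exacts [htY.2 h, htY.1 h]
  obtain ⟨q, hq, hqp, hqY, b, hb, hbq⟩ := hex
  have e1 := hl a ha.2 p hp.1 hp.2 hap
  have e2 := hl b hb q hq hqY hbq
  refine ⟨p, q, hqp.symm, hp.1, hq, hp.2, hqY, touch_singleton_left.2 ⟨a, ha.2, hap.symm⟩,
    touch_singleton_left.2 ⟨b, hb, hbq.symm⟩, fun y hy w hw hyw => ?_,
    fun w hw hpw w' hw' hpw' hwY hwY' => ?_, fun w hw hpw w' hw' hpw' hwY hwY' => ?_⟩
  · by_contra! hc
    have := hl y hy w hw hc.1 hyw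
    grind
  · have := hl w hwY p hp.1 hp.2 hpw.symm
    have := hl w' hwY' p hp.1 hp.2 hpw'.symm
    grind
  · have := hl w hwY q hq hqY hpw.symm
    have := hl w' hwY' q hq hqY hpw'.symm
    grind

/-- Two peripheral cycles through an edge share nothing else. -/
lemma Periph.inter_subset (hG : NoMinor G) (hU : NoSep G U) {C₁ C₂ : Set V}
    (h₁ : Periph G U C₁) (h₂ : Periph G U C₂) (hne : C₁ ≠ C₂) {u v : V} (hu₁ : u ∈ C₁)
    (hu₂ : u ∈ C₂) (hv₁ : v ∈ C₁) (hv₂ : v ∈ C₂) (huv : u ≠ v) : C₁ ∩ C₂ ⊆ {u, v} := by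
  intro x hx
  by_contra hxuv
  simp only [Set.mem_insert_iff, Set.mem_singleton_iff, not_or] at hxuv
  obtain ⟨y, hy₁, hy₂⟩ : ∃ y ∈ C₁, y ∉ C₂ := by
    by_contra! h
    exact hne (h₁.cyc.eq_of_subset h₂.cyc h)
  have hyd : y ∈ C₁ \ C₂ := ⟨hy₁, hy₂⟩
  set Y := comp G (C₁ \ C₂) y with hY
  have hYs : Y ⊆ C₁ \ C₂ := comp_subset _ _
  have hYC : IsConn G Y := isConn_comp hyd
  obtain ⟨p, q, hpq, hp, hq, hpY, hqY, htp, htq, hcl, hp1, hq1⟩ :=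
    h₁.cyc.exists_ends hYC (fun w hw => (hYs hw).1) hu₁ hv₁ (fun h => (hYs h).2 hu₂)
      (fun h => (hYs h).2 hv₂) huv
  have hp₂ : p ∈ C₂ := by
    by_contra h
    obtain ⟨b, hb, hpb⟩ := touch_singleton_left.1 htp
    exact hpY (mem_comp_of_adj hb ⟨hp, h⟩ hpb.symm)
  have hq₂ : q ∈ C₂ := by
    by_contra h
    obtain ⟨b, hb, hqb⟩ := touch_singleton_left.1 htq
    exact hqY (mem_comp_of_adj hb ⟨hq, h⟩ hqb.symm)
  have hnadj : ¬ G.Adj p q := by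
    intro hadj
    obtain ⟨b, hb, hpb⟩ := touch_singleton_left.1 htp
    obtain ⟨c, hc, hqc⟩ := touch_singleton_left.1 htq
    obtain ⟨p', hp', hpn⟩ := h₁.cyc.exists_other hp hq hadj
    obtain ⟨q', hq', hqn⟩ := h₁.cyc.exists_other hq hp hadj.symm
    have hall : ∀ w ∈ C₁, w ∈ Y ∨ w = p ∨ w = q := by
      intro w hw
      refine (h₁.cyc.1.2 p hp w hw).closed (A := {w | w ∈ Y ∨ w = p ∨ w = q})
        (.inr (.inl rfl)) ?_
      rintro a (ha | rfl | rfl) d hd had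
      · exact hcl a ha d hd had
      · have e1 := (hpn d).1 ⟨hd, had⟩
        have e2 := (hpn b).1 ⟨(hYs hb).1, hpb⟩
        rcases e1 with rfl | rfl
        · exact .inr (.inr rfl)
        · rcases e2 with rfl | rfl
          exacts [absurd hb hqY, .inl hb]
      · have e1 := (hqn d).1 ⟨hd, had⟩
        have e2 := (hqn c).1 ⟨(hYs hc).1, hqc⟩
        rcases e1 with rfl | rfl
        · exact .inr (.inl rfl)
        · rcases e2 with rfl | rfl
          exacts [absurd hc hpY, .inl hc]
    have eu := hall u hu₁
    have ev := hall v hv₁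
    have ex := hall x hx.1
    have nu : u ∉ Y := fun h => (hYs h).2 hu₂
    have nv : v ∉ Y := fun h => (hYs h).2 hv₂
    have nx : x ∉ Y := fun h => (hYs h).2 hx.2
    grind
  obtain ⟨Z₁, Z₂, hZ, hZd, hZn, hZ₁, hZ₂, tp₁, tp₂, tq₁, tq₂⟩ := h₂.cyc.arcs hp₂ hq₂ hpq hnadj
  have hZ₁C : Z₁ ⊆ C₂ \ {p, q} := hZ ▸ Set.subset_union_left
  have hZ₂C : Z₂ ⊆ C₂ \ {p, q} := hZ ▸ Set.subset_union_right
  have hC₂ : ∀ w ∈ C₂, w = p ∨ w = q ∨ w ∈ Z₁ ∨ w ∈ Z₂ := by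
    intro w hw
    by_contra! hc
    have : w ∈ Z₁ ∪ Z₂ := hZ ▸ ⟨hw, by simp [hc]⟩
    rcases this with h | h
    exacts [hc.2.2.1 h, hc.2.2.2 h]
  -- the case of an arc inside the first cycle
  have hcase : ∀ A B : Set V, (∀ w ∈ C₂, w = p ∨ w = q ∨ w ∈ A ∨ w ∈ B) → A ⊆ C₂ \ {p, q} →
      B ⊆ C₂ \ {p, q} → Disjoint A B → ¬ Touch G A B → IsConn G A → IsConn G B →
      Touch G {p} A → Touch G {q} A → A ⊆ C₁ →
      ∃ Q : Set V, Q ⊆ (U \ C₂) \ Y ∧ IsConn G Q ∧ Touch G Q A ∧ Touch G Q B := by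
    intro A B hAB hA hB hd hnt hAc hBc tpA tqA hAC
    have hAcl : ∀ a ∈ A, ∀ w ∈ C₂, G.Adj a w → w ∈ A ∨ w = p ∨ w = q := by
      intro a ha w hw haw
      rcases hAB w hw with h | h | h | h
      · exact .inr (.inl h)
      · exact .inr (.inr h)
      · exact .inl h
      · exact absurd (touch_of_adj haw ha h) hnt
    have hAnb : ∀ a ∈ A, ∃ b c, b ∈ C₁ ∧ c ∈ C₁ ∧ (∀ w ∈ C₂, G.Adj a w → w = b ∨ w = c) ∧
        (∀ w ∈ C₁, G.Adj a w → w = b ∨ w = c) ∧ (b ∈ A ∨ b = p ∨ b = q) ∧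
          (c ∈ A ∨ c = p ∨ c = q) := by
      intro a ha
      obtain ⟨b, c, hbc, hn⟩ := h₂.cyc.2 a (hA ha).1
      obtain ⟨b', c', hbc', hn'⟩ := h₁.cyc.2 a (hAC ha)
      have hb := (hn b).2 (.inl rfl)
      have hc := (hn c).2 (.inr rfl)
      have hb2 := hAcl a ha b hb.1 hb.2
      have hc2 := hAcl a ha c hc.1 hc.2
      have hb1 : b ∈ C₁ := by
        rcases hb2 with h | rfl | rfl
        exacts [hAC h, hp, hq]
      have hc1 : c ∈ C₁ := by
        rcases hc2 with h | rfl | rfl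
        exacts [hAC h, hp, hq]
      refine ⟨b, c, hb1, hc1, fun w hw haw => (hn w).1 ⟨hw, haw⟩, fun w hw haw => ?_, hb2, hc2⟩
      have e1 := (hn' b).1 ⟨hb1, hb.2⟩
      have e2 := (hn' c).1 ⟨hc1, hc.2⟩
      have e3 := (hn' w).1 ⟨hw, haw⟩
      grind
    have hends : ∀ r, r ∈ C₁ → r ∉ Y → Touch G {r} Y → Touch G {r} A →
        ∀ w ∈ C₁, G.Adj r w → w ∈ Y ∨ w ∈ A := by
      intro r hr hrY hrt hrA w hw hrw
      obtain ⟨b, hb, hrb⟩ := touch_singleton_left.1 hrt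
      obtain ⟨c, hc, hrc⟩ := touch_singleton_left.1 hrA
      obtain ⟨d, hbd, hn⟩ := h₁.cyc.exists_other hr (hYs hb).1 hrb
      have e1 := (hn c).1 ⟨hAC hc, hrc⟩
      have e2 := (hn w).1 ⟨hw, hrw⟩
      have e3 : b ≠ c := by
        rintro rfl
        exact (hYs hb).2 (hA hc).1
      grind
    have hall : ∀ w ∈ C₁, w ∈ Y ∨ w ∈ A ∨ w = p ∨ w = q := by
      intro w hw
      refine (h₁.cyc.1.2 p hp w hw).closed (A := {w | w ∈ Y ∨ w ∈ A ∨ w = p ∨ w = q})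
        (.inr (.inr (.inl rfl))) ?_
      rintro a (ha | ha | rfl | rfl) d hd had
      · rcases hcl a ha d hd had with h | h
        exacts [.inl h, .inr (.inr h)]
      · obtain ⟨b, c, -, -, -, h, hb, hc⟩ := hAnb a ha
        rcases h d hd had with rfl | rfl
        exacts [.inr hb, .inr hc]
      · rcases hends a hp hpY htp tpA d hd had with h | h
        exacts [.inl h, .inr (.inl h)]
      · rcases hends a hq hqY htq tqA d hd had with h | h
        exacts [.inl h, .inr (.inl h)]
    have hBC : ∀ w ∈ B, w ∉ C₁ := by
      intro w hw hw'
      rcases hall w hw' with h | h | h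
      · exact (hYs h).2 (hB hw).1
      · exact Set.disjoint_left.1 hd h hw
      · exact (hB hw).2 h
    obtain ⟨a, ha⟩ := hAc.1
    obtain ⟨b, c, hb, hc, hn2, hn1, -, -⟩ := hAnb a ha
    obtain ⟨z, hz⟩ := hBc.1
    have hg : ∃ g ∈ U, G.Adj a g ∧ g ∉ C₁ ∧ g ∉ C₂ := by
      rcases hU {a} (by simpa using h₁.sub (hAC ha)) ⟨a, rfl⟩ b c with h | h
      · obtain ⟨_, rfl, g, hgU, hga, hgb, hgc, hadj⟩ := h
        refine ⟨g, hgU, hadj, fun h => ?_, fun h => ?_⟩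
        · rcases hn1 g h hadj with h | h
          exacts [hgb h, hgc h]
        · rcases hn2 g h hadj with h | h
          exacts [hgb h, hgc h]
      · rcases h (h₂.sub (hB hz).1) with rfl | rfl | rfl
        · exact (Set.disjoint_left.1 hd ha hz).elim
        · exact (hBC _ hz hb).elim
        · exact (hBC _ hz hc).elim
    obtain ⟨g, hgU, hag, hg₁, hg₂⟩ := hg
    have hgD : g ∈ (U \ C₁) \ B := ⟨⟨hgU, hg₁⟩, fun h => hg₂ (hB h).1⟩
    set Q := comp G ((U \ C₁) \ B) g with hQ
    have hQs : Q ⊆ (U \ C₁) \ B := comp_subset _ _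
    refine ⟨Q, fun w hw => ⟨⟨(hQs hw).1.1, fun h => ?_⟩, fun h => (hQs hw).1.2 (hYs h).1⟩,
      isConn_comp hgD, ⟨g, mem_comp_self hgD, a, ha, hag.symm⟩, ?_⟩
    · rcases hAB w h with rfl | rfl | h | h
      exacts [(hQs hw).1.2 hp, (hQs hw).1.2 hq, (hQs hw).1.2 (hAC h), (hQs hw).2 h]
    · have hr := h₁.conn g hgD.1 z ⟨h₂.sub (hB hz).1, hBC z hz⟩
      obtain ⟨s, hs, t, ht, hst⟩ := hr.exists_cross (A := Q) (mem_comp_self hgD)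
        fun h => (hQs h).2 hz
      refine ⟨s, hs.2, t, ?_, hst⟩
      by_contra h
      exact ht.2 (mem_comp_of_adj hs.2 ⟨ht.1, h⟩ hst)
  have hQ : ∃ Q : Set V, Q ⊆ (U \ C₂) \ Y ∧ IsConn G Q ∧ Touch G Q Z₁ ∧ Touch G Q Z₂ := by
    by_cases hs₁ : Z₁ ⊆ C₁
    · exact hcase Z₁ Z₂ hC₂ hZ₁C hZ₂C hZd hZn hZ₁ hZ₂ tp₁ tq₁ hs₁
    · by_cases hs₂ : Z₂ ⊆ C₁
      · obtain ⟨Q, hQ, hQc, t₁, t₂⟩ := hcase Z₂ Z₁ (fun w hw => by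
          have := hC₂ w hw
          tauto) hZ₂C hZ₁C hZd.symm (fun h => hZn h.symm) hZ₂ hZ₁ tp₂ tq₂ hs₂
        exact ⟨Q, hQ, hQc, t₂, t₁⟩
      · obtain ⟨z₁, hz₁, hz₁'⟩ := Set.not_subset.1 hs₁
        obtain ⟨z₂, hz₂, hz₂'⟩ := Set.not_subset.1 hs₂
        have hr := h₁.conn z₁ ⟨h₂.sub (hZ₁C hz₁).1, hz₁'⟩ z₂ ⟨h₂.sub (hZ₂C hz₂).1, hz₂'⟩
        rcases hr.touch_or_exists hz₁ hz₂ hZd with h | ⟨Q, hQ, hQc, t₁, t₂⟩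
        · exact absurd h hZn
        · refine ⟨Q, fun w hw => ⟨⟨(hQ hw).1.1, fun h => ?_⟩, fun h => (hQ hw).1.2 (hYs h).1⟩,
            hQc, t₁.symm, t₂⟩
          have hwQ := hQ hw
          rcases hC₂ w h with rfl | rfl | h | h
          exacts [hwQ.1.2 hp, hwQ.1.2 hq, hwQ.2 (.inl h), hwQ.2 (.inr h)]
  obtain ⟨Q, hQs, hQc, tQ₁, tQ₂⟩ := hQ
  obtain ⟨r, hr⟩ := hQc.1
  set T := comp G ((U \ C₂) \ Y) r with hT
  have hTs : T ⊆ (U \ C₂) \ Y := comp_subset _ _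
  have hQT : Q ⊆ T := hQc.subset_comp hQs hr
  have hTc : IsConn G T := isConn_comp (hQs hr)
  have tTY : Touch G T Y := by
    obtain ⟨s, hs, t, ht, hst⟩ := (h₂.conn r (hQs hr).1 y ⟨h₁.sub hy₁, hy₂⟩).exists_cross
      (A := T) (hQT hr) fun h => (hTs h).2 (mem_comp_self hyd)
    refine ⟨s, hs.2, t, ?_, hst⟩
    by_contra h
    exact ht.2 (mem_comp_of_adj hs.2 ⟨ht.1, h⟩ hst)
  have dd : ∀ {A B C : Set V}, A ⊆ B → Disjoint B C → Disjoint A C := fun h h' => h'.mono_left h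
  have dC : Disjoint T C₂ := Set.disjoint_left.2 fun w hw => (hTs hw).1.2
  have dY : Disjoint Y C₂ := Set.disjoint_left.2 fun w hw => (hYs hw).2
  have sZ₁ : Z₁ ⊆ C₂ := fun w hw => (hZ₁C hw).1
  have sZ₂ : Z₂ ⊆ C₂ := fun w hw => (hZ₂C hw).1
  refine hG.not_K33 (isConn_singleton p) (isConn_singleton q) hTc hYC hZ₁ hZ₂
    (by simpa using hpq) ?_ ?_ (dY.mono_right sZ₁) (dY.mono_right sZ₂) hZd
    ?_ ?_ ?_ ?_ ?_ ?_ ?_ (dC.mono_right sZ₁) (dC.mono_right sZ₂)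
    htp tp₁ tp₂ htq tq₁ tq₂ tTY (tQ₁.left hQT) (tQ₂.left hQT)
  · exact Set.disjoint_singleton_left.2 fun h => (hTs h).1.2 hp₂
  · exact Set.disjoint_singleton_left.2 fun h => (hTs h).1.2 hq₂
  · exact Set.disjoint_singleton_left.2 hpY
  · exact Set.disjoint_singleton_left.2 fun h => (hZ₁C h).2 (.inl rfl)
  · exact Set.disjoint_singleton_left.2 fun h => (hZ₂C h).2 (.inl rfl)
  · exact Set.disjoint_singleton_left.2 hqY
  · exact Set.disjoint_singleton_left.2 fun h => (hZ₁C h).2 (.inr rfl)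
  · exact Set.disjoint_singleton_left.2 fun h => (hZ₂C h).2 (.inr rfl)
  · exact Set.disjoint_left.2 fun w hw => (hTs hw).2

/-- Every edge is in at most two peripheral cycles. -/
lemma Periph.two (hG : NoMinor G) (hU : NoSep G U) {C₁ C₂ C₃ : Set V}
    (h₁ : Periph G U C₁) (h₂ : Periph G U C₂) (h₃ : Periph G U C₃) {u v : V} (huv : G.Adj u v)
    (hu₁ : u ∈ C₁) (hu₂ : u ∈ C₂) (hu₃ : u ∈ C₃) (hv₁ : v ∈ C₁) (hv₂ : v ∈ C₂) (hv₃ : v ∈ C₃) :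
    C₁ = C₂ ∨ C₂ = C₃ ∨ C₁ = C₃ := by
  by_contra! hne
  obtain ⟨a₁, s₁, t₁⟩ := h₁.cyc.arc hu₁ hv₁ huv
  obtain ⟨a₂, s₂, t₂⟩ := h₂.cyc.arc hu₂ hv₂ huv
  obtain ⟨a₃, s₃, t₃⟩ := h₃.cyc.arc hu₃ hv₃ huv
  have hd : ∀ {C D : Set V}, Periph G U C → Periph G U D → C ≠ D → u ∈ C → u ∈ D → v ∈ C →
      v ∈ D → Disjoint (C \ {u, v}) (D \ {u, v}) := by
    intro C D hC hD hCD h1 h2 h3 h4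
    rw [Set.disjoint_left]
    intro w hw hw'
    exact hw.2 (Periph.inter_subset hG hU hC hD hCD h1 h2 h3 h4 huv.ne ⟨hw.1, hw'.1⟩)
  have d₁₂ := hd h₁ h₂ hne.1 hu₁ hu₂ hv₁ hv₂
  have d₂₃ := hd h₂ h₃ hne.2.1 hu₂ hu₃ hv₂ hv₃
  have d₁₃ := hd h₁ h₃ hne.2.2 hu₁ hu₃ hv₁ hv₃
  have hr : ∀ {C D E : Set V}, Periph G U C → Periph G U D → Periph G U E →
      IsConn G (C \ {u, v}) → IsConn G (D \ {u, v}) →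
      Disjoint (C \ {u, v}) (E \ {u, v}) → Disjoint (D \ {u, v}) (E \ {u, v}) →
      u ∈ E → v ∈ E →
      ∃ a ∈ C \ {u, v}, ∃ b ∈ D \ {u, v}, Reach G ((U \ {u, v}) \ (E \ {u, v})) a b := by
    intro C D E hC hD hE hCc hDc hCE hDE hu hv
    obtain ⟨a, ha⟩ := hCc.1
    obtain ⟨b, hb⟩ := hDc.1
    refine ⟨a, ha, b, hb, (hE.conn a ⟨hC.sub ha.1, fun h => ?_⟩ b
      ⟨hD.sub hb.1, fun h => ?_⟩).mono ?_⟩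
    · exact Set.disjoint_left.1 hCE ha ⟨h, ha.2⟩
    · exact Set.disjoint_left.1 hDE hb ⟨h, hb.2⟩
    · intro w hw
      refine ⟨⟨hw.1, ?_⟩, fun h => hw.2 h.1⟩
      rintro (rfl | rfl)
      exacts [hw.2 hu, hw.2 hv]
  refine hG.three_connectors (S := {u}) (S' := {v}) (Ω := U \ {u, v}) (isConn_singleton u)
    (isConn_singleton v) (by simpa using huv.ne) (touch_of_adj huv rfl rfl)
    (Set.disjoint_singleton_left.2 fun h => h.2 (by simp))
    (Set.disjoint_singleton_left.2 fun h => h.2 (by simp)) a₁ a₂ a₃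
    (Set.sdiff_subset_sdiff_left h₁.sub) (Set.sdiff_subset_sdiff_left h₂.sub)
    (Set.sdiff_subset_sdiff_left h₃.sub) d₁₂ d₁₃ d₂₃ s₁ s₂ s₃ t₁ t₂ t₃
    (hr h₁ h₂ h₃ a₁ a₂ d₁₃ d₂₃ hu₃ hv₃) (hr h₂ h₃ h₁ a₂ a₃ d₁₂.symm d₁₃.symm hu₁ hv₁)
    (hr h₃ h₁ h₂ a₃ a₁ d₂₃.symm d₁₂ hu₂ hv₂)

end

end LocalGirth

namespace LocalGirth

set_option linter.unusedSectionVars false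

open Finset

section

open scoped Classical

universe u

variable {V : Type u} [Fintype V] {G H : SimpleGraph V} {D A : Set V}
  {S : Submodule (ZMod 2) (Chain V)} {z₀ : Chain V}

lemma deg2_add (z w : Chain V) (Y : Set V) (a : V) : deg2 (z + w) Y a = deg2 z Y a + deg2 w Y a := by
  simp only [deg2, ← sum_add_distrib]
  exact sum_congr rfl fun u _ => by split_ifs <;> simp

/-- `Y` is a union of components after deleting `p` and `q`, and not everything. -/
structure Sep (H : SimpleGraph V) (D Y : Set V) (p q : V) : Prop where
  sub : Y ⊆ D
  ne : Y.Nonempty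
  left : p ∉ Y
  right : q ∉ Y
  closed : ∀ y ∈ Y, ∀ w, H.Adj y w → w ∈ Y ∨ w = p ∨ w = q
  rest : ∃ r ∈ D, r ∉ Y ∧ r ≠ p ∧ r ≠ q

lemma Sep.swap {Y : Set V} {p q : V} (h : Sep H D Y p q) : Sep H D Y q p :=
  ⟨h.sub, h.ne, h.right, h.left, fun y hy w hw => (h.closed y hy w hw).imp_right Or.symm, by
    obtain ⟨r, h1, h2, h3, h4⟩ := h.rest
    exact ⟨r, h1, h2, h4, h3⟩⟩

lemma Sep.comp {Y : Set V} {p q y : V} (h : Sep H D Y p q) (hy : y ∈ Y) :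
    Sep H D (comp H Y y) p q := by
  have hs := comp_subset (G := H) Y y
  refine ⟨hs.trans h.sub, ⟨y, mem_comp_self hy⟩, fun h' => h.left (hs h'),
    fun h' => h.right (hs h'), fun a ha w haw => ?_, ?_⟩
  · rcases h.closed a (hs ha) w haw with h' | h'
    exacts [.inl (mem_comp_of_adj ha h' haw), .inr h']
  · obtain ⟨r, h1, h2, h3⟩ := h.rest
    exact ⟨r, h1, fun h' => h2 (hs h'), h3⟩

/-- A cycle through two disjoint connected sets. -/
lemma exists_theta_cycle {K K' Y : Set V} {a b : V} (hK : IsConn H K) (hK' : IsConn H K')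
    (haK : a ∉ K) (hbK : b ∉ K) (haK' : a ∉ K') (hbK' : b ∉ K') (hab : a ≠ b)
    (t₁ : Touch H {a} K) (t₂ : Touch H {b} K) (t₁' : Touch H {a} K') (t₂' : Touch H {b} K')
    (hY : K ⊆ Y) (hY' : Disjoint K' Y) :
    ∃ w ∈ cycles H, deg2 w Y a = 1 ∧
      ∀ u v, w s(u, v) ≠ 0 → u ∈ K ∨ u ∈ K' ∨ u = a ∨ u = b := by
  obtain ⟨p, hp, hpb, y, hy, hpy⟩ := exists_chain_through hK haK hbK hab t₁ t₂
  obtain ⟨p', hp', hpb', y', hy', hpy'⟩ := exists_chain_through hK' haK' hbK' hab t₁' t₂'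
  have hor : ∀ u v, (p + p') s(u, v) ≠ 0 → p s(u, v) ≠ 0 ∨ p' s(u, v) ≠ 0 := by
    intro u v h
    by_contra! hc
    exact h (by simp [hc])
  refine ⟨p + p', ⟨fun u v h => ?_, fun v => ?_⟩, ?_, fun u v h => ?_⟩
  · rcases hor u v h with h | h
    exacts [(hp u v h).1, (hp' u v h).1]
  · rw [bd_add, hpb, hpb']
    exact zmod_two_add_self _
  · rw [deg2_add]
    have h1 : deg2 p Y a = 1 := by
      simp only [deg2, hpy]
      rw [sum_eq_single y (fun u _ hu => by simp [hu]) (by simp)]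
      simp [hY hy]
    have h2 : deg2 p' Y a = 0 := by
      simp only [deg2, hpy']
      refine sum_eq_zero fun u _ => ?_
      by_cases hu : u = y'
      · rw [hu, if_neg (Set.disjoint_left.1 hY' hy')]
      · simp [hu]
    rw [h1, h2, add_zero]
  · rcases hor u v h with h | h
    · rcases (hp u v h).2.1 with h | h
      exacts [.inl h, .inr (.inr h)]
    · exact .inr (hp' u v h).2.1

/-- A cycle through an edge and a connected set. -/
lemma exists_edge_cycle {K : Set V} {a b : V} (hK : IsConn H K)
    (haK : a ∉ K) (hbK : b ∉ K) (hab : H.Adj a b)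
    (t₁ : Touch H {a} K) (t₂ : Touch H {b} K) :
    ∃ w ∈ cycles H, (∀ Y, K ⊆ Y → b ∉ Y → deg2 w Y a = 1) ∧ w s(a, b) = 1 ∧
      ∀ u v, w s(u, v) ≠ 0 → u ∈ K ∨ u = a ∨ u = b := by
  obtain ⟨p, hp, hpb, y, hy, hpy⟩ := exists_chain_through hK haK hbK hab.ne t₁ t₂
  have hyb : b ≠ y := fun h => hbK (h ▸ hy)
  have hw : ∀ u, (p + single a b) s(a, u) = (if u = y then 1 else 0) + if u = b then 1 else 0 := by
    intro u
    simp only [Pi.add_apply, hpy, single_apply]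
    simp [hab.ne]
  have hor : ∀ u v, (p + single a b) s(u, v) ≠ 0 →
      p s(u, v) ≠ 0 ∨ ((u = a ∧ v = b) ∨ (u = b ∧ v = a)) := by
    intro u v h
    by_contra! hc
    refine h ?_
    simp only [Pi.add_apply, hc.1, single_apply, zero_add]
    grind
  refine ⟨p + single a b, ⟨fun u v h => ?_, fun v => ?_⟩, fun Y hY hbY => ?_, ?_, fun u v h => ?_⟩
  · rcases hor u v h with h | ⟨rfl, rfl⟩ | ⟨rfl, rfl⟩
    exacts [(hp u v h).1, hab, hab.symm]
  · rw [bd_add, hpb, bd_single hab.ne]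
    exact zmod_two_add_self _
  · simp only [deg2, hw]
    rw [sum_eq_single y (fun u _ hu => ?_) (by simp)]
    · simp [hY hy, hyb.symm]
    · split_ifs <;> simp_all
  · simp [hw, hyb]
  · rcases hor u v h with h | ⟨rfl, rfl⟩ | ⟨rfl, rfl⟩
    exacts [(hp u v h).2.1, .inr (.inl rfl), .inr (.inr rfl)]

/-- A cycle space element not generated by cycles avoiding a vertex of `A`. -/
structure Core (H : SimpleGraph V) (D A : Set V) (S : Submodule (ZMod 2) (Chain V))
    (z₀ : Chain V) : Prop where
  edge : ∀ u v, H.Adj u v → u ∈ D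
  sub : A ⊆ D
  out : ∀ Y ⊆ D, Y.Nonempty → (∀ y ∈ Y, y ∉ A) → ∀ p q,
    ∃ y ∈ Y, ∃ w, w ∉ Y ∧ w ≠ p ∧ w ≠ q ∧ H.Adj y w
  avoid : ∀ z ∈ cycles H, ∀ a ∈ A, (∀ u, z s(a, u) = 0) → z ∈ S
  mem : z₀ ∈ cycles H
  notMem : z₀ ∉ S

lemma Core.exists_mem (h : Core H D A S z₀) {Y : Set V} {p q : V} (hY : Sep H D Y p q) :
    ∃ a ∈ Y, a ∈ A := by
  by_contra! hc
  obtain ⟨y, hy, w, h1, h2, h3, h4⟩ := h.out Y hY.sub hY.ne hc p q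
  rcases hY.closed y hy w h4 with h | h | h
  exacts [h1 h, h2 h, h3 h]

lemma Core.compl (h : Core H D A S z₀) {Y : Set V} {p q : V} (hY : Sep H D Y p q) :
    Sep H D (D \ (Y ∪ {p, q})) p q := by
  obtain ⟨r, hr, h1, h2, h3⟩ := hY.rest
  obtain ⟨y, hy⟩ := hY.ne
  refine ⟨Set.sdiff_subset, ⟨r, hr, by simp [h1, h2, h3]⟩, by simp, by simp, fun a ha w haw => ?_,
    y, hY.sub hy, by simp [hy], fun e => hY.left (e ▸ hy), fun e => hY.right (e ▸ hy)⟩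
  have ha' := ha.2
  simp only [Set.mem_union, Set.mem_insert_iff, Set.mem_singleton_iff, not_or] at ha'
  by_cases hw : w ∈ Y
  · rcases hY.closed w hw a haw.symm with h | h | h
    exacts [absurd h ha'.1, absurd h ha'.2.1, absurd h ha'.2.2]
  · by_cases h' : w = p ∨ w = q
    · exact .inr h'
    · exact .inl ⟨h.edge w a haw.symm, by simpa [hw] using h'⟩

lemma Core.split (h : Core H D A S z₀) {Y : Set V} {p q : V} (hY : Sep H D Y p q) {z : Chain V}
    (hz : z ∈ cycles H) (hp : deg2 z Y p = 0) (hq : deg2 z Y q = 0) : z ∈ S := by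
  obtain ⟨a, ha, haA⟩ := h.exists_mem hY
  obtain ⟨b, hb, hbA⟩ := h.exists_mem (h.compl hY)
  have hb' := hb.2
  simp only [Set.mem_union, Set.mem_insert_iff, Set.mem_singleton_iff, not_or] at hb'
  have hm : meet z Y ∈ cycles H := by
    refine ⟨fun u v huv => hz.1 u v fun h0 => huv (by simp [meet_apply, h0]), fun v => ?_⟩
    by_cases hv : v ∈ Y
    · exact bd_meet_of_mem hz hv
    · rw [bd_meet_of_notMem z hv]
      by_cases hvp : v = p
      · rw [hvp, hp]
      by_cases hvq : v = q
      · rw [hvq, hq]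
      exact deg2_eq_zero hz fun y hy hyv => by
        rcases hY.closed y hy v hyv with h | h | h
        exacts [hv h, hvp h, hvq h]
  have h1 : meet z Y ∈ S := by
    refine h.avoid _ hm b hbA fun u => ?_
    rw [meet_apply]
    split_ifs with hu
    · by_contra h0
      rcases hu with hu | hu
      · exact hb'.1 hu
      · rcases hY.closed u hu b (hz.1 _ _ h0).symm with h | h | h
        exacts [hb'.1 h, hb'.2.1 h, hb'.2.2 h]
    · rfl
  have h2 : z + meet z Y ∈ S := by
    refine h.avoid _ (Submodule.add_mem _ hz hm) a haA fun u => ?_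
    rw [Pi.add_apply, meet_apply, if_pos (.inl ha), zmod_two_add_self]
  have h3 : z = (z + meet z Y) + meet z Y := by rw [add_assoc, chain_add_self, add_zero]
  rw [h3]
  exact S.add_mem h2 h1

/-- There is no cut vertex. -/
lemma Core.not_sep_single (h : Core H D A S z₀) {Y : Set V} {p q : V} (hY : Sep H D Y p q)
    (hcl : ∀ y ∈ Y, ¬ H.Adj y q) : False := by
  have hq : ∀ z ∈ cycles H, deg2 z Y q = 0 := fun z hz => deg2_eq_zero hz hcl
  refine h.notMem (h.split hY h.mem (deg2_eq_zero_of_single h.mem hY.left fun y hy w hyw => ?_)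
    (hq _ h.mem))
  rcases hY.closed y hy w hyw with h | h | rfl
  exacts [.inl h, .inr h, absurd hyw (hcl y hy)]

lemma Core.touch_right (h : Core H D A S z₀) {Y : Set V} {p q : V} (hY : Sep H D Y p q) :
    Touch H {q} Y := by
  by_contra hc
  exact h.not_sep_single hY fun y hy hyq => hc (touch_of_adj hyq.symm rfl hy)

lemma Core.touch_left (h : Core H D A S z₀) {Y : Set V} {p q : V} (hY : Sep H D Y p q) :
    Touch H {p} Y := h.touch_right hY.swap

lemma Core.deg2_eq_zero (h : Core H D A S z₀) {Y : Set V} {p q : V} (hpq : p ≠ q)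
    (hY : Sep H D Y p q) {w : Chain V} (hw : w ∈ cycles H) (hS : w ∈ S) : deg2 w Y p = 0 := by
  have key : ∀ z ∈ cycles H, z ∉ S → deg2 z Y p = 1 := by
    intro z hz hzS
    refine zmod_two_ne_zero.1 fun h0 => hzS (h.split hY hz h0 ?_)
    rw [← deg2_eq_deg2 hz hY.left hY.right hpq hY.closed, h0]
  have h1 := key z₀ h.mem h.notMem
  have h2 := key (z₀ + w) (Submodule.add_mem _ h.mem hw) fun h' =>
    h.notMem ((S.add_mem_iff_left hS).1 h')
  rw [deg2_add, h1] at h2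
  simpa using h2

/-- Two vertices of `A` that do not separate. -/
lemma Core.mem_of_conn (h : Core H D A S z₀) {a b : V} (ha : a ∈ A) (hb : b ∈ A) (hab : a ≠ b)
    (hD : ∀ x ∈ D \ {a, b}, ∀ y ∈ D \ {a, b}, Reach H (D \ {a, b}) x y) {z : Chain V}
    (hz : z ∈ cycles H) (h0 : z s(a, b) = 0) : z ∈ S := by
  have hDv : ∀ u v, z s(u, v) ≠ 0 → v ∈ D := fun u v huv => h.edge v u (hz.1 u v huv).symm
  have hla : z s(a, a) = 0 := cycles_loop hz a
  obtain ⟨c, hc, hcb⟩ := exists_chain_of_sum_eq_zero hD (f := fun v => z s(a, v))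
    (fun v hv => ⟨hDv a v hv, by
      rintro (rfl | rfl)
      exacts [hv hla, hv h0]⟩) (hz.2 a)
  set t : Chain V := meet z {a} with ht
  have hta : ∀ v, t s(a, v) = z s(a, v) := fun v => by rw [ht, meet_apply, if_pos (.inl rfl)]
  have htv : ∀ u v, u ≠ a → t s(u, v) = if v = a then z s(a, u) else 0 := by
    intro u v hu
    rw [ht, meet_apply]
    by_cases hv : v = a
    · rw [if_pos (.inr hv), if_pos hv, hv, Sym2.eq_swap]
    · rw [if_neg (by simp [hu, hv]), if_neg hv]
  have hca : ∀ v, c s(a, v) = 0 := by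
    intro v
    by_contra h'
    exact (hc a v h').2.1.2 (.inl rfl)
  have hcb' : ∀ v, c s(b, v) = 0 := by
    intro v
    by_contra h'
    exact (hc b v h').2.1.2 (.inr rfl)
  have hm : t + c ∈ cycles H := by
    refine ⟨fun u v huv => ?_, fun v => ?_⟩
    · by_cases h1 : c s(u, v) = 0
      · refine hz.1 u v fun h2 => huv ?_
        simp [h1, ht, meet_apply, h2]
      · exact (hc u v h1).1
    · rw [bd_add, hcb]
      by_cases hv : v = a
      · subst hv
        rw [ht, bd_meet_of_mem hz (Set.mem_singleton v), hla, add_zero]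
      · have : bd t v = z s(a, v) := by
          simp only [bd, htv v _ hv]
          simp
        rw [this, zmod_two_add_self]
  have h1 : t + c ∈ S := by
    refine h.avoid _ hm b hb fun v => ?_
    rw [Pi.add_apply, hcb', htv b v hab.symm, h0, ite_self, add_zero]
  have h2 : z + (t + c) ∈ S := by
    refine h.avoid _ (Submodule.add_mem _ hz hm) a ha fun v => ?_
    rw [Pi.add_apply, Pi.add_apply, hta, hca, add_zero, zmod_two_add_self]
  have h3 : z = (z + (t + c)) + (t + c) := by rw [add_assoc, chain_add_self, add_zero]
  rw [h3]
  exact S.add_mem h2 h1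

lemma Core.sep_comp (h : Core H D A S z₀) {a b x y : V} (hx : x ∈ D \ {a, b}) (hy : y ∈ D \ {a, b})
    (hxy : ¬ Reach H (D \ {a, b}) x y) : Sep H D (LocalGirth.comp H (D \ {a, b}) x) a b := by
  have hs := comp_subset (G := H) (D \ {a, b}) x
  have hy2 := hy.2
  simp only [Set.mem_insert_iff, Set.mem_singleton_iff, not_or] at hy2
  refine ⟨fun w hw => (hs hw).1, ⟨x, mem_comp_self hx⟩, fun h' => (hs h').2 (.inl rfl),
    fun h' => (hs h').2 (.inr rfl), fun u hu w huw => ?_, y, hy.1, fun h' => hxy h'.2, hy2⟩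
  by_cases h' : w = a ∨ w = b
  · exact .inr h'
  · exact .inl (mem_comp_of_adj hu ⟨h.edge w u huw.symm, h'⟩ huw)

/-- Adjacent vertices of `A` do not separate. -/
lemma Core.not_sep_of_adj (h : Core H D A S z₀) {a b : V} (hab : H.Adj a b) {Y : Set V} :
    ¬ Sep H D Y a b := by
  intro hY
  obtain ⟨y, hy⟩ := hY.ne
  have hK := hY.comp hy
  have hs := comp_subset (G := H) Y y
  obtain ⟨w, hw, hw1, -, hw2⟩ := exists_edge_cycle (isConn_comp hy) hK.left hK.right hab
    (h.touch_left hK) (h.touch_right hK)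
  obtain ⟨c, hc, hcA⟩ := h.exists_mem (h.compl hY)
  have hc2 := hc.2
  simp only [Set.mem_union, Set.mem_insert_iff, Set.mem_singleton_iff, not_or] at hc2
  have hwS : w ∈ S := by
    refine h.avoid w hw c hcA fun u => ?_
    by_contra h0
    rcases hw2 c u h0 with h | h | h
    exacts [hc2.1 (hs h), hc2.2.1 h, hc2.2.2 h]
  have h1 := h.deg2_eq_zero hab.ne hY hw hwS
  rw [hw1 Y hs hY.right] at h1
  exact one_ne_zero h1

lemma Core.edge_eq_zero (h : Core H D A S z₀) {a b : V} (ha : a ∈ A) (hb : b ∈ A)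
    (hab : H.Adj a b) {w : Chain V} (hw : w ∈ cycles H) (hS : w ∈ S) : w s(a, b) = 0 := by
  have hD : ∀ x ∈ D \ {a, b}, ∀ y ∈ D \ {a, b}, Reach H (D \ {a, b}) x y := by
    intro x hx y hy
    by_contra hxy
    exact h.not_sep_of_adj hab (h.sep_comp hx hy hxy)
  have key : ∀ z ∈ cycles H, z ∉ S → z s(a, b) = 1 := fun z hz hzS =>
    zmod_two_ne_zero.1 fun h0 => hzS (h.mem_of_conn ha hb hab.ne hD hz h0)
  have h1 := key z₀ h.mem h.notMem
  have h2 := key (z₀ + w) (Submodule.add_mem _ h.mem hw) fun h' =>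
    h.notMem ((S.add_mem_iff_left hS).1 h')
  rw [Pi.add_apply, h1] at h2
  simpa using h2

lemma Core.exists_not_reach (h : Core H D A S z₀) {a b : V} (ha : a ∈ A) (hb : b ∈ A)
    (hab : a ≠ b) (hn : ¬ H.Adj a b) :
    ∃ x ∈ D \ {a, b}, ∃ y ∈ D \ {a, b}, ¬ Reach H (D \ {a, b}) x y := by
  by_contra! hc
  refine h.notMem (h.mem_of_conn ha hb hab hc h.mem ?_)
  by_contra h0
  exact hn (h.mem.1 _ _ h0)

lemma Core.sep_of_not_adj (h : Core H D A S z₀) {a b : V} (ha : a ∈ A) (hb : b ∈ A)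
    (hab : a ≠ b) (hn : ¬ H.Adj a b) {v : V} (hv : v ∈ D \ {a, b}) :
    Sep H D (LocalGirth.comp H (D \ {a, b}) v) a b := by
  obtain ⟨x, hx, y, hy, hxy⟩ := h.exists_not_reach ha hb hab hn
  by_cases h1 : Reach H (D \ {a, b}) v x
  · exact h.sep_comp hv hy fun h2 => hxy (h1.symm.trans h2)
  · exact h.sep_comp hv hx h1

end

end LocalGirth

namespace LocalGirth

set_option linter.unusedSectionVars false

open Finset

section

open scoped Classical

universe u

variable {V : Type u} [Fintype V] {G H : SimpleGraph V} {D A : Set V}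
  {S : Submodule (ZMod 2) (Chain V)} {z₀ : Chain V}

lemma Core.degree_two_of_sep (h : Core H D A S z₀) {a b : V} {K : Set V} (ha : a ∈ A) (hb : b ∈ A)
    (hab : a ≠ b) (hK : IsConn H K) (hs : Sep H D K a b) :
    ∀ v ∈ K, v ∈ A ∧ ∃ x y, x ≠ y ∧ ∀ u, H.Adj v u ↔ u = x ∨ u = y := by
  induction hn : K.ncard using Nat.strong_induction_on generalizing a b K with
  | _ n ih =>
  have aux : ∀ c ∈ K, c ∈ A → ∀ v ∈ K, v ≠ c →
      v ∈ A ∧ ∃ x y, x ≠ y ∧ ∀ u, H.Adj v u ↔ u = x ∨ u = y := by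
    intro c hc hcA v hv hvc
    have hca : c ≠ a := fun e => hs.left (e ▸ hc)
    have hcb : c ≠ b := fun e => hs.right (e ▸ hc)
    have hvK : v ∈ K \ {c} := ⟨hv, hvc⟩
    set Y := comp H (K \ {c}) v with hY
    have hYK : Y ⊆ K \ {c} := comp_subset _ _
    have hYc : IsConn H Y := isConn_comp hvK
    have hcl : ∀ y ∈ Y, ∀ w, H.Adj y w → w ∈ Y ∨ w = c ∨ w = a ∨ w = b := by
      intro y hy w hyw
      by_cases hwc : w = c
      · exact .inr (.inl hwc)
      rcases hs.closed y (hYK hy).1 w hyw with h | h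
      · exact .inl (mem_comp_of_adj hy ⟨h, hwc⟩ hyw)
      · exact .inr (.inr h)
    have main : ∀ a b, a ∈ A → b ∈ A → a ∉ K → b ∉ K → a ≠ b → c ≠ a → c ≠ b →
        (∀ y ∈ Y, ∀ w, H.Adj y w → w ∈ Y ∨ w = c ∨ w = a ∨ w = b) → ¬ Touch H {b} Y →
        v ∈ A ∧ ∃ x y, x ≠ y ∧ ∀ u, H.Adj v u ↔ u = x ∨ u = y := by
      intro a b ha hb haK hbK hab hca hcb hcl ht
      have hsep : Sep H D Y a c := by
        refine ⟨fun y hy => hs.sub (hYK hy).1, hYc.1, fun h' => haK (hYK h').1,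
          fun h' => (hYK h').2 rfl, fun y hy w hyw => ?_, b, h.sub hb, fun h' => hbK (hYK h').1,
          hab.symm, hcb.symm⟩
        rcases hcl y hy w hyw with h | h | h | rfl
        · exact .inl h
        · exact .inr (.inr h)
        · exact .inr (.inl h)
        · exact (ht (touch_of_adj hyw.symm rfl hy)).elim
      refine ih Y.ncard ?_ ha hcA hca.symm hYc hsep rfl v (mem_comp_self hvK)
      rw [← hn]
      exact Set.ncard_lt_ncard ⟨fun y hy => (hYK hy).1, fun h' => (hYK (h' hc)).2 rfl⟩
        (Set.toFinite _)
    by_cases htb : Touch H {b} Y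
    · by_cases hta : Touch H {a} Y
      · exfalso
        have hs' := h.compl hs
        obtain ⟨x, hx⟩ := hs'.ne
        have hs'' := hs'.comp hx
        set K' := LocalGirth.comp H (D \ (K ∪ {a, b})) x with hK'
        have hK's : K' ⊆ D \ (K ∪ {a, b}) := comp_subset _ _
        have hdis : Disjoint K' K := Set.disjoint_left.2 fun w hw hw' => (hK's hw).2 (.inl hw')
        obtain ⟨w, hw, hw1, hw2⟩ := exists_theta_cycle (Y := K) hYc (isConn_comp hx)
          (fun h' => hs.left (hYK h').1) (fun h' => hs.right (hYK h').1) hs''.left hs''.right hab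
          hta htb (h.touch_left hs'') (h.touch_right hs'') (fun y hy => (hYK hy).1) hdis
        have hwS : w ∈ S := by
          refine h.avoid w hw c hcA fun u => ?_
          by_contra h0
          rcases hw2 c u h0 with h | h | h | h
          exacts [(hYK h).2 rfl, (hK's h).2 (.inl hc), hca h, hcb h]
        rw [h.deg2_eq_zero hab hs hw hwS] at hw1
        exact zero_ne_one hw1
      · exact main b a hb ha hs.right hs.left hab.symm hcb hca
          (fun y hy w hyw => (hcl y hy w hyw).imp_right (Or.imp_right Or.symm)) hta
    · exact main a b ha hb hs.left hs.right hab hca hcb hcl htb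
  obtain ⟨c, hc, hcA⟩ := h.exists_mem hs
  intro v hv
  by_cases hvc : v = c
  · by_cases hex : ∃ u ∈ K, u ≠ c
    · obtain ⟨u, hu, huc⟩ := hex
      exact aux u hu (aux c hc hcA u hu huc).1 v hv (hvc ▸ huc.symm)
    · push Not at hex
      refine ⟨hvc ▸ hcA, a, b, hab, fun u => ⟨fun hvu => ?_, ?_⟩⟩
      · rcases hs.closed v hv u hvu with h' | h'
        · exact absurd ((hex u h').trans hvc.symm) hvu.ne'
        · exact h'
      · obtain ⟨x, hx, hax⟩ := touch_singleton_left.1 (h.touch_left hs)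
        obtain ⟨y, hy, hby⟩ := touch_singleton_left.1 (h.touch_right hs)
        rw [hex x hx, ← hvc] at hax
        rw [hex y hy, ← hvc] at hby
        rintro (rfl | rfl)
        exacts [hax.symm, hby.symm]
  · exact aux c hc hcA v hv hvc

lemma Core.cycSet (h : Core H D A S z₀) : CycSet H D := by
  have hz : ∃ u v, z₀ s(u, v) ≠ 0 := by
    by_contra! hc
    refine h.notMem ?_
    have : z₀ = 0 := funext fun e => by
      induction e with
      | _ u v => exact hc u v
    rw [this]
    exact S.zero_mem
  obtain ⟨u, v, huv⟩ := hz
  have huv' := h.mem.1 u v huv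
  have hu : u ∈ D := h.edge u v huv'
  have hv : v ∈ D := h.edge v u huv'.symm
  have hconn : (∀ x ∈ D, ∃ w, H.Adj x w) → IsConn H D := by
    intro hdeg
    refine .of_root hu fun w hw => ?_
    by_contra hc
    set Y := LocalGirth.comp H D u with hY
    have hYD : Y ⊆ D := comp_subset _ _
    have hwY : w ∉ Y := fun h' => hc h'.2
    obtain ⟨x, hwx⟩ := hdeg w hw
    have hx : x ∈ D := h.edge x w hwx.symm
    have hxY : x ∉ Y := fun h' => hwY (mem_comp_of_adj h' hw hwx.symm)
    refine h.not_sep_single (Y := Y) (p := w) (q := w) ⟨hYD, ⟨u, mem_comp_self hu⟩, hwY, hwY,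
      fun y hy z hyz => .inl (mem_comp_of_adj hy (h.edge z y hyz.symm) hyz), x, hx, hxY,
      hwx.ne', hwx.ne'⟩ fun y hy hyw => hwY (mem_comp_of_adj hy hw hyw)
  have hfin : (∀ x ∈ D, ∃ a b, a ≠ b ∧ ∀ u, H.Adj x u ↔ u = a ∨ u = b) → CycSet H D := by
    intro hd
    refine ⟨hconn fun x hx => ?_, fun x hx => ?_⟩
    · obtain ⟨a, b, -, h'⟩ := hd x hx
      exact ⟨a, (h' a).2 (.inl rfl)⟩
    · obtain ⟨a, b, hab, h'⟩ := hd x hx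
      exact ⟨a, b, hab, fun u => ⟨fun hu => (h' u).1 hu.2, fun hu =>
        ⟨h.edge u x ((h' u).2 hu).symm, (h' u).2 hu⟩⟩⟩
  by_cases hcl : ∃ a ∈ A, ∃ b ∈ A, a ≠ b ∧ ¬ H.Adj a b
  · obtain ⟨a, ha, b, hb, hab, hn⟩ := hcl
    have key : ∀ a ∈ A, ∀ b ∈ A, a ≠ b → ¬ H.Adj a b → ∀ x ∈ D \ {a, b},
        x ∈ A ∧ ∃ a b, a ≠ b ∧ ∀ u, H.Adj x u ↔ u = a ∨ u = b := fun a ha b hb hab hn x hx =>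
      h.degree_two_of_sep ha hb hab (isConn_comp hx) (h.sep_of_not_adj ha hb hab hn hx) x
        (mem_comp_self hx)
    have h1 := key a ha b hb hab hn
    obtain ⟨x, hx, y, hy, hxy⟩ := h.exists_not_reach ha hb hab hn
    have hxy' : ¬ H.Adj x y := fun h' => hxy (.of_adj h' hx hy)
    have hxy'' : x ≠ y := by
      rintro rfl
      exact hxy (.refl _ _)
    have h2 := key x (h1 x hx).1 y (h1 y hy).1 hxy'' hxy'
    refine hfin fun w hw => ?_
    by_cases hwab : w ∈ D \ {a, b}
    · exact (h1 w hwab).2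
    · refine (h2 w ⟨hw, ?_⟩).2
      rintro (rfl | rfl)
      exacts [hwab hx, hwab hy]
  · push Not at hcl
    have hDA : ∀ x ∈ D, x ∈ A := by
      by_contra! hc
      obtain ⟨x, hx, hxA⟩ := hc
      have hxD : x ∈ D \ A := ⟨hx, hxA⟩
      set Y := LocalGirth.comp H (D \ A) x with hY
      have hYD : Y ⊆ D \ A := comp_subset _ _
      have hout : ∀ p q, ∃ w ∈ A, w ≠ p ∧ w ≠ q ∧ Touch H {w} Y := by
        intro p q
        obtain ⟨y, hy, w, h1, h2, h3, h4⟩ := h.out Y (fun y hy => (hYD hy).1)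
          ⟨x, mem_comp_self hxD⟩ (fun y hy => (hYD hy).2) p q
        refine ⟨w, ?_, h2, h3, touch_of_adj h4.symm rfl hy⟩
        by_contra hw
        exact h1 (mem_comp_of_adj hy ⟨h.edge w y h4.symm, hw⟩ h4)
      obtain ⟨a, ha, -, -, ta⟩ := hout x x
      obtain ⟨b, hb, hba, -, tb⟩ := hout a a
      obtain ⟨c, hc, hca, hcb, -⟩ := hout a b
      have hab := hcl a ha b hb hba.symm
      obtain ⟨w, hw, -, hw1, hw2⟩ := exists_edge_cycle (isConn_comp hxD)
        (fun h' => (hYD h').2 ha) (fun h' => (hYD h').2 hb) hab ta tb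
      have hwS : w ∈ S := by
        refine h.avoid w hw c hc fun u => ?_
        by_contra h0
        rcases hw2 c u h0 with h | h | h
        exacts [(hYD h).2 hc, hca h, hcb h]
      rw [h.edge_eq_zero ha hb hab hw hwS] at hw1
      exact zero_ne_one hw1
    have hall : ∀ x ∈ D, ∀ y ∈ D, x ≠ y → H.Adj x y := fun x hx y hy =>
      hcl x (hDA x hx) y (hDA y hy)
    obtain ⟨w, hw, hwv⟩ : ∃ w, z₀ s(u, w) ≠ 0 ∧ w ≠ v := by
      by_contra! hc
      have hb := h.mem.2 u
      rw [bd, sum_eq_single v (fun w _ hwv => by_contra fun h' => hwv (hc w h')) (by simp)] at hb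
      exact huv hb
    have huw := h.mem.1 u w hw
    have hwD : w ∈ D := h.edge w u huw.symm
    have hD3 : ∀ x ∈ D, x = u ∨ x = v ∨ x = w := by
      by_contra! hc
      obtain ⟨x, hx, hxu, hxv, hxw⟩ := hc
      obtain ⟨t, ht, -, ht1, ht2⟩ := exists_edge_cycle (H := H) (isConn_singleton w) (a := u)
        (b := v) huw.ne hwv.symm huv' (touch_of_adj huw rfl rfl)
        (touch_of_adj (hall v hv w hwD hwv.symm) rfl rfl)
      have htS : t ∈ S := by
        refine h.avoid t ht x (hDA x hx) fun s => ?_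
        by_contra h0
        rcases ht2 x s h0 with h | h | h
        exacts [hxw h, hxu h, hxv h]
      rw [h.edge_eq_zero (hDA u hu) (hDA v hv) huv' ht htS] at ht1
      exact zero_ne_one ht1
    have hmem : ∀ x y, H.Adj x y → y ∈ D := fun x y hxy => h.edge y x hxy.symm
    have e1 := huv'.ne
    have e2 := huw.ne
    refine hfin fun x hx => ?_
    rcases hD3 x hx with rfl | rfl | rfl
    · exact ⟨v, w, hwv.symm, fun y => ⟨fun hy => by
        rcases hD3 y (hmem _ _ hy) with rfl | h
        exacts [absurd rfl hy.ne, h], by rintro (rfl | rfl) <;> assumption⟩⟩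
    · refine ⟨u, w, e2, fun y => ⟨fun hy => ?_, ?_⟩⟩
      · rcases hD3 y (hmem _ _ hy) with h | rfl | h
        exacts [.inl h, absurd rfl hy.ne, .inr h]
      · rintro (rfl | rfl)
        exacts [huv'.symm, hall _ hv _ hwD hwv.symm]
    · refine ⟨u, v, e1, fun y => ⟨fun hy => ?_, ?_⟩⟩
      · rcases hD3 y (hmem _ _ hy) with h | h | rfl
        exacts [.inl h, .inr h, absurd rfl hy.ne]
      · rintro (rfl | rfl)
        exacts [huw.symm, hall _ hwD _ hv hwv]

end

end LocalGirth

namespace LocalGirth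

set_option linter.unusedSectionVars false

open Finset

section

open scoped Classical

universe u

variable {V : Type u} [Fintype V] {G H : SimpleGraph V} {U : Set V}

lemma CycSet.eq_zero_or_chi {C : Set V} (hC : CycSet G C) {z : Chain V}
    (hz : z ∈ cycles (within G C)) : z = 0 ∨ z = chi G C := by
  by_cases h0 : ∃ u v, z s(u, v) ≠ 0
  · right
    obtain ⟨u, v, huv⟩ := h0
    have hadj := hz.1 u v huv
    have key : ∀ a b, z s(a, b) ≠ 0 → ∀ c ∈ C, G.Adj a c → z s(a, c) = 1 := by
      intro a b hab c hc hac
      have hab' := hz.1 a b hab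
      obtain ⟨d, hbd, hd⟩ := hC.exists_other hab'.2.1 hab'.2.2 hab'.1
      rcases (hd c).1 ⟨hc, hac⟩ with rfl | rfl
      · exact zmod_two_ne_zero.1 hab
      · have hb := hz.2 a
        rw [bd, ← sum_subset (subset_univ {b, c}) (fun x _ hx => by
          by_contra h0
          have h1 := hz.1 a x h0
          have h2 := (hd x).1 ⟨h1.2.2, h1.1⟩
          simp only [mem_insert, mem_singleton, not_or] at hx
          exact h2.elim hx.1 hx.2), sum_pair hbd, zmod_two_ne_zero.1 hab] at hb
        have := CharTwo.add_eq_zero.1 hb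
        exact this.symm
    have hall : ∀ w ∈ C, ∃ x, z s(w, x) ≠ 0 := by
      intro w hw
      refine (hC.1.2 u hadj.2.1 w hw).closed (A := {w | ∃ x, z s(w, x) ≠ 0}) ⟨v, huv⟩ ?_
      rintro a ⟨b, hab⟩ c hc hac
      refine ⟨a, ?_⟩
      rw [Sym2.eq_swap, key a b hab c hc hac]
      exact one_ne_zero
    funext e
    induction e with
    | _ a b =>
    rw [chi_apply]
    by_cases h : G.Adj a b ∧ a ∈ C ∧ b ∈ C
    · rw [if_pos h]
      obtain ⟨x, hx⟩ := hall a h.2.1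
      exact key a x hx b h.2.2 h.1
    · rw [if_neg h]
      by_contra h0
      exact h (hz.1 a b h0)
  · left
    push Not at h0
    funext e
    induction e with
    | _ a b => exact h0 a b

/-- Peripheral cycles generate the cycle space. -/
lemma cycles_le_span (hU : NoSep G U) (B : Set V) (hBU : B ⊆ U) (hB : B = ∅ ∨ IsConn G B) :
    cycles (within G (U \ B)) ≤
      Submodule.span (ZMod 2) {z | ∃ C, Periph G U C ∧ z = chi G C} := by
  induction hn : (U \ B).ncard using Nat.strong_induction_on generalizing B with
  | _ n ih =>
  intro z₀ hz₀
  by_contra hS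
  set S := Submodule.span (ZMod 2) {z | ∃ C, Periph G U C ∧ z = chi G C} with hSdef
  set A : Set V := {a | a ∈ U \ B ∧ (B = ∅ ∨ ∃ b ∈ B, G.Adj b a)} with hA
  have hcore : Core (within G (U \ B)) (U \ B) A S z₀ := by
    refine ⟨fun u v h => h.2.1, fun a ha => ha.1, fun Y hY hYne hYA p q => ?_,
      fun z hz a ha hza => ?_, hz₀, hS⟩
    · have hYA' : ∀ y ∈ Y, B ≠ ∅ ∧ ∀ b ∈ B, ¬ G.Adj b y := by
        intro y hy
        have := hYA y hy
        simp only [hA, Set.mem_ofPred_eq, not_and, not_or] at this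
        have := this (hY hy)
        exact ⟨this.1, fun b hb hby => this.2 ⟨b, hb, hby⟩⟩
      obtain ⟨y₀, hy₀⟩ := hYne
      have hYU : Y ⊆ U := fun y hy => (hY hy).1
      obtain ⟨b, hb⟩ := Set.nonempty_iff_ne_empty.2 (hYA' y₀ hy₀).1
      have hbY : b ∉ Y := fun h => (hY h).2 hb
      have key : ∀ p q, b ≠ p → b ≠ q →
          ∃ y ∈ Y, ∃ w, w ∉ Y ∧ w ≠ p ∧ w ≠ q ∧ (within G (U \ B)).Adj y w := by
        intro p q hbp hbq
        rcases hU Y hYU ⟨y₀, hy₀⟩ p q with ⟨y, hy, w, hw, h1, h2, h3, h4⟩ | h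
        · exact ⟨y, hy, w, h1, h2, h3, h4, hY hy, hw, fun h => (hYA' y hy).2 w h h4.symm⟩
        · rcases h (hBU hb) with h | h | h
          exacts [absurd h hbY, absurd h hbp, absurd h hbq]
      have key2 : ∀ q, b ≠ q →
          ∃ y ∈ Y, ∃ w, w ∉ Y ∧ w ≠ b ∧ w ≠ q ∧ (within G (U \ B)).Adj y w := by
        intro q hbq
        obtain ⟨y, hy, w, h1, h2, -, h4⟩ := key q q hbq hbq
        exact ⟨y, hy, w, h1, fun e => h4.2.2.2 (e ▸ hb), h2, h4⟩
      by_cases hbp : b = p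
      · by_cases hbq : b = q
        · have hby : b ≠ y₀ := fun e => hbY (e ▸ hy₀)
          obtain ⟨y, hy, w, h1, h2, -, h4⟩ := key2 y₀ hby
          exact ⟨y, hy, w, h1, hbp ▸ h2, hbq ▸ h2, h4⟩
        · exact hbp ▸ key2 q hbq
      · by_cases hbq : b = q
        · obtain ⟨y, hy, w, h1, h2, h3, h4⟩ := key2 p hbp
          exact ⟨y, hy, w, h1, h3, hbq ▸ h2, h4⟩
        · exact key p q hbp hbq
    · have hins : insert a B ⊆ U := Set.insert_subset ha.1.1 hBU
      refine ih (U \ insert a B).ncard ?_ (insert a B) hins ?_ rfl ⟨fun u v huv => ?_, hz.2⟩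
      · rw [← hn]
        exact Set.ncard_lt_ncard ⟨Set.sdiff_subset_sdiff_right (Set.subset_insert a B),
          fun h => (h ha.1).2 (Set.mem_insert a B)⟩ (Set.toFinite _)
      · right
        rcases ha.2 with h | ⟨b, hb, hba⟩
        · rw [h, insert_empty_eq]
          exact isConn_singleton a
        · rcases hB with h | h
          · simp [h] at hb
          · exact h.insert ⟨b, hb, hba.symm⟩
      · have h1 := hz.1 u v huv
        refine ⟨h1.1, ⟨h1.2.1.1, ?_⟩, h1.2.2.1, ?_⟩
        · rintro (rfl | h)
          exacts [huv (hza v), h1.2.1.2 h]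
        · rintro (rfl | h)
          exacts [huv (by rw [Sym2.eq_swap]; exact hza u), h1.2.2.2 h]
  have hc := hcore.cycSet
  have hc' : CycSet G (U \ B) := by
    refine ⟨hc.1.mono_graph fun a _ b _ h => h.1, fun v hv => ?_⟩
    obtain ⟨a, b, hab, h⟩ := hc.2 v hv
    exact ⟨a, b, hab, fun u => ⟨fun hu => (h u).1 ⟨hu.1, hu.2, hv, hu.1⟩, fun hu =>
      ⟨((h u).2 hu).1, ((h u).2 hu).2.1⟩⟩⟩
  have hp : Periph G U (U \ B) := by
    refine ⟨Set.sdiff_subset, hc', ?_⟩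
    rw [Set.sdiff_sdiff_cancel_left hBU]
    rcases hB with rfl | h
    · simp
    · exact h.2
  rcases hc'.eq_zero_or_chi hz₀ with h | h
  · exact hS (h ▸ S.zero_mem)
  · exact hS (Submodule.subset_span ⟨_, hp, h⟩)

lemma hasFam_of_noSep (hG : NoMinor G) (hU : NoSep G U) : HasFam (within G U) := by
  set F₀ : Set V → Chain V := fun C => if Periph G U C then chi G C else 0 with hF₀
  have hmem : ∀ C, F₀ C ∈ cycles (within G U) := by
    intro C
    simp only [hF₀]
    split_ifs with h
    · refine cycles_mono (fun a b hab => ?_) h.cyc.chi_mem_within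
      exact ⟨hab.1, h.sub hab.2.1, h.sub hab.2.2⟩
    · exact Submodule.zero_mem _
  have htwo : ∀ e i j k, F₀ i e ≠ 0 → F₀ j e ≠ 0 → F₀ k e ≠ 0 → i = j ∨ j = k ∨ i = k := by
    intro e
    induction e with
    | _ u v =>
    intro i j k hi hj hk
    have h : ∀ C, F₀ C s(u, v) ≠ 0 → Periph G U C ∧ G.Adj u v ∧ u ∈ C ∧ v ∈ C := by
      intro C hC
      simp only [hF₀] at hC
      split_ifs at hC with h
      · exact ⟨h, chi_ne_zero.1 hC⟩
      · simp at hC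
    obtain ⟨pi, ha, ui, vi⟩ := h i hi
    obtain ⟨pj, -, uj, vj⟩ := h j hj
    obtain ⟨pk, -, uk, vk⟩ := h k hk
    exact Periph.two hG hU pi pj pk ha ui uj uk vi vj vk
  have hzero : ∀ e i j, i ≠ j → F₀ i e ≠ 0 → F₀ j e ≠ 0 → (∑ C, F₀ C) e = 0 := by
    intro e i j hij hi hj
    rw [Finset.sum_apply, ← sum_subset (subset_univ {i, j}) (fun k _ hk => by
      by_contra h0
      simp only [mem_insert, mem_singleton, not_or] at hk
      rcases htwo e i j k hi hj h0 with h | h | h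
      exacts [hij h, hk.2 h.symm, hk.1 h.symm]), sum_pair hij, zmod_two_ne_zero.1 hi,
      zmod_two_ne_zero.1 hj]
    rfl
  refine ⟨Option (Set V), inferInstance, fun o => o.elim (∑ C, F₀ C) F₀, ?_, ?_, ?_, ?_⟩
  · rintro (_ | C)
    exacts [Submodule.sum_mem _ fun C _ => hmem C, hmem C]
  · rintro e (_ | i) (_ | j) (_ | k) hi hj hk
    · exact .inl rfl
    · exact .inl rfl
    · exact .inr (.inr rfl)
    · by_cases h : j = k
      · exact .inr (.inl (h ▸ rfl))
      · exact absurd (hzero e j k h hj hk) hi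
    · exact .inr (.inl rfl)
    · by_cases h : i = k
      · exact .inr (.inr (h ▸ rfl))
      · exact absurd (hzero e i k h hi hk) hj
    · by_cases h : i = j
      · exact .inl (h ▸ rfl)
      · exact absurd (hzero e i j h hi hj) hk
    · simpa using htwo e i j k hi hj hk
  · rw [Fintype.sum_option]
    exact chain_add_self _
  · intro z hz
    have h1 := cycles_le_span hU ∅ (Set.empty_subset U) (.inl rfl)
      (by simpa using hz : z ∈ cycles (within G (U \ ∅)))
    rw [← Submodule.mem_span_range_iff_exists_fun]
    refine Submodule.span_mono ?_ h1
    rintro _ ⟨C, hC, rfl⟩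
    exact ⟨some C, by simp [hF₀, hC]⟩

lemma HasFam.sup_of_not_reach {X Z : Set V} {p q : V} (hXZ : X ∩ Z ⊆ {p, q})
    (hp : p ∈ Z) (hq : q ∉ comp G Z p) (h₁ : HasFam (within G X))
    (h₂ : ∀ Y ⊆ Z, HasFam (within G Y)) : HasFam (within G X ⊔ within G Z) := by
  set P := comp G Z p with hP
  have hPZ : P ⊆ Z := comp_subset _ _
  have s₁ : HasFam (within G X ⊔ within G P) := by
    refine h₁.sup (h₂ P hPZ) (X := X) (Y := P) (p := p) (q := p) (fun u v h => h.2.1)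
      (fun u v h => h.2.1) (fun w hw => ?_) (by simp)
    rcases hXZ ⟨hw.1, hPZ hw.2⟩ with h | h
    · exact .inl h
    · exact absurd ((h : w = q) ▸ hw.2) hq
  have s₂ : HasFam ((within G X ⊔ within G P) ⊔ within G (Z \ P)) := by
    refine s₁.sup (h₂ (Z \ P) Set.sdiff_subset) (X := X ∪ P) (Y := Z \ P) (p := q) (q := q)
      (fun u v h => h.imp (fun h => h.2.1) (fun h => h.2.1)) (fun u v h => h.2.1)
      (fun w hw => ?_) (by simp)
    rcases hw.1 with h | h
    · rcases hXZ ⟨h, hw.2.1⟩ with h | h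
      · exact absurd (mem_comp_self hp) ((h : w = p) ▸ hw.2.2)
      · exact .inl h
    · exact absurd h hw.2.2
  refine s₂.mono ?_
  rintro u v (h | h)
  · exact .inl (.inl h)
  · by_cases hu : u ∈ P
    · exact .inl (.inr ⟨h.1, hu, mem_comp_of_adj hu h.2.2 h.1⟩)
    · exact .inr ⟨h.1, ⟨h.2.1, hu⟩, h.2.2, fun hv => hu (mem_comp_of_adj hv h.2.1 h.1.symm)⟩

lemma NoMinor.add_edge (hG : NoMinor G) {X Z : Set V} {p q : V} (hXZ : X ∩ Z ⊆ {p, q})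
    (hp : p ∈ X) (hq : q ∈ X) (hpq : p ≠ q) (h : Reach G Z p q) :
    NoMinor (within G X ⊔ SimpleGraph.edge p q) := by
  rcases h.touch_or_exists (A := {p}) (B := {q}) rfl rfl (by simpa using hpq) with ht | ht
  · refine hG.mono ?_
    rintro u v (h | h)
    · exact h.1
    · have ht' : G.Adj p q := by simpa [Touch] using ht
      rw [SimpleGraph.edge_adj] at h
      rcases h.1 with ⟨rfl, rfl⟩ | ⟨rfl, rfl⟩
      exacts [ht', ht'.symm]
  · obtain ⟨Q, hQ, hQc, t₁, t₂⟩ := ht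
    have hQX : ∀ w ∈ Q, w ∉ X := fun w hw hwX => by
      rcases hXZ ⟨hwX, (hQ hw).1⟩ with h | h
      exacts [(hQ hw).2 (.inl h), (hQ hw).2 (.inr h)]
    have hcon : IsConn G ({p} ∪ Q) := (isConn_singleton p).union hQc t₁
    set R : V → Set V := fun v => if v = p then {p} ∪ Q else if v ∈ X then {v} else ∅ with hR
    have hRp : R p = {p} ∪ Q := if_pos rfl
    have hRv : ∀ v ∈ X, v ≠ p → R v = {v} := fun v hv hvp => by simp [hR, hv, hvp]
    have hmem : ∀ v ∈ X, v ∈ R v := by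
      intro v hv
      by_cases h : v = p
      · rw [h, hRp]
        exact .inl rfl
      · rw [hRv v hv h]
        rfl
    have hsub : ∀ v, v ≠ p → ∀ w ∈ R v, w = v ∧ v ∈ X := by
      intro v hv w hw
      simp only [hR, if_neg hv] at hw
      split_ifs at hw with h
      · exact ⟨hw, h⟩
      · exact absurd hw (Set.notMem_empty w)
    have hdis : ∀ v, v ≠ p → Disjoint (R p) (R v) := by
      intro v hv
      rw [Set.disjoint_right]
      intro w hw
      obtain ⟨rfl, hwX⟩ := hsub v hv w hw
      rw [hRp]
      rintro (h | h)
      exacts [hv h, hQX _ h hwX]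
    refine hG.of_branch R (fun v hv => ?_) (fun u v huv => ?_) ?_
    · by_cases h : v = p
      · rw [h, hRp]
        exact hcon
      · obtain ⟨w, hw⟩ := hv
        rw [hRv v (hsub v h w hw).2 h]
        exact isConn_singleton v
    · by_cases hu : u = p
      · exact hu ▸ hdis v fun e => huv (hu.trans e.symm)
      · by_cases hv : v = p
        · exact hv ▸ (hdis u hu).symm
        · rw [Set.disjoint_left]
          intro w hw hw'
          exact huv ((hsub u hu w hw).1.symm.trans (hsub v hv w hw').1)
    · have ht : Touch G (R p) (R q) := by
        rw [hRp, hRv q hq hpq.symm]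
        exact t₂.left Set.subset_union_right
      rintro u v (h | h)
      · exact touch_of_adj h.1 (hmem u h.2.1) (hmem v h.2.2)
      · rw [SimpleGraph.edge_adj] at h
        rcases h.1 with ⟨rfl, rfl⟩ | ⟨rfl, rfl⟩
        exacts [ht, ht.symm]

/-- Graphs without `K₅` and `K₃,₃` minors have face families. -/
lemma NoMinor.hasFam_within (hG : NoMinor G) (U : Set V) : HasFam (within G U) := by
  induction hn : U.ncard using Nat.strong_induction_on generalizing G U with
  | _ n ih =>
  by_cases hU : NoSep G U
  · exact hasFam_of_noSep hG hU
  simp only [NoSep, not_forall, not_or] at hU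
  obtain ⟨Y, hYU, ⟨y, hy⟩, p, q, hcl, hne⟩ := hU
  push Not at hcl
  obtain ⟨r, hrU, hr⟩ := Set.not_subset.1 hne
  set X := U ∩ (Y ∪ {p, q}) with hX
  set Z := U \ Y with hZ
  have hXn : ∀ W ⊆ X, W.ncard < n := fun W hW => hn ▸ Set.ncard_lt_ncard
    ⟨fun w hw => (hW hw).1, fun h => hr (hW (h hrU)).2⟩ (Set.toFinite _)
  have hZn : ∀ W ⊆ Z, W.ncard < n := fun W hW => hn ▸ Set.ncard_lt_ncard
    ⟨fun w hw => (hW hw).1, fun h => (hW (h (hYU hy))).2 hy⟩ (Set.toFinite _)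
  have hXZ : X ∩ Z ⊆ {p, q} := fun w hw => hw.1.2.resolve_left hw.2.2
  have hle : within G U ≤ within G X ⊔ within G Z := by
    have hYX : ∀ u v, u ∈ Y → v ∈ U → G.Adj u v → (within G X).Adj u v := by
      intro u v hu hv huv
      refine ⟨huv, ⟨hYU hu, .inl hu⟩, hv, ?_⟩
      by_cases hvY : v ∈ Y
      · exact .inl hvY
      · right
        by_cases hvp : v = p
        · exact .inl hvp
        · by_contra hvq
          exact hcl u hu v hv hvY hvp (fun e => hvq (.inr e)) huv
    intro u v huv
    by_cases hu : u ∈ Y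
    · exact .inl (hYX u v hu huv.2.2 huv.1)
    by_cases hv : v ∈ Y
    · exact .inl (hYX v u hv huv.2.1 huv.1.symm).symm
    · exact .inr ⟨huv.1, ⟨huv.2.1, hu⟩, huv.2.2, hv⟩
  have fX : ∀ W ⊆ X, HasFam (within G W) := fun W hW => ih _ (hXn W hW) hG W rfl
  have fZ : ∀ W ⊆ Z, HasFam (within G W) := fun W hW => ih _ (hZn W hW) hG W rfl
  have hone : ∀ t, X ∩ Z ⊆ {t} → HasFam (within G U) := fun t ht =>
    ((fX X subset_rfl).sup (fZ Z subset_rfl) (X := X) (Y := Z) (p := t) (q := t)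
      (fun u v h => h.2.1) (fun u v h => h.2.1) (by simpa using ht) (by simp)).mono hle
  by_cases hpq : p = q
  · exact hone q (by simpa [hpq] using hXZ)
  by_cases hp : p ∈ X ∧ p ∈ Z
  · by_cases hq : q ∈ X ∧ q ∈ Z
    · by_cases rZ : q ∈ comp G Z p
      · by_cases rX : q ∈ comp G X p
        · have n₁ := hG.add_edge hXZ hp.1 hq.1 hpq rZ.2
          have n₂ := hG.add_edge (by rwa [Set.inter_comm]) hp.2 hq.2 hpq rX.2
          have f₁ := ih _ (hXn X subset_rfl) n₁ X rfl
          have f₂ := ih _ (hZn Z subset_rfl) n₂ Z rfl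
          have hadj : ∀ W : Set V, (within G W ⊔ SimpleGraph.edge p q).Adj p q := fun W =>
            .inr (by simp [SimpleGraph.edge_adj, hpq])
          refine (f₁.sup f₂ (X := X) (Y := Z) (p := p) (q := q)
            (fun u v h => h.2.1) (fun u v h => h.2.1) hXZ fun _ =>
              ⟨⟨hadj X, hp.1, hq.1⟩, hadj Z, hp.2, hq.2⟩).mono (hle.trans ?_)
          rintro u v (h | h)
          · exact .inl ⟨.inl h, h.2⟩
          · exact .inr ⟨.inl h, h.2⟩
        · refine (HasFam.sup_of_not_reach (X := Z) (Z := X) (by rwa [Set.inter_comm]) hp.1 rX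
            (fZ Z subset_rfl) fX).mono (hle.trans ?_)
          rw [sup_comm]
      · exact (HasFam.sup_of_not_reach hXZ hp.2 rZ (fX X subset_rfl) fZ).mono hle
    · refine hone p fun w hw => ?_
      rcases hXZ hw with h | h
      · exact h
      · exact absurd ((h : w = q) ▸ hw) hq
  · refine hone q fun w hw => ?_
    rcases hXZ hw with h | h
    · exact absurd ((h : w = p) ▸ hw) hp
    · exact h

end

end LocalGirth

namespace LocalGirth

open Finset

set_option linter.unusedSectionVars false

section

open scoped Classical

universe u

variable {V : Type u} [Fintype V] {G H : SimpleGraph V} {ι : Type u} [Fintype ι]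

/-- All triangles of `G` use edges from a set of at most three pairs. -/
def FewTriangles (G : SimpleGraph V) : Prop :=
  ∃ T : Finset (Sym2 V), T.card ≤ 3 ∧
    ∀ a b c, G.Adj a b → G.Adj b c → G.Adj a c → s(a, b) ∈ T

lemma FewTriangles.mono (h : FewTriangles G) (hH : H ≤ G) : FewTriangles H := by
  obtain ⟨T, hT, hT'⟩ := h
  exact ⟨T, hT, fun a b c h₁ h₂ h₃ => hT' a b c (hH h₁) (hH h₂) (hH h₃)⟩

lemma exists_next {z : Chain V} (hz : z ∈ cycles H) {a b : V} (h : z s(a, b) ≠ 0) :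
    ∃ c, c ≠ a ∧ z s(b, c) ≠ 0 := by
  by_contra! hc
  have h1 := hz.2 b
  rw [bd, sum_eq_single a (fun c _ hca => hc c hca) (by simp), Sym2.eq_swap] at h1
  exact h h1

/-- A nonzero cycle contains a triangle or a quadrilateral or has at least five edges. -/
lemma cycle_cases {z : Chain V} (hz : z ∈ cycles H) (h0 : z ≠ 0) :
    (∃ a b c, z s(a, b) ≠ 0 ∧ z s(b, c) ≠ 0 ∧ z s(a, c) ≠ 0) ∨
    (∃ a b c d, a ≠ c ∧ b ≠ d ∧ z s(a, b) ≠ 0 ∧ z s(b, c) ≠ 0 ∧ z s(c, d) ≠ 0 ∧ z s(d, a) ≠ 0) ∨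
    5 ≤ (univ.filter fun e => z e ≠ 0).card := by
  obtain ⟨e, he⟩ := Function.ne_iff.1 h0
  induction e with
  | _ a b =>
  change z s(a, b) ≠ 0 at he
  obtain ⟨c, hca, hbc⟩ := exists_next hz he
  obtain ⟨d, hdb, hcd⟩ := exists_next hz hbc
  by_cases hda : d = a
  · subst hda
    exact .inl ⟨d, b, c, he, hbc, by rwa [Sym2.eq_swap]⟩
  obtain ⟨f, hfc, hdf⟩ := exists_next hz hcd
  by_cases hfb : f = b
  · subst hfb
    exact .inl ⟨f, c, d, hbc, hcd, by rwa [Sym2.eq_swap]⟩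
  by_cases hfa : f = a
  · subst hfa
    exact .inr (.inl ⟨f, b, c, d, hca.symm, hdb.symm, he, hbc, hcd, hdf⟩)
  obtain ⟨g, hgd, hfg⟩ := exists_next hz hdf
  refine .inr (.inr ?_)
  have n1 := (hz.1 _ _ he).ne
  have n2 := (hz.1 _ _ hbc).ne
  have n3 := (hz.1 _ _ hcd).ne
  have n4 := (hz.1 _ _ hdf).ne
  have n5 := (hz.1 _ _ hfg).ne
  have : ({s(a, b), s(b, c), s(c, d), s(d, f), s(f, g)} : Finset (Sym2 V)).card = 5 := by
    rw [card_insert_of_notMem, card_insert_of_notMem, card_insert_of_notMem, card_pair] <;>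
    simp only [mem_insert, mem_singleton, Sym2.eq_iff, ne_eq] <;> grind
  rw [← this]
  refine card_le_card fun e he => ?_
  simp only [mem_insert, mem_singleton] at he
  rcases he with rfl | rfl | rfl | rfl | rfl <;> simpa

lemma eq_quad {z : Chain V} {a b c d : V} (hac : a ≠ c) (hbd : b ≠ d)
    (nab : a ≠ b) (nbc : b ≠ c) (ncd : c ≠ d) (nda : d ≠ a)
    (hab : z s(a, b) ≠ 0) (hbc : z s(b, c) ≠ 0) (hcd : z s(c, d) ≠ 0) (hda : z s(d, a) ≠ 0)
    (h : (univ.filter fun e => z e ≠ 0).card ≤ 4) : z = quad a b c d := by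
  have h4 : ({s(a, b), s(b, c), s(c, d), s(d, a)} : Finset (Sym2 V)).card = 4 := by
    rw [card_insert_of_notMem, card_insert_of_notMem, card_pair] <;>
    simp only [mem_insert, mem_singleton, Sym2.eq_iff, ne_eq] <;> grind
  have hs : ({s(a, b), s(b, c), s(c, d), s(d, a)} : Finset (Sym2 V)) =
      univ.filter fun e => z e ≠ 0 := by
    refine eq_of_subset_of_card_le (fun e he => ?_) (by omega)
    simp only [mem_insert, mem_singleton] at he
    rcases he with rfl | rfl | rfl | rfl <;> simpa
  funext e
  have he := congrArg (e ∈ ·) hs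
  simp only [mem_insert, mem_singleton, mem_filter, mem_univ, true_and, eq_iff_iff] at he
  have hv : z e = if (e = s(a, b) ∨ e = s(b, c) ∨ e = s(c, d) ∨ e = s(d, a)) then 1 else 0 := by
    split_ifs with h1
    · exact zmod_two_ne_zero.1 (he.1 h1)
    · by_contra h2
      exact h1 (he.2 h2)
  rw [hv]
  simp only [quad, Pi.add_apply, single]
  have e1 : s(a, b) ≠ s(b, c) := by simp only [ne_eq, Sym2.eq_iff]; grind
  have e2 : s(a, b) ≠ s(c, d) := by simp only [ne_eq, Sym2.eq_iff]; grind
  have e3 : s(a, b) ≠ s(d, a) := by simp only [ne_eq, Sym2.eq_iff]; grind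
  have e4 : s(b, c) ≠ s(c, d) := by simp only [ne_eq, Sym2.eq_iff]; grind
  have e5 : s(b, c) ≠ s(d, a) := by simp only [ne_eq, Sym2.eq_iff]; grind
  have e6 : s(c, d) ≠ s(d, a) := by simp only [ne_eq, Sym2.eq_iff]; grind
  by_cases h1 : e = s(a, b)
  · subst h1; simp [e1, e2, e3]
  by_cases h2 : e = s(b, c)
  · subst h2; simp [e1.symm, e4, e5]
  by_cases h3 : e = s(c, d)
  · subst h3; simp [e2.symm, e4.symm, e6]
  by_cases h4 : e = s(d, a)
  · subst h4; simp [e3.symm, e5.symm, e6.symm]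
  simp [h1, h2, h3, h4]

/-- Each edge is in at most two members of the family. -/
lemma IsFam.sum_card_le {F : ι → Chain V} (hF : IsFam H F) (J : Finset ι) (S : Finset (Sym2 V)) :
    ∑ i ∈ J, (S.filter fun e => F i e ≠ 0).card ≤ 2 * S.card := by
  simp only [card_filter]
  rw [sum_comm, mul_comm, ← smul_eq_mul]
  refine sum_le_card_nsmul _ _ _ fun e _ => ?_
  rw [← card_filter]
  by_contra! h
  obtain ⟨i, j, k, hi, hj, hk, hij, hik, hjk⟩ := two_lt_card_iff.1 h
  simp only [mem_filter] at hi hj hk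
  rcases hF.two e i j k hi.2 hj.2 hk.2 with h | h | h
  · exact hij h
  · exact hjk h
  · exact hik h

/-- The number of edges is at most the size of a spanning forest plus the number of
generators of the cycle space. -/
lemma card_edge_lt {F : ι → Chain V} (J : Finset ι) (A : Finset V) (hA : A.Nonempty)
    (hHA : ∀ u v, H.Adj u v → u ∈ A)
    (hJ : ∀ z ∈ cycles H, ∃ c : ι → ZMod 2, ∑ i ∈ J, c i • F i = z) :
    H.edgeFinset.card + 1 ≤ A.card + J.card := by
  obtain ⟨r, hr⟩ := hA
  let ext : (H.edgeSet → ZMod 2) → Chain V := fun f e => if h : e ∈ H.edgeSet then f ⟨e, h⟩ else 0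
  let L : (H.edgeSet → ZMod 2) →ₗ[ZMod 2] ({v // v ∈ A.erase r} → ZMod 2) :=
    { toFun := fun f v => bd (ext f) v
      map_add' := by
        intro f g
        funext v
        simp only [Pi.add_apply]
        rw [← bd_add]
        congr 1
        funext e
        simp only [ext, Pi.add_apply]
        split_ifs <;> simp
      map_smul' := by
        intro c f
        funext v
        simp only [Pi.smul_apply, bd, smul_eq_mul, RingHom.id_apply, mul_sum]
        refine sum_congr rfl fun u _ => ?_
        simp only [ext]
        split_ifs <;> simp }
  let Φ : (J → ZMod 2) →ₗ[ZMod 2] (H.edgeSet → ZMod 2) :=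
    { toFun := fun c e => ∑ i : J, c i * F i e
      map_add' := by
        intro c d
        funext e
        simp [add_mul, sum_add_distrib]
      map_smul' := by
        intro c d
        funext e
        simp [mul_sum, mul_assoc] }
  have hker : LinearMap.ker L ≤ LinearMap.range Φ := by
    intro f hf
    have hext : ext f ∈ cycles H := by
      have h1 : ∀ u v, ext f s(u, v) ≠ 0 → H.Adj u v := by
        intro u v h
        by_contra h2
        exact h (by simp [ext, h2])
      refine ⟨h1, ?_⟩
      have h2 : ∀ v, v ≠ r → bd (ext f) v = 0 := by
        intro v hv
        by_cases hvA : v ∈ A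
        · exact congrFun hf ⟨v, mem_erase.2 ⟨hv, hvA⟩⟩
        · refine sum_eq_zero fun u _ => ?_
          by_contra h3
          exact hvA (hHA _ _ (h1 _ _ h3))
      intro v
      by_cases hv : v = r
      · subst hv
        refine bd_eq_zero_of_forall_ne (fun w => ?_) h2
        by_contra h3
        exact (h1 _ _ h3).ne rfl
      · exact h2 v hv
    obtain ⟨c, hc⟩ := hJ _ hext
    refine ⟨fun i => c i, ?_⟩
    funext e
    have h3 := congrFun hc e
    simp only [Finset.sum_apply, Pi.smul_apply, smul_eq_mul, ext] at h3
    rw [dif_pos e.2] at h3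
    rw [← h3]
    exact sum_coe_sort J (fun i => c i * F i e)
  have h1 := LinearMap.finrank_range_add_finrank_ker L
  have h2 := Submodule.finrank_mono hker
  have h3 := LinearMap.finrank_range_le Φ
  have h4 := Submodule.finrank_le (LinearMap.range L)
  simp only [Module.finrank_fintype_fun_eq_card, Fintype.card_coe] at h1 h2 h3 h4
  rw [card_erase_of_mem hr] at h4
  have h5 : 0 < A.card := card_pos.2 ⟨r, hr⟩
  have h6 : H.edgeFinset.card = Fintype.card H.edgeSet := SimpleGraph.edgeFinset_card
  omega

lemma IsFam.exists_erase {F : ι → Chain V} (hF : IsFam H F) (k : ι) {z : Chain V}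
    (hz : z ∈ cycles H) : ∃ c : ι → ZMod 2, c k = 0 ∧ ∑ i, c i • F i = z := by
  obtain ⟨c, hc⟩ := hF.gen z hz
  refine ⟨fun i => c i - c k, by simp, ?_⟩
  simp only [sub_smul, sum_sub_distrib, ← smul_sum, hF.sum, hc]
  simp

/-- A graph with many edges and few triangles has a quadrilateral in its family avoiding the
triangles. -/
lemma IsFam.exists_quad {F : ι → Chain V} (hF : IsFam H F) {A : Finset V} (hA : A.Nonempty)
    (hHA : ∀ u v, H.Adj u v → u ∈ A) {T : Finset (Sym2 V)} (hT : T.card ≤ 3)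
    (hTri : ∀ a b c, H.Adj a b → H.Adj b c → H.Adj a c → s(a, b) ∈ T)
    (hE : 5 * A.card ≤ 3 * H.edgeFinset.card + 2) (hE' : A.card ≤ H.edgeFinset.card) :
    ∃ k x y z w, F k = quad x y z w ∧ x ≠ z ∧ y ≠ w ∧ H.Adj x y ∧ H.Adj y z ∧ H.Adj z w ∧
      H.Adj w x ∧ s(x, y) ∉ T ∧ s(y, z) ∉ T ∧ s(z, w) ∉ T ∧ s(w, x) ∉ T := by
  by_contra! hno
  set J : Finset ι := univ.filter fun i => F i ≠ 0 with hJdef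
  have hm : H.edgeFinset.card + 2 ≤ A.card + J.card := by
    by_cases hJ : J.Nonempty
    · obtain ⟨k, hk⟩ := hJ
      have := card_edge_lt (H := H) (F := F) (J.erase k) A hA hHA (by
        intro z hz
        obtain ⟨c, hck, hc⟩ := hF.exists_erase k hz
        refine ⟨c, ?_⟩
        rw [← hc]
        refine sum_subset (subset_univ _) fun i _ hi => ?_
        simp only [mem_erase, hJdef, mem_filter, mem_univ, true_and, not_and_or, not_not] at hi
        rcases hi with rfl | hi
        · simp [hck]
        · simp [hi])
      rw [card_erase_of_mem hk] at this
      have : 0 < J.card := card_pos.2 ⟨k, hk⟩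
      omega
    · have := card_edge_lt (H := H) (F := F) J A hA hHA (by
        intro z hz
        obtain ⟨c, hc⟩ := hF.gen z hz
        refine ⟨c, ?_⟩
        rw [← hc]
        refine sum_subset (subset_univ _) fun i _ hi => ?_
        simp only [hJdef, mem_filter, mem_univ, true_and, not_not] at hi
        simp [hi])
      rw [not_nonempty_iff_eq_empty] at hJ
      rw [hJ, card_empty] at this
      omega
  have h1 := hF.sum_card_le J H.edgeFinset
  have h2 := hF.sum_card_le J T
  have h3 : ∀ i ∈ J, 5 ≤ (H.edgeFinset.filter fun e => F i e ≠ 0).card +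
      (T.filter fun e => F i e ≠ 0).card := by
    intro i hi
    have hi0 : F i ≠ 0 := by simpa [hJdef] using hi
    have hmem := hF.mem i
    have heq : (H.edgeFinset.filter fun e => F i e ≠ 0) = univ.filter fun e => F i e ≠ 0 := by
      ext e
      induction e with
      | _ a b =>
      simp only [mem_filter, SimpleGraph.mem_edgeFinset, SimpleGraph.mem_edgeSet, mem_univ,
        true_and, and_iff_right_iff_imp]
      exact hmem.1 a b
    rw [heq]
    rcases cycle_cases hmem hi0 with ⟨a, b, c, hab, hbc, hac⟩ | ⟨a, b, c, d, hac, hbd, hab, hbc,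
      hcd, hda⟩ | h5
    · have gab := hmem.1 _ _ hab
      have gbc := hmem.1 _ _ hbc
      have gac := hmem.1 _ _ hac
      have nab := gab.ne
      have nbc := gbc.ne
      have nac := gac.ne
      have h33 : ({s(a, b), s(b, c), s(a, c)} : Finset (Sym2 V)).card = 3 := by
        rw [card_insert_of_notMem, card_pair] <;>
        simp only [mem_insert, mem_singleton, Sym2.eq_iff, ne_eq] <;> grind
      have s1 : ({s(a, b), s(b, c), s(a, c)} : Finset (Sym2 V)) ⊆
          T.filter fun e => F i e ≠ 0 := by
        intro e he
        simp only [mem_insert, mem_singleton] at he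
        rcases he with rfl | rfl | rfl
        · exact mem_filter.2 ⟨hTri _ _ _ gab gbc gac, hab⟩
        · exact mem_filter.2 ⟨hTri _ _ _ gbc gac.symm gab.symm, hbc⟩
        · exact mem_filter.2 ⟨hTri _ _ _ gac gbc.symm gab, hac⟩
      have c1 := card_le_card s1
      have c2 := card_le_card (s1.trans (filter_subset_filter _ (subset_univ _)))
      omega
    · have gab := hmem.1 _ _ hab
      have gbc := hmem.1 _ _ hbc
      have gcd := hmem.1 _ _ hcd
      have gda := hmem.1 _ _ hda
      by_contra! hlt
      have h4 : ({s(a, b), s(b, c), s(c, d), s(d, a)} : Finset (Sym2 V)).card = 4 := by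
        have := gab.ne
        have := gbc.ne
        have := gcd.ne
        have := gda.ne
        rw [card_insert_of_notMem, card_insert_of_notMem, card_pair] <;>
        simp only [mem_insert, mem_singleton, Sym2.eq_iff, ne_eq] <;> grind
      have c1 := card_le_card (s := {s(a, b), s(b, c), s(c, d), s(d, a)})
        (t := univ.filter fun e => F i e ≠ 0) (by
          intro e he
          simp only [mem_insert, mem_singleton] at he
          rcases he with rfl | rfl | rfl | rfl <;> simpa)
      have h0 : (T.filter fun e => F i e ≠ 0) = ∅ := by
        rw [← card_eq_zero]
        omega
      have hq := eq_quad hac hbd gab.ne gbc.ne gcd.ne gda.ne hab hbc hcd hda (by omega)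
      have hnT : ∀ e, F i e ≠ 0 → e ∉ T := by
        intro e he heT
        have : e ∈ (T.filter fun e => F i e ≠ 0) := mem_filter.2 ⟨heT, he⟩
        simp [h0] at this
      exact hnT _ hda (hno i a b c d hq hac hbd gab gbc gcd gda (hnT _ hab) (hnT _ hbc)
        (hnT _ hcd))
    · omega
  have h4 := card_nsmul_le_sum J _ 5 h3
  rw [sum_add_distrib, smul_eq_mul] at h4
  omega

end

end LocalGirth

namespace LocalGirth

open Finset

set_option linter.unusedSectionVars false

section

open scoped Classical

universe u

variable {V : Type u} [Fintype V] {G H : SimpleGraph V} {ι : Type u} [Fintype ι]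

/-- A cycle that behaves like the intersection of the interiors of two cycles. -/
lemma IsFam.exists_product {F : ι → Chain V} (hF : IsFam H F) (k : ι) {A B : Chain V}
    (hA : A ∈ cycles H) (hB : B ∈ cycles H) :
    ∃ D ∈ cycles H, (∀ e, A e = 0 → B e = 0 → D e = 0) ∧ ∀ e, F k e ≠ 0 → D e = A e * B e := by
  obtain ⟨α, hαk, hα⟩ := hF.exists_erase k hA
  obtain ⟨β, hβk, hβ⟩ := hF.exists_erase k hB
  have key : ∀ i e, F i e ≠ 0 → ∃ j, j ≠ i ∧ F i e = 1 ∧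
      ∀ c : ι → ZMod 2, (∑ l, c l • F l) e = c i + c j := by
    intro i e hi
    obtain ⟨j, hji, hj⟩ := hF.exists_other hi
    refine ⟨j, hji, zmod_two_ne_zero.1 hi, fun c => ?_⟩
    rw [Finset.sum_apply, ← sum_subset (subset_univ {i, j}), sum_pair hji.symm]
    · simp [zmod_two_ne_zero.1 hi, zmod_two_ne_zero.1 hj]
    · intro l _ hl
      simp only [mem_insert, mem_singleton, not_or] at hl
      have : F l e = 0 := by
        by_contra h
        rcases hF.two e i j l hi hj h with h | h | h
        · exact hji h.symm
        · exact hl.2 h.symm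
        · exact hl.1 h.symm
      simp [this]
  refine ⟨∑ i, (α i * β i) • F i, sum_mem fun i _ => Submodule.smul_mem _ _ (hF.mem i), ?_, ?_⟩
  · intro e hAe hBe
    by_cases h : ∃ i, F i e ≠ 0
    · obtain ⟨i, hi⟩ := h
      obtain ⟨j, -, -, hc⟩ := key i e hi
      rw [hc]
      rw [← hα, hc] at hAe
      rw [← hβ, hc] at hBe
      rw [CharTwo.add_eq_zero.1 hAe, CharTwo.add_eq_zero.1 hBe, zmod_two_add_self]
    · push Not at h
      simp [h]
  · intro e he
    obtain ⟨j, -, -, hc⟩ := key k e he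
    rw [← hα, ← hβ, hc, hc, hc, hαk, hβk]
    simp

lemma single_ne_zero_iff {u v : V} {e : Sym2 V} : single u v e ≠ 0 ↔ e = s(u, v) := by
  simp [single]

lemma quad_rotate (x y z w : V) : quad x y z w = quad y z w x := by
  simp only [quad]
  abel

lemma eq_of_bd {D : Chain V} (hD : D ∈ cycles H) {v a b : V} (hab : a ≠ b)
    (h : ∀ u, u ≠ a → u ≠ b → D s(v, u) = 0) : D s(v, a) = D s(v, b) := by
  have h1 := hD.2 v
  rw [bd, ← sum_subset (subset_univ {a, b}) (by
    intro u _ hu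
    simp only [mem_insert, mem_singleton, not_or] at hu
    exact h u hu.1 hu.2), sum_pair hab] at h1
  exact CharTwo.add_eq_zero.1 h1

lemma pentagon_mem {a b c d e : V} (h₁ : H.Adj a b) (h₂ : H.Adj b c) (h₃ : H.Adj c d)
    (h₄ : H.Adj d e) (h₅ : H.Adj e a) :
    single a b + single b c + single c d + single d e + single e a ∈ cycles H := by
  refine ⟨fun u v h => ?_, fun v => ?_⟩
  · have : s(u, v) = s(a, b) ∨ s(u, v) = s(b, c) ∨ s(u, v) = s(c, d) ∨ s(u, v) = s(d, e) ∨
        s(u, v) = s(e, a) := by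
      by_contra! hn
      simp only [← single_ne_zero_iff (e := s(u, v)), not_not, ne_eq] at hn
      exact h (by simp [hn])
    rw [← SimpleGraph.mem_edgeSet]
    rcases this with h | h | h | h | h <;> rw [h] <;> assumption
  · simp only [bd_add, bd_single h₁.ne, bd_single h₂.ne, bd_single h₃.ne, bd_single h₄.ne,
      bd_single h₅.ne]
    generalize (if v = a then (1 : ZMod 2) else 0) = A
    generalize (if v = b then (1 : ZMod 2) else 0) = B
    generalize (if v = c then (1 : ZMod 2) else 0) = C
    generalize (if v = d then (1 : ZMod 2) else 0) = D
    generalize (if v = e then (1 : ZMod 2) else 0) = E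
    revert A B C D E
    decide

/-- Opposite corners of a quadrilateral of the family cannot both be joined by paths of
length three. -/
lemma IsFam.not_both {F : ι → Chain V} (hF : IsFam H F) {k : ι} {x y z w p q p' q' : V}
    (hk : F k = quad x y z w) (hxz : x ≠ z) (hyw : y ≠ w)
    (hxy : H.Adj x y) (hyz : H.Adj y z) (hzw : H.Adj z w) (hwx : H.Adj w x)
    (txy : ∀ a, H.Adj x a → ¬ H.Adj y a) (tyz : ∀ a, H.Adj y a → ¬ H.Adj z a)
    (tzw : ∀ a, H.Adj z a → ¬ H.Adj w a) (twx : ∀ a, H.Adj w a → ¬ H.Adj x a)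
    (hxp : H.Adj x p) (hpq : H.Adj p q) (hqz : H.Adj q z)
    (hyp : H.Adj y p') (hpq' : H.Adj p' q') (hqw : H.Adj q' w) : False := by
  have nxy := hxy.ne
  have nyz := hyz.ne
  have nzw := hzw.ne
  have nwx := hwx.ne
  have nxp := hxp.ne
  have npq := hpq.ne
  have nqz := hqz.ne
  have nyp := hyp.ne
  have npq' := hpq'.ne
  have nqw := hqw.ne
  have hqz' := hqz.symm
  have hqw' := hqw.symm
  have npz : p ≠ z := by rintro rfl; exact txy _ hxp hyz
  have npy : p ≠ y := by rintro rfl; exact tyz _ hpq hqz'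
  have npw : p ≠ w := by rintro rfl; exact tzw _ hqz' hpq
  have nqx : q ≠ x := by rintro rfl; exact txy _ hqz hyz
  have nqy : q ≠ y := by rintro rfl; exact txy _ hxp hpq.symm
  have nqw1 : q ≠ w := by rintro rfl; exact twx _ hpq.symm hxp
  have npw' : p' ≠ w := by rintro rfl; exact tyz _ hyp hzw
  have npx' : p' ≠ x := by rintro rfl; exact twx _ hqw' hpq'
  have npz' : p' ≠ z := by rintro rfl; exact tzw _ hpq' hqw'
  have nqy' : q' ≠ y := by rintro rfl; exact twx _ hqw' hxy
  have nqx' : q' ≠ x := by rintro rfl; exact txy _ hpq'.symm hyp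
  have nqz' : q' ≠ z := by rintro rfl; exact tyz _ hyp hpq'.symm
  have n1 : p ≠ p' := by rintro rfl; exact txy _ hxp hyp
  have n2 : p ≠ q' := by rintro rfl; exact twx _ hqw' hxp
  have n3 : q ≠ p' := by rintro rfl; exact tyz _ hyp hqz'
  have n4 : q ≠ q' := by rintro rfl; exact tzw _ hqz' hqw'
  obtain ⟨D, hD, hD0, hDk⟩ := hF.exists_product k
    (pentagon_mem hxp hpq hqz hyz.symm hxy.symm) (pentagon_mem hyp hpq' hqw hzw.symm hyz.symm)
  have supp : ∀ u v, ¬ (s(u, v) = s(x, p) ∨ s(u, v) = s(p, q) ∨ s(u, v) = s(q, z) ∨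
      s(u, v) = s(z, y) ∨ s(u, v) = s(y, x) ∨ s(u, v) = s(y, p') ∨ s(u, v) = s(p', q') ∨
      s(u, v) = s(q', w) ∨ s(u, v) = s(w, z)) → D s(u, v) = 0 := by
    intro u v h
    simp only [not_or] at h
    simp only [← single_ne_zero_iff (e := s(u, v)), not_not, ne_eq] at h
    exact hD0 _ (by simp [h]) (by simp [h])
  simp only [Sym2.eq_iff] at supp
  have v1 : D s(z, y) = 1 := by
    rw [hDk]
    · simp only [Pi.add_apply, single_apply]
      simp [*, hxz.symm, nyz.symm, nqz.symm, npz.symm, npy.symm, nqy.symm, nqy'.symm,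
        nqz'.symm, npz'.symm]
    · rw [hk]
      simp only [quad, Pi.add_apply, single_apply]
      simp [*, hxz.symm, nyz.symm]
  have v2 : D s(x, y) = 0 := by
    rw [hDk]
    · simp only [Pi.add_apply, single_apply]
      simp [*, nxy.symm, nqx.symm, nwx.symm, npx'.symm, nqx'.symm]
    · rw [hk]
      simp only [quad, Pi.add_apply, single_apply]
      simp [*, nwx.symm]
  have v3 : D s(z, w) = 0 := by
    rw [hDk]
    · simp only [Pi.add_apply, single_apply]
      simp [*, hxz.symm, nyz.symm, npz.symm, nqz.symm, hyw.symm, npw.symm, nqw1.symm]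
    · rw [hk]
      simp only [quad, Pi.add_apply, single_apply]
      simp [*, hxz.symm, nyz.symm, hyw.symm, nzw.symm]
  have e1 : D s(z, q) = D s(z, y) := eq_of_bd hD nqy fun u h1 h2 => by
    by_cases hu : u = w
    · rw [hu, v3]
    · apply supp
      grind
  have e2 : D s(q, p) = D s(q, z) := eq_of_bd hD npz fun u h1 h2 => by
    apply supp
    grind
  have e3 : D s(p, x) = D s(p, q) := eq_of_bd hD nqx.symm fun u h1 h2 => by
    apply supp
    grind
  have e4 : D s(x, p) = D s(x, y) := eq_of_bd hD npy fun u h1 h2 => by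
    apply supp
    grind
  rw [Sym2.eq_swap, e3, Sym2.eq_swap, e2, Sym2.eq_swap, e1, v1, v2] at e4
  exact one_ne_zero e4

end

end LocalGirth

namespace LocalGirth

open Finset

set_option linter.unusedSectionVars false

section

open scoped Classical

universe u

variable {V : Type u} [Fintype V] {G H : SimpleGraph V} {ι : Type u} [Fintype ι]

lemma FewTriangles.ident {x z : V} (h : FewTriangles H) (hxz : x ≠ z)
    (hp : ∀ p q, H.Adj x p → H.Adj p q → ¬ H.Adj q z) : FewTriangles (ident H x z) := by
  obtain ⟨T, hT, hT'⟩ := h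
  let f : V → V := fun v => if v = z then x else v
  have hfz : f z = x := if_pos rfl
  have hf : ∀ v, v ≠ z → f v = v := fun v hv => if_neg hv
  refine ⟨T.image (Sym2.map f), card_image_le.trans hT, ?_⟩
  have key : ∀ a b c, H.Adj a b → H.Adj b c → H.Adj a c →
      s(f a, f b) ∈ T.image (Sym2.map f) := fun a b c h₁ h₂ h₃ =>
    mem_image.2 ⟨_, hT' a b c h₁ h₂ h₃, rfl⟩
  have lift : ∀ a b, (LocalGirth.ident H x z).Adj a b → a ≠ x → b ≠ x → H.Adj a b := by
    rintro a b ⟨-, -, -, h | h | h⟩ ha hb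
    exacts [h, absurd h.1 ha, absurd h.1 hb]
  have lift' : ∀ b, (LocalGirth.ident H x z).Adj x b → H.Adj x b ∨ H.Adj z b := by
    rintro b ⟨-, -, h1, h | h | h⟩
    exacts [.inl h, .inr h.2, absurd h.1 (Ne.symm h1)]
  have main : ∀ a b, (LocalGirth.ident H x z).Adj x a → (LocalGirth.ident H x z).Adj x b →
      (LocalGirth.ident H x z).Adj a b → ∃ c, f c = x ∧ H.Adj c a ∧ H.Adj c b ∧ H.Adj a b ∧
        a ≠ z ∧ b ≠ z := by
    intro a b ha hb hab
    have h1 := lift a b hab ha.2.2.1.symm hb.2.2.1.symm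
    rcases lift' a ha with h2 | h2 <;> rcases lift' b hb with h3 | h3
    · exact ⟨x, hf x hxz, h2, h3, h1, hab.1, hab.2.1⟩
    · exact (hp a b h2 h1 h3.symm).elim
    · exact (hp b a h3 h1.symm h2.symm).elim
    · exact ⟨z, hfz, h2, h3, h1, hab.1, hab.2.1⟩
  intro a b c hab hbc hac
  by_cases hax : a = x
  · subst hax
    obtain ⟨d, hd, h1, h2, h3, h4, h5⟩ := main b c hab hac hbc
    have := key d b c h1 h3 h2
    rwa [hd, hf b h4] at this
  by_cases hbx : b = x
  · subst hbx
    obtain ⟨d, hd, h1, h2, h3, h4, h5⟩ := main a c hab.symm hbc hac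
    have := key a d c h1.symm h2 h3
    rwa [hd, hf a h4] at this
  by_cases hcx : c = x
  · subst hcx
    obtain ⟨d, hd, h1, h2, h3, h4, h5⟩ := main a b hac.symm hbc.symm hab
    have := key a b d h3 h2.symm h1.symm
    rwa [hf a h4, hf b h5] at this
  · have := key a b c (lift _ _ hab hax hbx) (lift _ _ hbc hbx hcx) (lift _ _ hac hax hcx)
    rwa [hf a hab.1, hf b hbc.1] at this

lemma ThreeCol.of_ident {x z : V} {A : Finset V} (hn : ¬ H.Adj x z) (hx : x ∈ A) (hxz : x ≠ z)
    (h : ThreeCol (ident H x z) (A.erase z)) : ThreeCol H A := by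
  obtain ⟨φ, hφ⟩ := h
  refine ⟨fun v => if v = z then φ x else φ v, fun u hu v hv huv => ?_⟩
  have hxA : x ∈ A.erase z := mem_erase.2 ⟨hxz, hx⟩
  by_cases h1 : u = z
  · subst h1
    have h2 := huv.ne'
    have h3 : x ≠ v := by rintro rfl; exact hn huv.symm
    simp only [if_true, if_neg h2]
    exact hφ _ hxA _ (mem_erase.2 ⟨h2, hv⟩) ⟨hxz, h2, h3, .inr (.inl ⟨rfl, huv⟩)⟩
  by_cases h2 : v = z
  · subst h2
    have h3 : u ≠ x := by rintro rfl; exact hn huv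
    simp only [if_true, if_neg h1]
    exact hφ _ (mem_erase.2 ⟨h1, hu⟩) _ hxA ⟨h1, hxz, h3, .inr (.inr ⟨rfl, huv.symm⟩)⟩
  simp only [if_neg h1, if_neg h2]
  exact hφ _ (mem_erase.2 ⟨h1, hu⟩) _ (mem_erase.2 ⟨h2, hv⟩) ⟨h1, h2, huv.ne, .inl huv⟩

lemma edgesIn_eq_card {A : Finset V} (hA : ∀ u v, H.Adj u v → u ∈ A) :
    edgesIn H A = H.edgeFinset.card := by
  have h1 := two_mul_edgesIn (G := H) A
  have h2 : cross H A A = ∑ v, (H.degree v : ℤ) := by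
    rw [cross]
    rw [sum_subset (subset_univ A) (by
      intro v _ hv
      exact sum_eq_zero fun w _ => if_neg fun h => hv (hA _ _ h))]
    refine sum_congr rfl fun v _ => ?_
    rw [sum_subset (subset_univ A) (by
      intro w _ hw
      exact if_neg fun h => hw (hA _ _ h.symm))]
    rw [← SimpleGraph.card_neighborFinset_eq_degree, sum_boole]
    congr 2
    ext w
    simp
  have h3 := H.sum_degrees_eq_twice_card_edges
  rw [h2, ← Nat.cast_sum, h3] at h1
  push_cast at h1
  omega

/-- Three-colourability from a face family and few triangles. -/
theorem threeCol_of_hasFam (A : Finset V) (hG : HasFam G) (hT : FewTriangles G) :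
    ThreeCol G A := by
  induction hn : A.card using Nat.strong_induction_on generalizing A G with
  | _ n ih =>
  by_contra hcol
  obtain ⟨R, hRA, hR, hRp⟩ := exists_potential_le_two hcol
  have hRA' : R = A := by
    by_contra hne
    exact hR (ih _ (hn ▸ card_lt_card (hRA.ssubset_of_ne hne)) R hG hT rfl)
  subst hRA'
  set H := within G (R : Set V) with hH
  have hHA : ∀ u v, H.Adj u v → u ∈ R := fun u v h => by
    rw [hH] at h; exact_mod_cast h.2.1
  have hle : H ≤ G := within_le _
  have hHH : HasFam H := hG.mono hle
  have hHT : FewTriangles H := hT.mono hle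
  have hHcol : ¬ ThreeCol H R := by
    rintro ⟨φ, hφ⟩
    exact hcol ⟨φ, fun u hu v hv huv => hφ u hu v hv ⟨huv, hu, hv⟩⟩
  have hne : R.Nonempty := by
    rw [nonempty_iff_ne_empty]
    rintro rfl
    exact hcol (threeCol_of_card_le (by simp))
  have hcong : edgesIn G R = edgesIn H R := edgesIn_congr fun u hu v hv =>
    ⟨fun h => ⟨h, hu, hv⟩, fun h => hle h⟩
  rw [potential, hcong, edgesIn_eq_card hHA] at hRp
  have h4 : 3 < R.card := by
    by_contra! h
    exact hcol (threeCol_of_card_le h)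
  obtain ⟨T, hTc, hT'⟩ := hHT
  obtain ⟨ι, _, F, hF⟩ := hHH
  obtain ⟨k, x, y, z, w, hk, hxz, hyw, hxy, hyz, hzw, hwx, t1, t2, t3, t4⟩ :=
    hF.exists_quad hne hHA hTc hT' (by omega) (by omega)
  have txy : ∀ a, H.Adj x a → ¬ H.Adj y a := fun a h1 h2 => t1 (hT' _ _ _ hxy h2 h1)
  have tyz : ∀ a, H.Adj y a → ¬ H.Adj z a := fun a h1 h2 => t2 (hT' _ _ _ hyz h2 h1)
  have tzw : ∀ a, H.Adj z a → ¬ H.Adj w a := fun a h1 h2 => t3 (hT' _ _ _ hzw h2 h1)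
  have twx : ∀ a, H.Adj w a → ¬ H.Adj x a := fun a h1 h2 => t4 (hT' _ _ _ hwx h2 h1)
  have nxz : ¬ H.Adj x z := fun h => txy z h hyz
  have nyw : ¬ H.Adj y w := fun h => tyz w h hzw
  have hFT : FewTriangles H := ⟨T, hTc, hT'⟩
  have hP : ∃ p q, H.Adj x p ∧ H.Adj p q ∧ H.Adj q z := by
    by_contra! hp
    refine hHcol (.of_ident nxz (hHA _ _ hxy) hxz ?_)
    refine ih _ ?_ _ (hF.ident hk hxz hxy.ne' hyz.ne hwx.ne hzw.ne' hyw nxz)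
      (hFT.ident hxz hp) rfl
    exact hn ▸ card_erase_lt_of_mem (hHA _ _ hzw)
  have hQ : ∃ p q, H.Adj y p ∧ H.Adj p q ∧ H.Adj q w := by
    by_contra! hp
    refine hHcol (.of_ident nyw (hHA _ _ hyz) hyw ?_)
    refine ih _ ?_ _ (hF.ident (hk.trans (quad_rotate _ _ _ _)) hyw hyz.ne' hzw.ne hxy.ne
      hwx.ne' hxz.symm nyw) (hFT.ident hyw hp) rfl
    exact hn ▸ card_erase_lt_of_mem (hHA _ _ hwx)
  obtain ⟨p, q, hxp, hpq, hqz⟩ := hP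
  obtain ⟨p', q', hyp, hpq', hqw⟩ := hQ
  exact hF.not_both hk hxz hyw hxy hyz hzw hwx txy tyz tzw twx hxp hpq hqz hyp hpq' hqw

end

end LocalGirth

namespace LocalGirth

open Set

set_option linter.unusedSectionVars false

section

open scoped Classical

variable {V : Type*} {G : SimpleGraph V}

/-- A partial colouring of `L` in which two vertices of colour `2` never touch a common connected
set of uncoloured vertices. -/
structure TGood (G : SimpleGraph V) (Γ L : Set V) (c : V → Fin 3) : Prop where
  proper : ∀ u ∈ L, ∀ v ∈ L, G.Adj u v → c u ≠ c v
  sep : ∀ u ∈ L, ∀ v ∈ L, u ≠ v → c u = 2 → c v = 2 →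
    ∀ K ⊆ Γ \ L, IsConn G K → Touch G {u} K → ¬ Touch G {v} K

structure TSetup (G : SimpleGraph V) (Γ W L : Set V) : Prop where
  noMinor : NoMinor G
  conn : IsConn G W
  disj : Disjoint Γ W
  sub : L ⊆ Γ
  touch : ∀ l ∈ L, Touch G {l} W

lemma TSetup.restrict {Γ W L : Set V} (h : TSetup G Γ W L) {Γ' : Set V} (hΓ : Γ' ⊆ Γ) :
    TSetup G Γ' W (L ∩ Γ') :=
  ⟨h.noMinor, h.conn, h.disj.mono_left hΓ, inter_subset_right, fun l hl => h.touch l hl.1⟩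

lemma exists_split {X : Set V} {a b : V} (ha : a ∈ X) (hb : b ∈ X) (h : ¬ Reach G X a b) :
    ∃ D₁ D₂ : Set V, a ∈ D₁ ∧ b ∈ D₂ ∧ Disjoint D₁ D₂ ∧ D₁ ∪ D₂ = X ∧
      ∀ u ∈ D₁, ∀ v ∈ D₂, ¬ G.Adj u v :=
  ⟨comp G X a, X \ comp G X a, mem_comp_self ha, ⟨hb, fun hc => h hc.2⟩, disjoint_sdiff_right,
    union_sdiff_self.trans (union_eq_right.2 (comp_subset _ _)), fun _ hu _ hv huv =>
      hv.2 (mem_comp_of_adj hu hv.1 huv)⟩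

lemma TGood.combine {Γ L D₁ D₂ : Set V} {r z : V} {c₁ c₂ : V → Fin 3}
    (hr : r ∈ L) (hz : z ∈ L) (hL : L ⊆ Γ) (hΓ : Γ ⊆ D₁ ∪ D₂ ∪ {r, z}) (hd : Disjoint D₁ D₂)
    (hrD : r ∉ D₂) (hzD : z ∉ D₂) (hno : ∀ u ∈ D₁, ∀ v ∈ D₂, ¬ G.Adj u v)
    (h₁ : TGood G (D₁ ∪ {r, z}) (L ∩ (D₁ ∪ {r, z})) c₁)
    (h₂ : TGood G (D₂ ∪ {r, z}) (L ∩ (D₂ ∪ {r, z})) c₂)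
    (er : c₁ r = c₂ r) (ez : c₁ z = c₂ z) :
    TGood G Γ L fun v => if v ∈ D₂ then c₂ v else c₁ v := by
  have e1 : ∀ v ∈ D₁ ∪ {r, z}, (if v ∈ D₂ then c₂ v else c₁ v) = c₁ v := by
    intro v hv
    refine if_neg fun h => ?_
    rcases hv with hv | rfl | rfl
    exacts [hd.notMem_of_mem_left hv h, hrD h, hzD h]
  have e2 : ∀ v ∈ D₂ ∪ {r, z}, (if v ∈ D₂ then c₂ v else c₁ v) = c₂ v := by
    rintro v (hv | rfl | rfl)
    · exact if_pos hv
    · rw [if_neg hrD, er]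
    · rw [if_neg hzD, ez]
  have side : ∀ v ∈ Γ, v ∉ D₂ → v ∈ D₁ ∪ {r, z} := by
    intro v hv h
    rcases hΓ hv with (h1 | h1) | h1
    exacts [.inl h1, absurd h1 h, .inr h1]
  have side' : ∀ v ∈ Γ, v ∉ D₁ → v ∈ D₂ ∪ {r, z} := by
    intro v hv h
    rcases hΓ hv with (h1 | h1) | h1
    exacts [absurd h1 h, .inl h1, .inr h1]
  constructor
  · intro u hu v hv huv
    by_cases h : u ∉ D₂ ∧ v ∉ D₂
    · have h1 := side u (hL hu) h.1
      have h2 := side v (hL hv) h.2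
      rw [e1 u h1, e1 v h2]
      exact h₁.proper u ⟨hu, h1⟩ v ⟨hv, h2⟩ huv
    · have h' : u ∉ D₁ ∧ v ∉ D₁ := by
        rw [not_and_or, not_not, not_not] at h
        rcases h with h | h
        · exact ⟨hd.notMem_of_mem_right h, fun hc => hno v hc u h huv.symm⟩
        · exact ⟨fun hc => hno u hc v h huv, hd.notMem_of_mem_right h⟩
      have h1 := side' u (hL hu) h'.1
      have h2 := side' v (hL hv) h'.2
      rw [e2 u h1, e2 v h2]
      exact h₂.proper u ⟨hu, h1⟩ v ⟨hv, h2⟩ huv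
  · intro u hu v hv huv cu cv K hK hKc tu tv
    beta_reduce at cu cv
    have hKD : ∀ k ∈ K, k ∈ D₁ ∨ k ∈ D₂ := by
      intro k hk
      rcases hΓ (hK hk).1 with h | rfl | rfl
      exacts [h, absurd hr (hK hk).2, absurd hz (hK hk).2]
    by_cases h : (K ∩ D₁).Nonempty
    · have hK1 : K ⊆ D₁ := by
        intro k hk
        by_contra hkD
        obtain ⟨a, ha, b, hb, hab⟩ := hKc.exists_cross h ⟨k, hk, hkD⟩
        exact hno a ha.2 b ((hKD b hb.1).resolve_left hb.2) hab
      have aux : ∀ w ∈ L, Touch G {w} K → w ∈ D₁ ∪ {r, z} := by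
        intro w hw ht
        obtain ⟨k, hk, hwk⟩ := touch_singleton_left.1 ht
        exact side w (hL hw) fun hc => hno k (hK1 hk) w hc hwk.symm
      have h1 := aux u hu tu
      have h2 := aux v hv tv
      rw [e1 u h1] at cu
      rw [e1 v h2] at cv
      exact h₁.sep u ⟨hu, h1⟩ v ⟨hv, h2⟩ huv cu cv K
        (fun k hk => ⟨.inl (hK1 hk), fun hc => (hK hk).2 hc.1⟩) hKc tu tv
    · have hK2 : K ⊆ D₂ := fun k hk => (hKD k hk).resolve_left fun hc => h ⟨k, hk, hc⟩
      have aux : ∀ w ∈ L, Touch G {w} K → w ∈ D₂ ∪ {r, z} := by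
        intro w hw ht
        obtain ⟨k, hk, hwk⟩ := touch_singleton_left.1 ht
        exact side' w (hL hw) fun hc => hno w hc k (hK2 hk) hwk
      have h1 := aux u hu tu
      have h2 := aux v hv tv
      rw [e2 u h1] at cu
      rw [e2 v h2] at cv
      exact h₂.sep u ⟨hu, h1⟩ v ⟨hv, h2⟩ huv cu cv K
        (fun k hk => ⟨.inl (hK2 hk), fun hc => (hK hk).2 hc.1⟩) hKc tu tv

lemma NoMinor.ident (hG : NoMinor G) {x z : V} (h : G.Adj x z) : NoMinor (ident G x z) := by
  let R : V → Set V := fun v => if v = x then {x, z} else if v = z then ∅ else {v}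
  have hx : R x = {x, z} := if_pos rfl
  have hz : R z = ∅ := by simp [R, h.ne']
  have hv : ∀ v, v ≠ x → v ≠ z → R v = {v} := fun v h1 h2 => by simp [R, h1, h2]
  refine hG.of_branch R (fun v hne => ?_) (fun u v huv => ?_) fun u v huv => ?_
  · by_cases h1 : v = x
    · rw [h1, hx]
      exact isConn_pair h
    by_cases h2 : v = z
    · rw [h2, hz] at hne
      exact absurd hne not_nonempty_empty
    rw [hv v h1 h2]
    exact isConn_singleton v
  · rw [Set.disjoint_left]
    intro a ha hb
    simp only [R] at ha hb
    split_ifs at ha hb <;> grind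
  · obtain ⟨h1, h2, h3, h4⟩ := huv
    have mem : ∀ w, w ≠ z → w ∈ R w := by
      intro w hw
      by_cases hwx : w = x
      · rw [hwx, hx]; simp
      · rw [hv w hwx hw]; rfl
    rcases h4 with h4 | ⟨rfl, h4⟩ | ⟨rfl, h4⟩
    · exact ⟨u, mem u h1, v, mem v h2, h4⟩
    · exact ⟨z, by rw [hx]; simp, v, mem v h2, h4⟩
    · exact ⟨u, mem u h1, z, by rw [hx]; simp, h4.symm⟩

lemma ident_adj_of_adj {x z a b : V} (h : G.Adj a b) (ha : a ≠ z) (hb : b ≠ z) :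
    (ident G x z).Adj a b := ⟨ha, hb, h.ne, .inl h⟩

lemma IsConn.ident {x z : V} {K : Set V} (h : IsConn G K) (hz : z ∉ K) :
    IsConn (LocalGirth.ident G x z) K :=
  h.mono_graph fun _ ha _ hb hab => ident_adj_of_adj hab (fun hc => hz (hc ▸ ha))
    fun hc => hz (hc ▸ hb)

lemma Touch.ident {x z : V} {A B : Set V} (h : Touch G A B) (hA : z ∉ A) (hB : z ∉ B) :
    Touch (LocalGirth.ident G x z) A B := by
  obtain ⟨a, ha, b, hb, hab⟩ := h
  exact ⟨a, ha, b, hb, ident_adj_of_adj hab (fun hc => hA (hc ▸ ha)) fun hc => hB (hc ▸ hb)⟩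

lemma TSetup.ident {Γ W L : Set V} (h : TSetup G Γ W L) {x z : V} (hxz : G.Adj x z)
    (hz : z ∈ Γ) : TSetup (LocalGirth.ident G x z) (Γ \ {z}) W (L \ {z}) := by
  have hzW : z ∉ W := h.disj.notMem_of_mem_left hz
  refine ⟨h.noMinor.ident hxz, h.conn.ident hzW, h.disj.mono_left sdiff_subset,
    sdiff_subset_sdiff_left h.sub, fun l hl => (h.touch l hl.1).ident ?_ hzW⟩
  exact fun hc => hl.2 hc.symm

end

end LocalGirth

namespace LocalGirth

open Set

set_option linter.unusedSectionVars false

section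

open scoped Classical

universe u

variable {V : Type u} [Finite V] {G : SimpleGraph V}

/-- Extension from a precoloured edge, for small sets. -/
def EdgeExtends (V : Type u) (n : ℕ) : Prop :=
  ∀ (G : SimpleGraph V) (Γ W L : Set V), TSetup G Γ W L → Γ.ncard < n →
    ∀ r ∈ L, ∀ y ∈ L, G.Adj r y → ∀ α β : Fin 3, α ≠ β → ∃ c, TGood G Γ L c ∧ c r = α ∧ c y = β

/-- Extension from a precoloured vertex, for small sets. -/
def VertexExtends (V : Type u) (n : ℕ) : Prop :=
  ∀ (G : SimpleGraph V) (Γ W L : Set V), TSetup G Γ W L → Γ.ncard < n →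
    ∀ y ∈ L, ∀ α : Fin 3, ∃ c, TGood G Γ L c ∧ c y = α

/-- Adding a vertex that cannot cause a conflict. -/
lemma TGood.extend {Γ L : Set V} {c : V → Fin 3} {r : V} {α : Fin 3} (hr : r ∈ L)
    (h : TGood G (Γ \ {r}) (L \ {r}) c) (hp : ∀ v ∈ L, G.Adj r v → α ≠ c v)
    (ht : α = 2 → ∀ v ∈ Γ \ L, ¬ G.Adj r v) : TGood G Γ L (Function.update c r α) := by
  have hne : ∀ v, v ≠ r → Function.update c r α v = c v := fun v hv =>
    Function.update_of_ne hv _ _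
  have hrr : Function.update c r α r = α := Function.update_self _ _ _
  have hK : ∀ K ⊆ Γ \ L, K ⊆ (Γ \ {r}) \ (L \ {r}) := fun K hK k hk =>
    ⟨⟨(hK hk).1, fun hc => (hK hk).2 (hc ▸ hr)⟩, fun hc => (hK hk).2 hc.1⟩
  have noK : α = 2 → ∀ K ⊆ Γ \ L, ¬ Touch G {r} K := by
    rintro h2 K hK hT
    obtain ⟨k, hk, hrk⟩ := touch_singleton_left.1 hT
    exact ht h2 k (hK hk) hrk
  constructor
  · intro u hu v hv huv
    by_cases h1 : u = r
    · subst h1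
      rw [hrr, hne v huv.ne']
      exact hp v hv huv
    by_cases h2 : v = r
    · subst h2
      rw [hrr, hne u h1]
      exact (hp u hu huv.symm).symm
    rw [hne u h1, hne v h2]
    exact h.proper u ⟨hu, h1⟩ v ⟨hv, h2⟩ huv
  · intro u hu v hv huv cu cv K hKs hKc tu tv
    by_cases h1 : u = r
    · subst h1
      rw [hrr] at cu
      exact noK cu K hKs tu
    by_cases h2 : v = r
    · subst h2
      rw [hrr] at cv
      exact noK cv K hKs tv
    rw [hne u h1] at cu
    rw [hne v h2] at cv
    exact h.sep u ⟨hu, h1⟩ v ⟨hv, h2⟩ huv cu cv K (hK K hKs) hKc tu tv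

lemma TGood.of_ident {Γ L : Set V} {c : V → Fin 3} {z r : V} (hr : r ∉ Γ) (hL : L ⊆ Γ)
    (h : TGood (LocalGirth.ident G z r) Γ L c) : TGood G Γ L c := by
  have hrL : ∀ v ∈ L, v ≠ r := fun v hv hc => hr (hL (hc ▸ hv))
  refine ⟨fun u hu v hv huv => h.proper u hu v hv (ident_adj_of_adj huv (hrL u hu) (hrL v hv)),
    fun u hu v hv huv cu cv K hK hKc tu tv => ?_⟩
  have hrK : r ∉ K := fun hc => hr (hK hc).1
  exact h.sep u hu v hv huv cu cv K hK (hKc.ident hrK)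
    (tu.ident (fun hc => hrL u hu hc.symm) hrK) (tv.ident (fun hc => hrL v hv hc.symm) hrK)

/-- Undoing the contraction of an uncoloured vertex into a vertex of colour `2`. -/
lemma TGood.of_ident_two {Γ L : Set V} {c : V → Fin 3} {y k : V} (hy : y ∈ L) (hk : k ∉ L)
    (hyk : G.Adj y k) (hc : c y = 2)
    (h : TGood (LocalGirth.ident G y k) (Γ \ {k}) L c) : TGood G Γ L c := by
  have hkL : ∀ v ∈ L, v ≠ k := fun v hv hc => hk (hc ▸ hv)
  have hprop : ∀ u ∈ L, ∀ v ∈ L, G.Adj u v → c u ≠ c v := fun u hu v hv huv =>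
    h.proper u hu v hv (ident_adj_of_adj huv (hkL u hu) (hkL v hv))
  have key : ∀ u ∈ L, u ≠ y → c u = 2 → ∀ K ⊆ Γ \ L, IsConn G K → k ∈ K → ¬ Touch G {u} K := by
    intro u hu huy cu K hK hKc hkK hT
    obtain ⟨a, ha, hua⟩ := touch_singleton_left.1 hT
    by_cases hak : a = k
    · subst hak
      refine h.proper u hu y hy ⟨hkL u hu, hyk.ne, huy, .inr (.inr ⟨rfl, hua.symm⟩)⟩ ?_
      rw [cu, hc]
    have haK : a ∈ K \ {k} := ⟨ha, hak⟩
    have hsub := comp_subset (G := G) (K \ {k}) a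
    have hkC : k ∉ comp G (K \ {k}) a := fun hc => (hsub hc).2 rfl
    have hCc : IsConn G (comp G (K \ {k}) a) := isConn_comp haK
    obtain ⟨p, hp, q, hq, hpq⟩ := hKc.exists_cross (A := comp G (K \ {k}) a)
      ⟨a, ha, mem_comp_self haK⟩ ⟨k, hkK, hkC⟩
    have hqk : q = k := by
      by_contra hqk
      exact hq.2 (mem_comp_of_adj hp.2 ⟨hq.1, hqk⟩ hpq)
    subst hqk
    refine h.sep u hu y hy huy cu hc (comp G (K \ {q}) a) (fun v hv => ?_) (hCc.ident hkC)
      ?_ ?_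
    · have := hsub hv
      exact ⟨⟨(hK this.1).1, this.2⟩, (hK this.1).2⟩
    · exact touch_singleton_left.2 ⟨a, mem_comp_self haK,
        ident_adj_of_adj hua (hkL u hu) hak⟩
    · refine touch_singleton_left.2 ⟨p, hp.2, hyk.ne, fun hc => hkC (hc ▸ hp.2), ?_,
        .inr (.inl ⟨rfl, hpq.symm⟩)⟩
      rintro rfl
      exact (hK hp.1).2 hy
  refine ⟨hprop, fun u hu v hv huv cu cv K hK hKc tu tv => ?_⟩
  by_cases hkK : k ∈ K
  · by_cases huy : u = y
    · subst huy
      exact key v hv huv.symm cv K hK hKc hkK tv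
    · exact key u hu huy cu K hK hKc hkK tu
  · exact h.sep u hu v hv huv cu cv K
      (fun w hw => ⟨⟨(hK hw).1, fun hc => hkK (hc ▸ hw)⟩, (hK hw).2⟩) (hKc.ident hkK)
      (tu.ident (fun hc => hkL u hu hc.symm) hkK) (tv.ident (fun hc => hkL v hv hc.symm) hkK)

lemma exists_third (α β : Fin 3) : ∃ γ : Fin 3, γ ≠ α ∧ γ ≠ β := by
  revert α β
  decide

lemma ncard_sdiff_singleton_lt' {Γ : Set V} {z : V} {n : ℕ} (hz : z ∈ Γ) (h : Γ.ncard < n + 1) :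
    (Γ \ {z}).ncard < n := by
  have := ncard_sdiff_singleton_lt_of_mem hz
  omega

lemma edgeExtends_aux {n : ℕ} (hE : EdgeExtends V n) (hV : VertexExtends V n)
    {Γ W L : Set V} (h : TSetup G Γ W L) (hn : Γ.ncard < n + 1) {r y : V} (hr : r ∈ L)
    (hy : y ∈ L) (hry : G.Adj r y) {α β : Fin 3} (hαβ : α ≠ β) (hα : α ≠ 2) :
    ∃ c, TGood G Γ L c ∧ c r = α ∧ c y = β := by
  by_cases hsp : ∃ z ∈ L, G.Adj r z ∧ ∃ a ∈ Γ \ {r, z}, ∃ b ∈ Γ \ {r, z},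
      ¬ Reach G (Γ \ {r, z}) a b
  · obtain ⟨z, hz, hrz, a, ha, b, hb, hab⟩ := hsp
    obtain ⟨D₁, D₂, hy2, hD₁, hD₂, hd, hU, hno⟩ : ∃ D₁ D₂ : Set V, y ∉ D₂ ∧ D₁.Nonempty ∧
        D₂.Nonempty ∧ Disjoint D₁ D₂ ∧ D₁ ∪ D₂ = Γ \ {r, z} ∧
        ∀ u ∈ D₁, ∀ v ∈ D₂, ¬ G.Adj u v := by
      by_cases hyz : y = z
      · obtain ⟨D₁, D₂, h1, h2, h3, h4, h5⟩ := exists_split ha hb hab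
        refine ⟨D₁, D₂, fun hc => ?_, ⟨a, h1⟩, ⟨b, h2⟩, h3, h4, h5⟩
        have : y ∈ Γ \ {r, z} := h4 ▸ Or.inr hc
        exact this.2 (by simp [hyz])
      · have hyΓ : y ∈ Γ \ {r, z} := ⟨h.sub hy, by simp [hyz, hry.ne']⟩
        obtain ⟨d, hd, hyd⟩ : ∃ d ∈ Γ \ {r, z}, ¬ Reach G (Γ \ {r, z}) y d := by
          by_contra! hc
          exact hab ((hc a ha).symm.trans (hc b hb))
        obtain ⟨D₁, D₂, h1, h2, h3, h4, h5⟩ := exists_split hyΓ hd hyd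
        exact ⟨D₁, D₂, h3.notMem_of_mem_left h1, ⟨y, h1⟩, ⟨d, h2⟩, h3, h4, h5⟩
    have hrΓ := h.sub hr
    have hzΓ := h.sub hz
    have hD : ∀ v, v ∈ D₁ ∨ v ∈ D₂ → v ∈ Γ ∧ v ≠ r ∧ v ≠ z := by
      intro v hv
      have : v ∈ Γ \ {r, z} := hU ▸ hv
      simpa using this
    have hr2 : r ∉ D₂ := fun hc => (hD r (.inr hc)).2.1 rfl
    have hz2 : z ∉ D₂ := fun hc => (hD z (.inr hc)).2.2 rfl
    have hr1 : r ∉ D₁ := fun hc => (hD r (.inl hc)).2.1 rfl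
    have hz1 : z ∉ D₁ := fun hc => (hD z (.inl hc)).2.2 rfl
    have hΓ : Γ ⊆ D₁ ∪ D₂ ∪ {r, z} := by
      intro v hv
      by_cases hv' : v ∈ ({r, z} : Set V)
      · exact .inr hv'
      · exact .inl (hU ▸ ⟨hv, hv'⟩)
    have sub : ∀ D : Set V, (∀ v ∈ D, v ∈ Γ) → D ∪ {r, z} ⊆ Γ := by
      rintro D hD v (hv | rfl | rfl)
      exacts [hD v hv, hrΓ, hzΓ]
    have sub1 := sub D₁ fun v hv => (hD v (.inl hv)).1
    have sub2 := sub D₂ fun v hv => (hD v (.inr hv)).1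
    have lt1 : (D₁ ∪ {r, z}).ncard < n := by
      obtain ⟨d, hd2⟩ := hD₂
      refine lt_of_lt_of_le (ncard_lt_ncard ⟨sub1, fun hc => ?_⟩ (toFinite _)) (by omega)
      have hdD := hD d (.inr hd2)
      rcases hc hdD.1 with h1 | h1 | h1
      exacts [hd.notMem_of_mem_left h1 hd2, hdD.2.1 h1, hdD.2.2 h1]
    have lt2 : (D₂ ∪ {r, z}).ncard < n := by
      obtain ⟨d, hd2⟩ := hD₁
      refine lt_of_lt_of_le (ncard_lt_ncard ⟨sub2, fun hc => ?_⟩ (toFinite _)) (by omega)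
      have hdD := hD d (.inl hd2)
      rcases hc hdD.1 with h1 | h1 | h1
      exacts [hd.notMem_of_mem_left hd2 h1, hdD.2.1 h1, hdD.2.2 h1]
    have hy1 : y ∈ D₁ ∪ {r, z} := by
      rcases hΓ (h.sub hy) with (h1 | h1) | h1
      exacts [.inl h1, absurd h1 hy2, .inr h1]
    have hri : ∀ D : Set V, r ∈ L ∩ (D ∪ {r, z}) := fun D => ⟨hr, by simp⟩
    have hzi : ∀ D : Set V, z ∈ L ∩ (D ∪ {r, z}) := fun D => ⟨hz, by simp⟩
    obtain ⟨c₁, g₁, cr, cy⟩ := hE G _ W _ (h.restrict sub1) lt1 r (hri _) y ⟨hy, hy1⟩ hry α β hαβ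
    have hne := g₁.proper r (hri _) z (hzi _) hrz
    obtain ⟨c₂, g₂, er, ez⟩ := hE G _ W _ (h.restrict sub2) lt2 r (hri _) z (hzi _) hrz _ _ hne
    refine ⟨_, TGood.combine hr hz h.sub hΓ hd hr2 hz2 hno g₁ g₂ er.symm ez.symm, ?_, ?_⟩
    · rw [if_neg hr2, cr]
    · rw [if_neg hy2, cy]
  push Not at hsp
  have hrΓ := h.sub hr
  have hyr : y ∈ L \ {r} := ⟨hy, hry.ne'⟩
  have hlt := ncard_sdiff_singleton_lt' hrΓ hn
  by_cases hN : ∃ z ∈ L, z ≠ y ∧ G.Adj r z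
  · obtain ⟨z, hz, hzy, hrz⟩ := hN
    have huniq : ∀ v ∈ L, G.Adj r v → v = y ∨ v = z := by
      intro v hv hrv
      by_contra! hc
      have hrW : r ∉ W := h.disj.notMem_of_mem_left hrΓ
      have hΩ : ∀ w ∈ L, G.Adj r w → ({w} : Set V) ⊆ Γ \ {r} := by
        rintro w hw hrw _ rfl
        exact ⟨h.sub hw, hrw.ne'⟩
      have hre : ∀ a ∈ L, ∀ b ∈ L, ∀ d ∈ L, G.Adj r a → G.Adj r b → G.Adj r d → a ≠ d →
          b ≠ d → ∃ a' ∈ ({a} : Set V), ∃ b' ∈ ({b} : Set V),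
            Reach G ((Γ \ {r}) \ {d}) a' b' := by
        intro a ha b hb d hd hra hrb hrd had hbd
        refine ⟨a, rfl, b, rfl, ?_⟩
        refine (hsp d hd hrd a ⟨h.sub ha, ?_⟩ b ⟨h.sub hb, ?_⟩).mono ?_
        · simp [had, hra.ne']
        · simp [hbd, hrb.ne']
        · rintro w ⟨hw, hw'⟩
          simp only [mem_insert_iff, mem_singleton_iff, not_or] at hw'
          exact ⟨⟨hw, hw'.1⟩, hw'.2⟩
      refine h.noMinor.three_connectors (S := {r}) (S' := W) (Ω := Γ \ {r}) (C₁ := {y})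
        (C₂ := {z}) (C₃ := {v}) (isConn_singleton _) h.conn (disjoint_singleton_left.2 hrW)
        (h.touch r hr) (disjoint_sdiff_right) (h.disj.symm.mono_right sdiff_subset)
        (isConn_singleton _) (isConn_singleton _) (isConn_singleton _)
        (hΩ y hy hry) (hΩ z hz hrz) (hΩ v hv hrv)
        (by simpa using hzy.symm) (by simpa using hc.1.symm) (by simpa using hc.2.symm)
        (touch_of_adj hry rfl rfl) (touch_of_adj hrz rfl rfl) (touch_of_adj hrv rfl rfl)
        (h.touch y hy).symm (h.touch z hz).symm (h.touch v hv).symm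
        (hre y hy z hz v hv hry hrz hrv hc.1.symm hc.2.symm)
        (hre z hz v hv y hy hrz hrv hry hzy hc.1)
        (hre v hv y hy z hz hrv hry hrz hc.2 hzy.symm)
    obtain ⟨γ, hγα, hγβ⟩ := exists_third α β
    have hadj : (LocalGirth.ident G z r).Adj z y :=
      ⟨hrz.ne', hry.ne', hzy, .inr (.inl ⟨rfl, hry⟩)⟩
    obtain ⟨c, hc, cz, cy⟩ := hE _ _ W _ (h.ident hrz.symm hrΓ) hlt z ⟨hz, hrz.ne'⟩ y hyr hadj
      γ β hγβ
    have hrL : r ∉ L \ {r} := fun hc => hc.2 rfl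
    refine ⟨_, (hc.of_ident (fun h => h.2 rfl) (sdiff_subset_sdiff_left h.sub)).extend hr ?_ (fun h2 => absurd h2 hα),
      Function.update_self _ _ _, ?_⟩
    · intro v hv hrv
      rcases huniq v hv hrv with rfl | rfl
      · rw [cy]; exact hαβ
      · rw [cz]; exact hγα.symm
    · rw [Function.update_of_ne hry.ne', cy]
  · push Not at hN
    obtain ⟨c, hc, cy⟩ := hV _ _ W _ ⟨h.noMinor, h.conn, h.disj.mono_left sdiff_subset,
      sdiff_subset_sdiff_left h.sub, fun l hl => h.touch l hl.1⟩ hlt y hyr β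
    refine ⟨_, hc.extend hr ?_ (fun h2 => absurd h2 hα), Function.update_self _ _ _, ?_⟩
    · intro v hv hrv
      by_cases hvy : v = y
      · rw [hvy, cy]; exact hαβ
      · exact absurd hrv (hN v hv hvy)
    · rw [Function.update_of_ne hry.ne', cy]

lemma edgeExtends_succ {n : ℕ} (hE : EdgeExtends V n) (hV : VertexExtends V n) :
    EdgeExtends V (n + 1) := by
  intro G Γ W L h hn r hr y hy hry α β hαβ
  by_cases hα : α = 2
  · obtain ⟨c, hc, cy, cr⟩ := edgeExtends_aux hE hV h hn hy hr hry.symm hαβ.symm (by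
      rintro rfl
      exact hαβ hα)
    exact ⟨c, hc, cr, cy⟩
  · exact edgeExtends_aux hE hV h hn hr hy hry hαβ hα

lemma vertexExtends_succ {n : ℕ} (hE : EdgeExtends V (n + 1)) (hV : VertexExtends V n) :
    VertexExtends V (n + 1) := by
  intro G Γ W L h hn y hy α
  have hyΓ := h.sub hy
  by_cases h1 : ∃ r ∈ L, G.Adj r y
  · obtain ⟨r, hr, hry⟩ := h1
    obtain ⟨γ, hγ, -⟩ := exists_third α α
    obtain ⟨c, hc, -, cy⟩ := hE G Γ W L h hn r hr y hy hry γ α hγ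
    exact ⟨c, hc, cy⟩
  push Not at h1
  by_cases h2 : α = 2 ∧ ∃ k ∈ Γ \ L, G.Adj y k
  · obtain ⟨rfl, k, hk, hyk⟩ := h2
    have hLk : L \ {k} = L := sdiff_singleton_eq_self hk.2
    have hs := h.ident hyk hk.1
    rw [hLk] at hs
    obtain ⟨c, hc, cy⟩ := hV _ _ W _ hs (ncard_sdiff_singleton_lt' hk.1 hn) y hy 2
    exact ⟨c, hc.of_ident_two hy hk.2 hyk cy, cy⟩
  have hα : α = 2 → ∀ v ∈ Γ \ L, ¬ G.Adj y v := fun ha v hv hyv => h2 ⟨ha, v, hv, hyv⟩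
  obtain ⟨c, hc⟩ : ∃ c, TGood G (Γ \ {y}) (L \ {y}) c := by
    by_cases hne : (L \ {y}).Nonempty
    · obtain ⟨l, hl⟩ := hne
      obtain ⟨c, hc, -⟩ := hV G _ W _ ⟨h.noMinor, h.conn, h.disj.mono_left sdiff_subset,
        sdiff_subset_sdiff_left h.sub, fun l hl => h.touch l hl.1⟩
        (ncard_sdiff_singleton_lt' hyΓ hn) l hl 0
      exact ⟨c, hc⟩
    · rw [not_nonempty_iff_eq_empty] at hne
      exact ⟨fun _ => 0, by simp [hne], by simp⟩
  exact ⟨_, hc.extend hy (fun v hv hyv => absurd hyv.symm (h1 v hv)) hα,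
    Function.update_self _ _ _⟩

lemma vertexExtends (n : ℕ) : EdgeExtends V n ∧ VertexExtends V n := by
  induction n with
  | zero =>
    exact ⟨fun G Γ W L _ hn => absurd hn (Nat.not_lt_zero _),
      fun G Γ W L _ hn => absurd hn (Nat.not_lt_zero _)⟩
  | succ n ih =>
    have := edgeExtends_succ ih.1 ih.2
    exact ⟨this, vertexExtends_succ this ih.2⟩

/-- There is a good colouring avoiding colour `2` on a set with at most one vertex in every
component. -/
theorem TSetup.exists_good {Γ W L : Set V} (h : TSetup G Γ W L) (B : Set V) (hB : B ⊆ L)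
    (hB' : ∀ a ∈ B, ∀ b ∈ B, Reach G Γ a b → a = b) :
    ∃ c, TGood G Γ L c ∧ ∀ b ∈ B, c b ≠ 2 := by
  have key : ∀ v, ∃ c, TGood G (comp G Γ v) (L ∩ comp G Γ v) c ∧
      ∀ b ∈ B, b ∈ comp G Γ v → c b ≠ 2 := by
    intro v
    have hs := h.restrict (comp_subset (G := G) Γ v)
    by_cases hb : ∃ b ∈ B, b ∈ comp G Γ v
    · obtain ⟨b, hb, hbv⟩ := hb
      obtain ⟨c, hc, cb⟩ := (vertexExtends _).2 G _ W _ hs (Nat.lt_succ_self _) b ⟨hB hb, hbv⟩ 0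
      refine ⟨c, hc, fun b' hb' hbv' => ?_⟩
      have := hB' b hb b' hb' (hbv.2.symm.trans hbv'.2)
      subst this
      rw [cb]
      decide
    push Not at hb
    by_cases hl : (L ∩ comp G Γ v).Nonempty
    · obtain ⟨l, hl⟩ := hl
      obtain ⟨c, hc, -⟩ := (vertexExtends _).2 G _ W _ hs (Nat.lt_succ_self _) l hl 0
      exact ⟨c, hc, fun b hb' hbv => absurd hbv (hb b hb')⟩
    · rw [not_nonempty_iff_eq_empty] at hl
      rw [hl]
      exact ⟨fun _ => 0, ⟨by simp, by simp⟩, fun _ _ _ => show (0 : Fin 3) ≠ 2 by decide⟩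
  choose f hf using key
  let rep : V → V := fun v => if hv : (comp G Γ v).Nonempty then hv.some else v
  have hrep : ∀ u v, u ∈ Γ → v ∈ comp G Γ u → rep u = rep v ∧
      comp G Γ (rep u) = comp G Γ u ∧ comp G Γ v = comp G Γ u := by
    intro u v hu hv
    have e := comp_eq_of_mem hv
    have hne : (comp G Γ u).Nonempty := ⟨v, hv⟩
    have hru : rep u = hne.some := dif_pos hne
    have hne' : (comp G Γ v).Nonempty := e ▸ hne
    have hrv : rep v = hne'.some := dif_pos hne'
    have aux : ∀ S T : Set V, S = T → ∀ (hS : S.Nonempty) (hT : T.Nonempty), hS.some = hT.some := by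
      rintro S _ rfl _ _
      rfl
    refine ⟨by rw [hru, hrv, aux _ _ e.symm hne hne'], ?_, e⟩
    rw [hru]
    exact comp_eq_of_mem hne.some_mem
  refine ⟨fun v => f (rep v) v, ⟨fun u hu v hv huv => ?_, ?_⟩, fun b hb => ?_⟩
  · have hus := mem_comp_self (G := G) (h.sub hu)
    have hvs := mem_comp_of_adj hus (h.sub hv) huv
    obtain ⟨e1, e2, e3⟩ := hrep u v (h.sub hu) hvs
    rw [← e1]
    exact (hf (rep u)).1.proper u ⟨hu, e2 ▸ hus⟩ v ⟨hv, e2 ▸ hvs⟩ huv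
  · intro u hu v hv huv cu cv K hK hKc tu tv
    obtain ⟨k, hk, huk⟩ := touch_singleton_left.1 tu
    obtain ⟨l, hl, hvl⟩ := touch_singleton_left.1 tv
    have hus := mem_comp_self (G := G) (h.sub hu)
    have hks := mem_comp_of_adj hus (hK hk).1 huk
    have hKs : K ⊆ comp G Γ u := by
      rw [← comp_eq_of_mem hks]
      exact hKc.subset_comp (fun w hw => (hK hw).1) hk
    have hvs := mem_comp_of_adj (hKs hl) (h.sub hv) hvl.symm
    obtain ⟨e1, e2, e3⟩ := hrep u v (h.sub hu) hvs
    rw [← e1] at cv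
    exact (hf (rep u)).1.sep u ⟨hu, e2 ▸ hus⟩ v ⟨hv, e2 ▸ hvs⟩ huv cu cv K
      (fun w hw => ⟨e2 ▸ hKs hw, fun hc => (hK hw).2 hc.1⟩) hKc tu tv
  · have hbs := mem_comp_self (G := G) (h.sub (hB hb))
    obtain ⟨e1, e2, e3⟩ := hrep b b (h.sub (hB hb)) hbs
    exact (hf (rep b)).2 b hb (e2 ▸ hbs)

end

end LocalGirth

namespace LocalGirth

open Set

set_option linter.unusedSectionVars false

section

open scoped Classical

universe u

variable {V : Type u} {G : SimpleGraph V}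

/-- The vertices in no triangle. -/
def triFree (G : SimpleGraph V) : Set V := {v | ∀ a b, G.Adj v a → G.Adj v b → ¬ G.Adj a b}

/-- A proper colouring of `U` that is of the first kind on `S` and on the vertices in no
triangle. -/
structure IsOk (G : SimpleGraph V) (U S : Set V) (c : V → Fin 3 ⊕ Bool) : Prop where
  proper : ∀ u ∈ U, ∀ v ∈ U, G.Adj u v → c u ≠ c v
  left : ∀ v ∈ U, v ∈ S ∨ v ∈ triFree G → (c v).isLeft = true

structure Setup (G : SimpleGraph V) (U W S : Set V) : Prop where
  disj : Disjoint U W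
  conn : IsConn G W
  touch : ∀ s ∈ S, s ∈ U → Touch G {s} W

lemma IsOk.mono {U S U' S' : Set V} {c : V → Fin 3 ⊕ Bool} (h : IsOk G U S c) (hU : U' ⊆ U)
    (hS : ∀ v ∈ U', v ∈ S' → v ∈ S) : IsOk G U' S' c :=
  ⟨fun u hu v hv => h.proper u (hU hu) v (hU hv), fun v hv h' => h.left v (hU hv)
    (h'.imp_left (hS v hv))⟩

lemma IsOk.map {U S : Set V} {c : V → Fin 3 ⊕ Bool} (h : IsOk G U S c) (π : Equiv.Perm (Fin 3)) :
    IsOk G U S fun v => (c v).map π id :=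
  ⟨fun u hu v hv huv hc => h.proper u hu v hv huv
    (Sum.map_injective.2 ⟨π.injective, Function.injective_id⟩ hc),
    fun v hv h' => by simpa using h.left v hv h'⟩

lemma IsOk.congr {U S : Set V} {c c' : V → Fin 3 ⊕ Bool} (h : IsOk G U S c)
    (hc : ∀ v ∈ U, c' v = c v) : IsOk G U S c' :=
  ⟨fun u hu v hv huv => by rw [hc u hu, hc v hv]; exact h.proper u hu v hv huv,
    fun v hv h' => by rw [hc v hv]; exact h.left v hv h'⟩

lemma IsOk.glue {U S U₁ S₁ U₂ S₂ : Set V} {c₁ c₂ : V → Fin 3 ⊕ Bool} (h₁ : IsOk G U₁ S₁ c₁)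
    (h₂ : IsOk G U₂ S₂ c₂) (ha : ∀ v ∈ U₁, v ∈ U₂ → c₁ v = c₂ v)
    (hno : ∀ u ∈ U₁, u ∉ U₂ → ∀ v ∈ U₂, v ∉ U₁ → ¬ G.Adj u v) (hU : U ⊆ U₁ ∪ U₂)
    (hS : ∀ v ∈ U, v ∈ S → (v ∈ U₁ ∧ v ∈ S₁) ∨ (v ∈ U₂ ∧ v ∈ S₂)) : ∃ c, IsOk G U S c := by
  have e1 : ∀ v ∈ U₁, (if v ∈ U₁ then c₁ v else c₂ v) = c₁ v := fun v hv => if_pos hv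
  have e2 : ∀ v ∈ U₂, (if v ∈ U₁ then c₁ v else c₂ v) = c₂ v := by
    intro v hv
    split_ifs with h
    exacts [ha v h hv, rfl]
  refine ⟨fun v => if v ∈ U₁ then c₁ v else c₂ v, fun u hu v hv huv => ?_, fun v hv h => ?_⟩
  · by_cases h1 : u ∈ U₁ ∧ v ∈ U₁
    · rw [e1 u h1.1, e1 v h1.2]
      exact h₁.proper u h1.1 v h1.2 huv
    by_cases h2 : u ∈ U₂ ∧ v ∈ U₂
    · rw [e2 u h2.1, e2 v h2.2]
      exact h₂.proper u h2.1 v h2.2 huv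
    have hu' := hU hu
    have hv' := hU hv
    rcases hu' with hu' | hu' <;> rcases hv' with hv' | hv'
    · exact absurd ⟨hu', hv'⟩ h1
    · exact absurd huv (hno u hu' (fun hc => h2 ⟨hc, hv'⟩) v hv' fun hc => h1 ⟨hu', hc⟩)
    · exact absurd huv.symm (hno v hv' (fun hc => h2 ⟨hu', hc⟩) u hu' fun hc => h1 ⟨hc, hv'⟩)
    · exact absurd ⟨hu', hv'⟩ h2
  · rcases h with h | h
    · rcases hS v hv h with ⟨h1, h2⟩ | ⟨h1, h2⟩
      · rw [e1 v h1]; exact h₁.left v h1 (.inl h2)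
      · rw [e2 v h1]; exact h₂.left v h1 (.inl h2)
    · rcases hU hv with h1 | h1
      · rw [e1 v h1]; exact h₁.left v h1 (.inr h)
      · rw [e2 v h1]; exact h₂.left v h1 (.inr h)

lemma IsOk.insert_right {U S : Set V} {c : V → Fin 3 ⊕ Bool} (h : IsOk G U S c) {l : V}
    (hl : ∀ v ∈ U, G.Adj l v → (c v).isLeft = true) (hlS : l ∉ S) (hlT : l ∉ triFree G)
    (b : Bool) : IsOk G (insert l U) S (Function.update c l (.inr b)) := by
  have hself : Function.update c l (.inr b) l = .inr b := Function.update_self _ _ _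
  have hne : ∀ v, v ≠ l → Function.update c l (.inr b) v = c v := fun v hv =>
    Function.update_of_ne hv _ _
  constructor
  · rintro u hu v hv huv heq
    by_cases h1 : u = l
    · subst h1
      have hvU := hv.resolve_left huv.ne'
      rw [hself, hne v huv.ne'] at heq
      have := hl v hvU huv
      rw [← heq] at this
      simp at this
    by_cases h2 : v = l
    · subst h2
      have huU := hu.resolve_left h1
      rw [hself, hne u h1] at heq
      have := hl u huU huv.symm
      rw [heq] at this
      simp at this
    rw [hne u h1, hne v h2] at heq
    exact h.proper u (hu.resolve_left h1) v (hv.resolve_left h2) huv heq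
  · intro v hv h'
    by_cases h1 : v = l
    · subst h1
      exact absurd h' (not_or.2 ⟨hlS, hlT⟩)
    rw [hne v h1]
    exact h.left v (hv.resolve_left h1) h'

lemma exists_perm {α : Type*} {K : Set α} {f g : α → Fin 3} (hf : InjOn f K) (hg : InjOn g K) :
    ∃ π : Equiv.Perm (Fin 3), ∀ k ∈ K, π (f k) = g k := by
  let e : {x // x ∈ f '' K} ≃ {x // x ∈ g '' K} :=
    (Equiv.Set.imageOfInjOn f K hf).symm.trans (Equiv.Set.imageOfInjOn g K hg)
  refine ⟨e.extendSubtype, fun k hk => ?_⟩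
  rw [Equiv.extendSubtype_apply_of_mem e (f k) ⟨k, hk, rfl⟩]
  have : (Equiv.Set.imageOfInjOn f K hf).symm ⟨f k, ⟨k, hk, rfl⟩⟩ = ⟨k, hk⟩ := by
    rw [Equiv.symm_apply_eq]
    rfl
  simp only [e, Equiv.trans_apply, this]
  rfl

/-- Colourings can be matched on a clique. -/
lemma IsOk.exists_match {U S U' S' K : Set V} {c c' : V → Fin 3 ⊕ Bool} (h : IsOk G U S c)
    (h' : IsOk G U' S' c') (hK : ∀ a ∈ K, ∀ b ∈ K, a ≠ b → G.Adj a b) (hU : K ⊆ U) (hU' : K ⊆ U')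
    (hl : ∀ k ∈ K, (c k).isLeft = true) (hl' : ∀ k ∈ K, (c' k).isLeft = true) :
    ∃ π : Equiv.Perm (Fin 3), ∀ k ∈ K, (c k).map π id = c' k := by
  let f : V → Fin 3 := fun v => (c v).elim id fun _ => 0
  let g : V → Fin 3 := fun v => (c' v).elim id fun _ => 0
  have hf : ∀ k ∈ K, c k = .inl (f k) := by
    intro k hk
    obtain ⟨i, hi⟩ := Sum.isLeft_iff.1 (hl k hk)
    simp [f, hi]
  have hg : ∀ k ∈ K, c' k = .inl (g k) := by
    intro k hk
    obtain ⟨i, hi⟩ := Sum.isLeft_iff.1 (hl' k hk)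
    simp [g, hi]
  obtain ⟨π, hπ⟩ := exists_perm (K := K) (f := f) (g := g)
    (fun a ha b hb hab => by
      by_contra hne
      exact h.proper a (hU ha) b (hU hb) (hK a ha b hb hne) (by rw [hf a ha, hf b hb, hab]))
    (fun a ha b hb hab => by
      by_contra hne
      exact h'.proper a (hU' ha) b (hU' hb) (hK a ha b hb hne) (by rw [hg a ha, hg b hb, hab]))
  refine ⟨π, fun k hk => ?_⟩
  rw [hf k hk, hg k hk, Sum.map_inl, hπ k hk]

/-- A minimal situation in which no colouring exists. -/
structure Crit (G : SimpleGraph V) (U W S : Set V) : Prop where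
  noMinor : NoMinor G
  setup : Setup G U W S
  sub : S ⊆ U
  ih : ∀ U' W' S', Setup G U' W' S' → U' ⊂ U → ∃ c, IsOk G U' S' c
  bad : ¬ ∃ c, IsOk G U S c

variable {U W S : Set V}

lemma Crit.exists_not_adj (h : Crit G U W S) {l : V} (hl : l ∈ U) (hlS : l ∉ S)
    (hlT : l ∉ triFree G) : ∃ s ∈ S, ¬ G.Adj l s := by
  by_contra! hc
  obtain ⟨c, hc'⟩ := h.ih (U \ {l}) {l} (G.neighborSet l) ⟨by simp, isConn_singleton l,
    fun s hs _ => touch_of_adj (G.adj_symm hs) rfl rfl⟩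
    ⟨sdiff_subset, fun hs => (hs hl).2 rfl⟩
  refine h.bad ⟨_, (((hc'.mono (S' := S) subset_rfl fun v _ hv => hc v hv).insert_right
    (fun v hv hlv => hc'.left v hv (.inl hlv)) hlS hlT true)).mono ?_ fun _ _ h => h⟩
  intro v hv
  by_cases hvl : v = l
  exacts [.inl hvl, .inr ⟨hv, hvl⟩]

/-- Removing a clique of `S` does not disconnect `U`. -/
lemma Crit.reach (h : Crit G U W S) {K : Set V} (hKS : K ⊆ S)
    (hK : ∀ a ∈ K, ∀ b ∈ K, a ≠ b → G.Adj a b) {a b : V} (ha : a ∈ U \ K) (hb : b ∈ U \ K) :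
    Reach G (U \ K) a b := by
  by_contra hab
  obtain ⟨D₁, D₂, ha1, hb2, hd, hU, hno⟩ := exists_split ha hb hab
  have hD : ∀ v, v ∈ D₁ ∨ v ∈ D₂ → v ∈ U ∧ v ∉ K := fun v hv => by
    have : v ∈ U \ K := hU ▸ hv
    exact this
  have hKU := hKS.trans h.sub
  have hs1 : D₁ ∪ K ⊂ U := by
    refine ⟨union_subset (fun v hv => (hD v (.inl hv)).1) hKU, fun hc => ?_⟩
    rcases hc hb.1 with h1 | h1
    exacts [hd.notMem_of_mem_left h1 hb2, hb.2 h1]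
  have hs2 : D₂ ∪ K ⊂ U := by
    refine ⟨union_subset (fun v hv => (hD v (.inr hv)).1) hKU, fun hc => ?_⟩
    rcases hc ha.1 with h1 | h1
    exacts [hd.notMem_of_mem_left ha1 h1, ha.2 h1]
  have hset : ∀ X ⊂ U, Setup G X W S := fun X hX => ⟨h.setup.disj.mono_left hX.1, h.setup.conn,
    fun s hs hsX => h.setup.touch s hs (hX.1 hsX)⟩
  obtain ⟨c₁, h₁⟩ := h.ih _ _ _ (hset _ hs1) hs1
  obtain ⟨c₂, h₂⟩ := h.ih _ _ _ (hset _ hs2) hs2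
  obtain ⟨π, hπ⟩ := h₂.exists_match h₁ hK subset_union_right subset_union_right
    (fun k hk => h₂.left k (.inr hk) (.inl (hKS hk)))
    (fun k hk => h₁.left k (.inr hk) (.inl (hKS hk)))
  refine h.bad (h₁.glue (h₂.map π) ?_ ?_ ?_ ?_)
  · rintro v (hv | hv) (hv' | hv')
    · exact absurd hv' (hd.notMem_of_mem_left hv)
    · exact (hπ v hv').symm
    · exact (hπ v hv).symm
    · exact (hπ v hv).symm
  · rintro u (hu | hu) hu' v (hv | hv) hv'
    · exact hno u hu v hv
    · exact absurd (.inr hv) hv'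
    · exact absurd (.inr hu) hu'
    · exact absurd (.inr hu) hu'
  · intro v hv
    by_cases hvK : v ∈ K
    · exact .inl (.inr hvK)
    · have : v ∈ D₁ ∪ D₂ := hU ▸ ⟨hv, hvK⟩
      rcases this with h1 | h1
      exacts [.inl (.inl h1), .inr (.inl h1)]
  · intro v hv hvS
    by_cases hvK : v ∈ K
    · exact .inl ⟨.inr hvK, hvS⟩
    · have : v ∈ D₁ ∪ D₂ := hU ▸ ⟨hv, hvK⟩
      rcases this with h1 | h1
      exacts [.inl ⟨.inl h1, hvS⟩, .inr ⟨.inl h1, hvS⟩]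

lemma Crit.reach_edge (h : Crit G U W S) {s s' : V} (hs : s ∈ S) (hs' : s' ∈ S)
    (hss : G.Adj s s') {a b : V} (ha : a ∈ U \ {s, s'}) (hb : b ∈ U \ {s, s'}) :
    Reach G (U \ {s, s'}) a b := by
  refine h.reach ?_ ?_ ha hb
  · rintro v (rfl | rfl) <;> assumption
  · rintro a (rfl | rfl) b (rfl | rfl) hab
    exacts [absurd rfl hab, hss, hss.symm, absurd rfl hab]

/-- A common neighbour of two adjacent vertices of `S` does not cut anything off from `S`. -/
lemma Crit.reach_of_triangle (h : Crit G U W S) {s s' l : V} (hs : s ∈ S) (hs' : s' ∈ S)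
    (hss : G.Adj s s') (hl : l ∈ U) (hlS : l ∉ S) (hls : G.Adj l s) (hls' : G.Adj l s') {v : V}
    (hv : v ∈ U \ {s, s', l}) :
    ∃ t ∈ S, t ∈ U \ {s, s', l} ∧ Reach G (U \ {s, s', l}) v t := by
  by_contra! hcon
  set X : Set V := U \ {s, s', l} with hX
  have hlT : l ∉ triFree G := fun hc => hc s s' hls hls' hss
  set D := comp G X v with hDdef
  have hDX : D ⊆ X := comp_subset _ _
  have hDS : ∀ t ∈ D, t ∉ S := fun t ht htS => hcon t htS (hDX ht) ht.2
  have hvD : v ∈ D := mem_comp_self hv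
  have hDU : ∀ t ∈ D, t ∈ U := fun t ht => (hDX ht).1
  have hDK : ∀ t ∈ D, t ≠ s ∧ t ≠ s' ∧ t ≠ l := fun t ht => by simpa using (hDX ht).2
  have hsU := h.sub hs
  have hsU' := h.sub hs'
  have hsl : s ≠ l := hls.ne'
  have hsl' : s' ≠ l := hls'.ne'
  have hsub1 : U \ D ⊂ U := ⟨sdiff_subset, fun hc => (hc (hDU v hvD)).2 hvD⟩
  obtain ⟨c₁, h₁⟩ := h.ih (U \ D) W S ⟨h.setup.disj.mono_left sdiff_subset, h.setup.conn,
    fun s hs hsX => h.setup.touch s hs hsX.1⟩ hsub1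
  have hsD : s ∈ U \ D := ⟨hsU, fun hc => (hDK s hc).1 rfl⟩
  have hsD' : s' ∈ U \ D := ⟨hsU', fun hc => (hDK s' hc).2.1 rfl⟩
  have hlD : l ∈ U \ D := ⟨hl, fun hc => (hDK l hc).2.2 rfl⟩
  suffices hc : ∃ c₂, IsOk G (D ∪ {s, s', l}) ∅ c₂ ∧ c₂ s = c₁ s ∧ c₂ s' = c₁ s' ∧
      c₂ l = c₁ l by
    obtain ⟨c₂, h₂, e1, e2, e3⟩ := hc
    refine h.bad (h₁.glue h₂ ?_ ?_ ?_ ?_)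
    · rintro w hw (hw' | rfl | rfl | rfl)
      exacts [absurd hw' hw.2, e1.symm, e2.symm, e3.symm]
    · rintro u hu hu' w hw hw' huw
      have hwD : w ∈ D := by
        by_contra hwD
        rcases hw with hw | rfl | rfl | rfl
        exacts [hwD hw, hw' hsD, hw' hsD', hw' hlD]
      exact hu.2 (mem_comp_of_adj hwD ⟨hu.1, fun hc => hu' (.inr hc)⟩ huw.symm)
    · intro w hw
      by_cases hwD : w ∈ D
      exacts [.inr (.inl hwD), .inl ⟨hw, hwD⟩]
    · intro w hw hwS
      exact .inl ⟨⟨hw, fun hc => hDS w hc hwS⟩, hwS⟩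
  have left1 : (c₁ s).isLeft = true := h₁.left s hsD (.inl hs)
  have left1' : (c₁ s').isLeft = true := h₁.left s' hsD' (.inl hs')
  by_cases hleft : (c₁ l).isLeft = true
  · obtain ⟨s₀, hs₀, hls₀⟩ := h.exists_not_adj hl hlS hlT
    have hs₀X : s₀ ∈ X := by
      refine ⟨h.sub hs₀, ?_⟩
      rintro (rfl | rfl | rfl)
      exacts [hls₀ hls, hls₀ hls', hlS hs₀]
    set E := comp G X s₀ with hE
    have hEX : E ⊆ X := comp_subset _ _
    have hs₀E : s₀ ∈ E := mem_comp_self hs₀X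
    have htouch : Touch G {l} E := by
      have hr := h.reach_edge hs hs' hss (a := s₀) (b := l)
        ⟨hs₀X.1, fun hc => hs₀X.2 (by rcases hc with rfl | rfl <;> simp)⟩
        ⟨hl, by simp [hsl.symm, hsl'.symm]⟩
      obtain ⟨p, hp, q, hq, hpq⟩ := hr.exists_cross hs₀E (fun hc => (hEX hc).2 (by simp))
      have hql : q = l := by
        by_contra hql
        refine hq.2 (mem_comp_of_adj hp.2 ⟨hq.1.1, ?_⟩ hpq)
        rintro (rfl | rfl | rfl)
        exacts [hq.1.2 (by simp), hq.1.2 (by simp), hql rfl]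
      exact touch_singleton_left.2 ⟨p, hp.2, hql ▸ hpq.symm⟩
    have hDE : Disjoint D E := by
      rw [Set.disjoint_left]
      intro a haD haE
      have : E = D := by rw [hE, hDdef, ← comp_eq_of_mem haE, comp_eq_of_mem haD]
      exact hDS s₀ (this ▸ hs₀E) hs₀
    have hKE : ∀ k ∈ ({s, s', l} : Set V), k ∉ E := fun k hk hc => (hEX hc).2 hk
    have hKU : ({s, s', l} : Set V) ⊆ U := by rintro k (rfl | rfl | rfl) <;> assumption
    have hsub2 : D ∪ {s, s', l} ⊂ U := by
      refine ⟨union_subset hDU hKU, fun hc => ?_⟩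
      rcases hc hs₀X.1 with h1 | h1
      exacts [hDS s₀ h1 hs₀, hs₀X.2 h1]
    obtain ⟨c₂, h₂⟩ := h.ih (D ∪ {s, s', l}) (W ∪ E) {s, s', l}
      ⟨(disjoint_union_right.2 ⟨h.setup.disj.mono_left hsub2.1,
          disjoint_union_left.2 ⟨hDE, Set.disjoint_left.2 hKE⟩⟩),
        h.setup.conn.union (isConn_comp hs₀X)
          ((h.setup.touch s₀ hs₀ hs₀X.1).symm.right (singleton_subset_iff.2 hs₀E)),
        by
          rintro k (rfl | rfl | rfl) -
          · exact (h.setup.touch _ hs hsU).right subset_union_left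
          · exact (h.setup.touch _ hs' hsU').right subset_union_left
          · exact htouch.right subset_union_right⟩ hsub2
    obtain ⟨π, hπ⟩ := h₂.exists_match h₁ (K := {s, s', l})
      (by
        rintro a (rfl | rfl | rfl) b (rfl | rfl | rfl) hab
        all_goals first | exact absurd rfl hab | assumption | (apply G.adj_symm; assumption))
      subset_union_right (by rintro k (rfl | rfl | rfl) <;> assumption)
      (fun k hk => h₂.left k (.inr hk) (.inl hk))
      (by rintro k (rfl | rfl | rfl) <;> assumption)
    exact ⟨_, (h₂.map π).mono subset_rfl (by simp), hπ s (by simp), hπ s' (by simp),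
      hπ l (by simp)⟩
  · obtain ⟨b, hb⟩ : ∃ b, c₁ l = .inr b := by
      rw [Bool.not_eq_true, Sum.isLeft_eq_false] at hleft
      exact Sum.isRight_iff.1 hleft
    have hsub2 : D ∪ {s, s'} ⊂ U := by
      refine ⟨union_subset hDU (by rintro k (rfl | rfl) <;> assumption), fun hc => ?_⟩
      rcases hc hl with h1 | h1 | h1
      exacts [hlD.2 h1, hsl h1.symm, hsl' h1.symm]
    obtain ⟨c₂, h₂⟩ := h.ih (D ∪ {s, s'}) {l} (G.neighborSet l)
      ⟨by
        rw [disjoint_singleton_right]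
        rintro (h1 | h1 | h1)
        exacts [hlD.2 h1, hsl h1.symm, hsl' h1.symm], isConn_singleton l,
        fun k hk _ => touch_of_adj (G.adj_symm hk) rfl rfl⟩ hsub2
    obtain ⟨π, hπ⟩ := h₂.exists_match h₁ (K := {s, s'})
      (by
        rintro a (rfl | rfl) b (rfl | rfl) hab
        exacts [absurd rfl hab, hss, hss.symm, absurd rfl hab])
      subset_union_right (by rintro k (rfl | rfl) <;> assumption)
      (fun k hk => h₂.left k (.inr hk) (.inl (by rcases hk with rfl | rfl <;> assumption)))
      (by rintro k (rfl | rfl) <;> assumption)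
    have h₃ := ((h₂.map π).mono (S' := ∅) subset_rfl (by simp)).insert_right (l := l)
      (fun v hv hlv => (h₂.map π).left v hv (.inl hlv)) (by simp) hlT b
    refine ⟨_, h₃.mono ?_ (by simp), ?_, ?_, ?_⟩
    · rintro w (hw | rfl | rfl | rfl)
      exacts [.inr (.inl hw), .inr (.inr (.inl rfl)), .inr (.inr (.inr rfl)), .inl rfl]
    · rw [Function.update_of_ne hsl, hπ s (by simp)]
    · rw [Function.update_of_ne hsl', hπ s' (by simp)]
    · rw [Function.update_self, hb]

end

end LocalGirth

namespace LocalGirth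

open Set

set_option linter.unusedSectionVars false

section

open scoped Classical

universe u

variable {V : Type u} {G : SimpleGraph V}

/-- A graph without a cyclic arrangement of connected sets is bipartite. -/
lemma exists_twoCol {Y : Set V} (hY : Y.Finite)
    (hno : ∀ A B C, IsConn G A → IsConn G B → IsConn G C → A ⊆ Y → B ⊆ Y → C ⊆ Y →
      Disjoint A B → Disjoint A C → Disjoint B C → Touch G A B → Touch G A C → Touch G B C →
      False) : ∃ c : V → Bool, ∀ u ∈ Y, ∀ v ∈ Y, G.Adj u v → c u ≠ c v := by
  induction Y, hY using Set.Finite.induction_on with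
  | empty => exact ⟨fun _ => true, by simp⟩
  | @insert v Y hv _ ih =>
    have hsub : Y ⊆ insert v Y := subset_insert _ _
    obtain ⟨c, hc⟩ := ih fun A B C a b d a' b' d' => hno A B C a b d (a'.trans hsub)
      (b'.trans hsub) (d'.trans hsub)
    have huniq : ∀ a ∈ Y, ∀ b ∈ comp G Y a, G.Adj v a → G.Adj v b → a = b := by
      intro a ha b hb hva hvb
      by_contra hne
      have hvS : ({v} : Set V) ⊆ insert v Y := by simp
      have hbY := comp_subset _ _ hb
      have haS : ({a} : Set V) ⊆ insert v Y := by simp [ha]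
      have hbS : ({b} : Set V) ⊆ insert v Y := by simp [hbY]
      rcases hb.2.touch_or_exists (A := {a}) (B := {b}) rfl rfl (by simp [hne]) with ht | ht
      · exact hno {v} {a} {b} (isConn_singleton v) (isConn_singleton a) (isConn_singleton b) hvS
          haS hbS (by simp [hva.ne]) (by simp [hvb.ne]) (by simp [hne])
          (touch_of_adj hva rfl rfl) (touch_of_adj hvb rfl rfl) ht
      · obtain ⟨Q, hQ, hQc, t1, t2⟩ := ht
        have hQv : v ∉ Q := fun h => hv (hQ h).1
        have hQa : a ∉ Q := fun h => (hQ h).2 (.inl rfl)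
        refine hno {v} {a} ({b} ∪ Q) (isConn_singleton v) (isConn_singleton a)
          ((isConn_singleton b).union hQc t2.symm) hvS haS
          (union_subset hbS fun x hx => .inr (hQ hx).1) (by simp [hva.ne]) ?_ ?_
          (touch_of_adj hva rfl rfl) (touch_of_adj hvb rfl (.inl rfl)) (t1.right subset_union_right)
        · simp [hvb.ne, hQv]
        · simp [hne, hQa]
    let g : Set V → Bool := fun K => if h : ∃ a ∈ K, G.Adj v a then c h.choose else false
    have hg : ∀ a ∈ Y, G.Adj v a → g (comp G Y a) = c a := by
      intro a ha hva
      have h : ∃ b ∈ comp G Y a, G.Adj v b := ⟨a, mem_comp_self ha, hva⟩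
      have : a = h.choose := huniq a ha _ h.choose_spec.1 hva h.choose_spec.2
      simp only [g, dif_pos h]
      rw [← this]
    have hnbr : ∀ a ∈ insert v Y, G.Adj v a → (c a).xor (g (comp G Y a)) = false := by
      intro a ha hva
      rw [hg a (ha.resolve_left hva.ne') hva, Bool.xor_self]
    refine ⟨fun u => if u = v then true else (c u).xor (g (comp G Y u)), fun u hu w hw huw => ?_⟩
    by_cases h1 : u = v
    · subst h1
      simp only [if_true, if_neg huw.ne', hnbr w hw huw]
      simp
    by_cases h2 : w = v
    · subst h2
      simp only [if_true, if_neg huw.ne, hnbr u hu huw.symm]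
      simp
    have hu' := hu.resolve_left h1
    have hw' := hw.resolve_left h2
    have : comp G Y w = comp G Y u := comp_eq_of_mem (mem_comp_of_adj (mem_comp_self hu') hw' huw)
    simp only [if_neg h1, if_neg h2, this]
    have := hc u hu' w hw' huw
    cases hcu : c u <;> cases hcw : c w <;> simp_all

/-- The vertices joined to `S` by paths inside `S` and the vertices in no triangle. -/
def core (G : SimpleGraph V) (U S : Set V) : Set V :=
  {v | ∃ s ∈ S, v ∈ comp G (S ∪ (triFree G ∩ U)) s}

variable {U W S : Set V}

lemma subset_core : S ⊆ core G U S := fun s hs => ⟨s, hs, mem_comp_self (.inl hs)⟩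

lemma core_subset (hS : S ⊆ U) : core G U S ⊆ U := by
  rintro v ⟨s, -, hv⟩
  rcases comp_subset _ _ hv with h | h
  exacts [hS h, h.2]

lemma core_soft {v : V} (hv : v ∈ core G U S) : v ∈ S ∨ v ∈ triFree G := by
  obtain ⟨s, -, hv⟩ := hv
  exact (comp_subset _ _ hv).imp_right fun h => h.1

lemma mem_core_of_adj {v w : V} (hv : v ∈ core G U S) (hw : w ∈ U) (hvw : G.Adj v w)
    (h : w ∈ S ∨ w ∈ triFree G) : w ∈ core G U S := by
  obtain ⟨s, hs, hv⟩ := hv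
  exact ⟨s, hs, mem_comp_of_adj hv (h.imp_right fun h => ⟨h, hw⟩) hvw⟩

lemma Crit.isConn_core (h : Crit G U W S) : IsConn G (W ∪ core G U S) := by
  have := h.setup.conn.biUnion S (fun s => comp G (S ∪ (triFree G ∩ U)) s)
    (fun s hs => isConn_comp (.inl hs))
    (fun s hs => .inl ((h.setup.touch s hs (h.sub hs)).symm.right
      (singleton_subset_iff.2 (mem_comp_self (.inl hs)))))
  convert this using 2
  ext v
  simp [core]

lemma isConn_union_nbrs {A Y : Set V} (hA : IsConn G A) (hY : ∀ y ∈ Y, ∃ a ∈ A, G.Adj a y) :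
    IsConn G (A ∪ Y) := by
  have := hA.biUnion Y (fun y => {y}) (fun y _ => isConn_singleton y)
    (fun y hy => .inl (touch_singleton_right.2 (hY y hy)))
  rwa [biUnion_of_singleton] at this

lemma exists_perm_ne : ∀ x₁ x₂ y₁ y₂ : Fin 3, ∃ π : Equiv.Perm (Fin 3), π y₁ ≠ x₁ ∧ π y₂ ≠ x₂ := by
  decide

/-- The core cannot be split along at most two edges. -/
lemma Crit.no_split [Finite V] (h : Crit G U W S) {ML MR : Set V} (hM : ML ∪ MR = core G U S)
    (hd : Disjoint ML MR) (hL : ML.Nonempty) (hR : IsConn G MR) (hRS : (MR ∩ S).Nonempty)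
    (hLW : IsConn G (ML ∪ W)) {a₁ b₁ a₂ b₂ : V}
    (hab : ∀ u ∈ ML, ∀ v ∈ MR, G.Adj u v → u = a₁ ∧ v = b₁ ∨ u = a₂ ∧ v = b₂) : False := by
  have hML : ML ⊆ core G U S := hM ▸ subset_union_left
  have hMR : MR ⊆ core G U S := hM ▸ subset_union_right
  have hcU : core G U S ⊆ U := core_subset h.sub
  have hcore : ∀ v ∈ core G U S, v ∈ ML ∨ v ∈ MR := fun v hv => by rw [← hM] at hv; exact hv
  set A : Set V := {v | v ∈ U ∧ v ∉ core G U S ∧ ∃ m ∈ MR, G.Adj m v} with hA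
  set R : Set V := (U \ core G U S) \ A with hRdef
  set I : Set V := {u | u ∈ R ∧ ∃ m ∈ ML, G.Adj m u} with hI
  set P : Set V := ⋃ u ∈ I, comp G R u with hP
  have hPR : P ⊆ R := iUnion₂_subset fun u _ => comp_subset _ _
  have hPstep : ∀ p ∈ P, ∀ r ∈ R, G.Adj p r → r ∈ P := by
    intro p hp r hr hpr
    obtain ⟨u, hu, hp⟩ := mem_iUnion₂.1 hp
    exact mem_iUnion₂.2 ⟨u, hu, mem_comp_of_adj hp hr hpr⟩
  have hIP : I ⊆ P := fun u hu => mem_iUnion₂.2 ⟨u, hu, mem_comp_self hu.1⟩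
  set L : Set V := ML ∪ P with hLdef
  set Y : Set V := {y | y ∈ A ∧ ∃ x ∈ L, G.Adj x y} with hYdef
  set T : Set V := U \ (L ∪ Y) with hTdef
  have hLU : L ⊆ U := union_subset (hML.trans hcU) fun v hv => (hPR hv).1.1
  have hYL : ∀ y ∈ Y, y ∉ L := by
    rintro y hy (hc | hc)
    exacts [hy.1.2.1 (hML hc), (hPR hc).2 hy.1]
  have hMRL : ∀ v ∈ MR, v ∉ L := by
    rintro v hv (hc | hc)
    exacts [hd.notMem_of_mem_left hc hv, (hPR hc).1.2 (hMR hv)]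
  have hMRY : ∀ v ∈ MR, v ∉ Y := fun v hv hc => hc.1.2.1 (hMR hv)
  have hMRT : MR ⊆ T := fun v hv => ⟨hcU (hMR hv), fun hc => hc.elim (hMRL v hv) (hMRY v hv)⟩
  have hWU : ∀ v ∈ U, v ∉ W := fun v hv => h.setup.disj.notMem_of_mem_left hv
  have hYU : Y ⊆ U := fun y hy => hy.1.1
  have hsoft : ∀ y ∈ Y, ¬ (y ∈ S ∨ y ∈ triFree G) := by
    rintro y ⟨⟨hyU, hyc, m, hm, hmy⟩, -⟩ hc
    exact hyc (mem_core_of_adj (hMR hm) hyU hmy hc)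
  have hLT : ∀ u ∈ L, ∀ v ∈ T, G.Adj u v → u ∈ ML ∧ v ∈ MR := by
    intro u hu v hv huv
    have hvA : v ∉ A := fun hc => hv.2 (.inr ⟨hc, u, hu, huv⟩)
    by_cases hvc : v ∈ core G U S
    · have hvR : v ∈ MR := (hcore v hvc).resolve_left fun hc => hv.2 (.inl (.inl hc))
      refine ⟨hu.resolve_right fun hc => ?_, hvR⟩
      exact (hPR hc).2 ⟨(hPR hc).1.1, (hPR hc).1.2, v, hvR, huv.symm⟩
    · exfalso
      have hvR : v ∈ R := ⟨⟨hv.1, hvc⟩, hvA⟩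
      refine hv.2 (.inl (.inr ?_))
      rcases hu with hu | hu
      · exact hIP ⟨hvR, u, hu, huv⟩
      · exact hPstep u hu v hvR huv
  have hLWc : IsConn G (W ∪ L) := by
    have := hLW.biUnion I (fun u => comp G R u) (fun u hu => isConn_comp hu.1) (by
      rintro u ⟨hu, m, hm, hmu⟩
      exact .inl (touch_of_adj hmu (.inl hm) (mem_comp_self hu)))
    convert this using 1
    rw [hLdef, hP]
    ac_rfl
  obtain ⟨s₀, hs₀R, hs₀⟩ := hRS
  have hWMR : Touch G W MR := ((h.setup.touch s₀ hs₀ (h.sub hs₀)).left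
    (singleton_subset_iff.2 hs₀R)).symm
  have hW1 : IsConn G (W ∪ MR ∪ Y) := isConn_union_nbrs (h.setup.conn.union hR hWMR) (by
    rintro y ⟨⟨-, -, m, hm, hmy⟩, -⟩
    exact ⟨m, .inr hm, hmy⟩)
  have hW2 : IsConn G (W ∪ L ∪ Y) := isConn_union_nbrs hLWc (by
    rintro y ⟨-, x, hx, hxy⟩
    exact ⟨x, .inr hx, hxy⟩)
  have hTL : ∀ v ∈ T, v ∉ L := fun v hv hc => hv.2 (.inl hc)
  have hTY : ∀ v ∈ T, v ∉ Y := fun v hv hc => hv.2 (.inr hc)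
  obtain ⟨b, hb⟩ := exists_twoCol (Set.toFinite Y) (by
    intro A B C hA hB hC sA sB sC dAB dAC dBC tAB tAC tBC
    have d1 : ∀ X ⊆ Y, Disjoint MR X := fun X hX => disjoint_left.2 fun v hv hc =>
      hMRY v hv (hX hc)
    have d2 : ∀ X ⊆ Y, Disjoint (W ∪ L) X := fun X hX => disjoint_left.2 fun v hv hc =>
      hv.elim (hWU v (hYU (hX hc))) (hYL v (hX hc))
    have t1 : ∀ X ⊆ Y, IsConn G X → Touch G MR X := by
      intro X hX hXc
      obtain ⟨x, hx⟩ := hXc.1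
      obtain ⟨⟨-, -, m, hm, hmy⟩, -⟩ := hX hx
      exact touch_of_adj hmy hm hx
    have t2 : ∀ X ⊆ Y, IsConn G X → Touch G (W ∪ L) X := by
      intro X hX hXc
      obtain ⟨x, hx⟩ := hXc.1
      obtain ⟨-, m, hm, hmy⟩ := hX hx
      exact touch_of_adj hmy (.inr hm) hx
    exact h.noMinor.not_K5 hR hLWc hA hB hC
      (disjoint_left.2 fun v hv hc => hc.elim (hWU v (hcU (hMR hv))) (hMRL v hv))
      (d1 A sA) (d1 B sB) (d1 C sC) (d2 A sA) (d2 B sB) (d2 C sC) dAB dAC dBC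
      (hWMR.symm.right subset_union_left) (t1 A sA hA) (t1 B sB hB) (t1 C sC hC)
      (t2 A sA hA) (t2 B sB hB) (t2 C sC hC) tAB tAC tBC)
  set N : Set V := {v | ∃ y ∈ Y, G.Adj v y} with hN
  obtain ⟨c₁, h₁⟩ := h.ih L (W ∪ MR ∪ Y) (S ∪ N)
    ⟨disjoint_left.2 (by
        rintro v hv ((hc | hc) | hc)
        exacts [hWU v (hLU hv) hc, hMRL v hc hv, hYL v hc hv]), hW1, by
      rintro s (hs | ⟨y, hy, hsy⟩) hsL
      · exact (h.setup.touch s hs (hLU hsL)).right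
          (subset_union_left.trans subset_union_left)
      · exact touch_of_adj hsy rfl (.inr hy)⟩
    ⟨hLU, fun hc => hMRL s₀ hs₀R (hc (h.sub hs₀))⟩
  obtain ⟨c₂, h₂⟩ := h.ih T (W ∪ L ∪ Y) (S ∪ N)
    ⟨disjoint_left.2 (by
        rintro v hv ((hc | hc) | hc)
        exacts [hWU v hv.1 hc, hTL v hv hc, hTY v hv hc]), hW2, by
      rintro s (hs | ⟨y, hy, hsy⟩) hsL
      · exact (h.setup.touch s hs hsL.1).right
          (subset_union_left.trans subset_union_left)
      · exact touch_of_adj hsy rfl (.inr hy)⟩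
    ⟨sdiff_subset, fun hc => by
      obtain ⟨m, hm⟩ := hL
      exact hTL m (hc (hcU (hML hm))) (.inl hm)⟩
  let f : (V → Fin 3 ⊕ Bool) → V → Fin 3 := fun c v => (c v).elim id fun _ => 0
  have hf : ∀ (c : V → Fin 3 ⊕ Bool) (v : V), (c v).isLeft = true → c v = .inl (f c v) := by
    intro c k hk
    obtain ⟨i, hi⟩ := Sum.isLeft_iff.1 hk
    simp [f, hi]
  obtain ⟨π, hπ₁, hπ₂⟩ := exists_perm_ne (f c₁ a₁) (f c₁ a₂) (f c₂ b₁) (f c₂ b₂)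
  have h₂' := h₂.map π
  have key : ∀ u ∈ L, ∀ v ∈ T, G.Adj u v → c₁ u ≠ (c₂ v).map π id := by
    intro u hu v hv huv
    obtain ⟨h1, h2⟩ := hLT u hu v hv huv
    rw [hf c₁ u (h₁.left u hu ((core_soft (hML h1)).imp_left .inl)),
      hf c₂ v (h₂.left v hv ((core_soft (hMR h2)).imp_left .inl)), Sum.map_inl]
    intro hc
    rcases hab u h1 v h2 huv with ⟨rfl, rfl⟩ | ⟨rfl, rfl⟩
    exacts [hπ₁ (Sum.inl.inj hc).symm, hπ₂ (Sum.inl.inj hc).symm]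
  let c : V → Fin 3 ⊕ Bool := fun v => if v ∈ L then c₁ v else if v ∈ Y then .inr (b v) else
    (c₂ v).map π id
  have e1 : ∀ v ∈ L, c v = c₁ v := fun v hv => if_pos hv
  have e2 : ∀ v ∈ Y, c v = .inr (b v) := fun v hv => by
    simp only [c]; rw [if_neg (hYL v hv), if_pos hv]
  have e3 : ∀ v ∈ T, c v = (c₂ v).map π id := fun v hv => by
    simp only [c]; rw [if_neg (hTL v hv), if_neg (hTY v hv)]
  have hcases : ∀ v ∈ U, v ∈ L ∨ v ∈ Y ∨ v ∈ T := by
    intro v hv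
    by_cases h1 : v ∈ L
    · exact .inl h1
    by_cases h2 : v ∈ Y
    · exact .inr (.inl h2)
    exact .inr (.inr ⟨hv, fun hc => hc.elim h1 h2⟩)
  have hYne : ∀ y ∈ Y, ∀ x, x ∈ L ∨ x ∈ T → G.Adj x y → c x ≠ c y := by
    intro y hy x hx hxy hc
    rw [e2 y hy] at hc
    have : (c x).isLeft = true := by
      rcases hx with hx | hx
      · rw [e1 x hx]
        exact h₁.left x hx (.inl (.inr ⟨y, hy, hxy⟩))
      · rw [e3 x hx]
        exact h₂'.left x hx (.inl (.inr ⟨y, hy, hxy⟩))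
    rw [hc] at this
    simp at this
  refine h.bad ⟨c, ⟨fun u hu v hv huv => ?_, fun v hv hvS => ?_⟩⟩
  · rcases hcases u hu with hu | hu | hu <;> rcases hcases v hv with hv | hv | hv
    · rw [e1 u hu, e1 v hv]; exact h₁.proper u hu v hv huv
    · exact hYne v hv u (.inl hu) huv
    · rw [e1 u hu, e3 v hv]; exact key u hu v hv huv
    · exact (hYne u hu v (.inl hv) huv.symm).symm
    · rw [e2 u hu, e2 v hv]
      exact fun hc => hb u hu v hv huv (Sum.inr.inj hc)
    · exact (hYne u hu v (.inr hv) huv.symm).symm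
    · rw [e3 u hu, e1 v hv]; exact (key v hv u hu huv.symm).symm
    · exact hYne v hv u (.inr hu) huv
    · rw [e3 u hu, e3 v hv]; exact h₂'.proper u hu v hv huv
  · rcases hcases v hv with hv | hv | hv
    · rw [e1 v hv]; exact h₁.left v hv (hvS.imp_left .inl)
    · exact absurd hvS (hsoft v hv)
    · rw [e3 v hv]; exact h₂'.left v hv (hvS.imp_left .inl)

end

end LocalGirth

namespace LocalGirth

open Set

set_option linter.unusedSectionVars false

section

open scoped Classical

universe u

variable {V : Type u} {G : SimpleGraph V} {U W S : Set V}

/-- A triangle inside `S` is all of `S`. -/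
lemma Crit.mem_of_triangle (h : Crit G U W S) {s s' s'' : V} (hs : s ∈ S) (hs' : s' ∈ S)
    (hs'' : s'' ∈ S) (h₁ : G.Adj s s') (h₂ : G.Adj s s'') (h₃ : G.Adj s' s'') {x : V}
    (hx : x ∈ S) : x ∈ ({s, s', s''} : Set V) := by
  by_contra hxK
  set K : Set V := {s, s', s''} with hK
  have hKS : K ⊆ S := by rintro k (rfl | rfl | rfl) <;> assumption
  have hxD : x ∈ U \ K := ⟨h.sub hx, hxK⟩
  have hD : IsConn G (U \ K) := .of_root hxD fun w hw => h.reach hKS (by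
    rintro a (rfl | rfl | rfl) b (rfl | rfl | rfl) hab
    all_goals first | exact absurd rfl hab | assumption | (apply G.adj_symm; assumption)) hxD hw
  have key : ∀ k k' k'', k ∈ S → k' ∈ S → k'' ∈ S → G.Adj k k' → G.Adj k k'' → G.Adj k' k'' →
      K = {k, k', k''} → Touch G {k} (U \ K) := by
    intro k k' k'' hk hk' hk'' a b c hKk
    have hxk : x ∉ ({k, k', k''} : Set V) := hKk ▸ hxK
    simp only [mem_insert_iff, mem_singleton_iff, not_or] at hxk
    obtain ⟨p, hp, q, hq, hpq⟩ := (h.reach_edge hk' hk'' c (a := k) (b := x)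
      ⟨h.sub hk, by simp [a.ne, b.ne]⟩ ⟨h.sub hx, by simp [hxk]⟩).exists_cross (A := {k}) rfl
      (by simp [hxk])
    obtain rfl : p = k := hp.2
    refine touch_of_adj hpq rfl ⟨hq.1.1, ?_⟩
    rw [hKk]
    rintro (hc | hc)
    exacts [hq.2 hc, hq.1.2 hc]
  have hWK : ∀ k ∈ S, Disjoint {k} W := fun k hk => by
    simpa using h.setup.disj.notMem_of_mem_left (h.sub hk)
  have hdK : ∀ k ∈ K, Disjoint {k} (U \ K) := fun k hk => by simp [hk]
  refine h.noMinor.not_K5 (isConn_singleton s) (isConn_singleton s') (isConn_singleton s'') hD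
    h.setup.conn (by simp [h₁.ne]) (by simp [h₂.ne]) (hdK s (by simp [hK])) (hWK s hs)
    (by simp [h₃.ne]) (hdK s' (by simp [hK])) (hWK s' hs') (hdK s'' (by simp [hK])) (hWK s'' hs'')
    (h.setup.disj.mono_left sdiff_subset) (touch_of_adj h₁ rfl rfl) (touch_of_adj h₂ rfl rfl)
    (key s s' s'' hs hs' hs'' h₁ h₂ h₃ rfl) (h.setup.touch s hs (h.sub hs))
    (touch_of_adj h₃ rfl rfl)
    (key s' s s'' hs' hs hs'' h₁.symm h₃ h₂ (insert_comm _ _ _)) (h.setup.touch s' hs' (h.sub hs'))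
    (key s'' s s' hs'' hs hs' h₂.symm h₃.symm h₁ ?_) (h.setup.touch s'' hs'' (h.sub hs''))
    ((h.setup.touch x hx (h.sub hx)).left (singleton_subset_iff.2 hxD))
  ext v
  simp only [hK, mem_insert_iff, mem_singleton_iff]
  tauto

lemma Crit.exists_reach (h : Crit G U W S) {s s' l : V} (hs : s ∈ S) (hs' : s' ∈ S)
    (hss : G.Adj s s') (hl : l ∈ U) (hlS : l ∉ S) (hls : G.Adj l s) (hls' : G.Adj l s') {v : V}
    (hv : v ∈ U) (hvs : v ≠ s) (hvs' : v ≠ s') (hvl : v ≠ l) :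
    ∃ w ∈ W, Reach G (((U ∪ W) \ {s, s'}) \ {l}) v w := by
  obtain ⟨t, ht, htX, hr⟩ := h.reach_of_triangle hs hs' hss hl hlS hls hls' (v := v)
    ⟨hv, by simp [hvs, hvs', hvl]⟩
  have hsub : U \ {s, s', l} ⊆ ((U ∪ W) \ {s, s'}) \ {l} := by
    rintro x ⟨hx, hx'⟩
    simp only [mem_insert_iff, mem_singleton_iff, not_or] at hx'
    exact ⟨⟨.inl hx, by simp [hx']⟩, by simp [hx']⟩
  obtain ⟨w, hw, htw⟩ := touch_singleton_left.1 (h.setup.touch t ht (h.sub ht))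
  have hwU : ∀ x ∈ U, w ≠ x := fun x hx hc => h.setup.disj.notMem_of_mem_left hx (hc ▸ hw)
  refine ⟨w, hw, (hr.mono hsub).trans (.of_adj htw (hsub htX) ⟨⟨.inr hw, ?_⟩, hwU l hl⟩)⟩
  rintro (hc | hc)
  exacts [hwU s (h.sub hs) hc, hwU s' (h.sub hs') hc]

/-- Two adjacent vertices of `S` have at most one common neighbour outside `S`. -/
lemma Crit.common_unique (h : Crit G U W S) {s s' l l₁ : V} (hs : s ∈ S) (hs' : s' ∈ S)
    (hss : G.Adj s s') (hl : l ∈ U) (hlS : l ∉ S) (hls : G.Adj l s) (hls' : G.Adj l s')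
    (hl₁ : l₁ ∈ U) (hlS₁ : l₁ ∉ S) (hls₁ : G.Adj l₁ s) (hls₁' : G.Adj l₁ s') : l = l₁ := by
  by_contra hne
  have hWU : ∀ x ∈ U, x ∉ W := fun x hx => h.setup.disj.notMem_of_mem_left hx
  obtain ⟨w₁, hw₁, hr₁⟩ := h.exists_reach hs hs' hss hl hlS hls hls' hl₁ hls₁.ne hls₁'.ne
    (Ne.symm hne)
  obtain ⟨w₂, hw₂, hr₂⟩ := h.exists_reach hs hs' hss hl₁ hlS₁ hls₁ hls₁' hl hls.ne hls'.ne hne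
  have hsub : U \ {s, s'} ⊆ ((U ∪ W) \ {s, s'}) \ W := fun x hx =>
    ⟨⟨.inl hx.1, hx.2⟩, hWU x hx.1⟩
  have hlm : l ∈ U \ {s, s'} := ⟨hl, by simp [hls.ne, hls'.ne]⟩
  have hlm₁ : l₁ ∈ U \ {s, s'} := ⟨hl₁, by simp [hls₁.ne, hls₁'.ne]⟩
  exact h.noMinor.three_connectors (S := {s}) (S' := {s'}) (Ω := (U ∪ W) \ {s, s'}) (C₁ := {l})
    (C₂ := {l₁}) (C₃ := W) (isConn_singleton s) (isConn_singleton s') (by simp [hss.ne])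
    (touch_of_adj hss rfl rfl) (by simp) (by simp) (isConn_singleton l) (isConn_singleton l₁)
    h.setup.conn (singleton_subset_iff.2 (hsub hlm).1) (singleton_subset_iff.2 (hsub hlm₁).1)
    (fun w hw => ⟨.inr hw, by
      rintro (hc | hc)
      exacts [hWU s (h.sub hs) (hc ▸ hw), hWU s' (h.sub hs') (hc ▸ hw)]⟩)
    (by simp [hne]) (by simpa using hWU l hl) (by simpa using hWU l₁ hl₁)
    (touch_of_adj hls.symm rfl rfl) (touch_of_adj hls₁.symm rfl rfl)
    (h.setup.touch s hs (h.sub hs)) (touch_of_adj hls'.symm rfl rfl)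
    (touch_of_adj hls₁'.symm rfl rfl) (h.setup.touch s' hs' (h.sub hs'))
    ⟨l, rfl, l₁, rfl, (h.reach_edge hs hs' hss hlm hlm₁).mono hsub⟩
    ⟨l₁, rfl, w₁, hw₁, hr₁⟩ ⟨w₂, hw₂, l, rfl, hr₂.symm⟩

lemma Crit.no_bypass (h : Crit G U W S) {s s' l l' q : V} {Q : Set V} (hs : s ∈ S) (hs' : s' ∈ S)
    (hss : G.Adj s s') (hl : l ∈ U \ core G U S) (hls : G.Adj l s) (hls' : G.Adj l s')
    (hl' : l' ∈ U \ core G U S) (hll : Reach G (U \ core G U S) l l') (hq : q ∈ S)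
    (hlq : G.Adj l' q) (hqQ : q ∉ Q) (hqs : q ≠ s) (hqs' : q ≠ s') (hQ : IsConn G Q)
    (hQM : Q ⊆ core G U S \ {s, s'}) (t : Touch G {s} Q) (t' : Touch G {s'} Q) : False := by
  have hWU : ∀ x ∈ U, x ∉ W := fun x hx => h.setup.disj.notMem_of_mem_left hx
  have hcU : core G U S ⊆ U := core_subset h.sub
  have hlS : l ∉ S := fun hc => hl.2 (subset_core hc)
  have hlQ : l ∉ Q := fun hc => hl.2 (hQM hc).1
  obtain ⟨p, hp⟩ := hQ.1
  have hpM := (hQM hp).1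
  have hpm : p ∈ U \ {s, s'} := ⟨hcU hpM, (hQM hp).2⟩
  have hps : p ≠ s ∧ p ≠ s' := by simpa using hpm.2
  obtain ⟨w, hw, hr⟩ := h.exists_reach hs hs' hss hl.1 hlS hls hls' (hcU hpM) hps.1 hps.2
    (fun hc => hlQ (hc ▸ hp))
  have hsub : U \ {s, s'} ⊆ ((U ∪ W) \ {s, s'}) \ W := fun x hx =>
    ⟨⟨.inl hx.1, hx.2⟩, hWU x hx.1⟩
  have hlm : l ∈ U \ {s, s'} := ⟨hl.1, by simp [hls.ne, hls'.ne]⟩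
  obtain ⟨w', hw', hqw⟩ := touch_singleton_left.1 (h.setup.touch q hq (h.sub hq))
  have hWΩ : W ⊆ (U ∪ W) \ {s, s'} := fun w hw => ⟨.inr hw, by
    rintro (hc | hc)
    exacts [hWU s (h.sub hs) (hc ▸ hw), hWU s' (h.sub hs') (hc ▸ hw)]⟩
  have hsub2 : U \ core G U S ⊆ ((U ∪ W) \ {s, s'}) \ Q := by
    refine fun x hx => ⟨⟨.inl hx.1, ?_⟩, fun hc => hx.2 (hQM hc).1⟩
    rintro (rfl | rfl)
    exacts [hx.2 (subset_core hs), hx.2 (subset_core hs')]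
  have hqm : q ∈ ((U ∪ W) \ {s, s'}) \ Q := ⟨⟨.inl (h.sub hq), by simp [hqs, hqs']⟩, hqQ⟩
  refine h.noMinor.three_connectors (S := {s}) (S' := {s'}) (Ω := (U ∪ W) \ {s, s'}) (C₁ := {l})
    (C₂ := Q) (C₃ := W) (isConn_singleton s) (isConn_singleton s') (by simp [hss.ne])
    (touch_of_adj hss rfl rfl) (by simp) (by simp) (isConn_singleton l) hQ
    h.setup.conn (singleton_subset_iff.2 (hsub hlm).1)
    (fun x hx => ⟨.inl (hcU (hQM hx).1), (hQM hx).2⟩) hWΩ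
    (by simp [hlQ]) (by simpa using hWU l hl.1)
    (disjoint_left.2 fun x hx => hWU x (hcU (hQM hx).1))
    (touch_of_adj hls.symm rfl rfl) t
    (h.setup.touch s hs (h.sub hs)) (touch_of_adj hls'.symm rfl rfl)
    t' (h.setup.touch s' hs' (h.sub hs'))
    ⟨l, rfl, p, hp, (h.reach_edge hs hs' hss hlm hpm).mono hsub⟩
    ⟨p, hp, w, hw, hr⟩ ⟨w', hw', l, rfl, Reach.symm ?_⟩
  exact ((hll.mono hsub2).trans (.of_adj hlq (hsub2 hl') hqm)).trans (.of_adj hqw hqm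
    ⟨hWΩ hw', fun hc => hWU w' (hcU (hQM hc).1) hw'⟩)

/-- Two adjacent vertices of `S` stay joined in the core after deleting two edges of `S`. -/
lemma Crit.reach_deleteEdges [Finite V] (h : Crit G U W S) {s s' q q' : V} (hs : s ∈ S)
    (hs' : s' ∈ S) (hq : q ∈ S) (hq' : q' ∈ S) :
    Reach (G.deleteEdges {s(s, s'), s(q, q')}) (core G U S) s s' := by
  by_contra hr
  set H := G.deleteEdges {s(s, s'), s(q, q')} with hH
  have hHG : ∀ X : Set V, ∀ a ∈ X, ∀ b ∈ X, H.Adj a b → G.Adj a b := fun X a _ b _ hab =>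
    G.deleteEdges_le _ hab
  set M := core G U S with hM
  have hsM : s ∈ M := subset_core hs
  set MR := comp H M s with hMR
  have hMRM : MR ⊆ M := comp_subset _ _
  have hsR : s ∈ MR := mem_comp_self hsM
  have hs'L : s' ∈ M \ MR := ⟨subset_core hs', fun hc => hr hc.2⟩
  have hWL : IsConn G ((M \ MR) ∪ W) := by
    have := h.setup.conn.biUnion (M \ MR) (fun v => comp H M v)
      (fun v hv => (isConn_comp hv.1).mono_graph (hHG _)) (by
      intro v hv
      refine .inl ?_
      by_contra ht
      have hnoS : ∀ t ∈ comp H M v, t ∉ S := fun t ht' htS => ht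
        ((h.setup.touch t htS (h.sub htS)).symm.right (singleton_subset_iff.2 ht'))
      obtain ⟨t, htS, hvt⟩ := hv.1
      have hct : comp G (S ∪ (triFree G ∩ U)) t ⊆ M := fun x hx => ⟨t, htS, hx⟩
      have hrt : Reach G M v t :=
        ((isConn_comp (.inl htS)).2 v hvt t (mem_comp_self (.inl htS))).mono hct
      refine hnoS t (hrt.closed (mem_comp_self hv.1) fun a ha b hb hab => ?_) htS
      refine mem_comp_of_adj ha hb ?_
      rw [hH, SimpleGraph.deleteEdges_adj]
      refine ⟨hab, ?_⟩
      rintro (hc | hc) <;> rcases Sym2.eq_iff.1 hc with ⟨rfl, rfl⟩ | ⟨rfl, rfl⟩ <;>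
        exact hnoS a ha (by assumption))
    convert this using 1
    rw [union_comm]
    congr 1
    refine Subset.antisymm (fun v hv => mem_iUnion₂.2 ⟨v, hv, mem_comp_self hv.1⟩)
      (iUnion₂_subset fun v hv x hx => ⟨comp_subset _ _ hx, fun hc => hv.2 ?_⟩)
    rw [hMR, ← comp_eq_of_mem hc]
    exact mem_comp_comm hx
  have hcases : ∀ u ∈ M \ MR, ∀ v ∈ MR, G.Adj u v → u = s' ∧ v = s ∨ u = q ∧ v = q' ∨
      u = q' ∧ v = q := by
    intro u hu v hv huv
    have hn : ¬ H.Adj v u := fun hc => hu.2 (mem_comp_of_adj hv hu.1 hc)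
    rw [hH, SimpleGraph.deleteEdges_adj] at hn
    push Not at hn
    rcases hn huv.symm with hc | hc <;> rcases Sym2.eq_iff.1 hc with ⟨rfl, rfl⟩ | ⟨rfl, rfl⟩
    · exact .inl ⟨rfl, rfl⟩
    · exact absurd hsR hu.2
    · exact .inr (.inr ⟨rfl, rfl⟩)
    · exact .inr (.inl ⟨rfl, rfl⟩)
  have hRc : IsConn G MR := (isConn_comp hsM).mono_graph (hHG _)
  by_cases hqL : q ∈ M \ MR
  · refine h.no_split (ML := M \ MR) (a₁ := s') (b₁ := s) (a₂ := q) (b₂ := q')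
      (sdiff_union_of_subset hMRM) disjoint_sdiff_left ⟨s', hs'L⟩ hRc ⟨s, hsR, hs⟩ hWL ?_
    intro u hu v hv huv
    rcases hcases u hu v hv huv with h1 | h1 | h1
    · exact .inl h1
    · exact .inr h1
    · exact absurd (h1.2 ▸ hv) hqL.2
  · refine h.no_split (ML := M \ MR) (a₁ := s') (b₁ := s) (a₂ := q') (b₂ := q)
      (sdiff_union_of_subset hMRM) disjoint_sdiff_left ⟨s', hs'L⟩ hRc ⟨s, hsR, hs⟩ hWL ?_
    intro u hu v hv huv
    rcases hcases u hu v hv huv with h1 | h1 | h1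
    · exact .inl h1
    · exact absurd (h1.1 ▸ hu) hqL
    · exact .inr h1

lemma exists_minimal_conn [Finite V] {M : Set V} {s s' : V} (hne : s ≠ s') (hs : s ∈ M)
    (h : Reach G M s s') : ∃ X ⊆ M, s ∈ X ∧ s' ∈ X ∧ IsConn G X ∧ IsConn G (X \ {s}) ∧
      IsConn G (X \ {s'}) := by
  obtain ⟨X, hX⟩ := exists_minimal_of_wellFoundedLT
    (fun X : Set V => X ⊆ M ∧ s ∈ X ∧ s' ∈ X ∧ IsConn G X)
    ⟨comp G M s, comp_subset _ _, mem_comp_self hs, ⟨hs, h⟩, isConn_comp hs⟩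
  obtain ⟨⟨hXM, hsX, hs'X, hXc⟩, hmin⟩ := hX
  have key : ∀ a ∈ X, ∀ b ∈ X, a ≠ b → (∀ Y : Set V, a ∈ Y → b ∈ Y → s ∈ Y ∧ s' ∈ Y) →
      IsConn G (X \ {a}) := by
    intro a ha b hb hab hY
    have hbX : b ∈ X \ {a} := ⟨hb, hab.symm⟩
    have hbK := mem_comp_self (G := G) hbX
    have hKX := comp_subset (G := G) (X \ {a}) b
    obtain ⟨p, hp, q, hq, hpq⟩ := (hXc.2 b hb a ha).exists_cross hbK fun hc => (hKX hc).2 rfl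
    have hqa : q = a := by
      by_contra hqa
      exact hq.2 (mem_comp_of_adj hp.2 ⟨hq.1, hqa⟩ hpq)
    subst hqa
    have hc : IsConn G (insert q (comp G (X \ {q}) b)) :=
      (isConn_comp hbX).insert ⟨p, hp.2, hpq.symm⟩
    have hsub : insert q (comp G (X \ {q}) b) ⊆ X :=
      insert_subset ha (hKX.trans sdiff_subset)
    obtain ⟨h1, h2⟩ := hY (insert q (comp G (X \ {q}) b)) (mem_insert _ _) (.inr hbK)
    have hXs := hmin ⟨hsub.trans hXM, h1, h2, hc⟩ hsub
    have : X \ {q} = comp G (X \ {q}) b :=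
      Subset.antisymm (fun x hx => (hXs hx.1).resolve_left hx.2) hKX
    rw [this]
    exact isConn_comp hbX
  exact ⟨X, hXM, hsX, hs'X, hXc, key s hsX s' hs'X hne fun Y h1 h2 => ⟨h1, h2⟩,
    key s' hs'X s hsX hne.symm fun Y h1 h2 => ⟨h2, h1⟩⟩

/-- Common neighbours of different edges of `S` lie in different components outside the core. -/
lemma Crit.edge_unique [Finite V] (h : Crit G U W S) {s s' q q' l l' : V} (hs : s ∈ S)
    (hs' : s' ∈ S) (hss : G.Adj s s') (hq : q ∈ S) (hq' : q' ∈ S) (hqq : G.Adj q q')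
    (hl : l ∈ U \ core G U S) (hls : G.Adj l s) (hls' : G.Adj l s')
    (hl' : l' ∈ U \ core G U S) (hlq : G.Adj l' q) (hlq' : G.Adj l' q')
    (hll : Reach G (U \ core G U S) l l') : s(s, s') = s(q, q') := by
  by_contra hne
  set H := G.deleteEdges {s(s, s'), s(q, q')} with hH
  have hHG : ∀ X : Set V, ∀ a ∈ X, ∀ b ∈ X, H.Adj a b → G.Adj a b := fun X a _ b _ hab =>
    G.deleteEdges_le _ hab
  have hTG : ∀ A B : Set V, Touch H A B → Touch G A B := by
    rintro A B ⟨a, ha, b, hb, hab⟩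
    exact ⟨a, ha, b, hb, G.deleteEdges_le _ hab⟩
  have hns : ¬ Touch H {s} {s'} := by
    rintro ⟨a, rfl, b, rfl, hab⟩
    rw [hH, SimpleGraph.deleteEdges_adj] at hab
    simp at hab
  have hnq : ¬ Touch H {q} {q'} := by
    rintro ⟨a, rfl, b, rfl, hab⟩
    rw [hH, SimpleGraph.deleteEdges_adj] at hab
    simp at hab
  obtain ⟨X, hXM, hsX, hs'X, hXc, hX1, hX2⟩ := exists_minimal_conn hss.ne (subset_core hs)
    (h.reach_deleteEdges hs hs' hq hq')
  by_cases hqX : q ∈ X ∧ q' ∈ X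
  · have key : ∀ a, a ∈ S → G.Adj l a → a ≠ q → a ≠ q' → IsConn H (X \ {a}) → False := by
      intro a haS hla haq haq' hXa
      rcases (hXa.2 q ⟨hqX.1, haq.symm⟩ q' ⟨hqX.2, haq'.symm⟩).touch_or_exists (A := {q})
        (B := {q'}) rfl rfl (by simp [hqq.ne]) with ht | ⟨Q, hQ, hQc, t, t'⟩
      · exact hnq ht
      · exact h.no_bypass hq hq' hqq hl' hlq hlq' hl hll.symm haS hla
          (fun hc => (hQ hc).1.2 rfl) haq haq' (hQc.mono_graph (hHG _))
          (fun x hx => ⟨hXM (hQ hx).1.1, (hQ hx).2⟩) (hTG _ _ t) (hTG _ _ t'.symm)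
    by_cases h1 : s = q ∨ s = q'
    · refine key s' hs' hls' ?_ ?_ hX2
      · rintro rfl
        rcases h1 with rfl | rfl
        exacts [hss.ne rfl, hne Sym2.eq_swap]
      · rintro rfl
        rcases h1 with rfl | rfl
        exacts [hne rfl, hss.ne rfl]
    · rw [not_or] at h1
      exact key s hs hls h1.1 h1.2 hX1
  · obtain ⟨a, haS, hla, haX⟩ : ∃ a ∈ S, G.Adj l' a ∧ a ∉ X := by
      by_cases h1 : q ∈ X
      · exact ⟨q', hq', hlq', fun hc => hqX ⟨h1, hc⟩⟩
      · exact ⟨q, hq, hlq, h1⟩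
    rcases (hXc.2 s hsX s' hs'X).touch_or_exists (A := {s}) (B := {s'}) rfl rfl
      (by simp [hss.ne]) with ht | ⟨Q, hQ, hQc, t, t'⟩
    · exact hns ht
    · exact h.no_bypass hs hs' hss hl hls hls' hl' hll haS hla (fun hc => haX (hQ hc).1)
        (fun hc => haX (hc ▸ hsX)) (fun hc => haX (hc ▸ hs'X)) (hQc.mono_graph (hHG _))
        (fun x hx => ⟨hXM (hQ hx).1, (hQ hx).2⟩) (hTG _ _ t) (hTG _ _ t'.symm)

end

end LocalGirth

namespace LocalGirth

open Set

set_option linter.unusedSectionVars false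

section

open scoped Classical

universe u

variable {V : Type u} {G : SimpleGraph V} {U W S : Set V}

lemma Crit.fewTriangles_within (h : Crit G U W S) {X : Set V}
    (hX : ∀ a b c, a ∈ X → b ∈ X → c ∈ X → G.Adj a b → G.Adj b c → G.Adj a c → a ∈ S) :
    FewTriangles (within G X) := by
  have hS : ∀ a b c, (within G X).Adj a b → (within G X).Adj b c → (within G X).Adj a c →
      a ∈ S ∧ b ∈ S ∧ c ∈ S := by
    rintro a b c ⟨h1, ha, hb⟩ ⟨h2, -, hc⟩ ⟨h3, -, -⟩
    exact ⟨hX a b c ha hb hc h1 h2 h3, hX b a c hb ha hc h1.symm h3 h2,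
      hX c a b hc ha hb h3.symm h1 h2.symm⟩
  by_cases ht : ∃ a b c, (within G X).Adj a b ∧ (within G X).Adj b c ∧ (within G X).Adj a c
  · obtain ⟨s, s', s'', h1, h2, h3⟩ := ht
    obtain ⟨hs, hs', hs''⟩ := hS _ _ _ h1 h2 h3
    refine ⟨{s(s, s'), s(s, s''), s(s', s'')}, Finset.card_le_three, ?_⟩
    intro a b c k1 k2 k3
    obtain ⟨ha, hb, -⟩ := hS _ _ _ k1 k2 k3
    have ha' := h.mem_of_triangle hs hs' hs'' h1.1 h3.1 h2.1 ha
    have hb' := h.mem_of_triangle hs hs' hs'' h1.1 h3.1 h2.1 hb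
    have hab := k1.1.ne
    simp only [mem_insert_iff, mem_singleton_iff] at ha' hb'
    simp only [Finset.mem_insert, Finset.mem_singleton, Sym2.eq_iff]
    rcases ha' with rfl | rfl | rfl <;> rcases hb' with rfl | rfl | rfl <;> simp_all
  · push Not at ht
    exact ⟨∅, by simp, fun a b c k1 k2 k3 => absurd k3 (ht a b c k1 k2)⟩

/-- No critical situation has a nonempty set `S`. -/
lemma Crit.eq_empty [Fintype V] (h : Crit G U W S) : S = ∅ := by
  by_contra hSne
  obtain ⟨s₀, hs₀⟩ := nonempty_iff_ne_empty.2 hSne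
  set M := core G U S with hM
  have hMU : M ⊆ U := core_subset h.sub
  have hSM : S ⊆ M := subset_core
  have hWU : ∀ x ∈ U, x ∉ W := fun x hx => h.setup.disj.notMem_of_mem_left hx
  set L : Set V := {l | l ∈ U \ M ∧ ∃ m ∈ M, G.Adj m l} with hL
  have hsoft : ∀ l ∈ L, ¬ (l ∈ S ∨ l ∈ triFree G) := by
    rintro l ⟨hl, m, hm, hml⟩ hc
    exact hl.2 (mem_core_of_adj hm hl.1 hml hc)
  set B : Set V := {l | l ∈ L ∧ ∃ s ∈ S, ∃ s' ∈ S, G.Adj s s' ∧ G.Adj l s ∧ G.Adj l s'} with hB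
  have hT : TSetup G (U \ M) (W ∪ M) L := ⟨h.noMinor, h.isConn_core,
    disjoint_left.2 (by
      rintro x ⟨hx, hx'⟩ (hc | hc)
      exacts [hWU x hx hc, hx' hc]), fun l hl => hl.1, by
    rintro l ⟨-, m, hm, hml⟩
    exact touch_of_adj hml.symm rfl (.inr hm)⟩
  obtain ⟨c, hc, hcB⟩ := hT.exists_good B (fun l hl => hl.1) (by
    rintro a ⟨ha, s, hs, s', hs', hss, has, has'⟩ b ⟨hb, q, hq, q', hq', hqq, hbq, hbq'⟩ hr
    have haS : a ∉ S := fun h => hsoft a ha (.inl h)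
    have hbS : b ∉ S := fun h => hsoft b hb (.inl h)
    have he := h.edge_unique hs hs' hss hq hq' hqq ha.1 has has' hb.1 hbq hbq' hr
    rcases Sym2.eq_iff.1 he with ⟨rfl, rfl⟩ | ⟨rfl, rfl⟩
    · exact h.common_unique hs hs' hss ha.1.1 haS has has' hb.1.1 hbS hbq hbq'
    · exact h.common_unique hs hs' hss ha.1.1 haS has has' hb.1.1 hbS hbq' hbq)
  set T : Set V := {l | l ∈ L ∧ c l = 2} with hTdef
  set X : Set V := {l | l ∈ L ∧ c l ≠ 2} with hX
  set R : Set V := (U \ M) \ L with hR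
  have hfew : FewTriangles (within G (M ∪ T)) := by
    refine h.fewTriangles_within fun a b d ha hb hd hab hbd had => ?_
    have hin : ∀ x ∈ M, x ∉ triFree G → x ∈ S := fun x hx hx' =>
      (core_soft hx).resolve_right hx'
    by_contra haS
    have haT : a ∈ T := ha.resolve_left fun hc => haS (hin a hc fun h => h b d hab had hbd)
    have hTT : ∀ x ∈ M ∪ T, G.Adj a x → x ∈ M := fun x hx hax => hx.resolve_right fun hxT =>
      hc.proper a haT.1 x hxT.1 hax (haT.2.trans hxT.2.symm)
    refine hcB a ⟨haT.1, b, hin b (hTT b hb hab) fun h => h a d hab.symm hbd had, d,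
      hin d (hTT d hd had) fun h => h a b had.symm hbd.symm hab, hbd, hab, had⟩ haT.2
  obtain ⟨ψ, hψ⟩ := threeCol_of_hasFam Finset.univ (h.noMinor.hasFam_within (M ∪ T)) hfew
  have hψ' : ∀ u ∈ M ∪ T, ∀ v ∈ M ∪ T, G.Adj u v → ψ u ≠ ψ v := fun u hu v hv huv =>
    hψ u (Finset.mem_univ _) v (Finset.mem_univ _) ⟨huv, hu, hv⟩
  have hWX : IsConn G (W ∪ M ∪ X) := isConn_union_nbrs h.isConn_core (by
    rintro x ⟨⟨-, m, hm, hmx⟩, -⟩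
    exact ⟨m, .inr hm, hmx⟩)
  have claim : ∀ K : Set V, ∃ d : V → Fin 3 ⊕ Bool, ∀ v ∈ R, K = comp G R v →
      IsOk G (K ∪ {t | t ∈ T ∧ Touch G {t} K}) {x | ∃ y ∈ X, G.Adj x y} d ∧
      ∀ t ∈ T, Touch G {t} K → d t = .inl (ψ t) := by
    intro K
    by_cases hK : ∃ v ∈ R, K = comp G R v
    swap
    · exact ⟨fun _ => .inl 0, fun v hv hKv => absurd ⟨v, hv, hKv⟩ hK⟩
    obtain ⟨v, hv, rfl⟩ := hK
    set K := comp G R v with hKdef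
    have hKR : K ⊆ R := comp_subset _ _
    set D : Set V := {t | t ∈ T ∧ Touch G {t} K} with hD
    have hDL : ∀ t ∈ D, t ∈ L := fun t ht => ht.1.1
    have hKD : K ∪ D ⊆ U \ M := union_subset (fun x hx => (hKR hx).1) fun t ht => (hDL t ht).1
    have hsub : K ∪ D ⊂ U := ⟨fun x hx => (hKD hx).1, fun hc =>
      (hKD (hc (h.sub hs₀))).2 (hSM hs₀)⟩
    obtain ⟨d, hd⟩ := h.ih (K ∪ D) (W ∪ M ∪ X) ({x | ∃ y ∈ X, G.Adj x y} ∪ D)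
      ⟨disjoint_left.2 (by
        rintro x hx ((hc | hc) | hc)
        · exact hWU x (hKD hx).1 hc
        · exact (hKD hx).2 hc
        · rcases hx with hx | hx
          exacts [(hKR hx).2 hc.1, hc.2 hx.1.2]), hWX, by
        rintro x (⟨y, hy, hxy⟩ | hx) -
        · exact touch_of_adj hxy rfl (.inr hy)
        · obtain ⟨-, m, hm, hmx⟩ := hDL x hx
          exact touch_of_adj hmx.symm rfl (.inl (.inr hm))⟩ hsub
    have hψok : IsOk G D ∅ fun v => if v ∈ D then .inl (ψ v) else .inl 0 :=
      ⟨fun u hu v hv huv => by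
        rw [if_pos hu, if_pos hv]
        exact fun hc => hψ' u (.inr hu.1) v (.inr hv.1) huv (Sum.inl.inj hc),
        fun v hv _ => by rw [if_pos hv]; rfl⟩
    obtain ⟨π, hπ⟩ := hd.exists_match hψok (K := D)
      (fun a ha b hb hab => absurd hb.2 (hc.sep a ha.1.1 b hb.1.1 hab ha.1.2 hb.1.2 K hKR
        (isConn_comp hv) ha.2)) subset_union_right subset_rfl
      (fun k hk => hd.left k (.inr hk) (.inl (.inr hk)))
      (fun k hk => by simp only [if_pos hk, Sum.isLeft_inl])
    refine ⟨fun v => (d v).map π id, fun _ _ _ => ⟨(hd.map π).mono subset_rfl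
      fun _ _ hx => .inl hx, fun t ht htK => ?_⟩⟩
    have := hπ t ⟨ht, htK⟩
    rwa [if_pos (show t ∈ D from ⟨ht, htK⟩)] at this
  choose d hd using claim
  let e : V → Fin 3 ⊕ Bool := fun v => if v ∈ M ∪ T then .inl (ψ v) else if v ∈ X then
    .inr (decide (c v = 0)) else d (comp G R v) v
  have hXM : ∀ v ∈ X, v ∉ M ∪ T := by
    rintro v hv (hc | hc)
    exacts [hv.1.1.2 hc, hv.2 hc.2]
  have hRM : ∀ v ∈ R, v ∉ M ∪ T := by
    rintro v hv (hc | hc)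
    exacts [hv.1.2 hc, hv.2 hc.1]
  have hRX : ∀ v ∈ R, v ∉ X := fun v hv hc => hv.2 hc.1
  have e1 : ∀ v ∈ M ∪ T, e v = .inl (ψ v) := fun v hv => if_pos hv
  have e2 : ∀ v ∈ X, e v = .inr (decide (c v = 0)) := fun v hv => by
    simp only [e]; rw [if_neg (hXM v hv), if_pos hv]
  have e3 : ∀ v ∈ R, e v = d (comp G R v) v := fun v hv => by
    simp only [e]; rw [if_neg (hRM v hv), if_neg (hRX v hv)]
  have hcases : ∀ v ∈ U, v ∈ M ∪ T ∨ v ∈ X ∨ v ∈ R := by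
    intro v hv
    by_cases h1 : v ∈ M
    · exact .inl (.inl h1)
    by_cases h2 : v ∈ L
    · by_cases h3 : c v = 2
      · exact .inl (.inr ⟨h2, h3⟩)
      · exact .inr (.inl ⟨h2, h3⟩)
    exact .inr (.inr ⟨⟨hv, h1⟩, h2⟩)
  have hMX : ∀ u ∈ M ∪ T, ∀ v ∈ X, e u ≠ e v := fun u hu v hv => by
    rw [e1 u hu, e2 v hv]; exact Sum.inl_ne_inr
  have hXR : ∀ u ∈ X, ∀ v ∈ R, G.Adj u v → e u ≠ e v := fun u hu v hv huv hne => by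
    have := (hd _ v hv rfl).1.left v (.inl (mem_comp_self hv)) (.inl ⟨u, hu, huv.symm⟩)
    rw [e2 u hu, e3 v hv] at hne
    rw [← hne] at this
    simp at this
  have hMR : ∀ u ∈ M ∪ T, ∀ v ∈ R, G.Adj u v → e u ≠ e v := fun u hu v hv huv => by
    have huT : u ∈ T := hu.resolve_left fun hc => hv.2 ⟨hv.1, u, hc, huv⟩
    have ht : Touch G {u} (comp G R v) := touch_of_adj huv rfl (mem_comp_self hv)
    rw [e1 u hu, e3 v hv, ← (hd _ v hv rfl).2 u huT ht]
    exact (hd _ v hv rfl).1.proper u (.inr ⟨huT, ht⟩) v (.inl (mem_comp_self hv)) huv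
  refine h.bad ⟨e, ⟨fun u hu v hv huv => ?_, fun v hv hvS => ?_⟩⟩
  · rcases hcases u hu with hu | hu | hu <;> rcases hcases v hv with hv | hv | hv
    · rw [e1 u hu, e1 v hv]
      exact fun hc => hψ' u hu v hv huv (Sum.inl.inj hc)
    · exact hMX u hu v hv
    · exact hMR u hu v hv huv
    · exact (hMX v hv u hu).symm
    · rw [e2 u hu, e2 v hv]
      intro heq
      have h1 := hc.proper u hu.1 v hv.1 huv
      have h2 := hu.2
      have h3 := hv.2
      have h4 := Sum.inr.inj heq
      rw [decide_eq_decide] at h4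
      omega
    · exact hXR u hu v hv huv
    · exact (hMR v hv u hu huv.symm).symm
    · exact (hXR v hv u hu huv.symm).symm
    · have hcomp : comp G R v = comp G R u :=
        comp_eq_of_mem (mem_comp_of_adj (mem_comp_self hu) hv huv)
      rw [e3 u hu, e3 v hv, hcomp]
      exact (hd _ u hu rfl).1.proper u (.inl (mem_comp_self hu)) v
        (.inl (hcomp ▸ mem_comp_self hv)) huv
  · rcases hcases v hv with hv | hv | hv
    · rw [e1 v hv]; rfl
    · exact absurd hvS (hsoft v hv.1)
    · rw [e3 v hv]
      exact (hd _ v hv rfl).1.left v (.inl (mem_comp_self hv))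
        (.inr (hvS.resolve_left fun hc => hv.1.2 (hSM hc)))

lemma exists_isOk_of_triFree [Fintype V] (hG : NoMinor G) (h : U ⊆ triFree G) (S : Set V) :
    ∃ c, IsOk G U S c := by
  obtain ⟨ψ, hψ⟩ := threeCol_of_hasFam Finset.univ (hG.hasFam_within U)
    ⟨∅, by simp, fun a b c h1 h2 h3 => absurd h2.1 (h h1.2.1 b c h1.1 h3.1)⟩
  exact ⟨fun v => .inl (ψ v), fun u hu v hv huv hc => hψ u (Finset.mem_univ _) v
    (Finset.mem_univ _) ⟨huv, hu, hv⟩ (Sum.inl.inj hc), fun _ _ _ => rfl⟩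

theorem Setup.exists_isOk [Fintype V] (hG : NoMinor G) (h : Setup G U W S) :
    ∃ c, IsOk G U S c := by
  induction hn : U.ncard using Nat.strong_induction_on generalizing U W S with
  | _ n ih =>
  by_contra hbad
  have hC : Crit G U W (S ∩ U) := by
    refine ⟨hG, ⟨h.disj, h.conn, fun s hs hsU => h.touch s hs.1 hsU⟩, inter_subset_right,
      fun U' W' S' h' hU => ih _ (hn ▸ Set.ncard_lt_ncard hU) h' rfl, ?_⟩
    rintro ⟨c, hc⟩
    exact hbad ⟨c, hc.mono subset_rfl fun v hv hvS => ⟨hvS, hv⟩⟩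
  have hS := hC.eq_empty
  refine hC.bad (exists_isOk_of_triFree hG (fun l hl => ?_) _)
  by_contra hlT
  obtain ⟨s, hs, -⟩ := hC.exists_not_adj hl (by simp [hS]) hlT
  rw [hS] at hs
  exact hs

theorem exists_isOk_univ [Fintype V] (hG : NoMinor G) : ∃ c, IsOk G univ ∅ c := by
  by_cases h : univ ⊆ triFree G
  · exact exists_isOk_of_triFree hG h _
  obtain ⟨x, -, hx⟩ := not_subset.1 h
  obtain ⟨c, hc⟩ := Setup.exists_isOk hG (U := {x}ᶜ) (W := {x}) (S := G.neighborSet x)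
    ⟨disjoint_compl_left, isConn_singleton x,
      fun s hs _ => touch_of_adj (G.adj_symm hs) rfl rfl⟩
  refine ⟨_, (((hc.mono (S' := ∅) subset_rfl (by simp)).insert_right
    (fun v hv hxv => hc.left v hv (.inl hxv)) (by simp) hx true)).mono ?_ fun _ _ h => h⟩
  intro v _
  by_cases hvx : v = x
  exacts [.inl hvx, .inr hvx]

end

end LocalGirth

namespace LocalGirth

lemma mem_triFree_of_not_cycle {V : Type*} {G : SimpleGraph V} {v : V}
    (h : ¬ G.VertexInCycleOfLength v 3) : v ∈ triFree G := by
  intro a b ha hb hab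
  refine h ⟨.cons ha (.cons hab (.cons hb.symm .nil)), ?_, rfl⟩
  rw [SimpleGraph.Walk.cons_isCycle_iff]
  simp [ha.ne, ha.ne', hb.ne, hb.ne', hab.ne]

end LocalGirth

/-- Every finite planar graph has a proper colouring with colours in {1,…,5} such that
vertices on no triangle get colours in {1,…,4} and vertices on no cycle of length 3 or 4
get colours in {1,2,3}. -/
theorem planar_local_girth_colouring {V : Type*} [Fintype V]
    (G : SimpleGraph V) (hG : G.IsPlanar) :
    ∃ φ : V → ℕ,
      (∀ v, φ v ∈ ({1, 2, 3, 4, 5} : Finset ℕ)) ∧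
      (∀ v, ¬ G.VertexInCycleOfLength v 3 → φ v ∈ ({1, 2, 3, 4} : Finset ℕ)) ∧
      (∀ v, ¬ G.VertexInCycleOfLength v 3 → ¬ G.VertexInCycleOfLength v 4 →
        φ v ∈ ({1, 2, 3} : Finset ℕ)) ∧
      ∀ ⦃u v⦄, G.Adj u v → φ u ≠ φ v := by
  obtain ⟨c, hc⟩ := LocalGirth.exists_isOk_univ (LocalGirth.noMinor_of_isPlanar hG)
  let f : Fin 3 ⊕ Bool → ℕ := Sum.elim (fun i => i + 1) fun b => if b then 5 else 4
  have hf : Function.Injective f := by decide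
  have h5 : ∀ x, f x ∈ ({1, 2, 3, 4, 5} : Finset ℕ) := by decide
  have h3 : ∀ x : Fin 3 ⊕ Bool, x.isLeft = true → f x ∈ ({1, 2, 3} : Finset ℕ) := by decide
  have hv : ∀ v, ¬ G.VertexInCycleOfLength v 3 → f (c v) ∈ ({1, 2, 3} : Finset ℕ) := fun v h =>
    h3 _ (hc.left v trivial (.inr (LocalGirth.mem_triFree_of_not_cycle h)))
  refine ⟨fun v => f (c v), fun v => h5 _, fun v h => ?_, fun v h _ => hv v h,
    fun u v huv heq => hc.proper u trivial v trivial huv (hf heq)⟩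
  have := hv v h
  simp only [Finset.mem_insert, Finset.mem_singleton] at this ⊢
  tauto
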